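/- Fix c ∈ {6, 7} and B ≥ 1. There exist a constant κ > 0 and N such that for every odd integer n ≥ N, the integral over the major arcs satisfies ∫_𝔐 F_c(α) e(−α n) dα ≥ κ · n^{Θ_c}. In particular the real part of this integral is ≥ κ n^{Θ_c}. -/

import Mathlib

open MeasureTheory Finset

noncomputable section

/-- `e(x) = exp(2πix)`. -/
def e (x : ℝ) : ℂ := Complex.exp (2 * Real.pi * Complex.I * x)

/-- `P_k = n^(1/k)`. -/
def P (n k : ℕ) : ℝ := (n : ℝ) ^ ((k : ℝ))⁻¹

/-- `θ_6 = 5/6`, `θ_7 = 87/98`. -/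
def θ (c : ℕ) : ℝ := if c = 6 then 5 / 6 else 87 / 98

/-- `Θ_c = 2/3 + θ_c/5 + 1/6 + 1/c`. -/
def Θ (c : ℕ) : ℝ := 2 / 3 + θ c / 5 + 1 / 6 + ((c : ℝ))⁻¹

/-- `f_k(α) = Σ_{P_k/2 < p ≤ P_k, p prime} e(α p^k) log p`. -/
def f (n k : ℕ) (α : ℝ) : ℂ :=
  ∑ p ∈ (Finset.range (n + 1)).filter
      (fun p : ℕ => p.Prime ∧ P n k / 2 < (p : ℝ) ∧ (p : ℝ) ≤ P n k),
    e (α * (p : ℝ) ^ k) * (Real.log p)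

/-- `f_{5,c}(α) = Σ_{1 < p ≤ P_5^{θ_c}, p prime} e(α p^5) log p`. -/
def f5 (n c : ℕ) (α : ℝ) : ℂ :=
  ∑ p ∈ (Finset.range (n + 1)).filter
      (fun p : ℕ => p.Prime ∧ 1 < (p : ℝ) ∧ (p : ℝ) ≤ P n 5 ^ θ c),
    e (α * (p : ℝ) ^ 5) * (Real.log p)

/-- `F_c(α) = f_2(α)^2 f_3(α)^2 f_{5,c}(α) f_6(α) f_c(α)`. -/
def F (n c : ℕ) (α : ℝ) : ℂ :=
  f n 2 α ^ 2 * f n 3 α ^ 2 * f5 n c α * f n 6 α * f n c α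

/-- `S_k(q,a) = Σ_{x=1,(x,q)=1}^{q} e(a x^k / q)`. -/
def S (k q a : ℕ) : ℂ :=
  ∑ x ∈ (Finset.Icc 1 q).filter (fun x => Nat.gcd x q = 1),
    e ((a : ℝ) * (x : ℝ) ^ k / q)

/-- `v_k(β) = (1/k) Σ_{2^{-k} n < m ≤ n} m^{1/k-1} e(β m)`. -/
def v (n k : ℕ) (β : ℝ) : ℂ :=
  ((k : ℂ))⁻¹ *
    ∑ m ∈ (Finset.Icc 1 n).filter (fun m : ℕ => (n : ℝ) / 2 ^ k < (m : ℝ)),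
      ((m : ℝ) ^ ((k : ℝ)⁻¹ - 1) : ℝ) * e (β * m)

/-- `w_c(β) = v_2(β)^2 v_3(β)^2 v_6(β) v_c(β)`. -/
def w (n c : ℕ) (β : ℝ) : ℂ := v n 2 β ^ 2 * v n 3 β ^ 2 * v n 6 β * v n c β

/-- `U_c(q,a) = S_2(q,a)^2 S_3(q,a)^2 S_5(q,a) S_6(q,a) S_c(q,a)`. -/
def U (c q a : ℕ) : ℂ := S 2 q a ^ 2 * S 3 q a ^ 2 * S 5 q a * S 6 q a * S c q a

/-- `A_{n,c}(q) = Σ_{a=1,(a,q)=1}^{q} U_c(q,a) e(-a n / q)`. -/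
def A (n : ℤ) (c q : ℕ) : ℂ :=
  ∑ a ∈ (Finset.Icc 1 q).filter (fun a => Nat.gcd a q = 1),
    U c q a * e (-((a : ℝ) * (n : ℝ)) / q)

/-- The major arcs `𝔐`. -/
def Maj (n : ℕ) (B : ℝ) : Set ℝ :=
  {α | α ∈ Set.Icc (0 : ℝ) 1 ∧ ∃ a q : ℕ, a ≤ q ∧ 1 ≤ q ∧
    (q : ℝ) ≤ Real.log n ^ B ∧ Nat.gcd a q = 1 ∧
    |α - (a : ℝ) / q| ≤ Real.log n ^ B / n}

/-- `Q_c = n^{2/(3c²(c-1))}`. -/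
def Q (n c : ℕ) : ℝ := (n : ℝ) ^ (2 / (3 * (c : ℝ) ^ 2 * ((c : ℝ) - 1)))

/-- The arcs `𝕽_c`. -/
def R (n c : ℕ) : Set ℝ :=
  {α | α ∈ Set.Icc (0 : ℝ) 1 ∧ ∃ a q : ℕ, a ≤ q ∧ 1 ≤ q ∧
    (q : ℝ) ≤ Q n c ∧ Nat.gcd a q = 1 ∧ |(q : ℝ) * α - a| ≤ Q n c / n}

/-- `τ = 2^{-20}`. -/
def τ : ℝ := ((2 : ℝ) ^ (20 : ℕ))⁻¹

/-- The sets `𝓔_c`. -/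
def E (n c : ℕ) : Set ℝ :=
  {α | α ∈ Set.Icc (0 : ℝ) 1 ∧
    ‖f n c α‖ ≤ P n c ^ (if c = 6 then 1 - 24 * τ else 139 / 140 - 24 * τ)}

end


namespace MajArc

/-- elementary symmetric sums over a finite set of primes -/
noncomputable def esy (s : Finset ℕ) (w : ℕ → ℝ) (j : ℕ) : ℝ :=
  ∑ A ∈ s.powersetCard j, ∏ p ∈ A, w p

/-- truncated inclusion-exclusion -/
noncomputable def trunc (s : Finset ℕ) (w : ℕ → ℝ) (b : ℕ) : ℝ :=
  ∑ j ∈ range (b + 1), (-1 : ℝ) ^ j * esy s w j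

lemma esy_zero (s : Finset ℕ) (w : ℕ → ℝ) : esy s w 0 = 1 := by simp [esy]

lemma esy_nonneg {s : Finset ℕ} {w : ℕ → ℝ} (hw : ∀ p ∈ s, 0 ≤ w p) (j : ℕ) : 0 ≤ esy s w j := by
  refine sum_nonneg fun A hA => prod_nonneg fun p hp => hw p ?_
  exact (mem_powersetCard.1 hA).1 hp

lemma esy_insert {s : Finset ℕ} {a : ℕ} (ha : a ∉ s) (w : ℕ → ℝ) (j : ℕ) :
    esy (insert a s) w (j + 1) = esy s w (j + 1) + w a * esy s w j := by
  unfold esy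
  rw [powersetCard_succ_insert ha, sum_union, sum_image, mul_sum]
  · congr 1
    refine sum_congr rfl fun A hA => ?_
    rw [prod_insert]
    exact fun h => ha ((mem_powersetCard.1 hA).1 h)
  · intro A hA B hB h
    have h1 : a ∉ A := fun h => ha ((mem_powersetCard.1 hA).1 h)
    have h2 : a ∉ B := fun h => ha ((mem_powersetCard.1 hB).1 h)
    rw [← erase_insert h1, ← erase_insert h2, h]
  · rw [Finset.disjoint_left]
    intro A hA hB
    obtain ⟨B, -, rfl⟩ := mem_image.1 hB
    exact ha ((mem_powersetCard.1 hA).1 (mem_insert_self a B))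

lemma trunc_succ (s : Finset ℕ) (w : ℕ → ℝ) (b : ℕ) :
    trunc s w (b + 1) = trunc s w b + (-1) ^ (b + 1) * esy s w (b + 1) := by
  unfold trunc; rw [sum_range_succ]

lemma trunc_zero (s : Finset ℕ) (w : ℕ → ℝ) : trunc s w 0 = 1 := by simp [trunc, esy_zero]

lemma trunc_insert {s : Finset ℕ} {a : ℕ} (ha : a ∉ s) (w : ℕ → ℝ) (b : ℕ) :
    trunc (insert a s) w (b + 1) = trunc s w (b + 1) - w a * trunc s w b := by
  induction b with
  | zero => simp [trunc_succ, trunc_zero, esy_insert ha, esy_zero]; ring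
  | succ b ih => rw [trunc_succ, ih, esy_insert ha, trunc_succ s w (b + 1), trunc_succ s w b]; ring

lemma prod_one_sub_mem {s : Finset ℕ} {w : ℕ → ℝ} (hw : ∀ p ∈ s, 0 ≤ w p ∧ w p ≤ 1) :
    0 ≤ ∏ p ∈ s, (1 - w p) ∧ ∏ p ∈ s, (1 - w p) ≤ 1 :=
  ⟨prod_nonneg fun p hp => by linarith [hw p hp],
   prod_le_one (fun p hp => by linarith [hw p hp]) fun p hp => by linarith [hw p hp]⟩

lemma bonf_aux (s : Finset ℕ) (w : ℕ → ℝ) (hw : ∀ p ∈ s, 0 ≤ w p ∧ w p ≤ 1) (b : ℕ) :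
    0 ≤ (-1 : ℝ) ^ b * (trunc s w b - ∏ p ∈ s, (1 - w p)) := by
  induction s using Finset.induction_on generalizing b with
  | empty =>
    have : trunc ∅ w b = 1 := by
      induction b with
      | zero => exact trunc_zero _ _
      | succ b ih =>
        rw [trunc_succ, ih]
        simp only [esy, add_eq_left]
        rw [powersetCard_eq_empty.2 (by simp)]
        simp
    simp [this]
  | insert a s ha ih =>
    have hs : ∀ p ∈ s, 0 ≤ w p ∧ w p ≤ 1 := fun p hp => hw p (mem_insert_of_mem hp)
    have hwa := hw a (mem_insert_self a s)
    cases b with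
    | zero =>
      have := (prod_one_sub_mem hw).2
      simp only [trunc_zero]; simpa using this
    | succ b =>
      rw [trunc_insert ha, prod_insert ha]
      have h1 := ih hs (b + 1)
      have h2 := mul_nonneg hwa.1 (ih hs b)
      have : (-1 : ℝ) ^ (b + 1) * (trunc s w (b + 1) - w a * trunc s w b
          - (1 - w a) * ∏ p ∈ s, (1 - w p)) =
          (-1 : ℝ) ^ (b + 1) * (trunc s w (b + 1) - ∏ p ∈ s, (1 - w p))
          + w a * ((-1 : ℝ) ^ b * (trunc s w b - ∏ p ∈ s, (1 - w p))) := by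
        rw [pow_succ]; ring
      rw [this]; positivity

/-- Bonferroni inequalities, even truncation. -/
lemma bonf (s : Finset ℕ) (w : ℕ → ℝ) (hw : ∀ p ∈ s, 0 ≤ w p ∧ w p ≤ 1) (b : ℕ) (hb : Even b) :
    ∏ p ∈ s, (1 - w p) ≤ trunc s w b ∧
      trunc s w b ≤ ∏ p ∈ s, (1 - w p) + esy s w (b + 1) := by
  have h1 := bonf_aux s w hw b
  have h2 := bonf_aux s w hw (b + 1)
  rw [trunc_succ, pow_succ, hb.neg_one_pow] at h2
  rw [hb.neg_one_pow] at h1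
  constructor <;> linarith

lemma esy_le {s : Finset ℕ} {w : ℕ → ℝ} (hw : ∀ p ∈ s, 0 ≤ w p) (j : ℕ) :
    esy s w j ≤ (1 / 4) ^ j * Real.exp (4 * ∑ p ∈ s, w p) := by
  have h1 : (4 : ℝ) ^ j * esy s w j ≤ ∏ p ∈ s, (1 + 4 * w p) := by
    have : ∏ p ∈ s, (1 + 4 * w p) = ∑ A ∈ s.powerset, ∏ p ∈ A, (4 * w p) := by
      simp_rw [add_comm (1 : ℝ)]
      rw [prod_add_one]
    rw [this, esy, mul_sum]
    calc _ = ∑ A ∈ s.powersetCard j, ∏ p ∈ A, (4 * w p) := by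
          refine sum_congr rfl fun A hA => ?_
          rw [prod_mul_distrib, prod_const, (mem_powersetCard.1 hA).2]
      _ ≤ _ := by
          refine sum_le_sum_of_subset_of_nonneg ?_ ?_
          · intro A hA; exact mem_powerset.2 (mem_powersetCard.1 hA).1
          · intro A hA _
            exact prod_nonneg fun p hp => by
              have := hw p (mem_powerset.1 hA hp); positivity
  have h2 : ∏ p ∈ s, (1 + 4 * w p) ≤ Real.exp (4 * ∑ p ∈ s, w p) := by
    rw [mul_sum, Real.exp_sum]
    refine prod_le_prod (fun p hp => ?_) fun p hp => ?_
    · have := hw p hp; positivity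
    · have := Real.add_one_le_exp (4 * w p); linarith
  rw [one_div, inv_pow, inv_mul_eq_div, le_div_iff₀ (by positivity), mul_comm]
  exact h1.trans h2

/-- The Brun-Hooley telescoping inequality. -/
lemma brun_hooley {r : ℕ} (x y d : Fin r → ℝ) (hx : ∀ i, 0 ≤ x i) (hxy : ∀ i, x i ≤ y i)
    (hd : ∀ i, y i ≤ x i + d i) :
    ∏ i, y i - ∑ t, d t * ∏ i ∈ univ.erase t, y i ≤ ∏ i, x i := by
  induction r with
  | zero => simp
  | succ r ih =>
    have hy : ∀ i, 0 ≤ y i := fun i => (hx i).trans (hxy i)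
    have hd0 : ∀ i, 0 ≤ d i := fun i => by linarith [hxy i, hd i]
    have h := ih (fun i => x i.succ) (fun i => y i.succ) (fun i => d i.succ)
      (fun i => hx _) (fun i => hxy _) (fun i => hd _)
    rw [Fin.prod_univ_succ, Fin.prod_univ_succ, Fin.sum_univ_succ]
    have e0 : ∏ i ∈ univ.erase (0 : Fin (r+1)), y i = ∏ i : Fin r, y i.succ := by
      have := mul_prod_erase univ y (mem_univ (0 : Fin (r+1)))
      rw [Fin.prod_univ_succ] at this
      have e : univ.erase (0 : Fin (r+1)) = univ.map (Fin.succEmb r) := by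
        ext i; simp [Fin.exists_succ_eq]
      rw [e, prod_map]; rfl
    have e1 : ∀ t : Fin r, ∏ i ∈ univ.erase t.succ, y i
        = y 0 * ∏ i ∈ univ.erase t, y i.succ := by
      intro t
      have e : univ.erase t.succ = insert (0 : Fin (r+1)) ((univ.erase t).map (Fin.succEmb r)) := by
        ext i
        refine Fin.cases ?_ (fun j => ?_) i
        · simp [(Fin.succ_ne_zero t).symm]
        · simp
      rw [e, prod_insert (by simp), prod_map]; rfl
    rw [e0]
    simp_rw [e1]
    have e2 : ∑ t : Fin r, d t.succ * (y 0 * ∏ i ∈ univ.erase t, y i.succ)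
        = y 0 * ∑ t : Fin r, d t.succ * ∏ i ∈ univ.erase t, y i.succ := by
      rw [mul_sum]; exact sum_congr rfl fun t _ => by ring
    rw [e2]
    have hP : 0 ≤ ∏ i : Fin r, y i.succ := prod_nonneg fun i _ => hy _
    have hX : 0 ≤ ∏ i : Fin r, x i.succ := prod_nonneg fun i _ => hx _
    have hXY : ∏ i : Fin r, x i.succ ≤ ∏ i : Fin r, y i.succ :=
      prod_le_prod (fun i _ => hx _) fun i _ => hxy _
    have := mul_le_mul_of_nonneg_left h (hy 0)
    nlinarith [hd 0, hxy 0, hd0 0, mul_le_mul_of_nonneg_right (hd 0) hX, mul_le_mul_of_nonneg_left hXY (hd0 0)]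

end MajArc

namespace MajArc

lemma count_mod (a b q v : ℕ) (hq : 0 < q) (hab : a ≤ b) :
    |((#{m ∈ Ioc a b | m ≡ v [MOD q]} : ℕ) : ℝ) - ((b : ℝ) - a) / q| ≤ 1 := by
  have h := Nat.Ioc_filter_modEq_card a b hq v
  have hq' : (0 : ℚ) < q := by exact_mod_cast hq
  have hmono : ⌊((a : ℚ) - v) / q⌋ ≤ ⌊((b : ℚ) - v) / q⌋ := by
    apply Int.floor_le_floor
    have : (a : ℚ) ≤ b := by exact_mod_cast hab
    gcongr
  rw [max_eq_left (by linarith)] at h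
  have h2 : ((#{m ∈ Ioc a b | m ≡ v [MOD q]} : ℕ) : ℚ) =
    (⌊((b : ℚ) - v) / q⌋ : ℚ) - ⌊((a : ℚ) - v) / q⌋ := by exact_mod_cast h
  have h3 : |((#{m ∈ Ioc a b | m ≡ v [MOD q]} : ℕ) : ℚ) - ((b : ℚ) - a) / q| ≤ 1 := by
    rw [h2]
    have e1 := Int.floor_le (((b : ℚ) - v) / q)
    have e2 := Int.lt_floor_add_one (((b : ℚ) - v) / q)
    have e3 := Int.floor_le (((a : ℚ) - v) / q)
    have e4 := Int.lt_floor_add_one (((a : ℚ) - v) / q)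
    have e5 : ((b : ℚ) - a) / q = ((b : ℚ) - v) / q - ((a : ℚ) - v) / q := by ring
    rw [e5, abs_le]; constructor <;> linarith
  have h4 := (Rat.cast_le (K := ℝ)).2 h3
  push_cast at h4
  exact h4

lemma count_mod_dvd (a b q v d : ℕ) (hq : 0 < q) (hd : 0 < d) (hc : Nat.Coprime q d) (hab : a ≤ b) :
    |((#{m ∈ Ioc a b | m ≡ v [MOD q] ∧ d ∣ m} : ℕ) : ℝ) - ((b : ℝ) - a) / (q * d)| ≤ 1 := by
  obtain ⟨c, hc1, hc2⟩ := Nat.chineseRemainder hc v 0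
  have : ∀ m, (m ≡ v [MOD q] ∧ d ∣ m) ↔ m ≡ c [MOD (q * d)] := by
    intro m
    rw [← Nat.modEq_and_modEq_iff_modEq_mul hc]
    constructor
    · rintro ⟨h1, h2⟩
      exact ⟨h1.trans hc1.symm, ((Nat.modEq_zero_iff_dvd).2 h2).trans hc2.symm⟩
    · rintro ⟨h1, h2⟩
      exact ⟨h1.trans hc1, (Nat.modEq_zero_iff_dvd).1 (h2.trans hc2)⟩
  simp_rw [this]
  have := count_mod a b (q * d) c (by positivity) hab
  push_cast at this
  exact this

/-- divisibility indicator -/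
noncomputable def dv (m p : ℕ) : ℝ := if p ∣ m then 1 else 0

lemma dv_mem (m p : ℕ) : 0 ≤ dv m p ∧ dv m p ≤ 1 := by unfold dv; split_ifs <;> norm_num

lemma prod_dv {A : Finset ℕ} (hA : ∀ p ∈ A, p.Prime) (m : ℕ) :
    ∏ p ∈ A, dv m p = if (∏ p ∈ A, p) ∣ m then 1 else 0 := by
  unfold dv
  rw [prod_ite_zero]
  have : (∀ p ∈ A, p ∣ m) ↔ (∏ p ∈ A, p) ∣ m := by
    constructor
    · intro h
      exact Finset.prod_primes_dvd m (fun p hp => (hA p hp).prime) h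
    · intro h p hp
      exact (dvd_prod_of_mem _ hp).trans h
  simp only [this, prod_const_one]

/-- expansion lemma -/
lemma expand {r : ℕ} (s : Fin r → Finset ℕ) (hpr : ∀ t, ∀ p ∈ s t, p.Prime)
    (hdis : ∀ t t', t ≠ t' → Disjoint (s t) (s t')) (q : ℕ) (hq : 0 < q)
    (hco : ∀ t, ∀ p ∈ s t, ¬ p ∣ q)
    (Fm : Fin r → Finset (Finset ℕ)) (hF : ∀ t, ∀ B ∈ Fm t, B ⊆ s t)
    (co : Finset ℕ → ℝ) (hcoef : ∀ B, |co B| ≤ 1) (a b v : ℕ) (hab : a ≤ b) :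
    |∑ m ∈ (Ioc a b).filter (fun m => m ≡ v [MOD q]), ∏ t, ∑ B ∈ Fm t, co B * ∏ p ∈ B, dv m p
      - ((b : ℝ) - a) / q * ∏ t, ∑ B ∈ Fm t, co B * ∏ p ∈ B, (1 / (p : ℝ))| ≤ ∏ t, (#(Fm t) : ℝ) := by
  simp_rw [prod_univ_sum]
  rw [sum_comm, mul_sum, ← sum_sub_distrib]
  refine (abs_sum_le_sum_abs _ _).trans ?_
  have hcard : ∏ t, (#(Fm t) : ℝ) = ∑ x ∈ Fintype.piFinset Fm, (1 : ℝ) := by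
    rw [sum_const, Fintype.card_piFinset]; simp
  rw [hcard]
  refine sum_le_sum fun x hx => ?_
  rw [Fintype.mem_piFinset] at hx
  simp_rw [prod_mul_distrib]
  rw [← mul_sum]
  have hdisx : ∀ t t', t ≠ t' → Disjoint (x t) (x t') := fun t t' h =>
    (hdis t t' h).mono (hF t _ (hx t)) (hF t' _ (hx t'))
  have hbi : ∀ g : ℕ → ℝ, ∏ t, ∏ p ∈ x t, g p = ∏ p ∈ univ.biUnion x, g p := by
    intro g
    rw [prod_biUnion]
    intro i _ j _ hij
    exact hdisx i j hij
  simp_rw [hbi]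
  set A := univ.biUnion x with hA
  have hAp : ∀ p ∈ A, p.Prime ∧ ¬ p ∣ q := by
    intro p hp
    rw [hA, mem_biUnion] at hp
    obtain ⟨t, _, ht⟩ := hp
    exact ⟨hpr t p (hF t _ (hx t) ht), hco t p (hF t _ (hx t) ht)⟩
  have h1 : ∑ m ∈ (Ioc a b).filter (fun m => m ≡ v [MOD q]), ∏ p ∈ A, dv m p =
      ((#{m ∈ Ioc a b | m ≡ v [MOD q] ∧ (∏ p ∈ A, p) ∣ m} : ℕ) : ℝ) := by
    simp_rw [prod_dv (fun p hp => (hAp p hp).1)]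
    rw [sum_boole, filter_filter]
  have h2 := count_mod_dvd a b q v (∏ p ∈ A, p) hq
    (prod_pos fun p hp => (hAp p hp).1.pos)
    (Nat.Coprime.prod_right fun p hp =>
      (((hAp p hp).1.coprime_iff_not_dvd).2 (hAp p hp).2).symm) hab
  rw [h1]
  have h3 : ∏ p ∈ A, (1 / (p : ℝ)) = 1 / ((∏ p ∈ A, p : ℕ) : ℝ) := by
    push_cast; rw [prod_div_distrib]; simp
  rw [h3]
  have h4 : |∏ i, co (x i)| ≤ 1 := by
    rw [abs_prod]
    exact prod_le_one (fun _ _ => abs_nonneg _) fun _ _ => hcoef _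
  have h5 : (∏ i, co (x i)) * ((#{m ∈ Ioc a b | m ≡ v [MOD q] ∧ (∏ p ∈ A, p) ∣ m} : ℕ) : ℝ) -
      ((b : ℝ) - a) / q * ((∏ i, co (x i)) * (1 / ((∏ p ∈ A, p : ℕ) : ℝ))) =
      (∏ i, co (x i)) * (((#{m ∈ Ioc a b | m ≡ v [MOD q] ∧ (∏ p ∈ A, p) ∣ m} : ℕ) : ℝ) -
       ((b : ℝ) - a) / (q * ((∏ p ∈ A, p : ℕ) : ℝ))) := by
    field_simp
  rw [h5, abs_mul]
  exact mul_le_one₀ h4 (abs_nonneg _) h2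

/-- the family of sets of size at most `b`. -/
def famLe (s : Finset ℕ) (b : ℕ) : Finset (Finset ℕ) := s.powerset.filter (fun B => #B ≤ b)

lemma trunc_eq (s : Finset ℕ) (w : ℕ → ℝ) (b : ℕ) :
    trunc s w b = ∑ B ∈ famLe s b, (-1 : ℝ) ^ (#B) * ∏ p ∈ B, w p := by
  unfold trunc famLe esy
  rw [← sum_fiberwise_of_maps_to (s := s.powerset.filter (fun B => #B ≤ b)) (t := range (b+1))
    (g := fun B => #B)]
  · refine sum_congr rfl fun j hj => ?_
    rw [mul_sum]
    have : {i ∈ s.powerset.filter (fun B => #B ≤ b) | #i = j} = s.powersetCard j := by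
      ext B; simp only [mem_filter, mem_powerset, mem_powersetCard]
      have := mem_range.1 hj
      constructor
      · tauto
      · rintro ⟨h1, h2⟩; exact ⟨⟨h1, by omega⟩, h2⟩
    rw [this]
    exact sum_congr rfl fun B hB => by rw [(mem_powersetCard.1 hB).2]
  · intro B hB
    simp only [mem_filter] at hB
    exact mem_range.2 (by omega)

lemma card_famLe (s : Finset ℕ) (b : ℕ) : #(famLe s b) ≤ (#s + 1) ^ b := by
  have h1 : famLe s b ⊆ ((Fintype.piFinset fun _ : Fin b => insert 0 (s.image Nat.succ))).image
      (fun g => ((univ.image g).erase 0).image Nat.pred) := by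
    intro B hB
    simp only [famLe, mem_filter, mem_powerset] at hB
    obtain ⟨hBs, hBc⟩ := hB
    rw [mem_image]
    let L := B.equivFin
    refine ⟨fun i => if h : (i : ℕ) < #B then ((L.symm ⟨i, h⟩ : B) : ℕ).succ else 0, ?_, ?_⟩
    · rw [Fintype.mem_piFinset]
      intro i
      by_cases h : (i : ℕ) < #B
      · simp only [h, dite_true, mem_insert, mem_image]
        right
        exact ⟨_, hBs (L.symm ⟨i, h⟩).2, rfl⟩
      · simp [h]
    · ext p
      simp only [mem_image, mem_erase, mem_univ, true_and]
      constructor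
      · rintro ⟨y, ⟨hy0, i, rfl⟩, rfl⟩
        by_cases h : (i : ℕ) < #B
        · simp only [h, dite_true]
          exact (L.symm ⟨i, h⟩).2
        · simp [h] at hy0
      · intro hp
        refine ⟨p.succ, ⟨by simp, ⟨L ⟨p, hp⟩, lt_of_lt_of_le (L ⟨p, hp⟩).2 hBc⟩, ?_⟩, by simp⟩
        simp
  refine (card_le_card h1).trans (card_image_le.trans ?_)
  rw [Fintype.card_piFinset]
  simp only [prod_const, card_univ, Fintype.card_fin]
  apply Nat.pow_le_pow_left
  refine (card_insert_le _ _).trans ?_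
  rw [card_image_of_injective _ Nat.succ_injective]

lemma card_powersetCard_le (s : Finset ℕ) (b : ℕ) : #(s.powersetCard b) ≤ (#s + 1) ^ b := by
  refine le_trans (card_le_card ?_) (card_famLe s b)
  intro B hB
  rw [mem_powersetCard] at hB
  simp [famLe, hB.1, hB.2]

/-- sifting predicate -/
def Sift {r : ℕ} (s : Fin r → Finset ℕ) (m : ℕ) : Prop := ∀ t, ∀ p ∈ s t, ¬ p ∣ m

lemma prod_sift {r : ℕ} (s : Fin r → Finset ℕ) (m : ℕ) [Decidable (Sift s m)] :
    ∏ t, ∏ p ∈ s t, (1 - dv m p) = if Sift s m then 1 else 0 := by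
  split_ifs with h
  · refine prod_eq_one fun t _ => prod_eq_one fun p hp => ?_
    simp [dv, h t p hp]
  · unfold Sift at h; push Not at h
    obtain ⟨t, p, hp, hd⟩ := h
    exact prod_eq_zero (mem_univ t) (prod_eq_zero hp (by simp [dv, hd]))

end MajArc

namespace MajArc

open Classical in
lemma FL_abs {r : ℕ} (s : Fin r → Finset ℕ) (hpr : ∀ t, ∀ p ∈ s t, p.Prime)
    (hdis : ∀ t t', t ≠ t' → Disjoint (s t) (s t')) (q : ℕ) (hq : 0 < q)
    (hco : ∀ t, ∀ p ∈ s t, ¬ p ∣ q) (bt : Fin r → ℕ) (hbt : ∀ t, Even (bt t))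
    (ε : Fin r → ℝ) (hε0 : ∀ t, 0 ≤ ε t)
    (hε : ∀ t, esy (s t) (fun p => 1 / (p : ℝ)) (bt t + 1) ≤ ε t * ∏ p ∈ s t, (1 - 1 / (p : ℝ)))
    (Z : ℝ) (hZ : ∏ t, ((#(s t) + 1 : ℕ) : ℝ) ^ (bt t + 1) ≤ Z)
    (a b v : ℕ) (hab : a ≤ b) :
    |((#{m ∈ Ioc a b | m ≡ v [MOD q] ∧ Sift s m} : ℕ) : ℝ) -
       ((b : ℝ) - a) / q * ∏ t, ∏ p ∈ s t, (1 - 1 / (p : ℝ))| ≤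
     (∑ t, ε t) * Real.exp (∑ t, ε t) * (((b : ℝ) - a) / q * ∏ t, ∏ p ∈ s t, (1 - 1 / (p : ℝ)))
       + (r + 1) * Z := by
  set M := (Ioc a b).filter (fun m => m ≡ v [MOD q]) with hM
  set g : ℕ → ℝ := fun p => 1 / (p : ℝ) with hg
  set V : Fin r → ℝ := fun t => ∏ p ∈ s t, (1 - 1 / (p : ℝ)) with hV
  set H : ℝ := ((b : ℝ) - a) / q with hH
  set E := ∑ t, ε t with hE
  have hH0 : 0 ≤ H := by
    have : (a : ℝ) ≤ b := by exact_mod_cast hab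
    exact div_nonneg (by linarith) (by positivity)
  have hg01 : ∀ t, ∀ p ∈ s t, 0 ≤ g p ∧ g p ≤ 1 := by
    intro t p hp
    have h1 : (1 : ℝ) ≤ p := by exact_mod_cast (hpr t p hp).one_le
    exact ⟨by positivity, by rw [hg]; exact (div_le_one (by linarith)).2 h1⟩
  have hV0 : ∀ t, 0 ≤ V t := fun t => (prod_one_sub_mem (hg01 t)).1
  have hE0 : 0 ≤ E := sum_nonneg fun t _ => hε0 t
  -- count as a sum
  have hN : ((#{m ∈ Ioc a b | m ≡ v [MOD q] ∧ Sift s m} : ℕ) : ℝ) =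
      ∑ m ∈ M, ∏ t, ∏ p ∈ s t, (1 - dv m p) := by
    simp_rw [prod_sift]
    rw [sum_boole, hM, filter_filter]
  have hcoef : ∀ B : Finset ℕ, |((-1 : ℝ)) ^ (#B)| ≤ 1 := by intro B; simp
  -- bounds for cardinals
  have hZ1 : ∀ (Fm : Fin r → Finset (Finset ℕ)), (∀ t, #(Fm t) ≤ (#(s t) + 1) ^ (bt t + 1)) →
      ∏ t, (#(Fm t) : ℝ) ≤ Z := by
    intro Fm h
    refine le_trans (prod_le_prod (fun _ _ => by positivity) fun t _ => ?_) hZ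
    exact_mod_cast h t
  have hfam : ∀ t, #(famLe (s t) (bt t)) ≤ (#(s t) + 1) ^ (bt t + 1) := fun t =>
    (card_famLe _ _).trans (Nat.pow_le_pow_right (by omega) (by omega))
  -- main upper
  have hU := expand s hpr hdis q hq hco (fun t => famLe (s t) (bt t))
    (fun t B hB => by simp only [famLe, mem_filter, mem_powerset] at hB; exact hB.1)
    (fun B => (-1) ^ (#B)) hcoef a b v hab
  have hU' := hU.trans (hZ1 _ hfam)
  simp_rw [← trunc_eq] at hU'
  -- correction terms
  have hD : ∀ t0, |∑ m ∈ M, esy (s t0) (dv m) (bt t0 + 1) *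
      ∏ t ∈ univ.erase t0, trunc (s t) (dv m) (bt t)
      - H * (esy (s t0) g (bt t0 + 1) * ∏ t ∈ univ.erase t0, trunc (s t) g (bt t))| ≤ Z := by
    intro t0
    have h := expand s hpr hdis q hq hco
      (fun t => if t = t0 then (s t).powersetCard (bt t + 1) else famLe (s t) (bt t))
      (fun t B hB => by
        split_ifs at hB
        · exact (mem_powersetCard.1 hB).1
        · simp only [famLe, mem_filter, mem_powerset] at hB; exact hB.1)
      (fun B => (-1) ^ (#B)) hcoef a b v hab
    have h' := h.trans (hZ1 _ (fun t => by
      split_ifs with ht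
      · exact card_powersetCard_le _ _
      · exact hfam t))
    have key : ∀ w : ℕ → ℝ, ∏ t, ∑ B ∈ (if t = t0 then (s t).powersetCard (bt t + 1)
        else famLe (s t) (bt t)), (-1 : ℝ) ^ (#B) * ∏ p ∈ B, w p =
        - (esy (s t0) w (bt t0 + 1) * ∏ t ∈ univ.erase t0, trunc (s t) w (bt t)) := by
      intro w
      rw [← mul_prod_erase univ _ (mem_univ t0)]
      simp only [if_true]
      rw [← neg_mul]
      congr 1
      · unfold esy
        rw [← sum_neg_distrib]
        refine sum_congr rfl fun B hB => ?_
        rw [(mem_powersetCard.1 hB).2, Odd.neg_one_pow ((hbt t0).add_one)]; ring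
      · refine prod_congr rfl fun t ht => ?_
        rw [if_neg (mem_erase.1 ht).1, trunc_eq]
    simp_rw [key] at h'
    rw [sum_neg_distrib, mul_neg, sub_neg_eq_add, ← abs_neg] at h'
    refine le_of_eq_of_le ?_ h'
    congr 1
    simp only [hM, hH]
    ring
  -- pointwise sieve inequalities
  have hb1 : ∀ m t, _ := fun m t => bonf (s t) (dv m) (fun p _ => dv_mem m p) (bt t) (hbt t)
  have hx0 : ∀ m t, 0 ≤ ∏ p ∈ s t, (1 - dv m p) := fun m t =>
    (prod_one_sub_mem (fun p _ => dv_mem m p)).1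
  have hup : ∑ m ∈ M, ∏ t, ∏ p ∈ s t, (1 - dv m p) ≤ ∑ m ∈ M, ∏ t, trunc (s t) (dv m) (bt t) :=
    sum_le_sum fun m _ => prod_le_prod (fun t _ => hx0 m t) fun t _ => (hb1 m t).1
  have hlow : ∑ m ∈ M, ∏ t, trunc (s t) (dv m) (bt t) - ∑ t0, ∑ m ∈ M,
      esy (s t0) (dv m) (bt t0 + 1) * ∏ t ∈ univ.erase t0, trunc (s t) (dv m) (bt t) ≤
      ∑ m ∈ M, ∏ t, ∏ p ∈ s t, (1 - dv m p) := by
    rw [sum_comm, ← sum_sub_distrib]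
    exact sum_le_sum fun m _ => brun_hooley _ _ _ (hx0 m) (fun t => (hb1 m t).1)
      (fun t => (hb1 m t).2)
  -- the g-side
  have hg1 : ∀ t, _ := fun t => bonf (s t) g (hg01 t) (bt t) (hbt t)
  have hgU : ∀ t, trunc (s t) g (bt t) ≤ V t * Real.exp (ε t) := by
    intro t
    have h1 := (hg1 t).2
    have h2 := hε t
    have h3 := Real.add_one_le_exp (ε t)
    have h4 := mul_le_mul_of_nonneg_left h3 (hV0 t)
    have h5 : V t = ∏ p ∈ s t, (1 - g p) := rfl
    have h6 : esy (s t) g (bt t + 1) ≤ ε t * V t := h2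
    rw [← h5] at h1
    linarith
  have hgpos : ∀ t, 0 ≤ trunc (s t) g (bt t) := fun t => (hV0 t).trans (hg1 t).1
  have hgL : ∏ t, V t ≤ ∏ t, trunc (s t) g (bt t) :=
    prod_le_prod (fun t _ => hV0 t) fun t _ => (hg1 t).1
  have hgUU : ∏ t, trunc (s t) g (bt t) ≤ (∏ t, V t) * Real.exp E := by
    rw [hE, Real.exp_sum, ← prod_mul_distrib]
    exact prod_le_prod (fun t _ => hgpos t) fun t _ => hgU t
  have hgD : ∀ t0, esy (s t0) g (bt t0 + 1) * ∏ t ∈ univ.erase t0, trunc (s t) g (bt t) ≤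
      ε t0 * ((∏ t, V t) * Real.exp E) := by
    intro t0
    have h1 : ∏ t ∈ univ.erase t0, trunc (s t) g (bt t) ≤
        (∏ t ∈ univ.erase t0, V t) * Real.exp E := by
      have : Real.exp E ≥ Real.exp (∑ t ∈ univ.erase t0, ε t) :=
        Real.exp_le_exp.2 (sum_le_sum_of_subset_of_nonneg (erase_subset _ _) fun t _ _ => hε0 t)
      refine le_trans ?_ (mul_le_mul_of_nonneg_left this (prod_nonneg fun t _ => hV0 t))
      rw [Real.exp_sum, ← prod_mul_distrib]
      exact prod_le_prod (fun t _ => hgpos t) fun t _ => hgU t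
    calc _ ≤ (ε t0 * V t0) * ((∏ t ∈ univ.erase t0, V t) * Real.exp E) :=
          mul_le_mul (hε t0) h1 (prod_nonneg fun t _ => hgpos t) (mul_nonneg (hε0 t0) (hV0 t0))
      _ = _ := by rw [← mul_prod_erase univ V (mem_univ t0)]; ring
  have hP0 : 0 ≤ ∏ t, V t := prod_nonneg fun t _ => hV0 t
  have hZ0 : 0 ≤ Z := (abs_nonneg _).trans hU'
  have hexp : Real.exp E - 1 ≤ E * Real.exp E := by
    have h1 := Real.add_one_le_exp (-E)
    have h2 : Real.exp (-E) * Real.exp E = 1 := by rw [← Real.exp_add]; simp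
    have h3 := Real.exp_pos E
    nlinarith
  rw [hN]
  have hUab := abs_le.1 hU'
  rw [abs_le]
  constructor
  · have hs : ∑ t0, ∑ m ∈ M,
      esy (s t0) (dv m) (bt t0 + 1) * ∏ t ∈ univ.erase t0, trunc (s t) (dv m) (bt t) ≤
        E * (H * ((∏ t, V t) * Real.exp E)) + r * Z := by
      have : ∀ t0, ∑ m ∈ M, esy (s t0) (dv m) (bt t0 + 1) *
        ∏ t ∈ univ.erase t0, trunc (s t) (dv m) (bt t) ≤
          ε t0 * (H * ((∏ t, V t) * Real.exp E)) + Z := by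
        intro t0
        have h1 := (abs_le.1 (hD t0)).2
        have h2 := mul_le_mul_of_nonneg_left (hgD t0) hH0
        linarith
      refine (sum_le_sum fun t0 _ => this t0).trans ?_
      rw [sum_add_distrib, ← sum_mul]; simp [hE]
    have h1 := mul_le_mul_of_nonneg_left hgL hH0
    have h2 : E * (H * ((∏ t, V t) * Real.exp E)) = E * Real.exp E * (H * ∏ t, V t) := by ring
    linarith [hUab.1]
  · have h1 := mul_le_mul_of_nonneg_left hgUU hH0
    have h2 := mul_le_mul_of_nonneg_left hexp (mul_nonneg hH0 hP0)
    have h3 : 0 ≤ r * Z := by positivity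
    nlinarith [hUab.2]

end MajArc

namespace MajArc

/-- sieving level -/
def zz (r : ℕ) : ℕ := 2 ^ (2 ^ r)

/-- block of primes -/
def blk (q u : ℕ) : Finset ℕ :=
  (range (zz (u + 1))).filter (fun p => p.Prime ∧ zz u ≤ p ∧ ¬ p ∣ q)

lemma blk_mem {q u p : ℕ} : p ∈ blk q u ↔ p < zz (u + 1) ∧ p.Prime ∧ zz u ≤ p ∧ ¬ p ∣ q := by
  simp [blk]

lemma zz_mono {u v : ℕ} (h : u ≤ v) : zz u ≤ zz v :=
  Nat.pow_le_pow_right (by norm_num) (Nat.pow_le_pow_right (by norm_num) h)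

lemma zz_ge (u : ℕ) : 2 ≤ zz u := by
  have := zz_mono (Nat.zero_le u); simpa [zz] using this

lemma dyadic_recip (j : ℕ) (hj : 1 ≤ j) :
    ∑ p ∈ (range (2 ^ (j + 1))).filter (fun p => p.Prime ∧ 2 ^ j ≤ p), (1 / (p : ℝ)) ≤ 4 / j := by
  have hl2 : 0 < Real.log 2 := Real.log_pos (by norm_num)
  have hj' : (0 : ℝ) < j := by exact_mod_cast hj
  have h1 : ∑ p ∈ (range (2 ^ (j + 1))).filter (fun p => p.Prime ∧ 2 ^ j ≤ p), Real.log p ≤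
      Chebyshev.theta ((2 : ℝ) ^ (j + 1)) := by
    rw [Chebyshev.theta_eq_sum_Icc]
    apply sum_le_sum_of_subset_of_nonneg
    · intro p hp
      simp only [mem_filter, mem_range] at hp
      have : ⌊(2 : ℝ) ^ (j + 1)⌋₊ = 2 ^ (j + 1) := by
        rw [show (2 : ℝ) ^ (j + 1) = ((2 ^ (j + 1) : ℕ) : ℝ) by push_cast; rfl, Nat.floor_natCast]
      rw [this]
      simp only [mem_filter, mem_Icc]
      exact ⟨⟨by omega, by omega⟩, hp.2.1⟩
    · intro p _ _
      exact Real.log_natCast_nonneg p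
  have h2 := Chebyshev.theta_le_log4_mul_x (x := (2 : ℝ) ^ (j + 1)) (by positivity)
  have h4 : Real.log 4 = 2 * Real.log 2 := by
    rw [show (4 : ℝ) = 2 ^ 2 by norm_num, Real.log_pow]; norm_num
  have h3 : ∑ p ∈ (range (2 ^ (j + 1))).filter (fun p => p.Prime ∧ 2 ^ j ≤ p), (1 / (p : ℝ)) ≤
      ∑ p ∈ (range (2 ^ (j + 1))).filter (fun p => p.Prime ∧ 2 ^ j ≤ p),
        (1 / (2 ^ j * (j * Real.log 2))) * Real.log p := by
    refine sum_le_sum fun p hp => ?_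
    simp only [mem_filter, mem_range] at hp
    have hp2 : ((2 : ℝ) ^ j) ≤ p := by exact_mod_cast hp.2.2
    have h5 : j * Real.log 2 ≤ Real.log p := by
      rw [← Real.log_pow]; exact Real.log_le_log (by positivity) hp2
    rw [div_mul_eq_mul_div, one_mul, div_le_div_iff₀ (by linarith [show (0 : ℝ) < 2 ^ j by positivity]) (by positivity), one_mul, mul_comm (Real.log p)]
    exact mul_le_mul hp2 h5 (by positivity) (by positivity)
  rw [← mul_sum] at h3
  refine h3.trans ?_
  calc _ ≤ (1 / (2 ^ j * (j * Real.log 2))) * (2 * Real.log 2 * 2 ^ (j + 1)) := by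
        have h6 := h1.trans h2
        rw [h4] at h6
        gcongr
    _ = 4 / j := by field_simp; ring

lemma blk_recip (q u : ℕ) : ∑ p ∈ blk q u, (1 / (p : ℝ)) ≤ 4 := by
  have h1 : ∑ p ∈ blk q u, (1 / (p : ℝ)) ≤ ∑ j ∈ Ico (2 ^ u) (2 ^ (u + 1)),
      ∑ p ∈ (range (2 ^ (j + 1))).filter (fun p => p.Prime ∧ 2 ^ j ≤ p), (1 / (p : ℝ)) := by
    rw [← sum_biUnion]
    · apply sum_le_sum_of_subset_of_nonneg
      · intro p hp
        rw [blk_mem] at hp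
        rw [mem_biUnion]
        have hp0 : p ≠ 0 := hp.2.1.ne_zero
        refine ⟨Nat.log 2 p, ?_, ?_⟩
        · rw [mem_Ico]
          exact ⟨(Nat.le_log_iff_pow_le (by norm_num) hp0).2 hp.2.2.1,
            (Nat.log_lt_iff_lt_pow (by norm_num) hp0).2 hp.1⟩
        · simp only [mem_filter, mem_range]
          exact ⟨Nat.lt_pow_succ_log_self (by norm_num) p, hp.2.1, Nat.pow_log_le_self 2 hp0⟩
      · intro p _ _; positivity
    · intro i _ j _ hij
      simp only [Function.onFun]
      rw [disjoint_left]
      intro p h1 h2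
      simp only [mem_filter, mem_range] at h1 h2
      rcases lt_or_gt_of_ne hij with h | h
      · have := Nat.pow_le_pow_right (n := 2) (by norm_num) (show i + 1 ≤ j from h); omega
      · have := Nat.pow_le_pow_right (n := 2) (by norm_num) (show j + 1 ≤ i from h); omega
  refine h1.trans ?_
  have h2 : ∀ j ∈ Ico (2 ^ u) (2 ^ (u + 1)), ∑ p ∈ (range (2 ^ (j + 1))).filter
      (fun p => p.Prime ∧ 2 ^ j ≤ p), (1 / (p : ℝ)) ≤ 4 / 2 ^ u := by
    intro j hj
    rw [mem_Ico] at hj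
    have : 1 ≤ 2 ^ u := Nat.one_le_two_pow
    refine (dyadic_recip j (by omega)).trans ?_
    gcongr
    exact_mod_cast hj.1
  refine (sum_le_sum h2).trans ?_
  rw [sum_const, Nat.card_Ico, nsmul_eq_mul]
  have : 2 ^ (u + 1) - 2 ^ u = 2 ^ u := by rw [pow_succ]; omega
  rw [this]; push_cast; field_simp; exact le_rfl

lemma one_sub_ge_exp {x : ℝ} (h0 : 0 ≤ x) (h1 : x ≤ 1 / 2) : Real.exp (-(2 * x)) ≤ 1 - x := by
  have h2 := Real.add_one_le_exp (2 * x)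
  have h3 : Real.exp (-(2 * x)) * Real.exp (2 * x) = 1 := by rw [← Real.exp_add]; simp
  have h4 : 1 ≤ (1 - x) * Real.exp (2 * x) := by nlinarith
  have h5 := Real.exp_pos (2 * x)
  by_contra h
  push Not at h
  nlinarith

lemma blk_prod (q u : ℕ) : Real.exp (-8) ≤ ∏ p ∈ blk q u, (1 - 1 / (p : ℝ)) := by
  have h1 : ∏ p ∈ blk q u, Real.exp (-(2 * (1 / (p : ℝ)))) ≤ ∏ p ∈ blk q u, (1 - 1 / (p : ℝ)) := by
    refine prod_le_prod (fun _ _ => (Real.exp_pos _).le) fun p hp => ?_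
    have h2 : (2 : ℝ) ≤ p := by exact_mod_cast (blk_mem.1 hp).2.1.two_le
    exact one_sub_ge_exp (by positivity) (one_div_le_one_div_of_le (by norm_num) h2)
  refine le_trans ?_ h1
  rw [← Real.exp_sum, Real.exp_le_exp, sum_neg_distrib, ← mul_sum]
  linarith [blk_recip q u]

/-- sieve product -/
noncomputable def VV (q r : ℕ) : ℝ :=
  ∏ p ∈ (range (zz r)).filter (fun p => p.Prime ∧ ¬ p ∣ q), (1 - 1 / (p : ℝ))

lemma sift_union (q r : ℕ) : (univ : Finset (Fin r)).biUnion (fun t => blk q t) =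
    (range (zz r)).filter (fun p => p.Prime ∧ ¬ p ∣ q) := by
  ext p
  simp only [mem_biUnion, mem_univ, true_and, blk_mem, mem_filter, mem_range]
  constructor
  · rintro ⟨t, h1, h2, _, h4⟩
    exact ⟨lt_of_lt_of_le h1 (zz_mono (by omega)), h2, h4⟩
  · rintro ⟨h1, h2, h3⟩
    induction r with
    | zero => simp [zz] at h1; have := h2.two_le; omega
    | succ r ih =>
      by_cases h : p < zz r
      · obtain ⟨t, ht⟩ := ih h
        exact ⟨⟨t, by omega⟩, ht⟩
      · exact ⟨⟨r, by omega⟩, h1, h2, not_lt.1 h, h3⟩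

lemma blk_disj (q : ℕ) {t t' : ℕ} (h : t ≠ t') : Disjoint (blk q t) (blk q t') := by
  rw [disjoint_left]
  intro p h1 h2
  rw [blk_mem] at h1 h2
  rcases lt_or_gt_of_ne h with h | h
  · have := zz_mono (show t + 1 ≤ t' from h); omega
  · have := zz_mono (show t' + 1 ≤ t from h); omega

lemma VV_eq (q r : ℕ) : ∏ t : Fin r, ∏ p ∈ blk q t, (1 - 1 / (p : ℝ)) = VV q r := by
  unfold VV
  rw [← sift_union, prod_biUnion]
  intro i _ j _ hij
  exact blk_disj q (fun h => hij (Fin.ext h))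

/-- `m` has no prime factor below `zz r` apart from divisors of `q` -/
def Sf (q r m : ℕ) : Prop := ∀ p, p.Prime → p < zz r → ¬ p ∣ q → ¬ p ∣ m

lemma Sf_iff (q r m : ℕ) : Sift (fun t : Fin r => blk q t) m ↔ Sf q r m := by
  have := fun p => Finset.ext_iff.1 (sift_union q r) p
  simp only [mem_biUnion, mem_univ, true_and, mem_filter, mem_range] at this
  unfold Sift Sf
  constructor
  · intro h p hp hz hq
    obtain ⟨t, ht⟩ := (this p).2 ⟨hz, hp, hq⟩
    exact h t p ht
  · intro h t p hp
    obtain ⟨h1, h2, h3⟩ := (this p).1 ⟨t, hp⟩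
    exact h p h2 h1 h3

lemma pow_sum_bound (r b : ℕ) :
    ∑ t ∈ range r, 2 ^ (t + 1) * (2 * (b + (r - 1 - t)) + 1) + 4 * r + 4 * b + 6 = 2 ^ r * (4 * b + 6) := by
  induction r with
  | zero => simp
  | succ r ih =>
    rw [sum_range_succ']
    have : ∑ t ∈ range r, 2 ^ (t + 1 + 1) * (2 * (b + (r + 1 - 1 - (t + 1))) + 1) =
        2 * ∑ t ∈ range r, 2 ^ (t + 1) * (2 * (b + (r - 1 - t)) + 1) := by
      rw [mul_sum]
      refine sum_congr rfl fun t _ => ?_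
      rw [show r + 1 - 1 - (t + 1) = r - 1 - t by omega]; ring
    rw [this]
    have h2 : r + 1 - 1 - 0 = r := by omega
    rw [h2, pow_succ 2 r, zero_add, pow_one]
    linarith

lemma card_blk (q t : ℕ) : #(blk q t) + 1 ≤ 2 ^ (2 ^ (t + 1)) := by
  have h1 : blk q t ⊆ (range (zz (t + 1))).erase 0 := by
    intro p hp
    rw [blk_mem] at hp
    simp only [mem_erase, mem_range]
    exact ⟨hp.2.1.ne_zero, hp.1⟩
  have h2 := card_le_card h1
  have h3 := zz_ge (t + 1)
  rw [card_erase_of_mem (mem_range.2 (by omega)), card_range] at h2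
  change _ ≤ zz (t + 1)
  omega

lemma blk_Z (q r b : ℕ) : ((r : ℝ) + 1) * ∏ t : Fin r, ((#(blk q t) + 1 : ℕ) : ℝ) ^
    (2 * (b + (r - 1 - (t : ℕ))) + 1) ≤ (zz r : ℝ) ^ (4 * b + 6) := by
  have h1 : ∏ t : Fin r, (#(blk q t) + 1) ^ (2 * (b + (r - 1 - (t : ℕ))) + 1) ≤
      2 ^ (∑ t ∈ range r, 2 ^ (t + 1) * (2 * (b + (r - 1 - t)) + 1)) := by
    rw [← Fin.sum_univ_eq_sum_range (fun t => 2 ^ (t + 1) * (2 * (b + (r - 1 - t)) + 1)),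
      ← prod_pow_eq_pow_sum]
    refine prod_le_prod (fun _ _ => Nat.zero_le _) fun t _ => ?_
    rw [pow_mul]
    exact Nat.pow_le_pow_left (card_blk q t) _
  have h2 : r + 1 ≤ 2 ^ (4 * r + 4 * b + 6) := by
    have : r + 1 < 2 ^ (r + 1) := Nat.lt_two_pow_self
    exact this.le.trans (Nat.pow_le_pow_right (by norm_num) (by omega))
  have h3 : (r + 1) * ∏ t : Fin r, (#(blk q t) + 1) ^ (2 * (b + (r - 1 - (t : ℕ))) + 1) ≤
      (zz r) ^ (4 * b + 6) := by
    refine (Nat.mul_le_mul h2 h1).trans ?_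
    rw [← pow_add, zz, ← pow_mul, ← pow_sum_bound]
    apply le_of_eq; congr 1; ring
  exact_mod_cast h3

lemma eps_sum (r b : ℕ) :
    ∑ t : Fin r, (1 / 4 : ℝ) ^ (2 * (b + (r - 1 - (t : ℕ))) + 1) ≤ (1 / 4) ^ b := by
  rw [Fin.sum_univ_eq_sum_range (fun t => (1 / 4 : ℝ) ^ (2 * (b + (r - 1 - t)) + 1)) r,
    sum_range_reflect (fun t => (1 / 4 : ℝ) ^ (2 * (b + t) + 1)) r]
  have h1 : ∀ t ∈ range r, (1 / 4 : ℝ) ^ (2 * (b + t) + 1) ≤ (1 / 4) ^ (b + 1) * (1 / 4) ^ t := by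
    intro t _
    rw [← pow_add]
    exact pow_le_pow_of_le_one (by norm_num) (by norm_num) (by omega)
  refine (sum_le_sum h1).trans ?_
  rw [← mul_sum, geom_sum_eq (by norm_num)]
  have h2 : (0 : ℝ) < (1 / 4) ^ r := by positivity
  have h3 : (0 : ℝ) < (1 / 4) ^ b := by positivity
  rw [pow_succ, show (((1 : ℝ) / 4) ^ r - 1) / (1 / 4 - 1) = (1 - (1 / 4) ^ r) * (4 / 3) by ring]
  nlinarith [mul_pos h2 h3]

open Classical in
/-- Fundamental lemma of the sieve (Brun-Hooley). -/
lemma FL : ∃ C : ℝ, 0 < C ∧ ∀ (r b q v x y : ℕ), 0 < q → x ≤ y →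
    |((#{m ∈ Ioc x y | m ≡ v [MOD q] ∧ Sf q r m} : ℕ) : ℝ) - ((y : ℝ) - x) / q * VV q r| ≤
     C * (1 / 4) ^ b * (((y : ℝ) - x) / q * VV q r) + (zz r : ℝ) ^ (4 * b + 6) := by
  refine ⟨Real.exp 24 * Real.exp (Real.exp 24), by positivity, ?_⟩
  intro r b q v x y hq hxy
  have h := FL_abs (fun t : Fin r => blk q t) (fun t p hp => (blk_mem.1 hp).2.1)
    (fun t t' htt => blk_disj q (fun h => htt (Fin.ext h))) q hq
    (fun t p hp => (blk_mem.1 hp).2.2.2) (fun t => 2 * (b + (r - 1 - (t : ℕ))))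
    (fun t => even_two_mul _)
    (fun t => Real.exp 24 * (1 / 4 : ℝ) ^ (2 * (b + (r - 1 - (t : ℕ))) + 1)) (fun t => by positivity)
    (fun t => by
      have h1 := esy_le (s := blk q t) (w := fun p => 1 / (p : ℝ)) (fun p _ => by positivity)
        (2 * (b + (r - 1 - (t : ℕ))) + 1)
      have h2 := blk_recip q t
      have h3 := blk_prod q t
      have h4 : Real.exp (4 * ∑ p ∈ blk q t, 1 / (p : ℝ)) ≤ Real.exp 16 :=
        Real.exp_le_exp.2 (by linarith)
      have h5 : Real.exp 24 * Real.exp (-8) = Real.exp 16 := by rw [← Real.exp_add]; norm_num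
      have h6 : (0 : ℝ) < (1 / 4) ^ (2 * (b + (r - 1 - (t : ℕ))) + 1) := by positivity
      refine h1.trans ?_
      calc _ ≤ (1 / 4 : ℝ) ^ (2 * (b + (r - 1 - (t : ℕ))) + 1) * (Real.exp 24 * Real.exp (-8)) := by
            rw [h5]; gcongr
        _ ≤ (1 / 4 : ℝ) ^ (2 * (b + (r - 1 - (t : ℕ))) + 1) *
            (Real.exp 24 * ∏ p ∈ blk q t, (1 - 1 / (p : ℝ))) := by gcongr
        _ = _ := by ring) _ le_rfl x y v hxy
  simp_rw [Sf_iff] at h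
  rw [VV_eq] at h
  have hV0 : 0 ≤ VV q r := by
    refine prod_nonneg fun p hp => ?_
    have h2 : (1 : ℝ) ≤ p := by exact_mod_cast (mem_filter.1 hp).2.1.one_le
    have := (div_le_one (by linarith)).2 h2
    linarith
  have hH0 : 0 ≤ ((y : ℝ) - x) / q * VV q r := by
    have : (x : ℝ) ≤ y := by exact_mod_cast hxy
    exact mul_nonneg (div_nonneg (by linarith) (by positivity)) hV0
  refine h.trans (add_le_add (mul_le_mul_of_nonneg_right ?_ hH0) (blk_Z q r b))
  rw [← mul_sum]
  have h1 := eps_sum r b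
  have h2 : (1 / 4 : ℝ) ^ b ≤ 1 := pow_le_one₀ (by norm_num) (by norm_num)
  have h3 : Real.exp 24 * ∑ t : Fin r, (1 / 4 : ℝ) ^ (2 * (b + (r - 1 - (t : ℕ))) + 1) ≤
    Real.exp 24 * (1 / 4) ^ b := by gcongr
  have h4 : Real.exp (Real.exp 24 * ∑ t : Fin r, (1 / 4 : ℝ) ^ (2 * (b + (r - 1 - (t : ℕ))) + 1)) ≤
    Real.exp (Real.exp 24) := Real.exp_le_exp.2 (h3.trans (by
      have := Real.exp_pos 24; nlinarith))
  calc _ ≤ (Real.exp 24 * (1 / 4) ^ b) * Real.exp (Real.exp 24) := by gcongr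
    _ = _ := by ring

lemma VV_nonneg (q r : ℕ) : 0 ≤ VV q r := by
  refine prod_nonneg fun p hp => ?_
  have h2 : (1 : ℝ) ≤ p := by exact_mod_cast (mem_filter.1 hp).2.1.one_le
  have := (div_le_one (by linarith)).2 h2
  linarith

/-- the reciprocal function as a monoid homomorphism -/
noncomputable def recipHom : ℕ →* ℝ where
  toFun n := 1 / (n : ℝ)
  map_one' := by simp
  map_mul' a b := by push_cast; rw [one_div_mul_one_div]

lemma mertens_prod (N : ℕ) (hN : 2 ≤ N) :
    ∏ p ∈ (range N).filter Nat.Prime, (1 - 1 / (p : ℝ)) ≤ 1 / Real.log N := by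
  have hlog : 0 < Real.log N := Real.log_pos (by exact_mod_cast hN)
  have h1 := (EulerProduct.summable_and_hasSum_smoothNumbers_prod_primesBelow_geometric
    (f := recipHom) (fun {p} hp => by
        have : (1 : ℝ) < p := by exact_mod_cast hp.one_lt
        change ‖1 / (p : ℝ)‖ < 1
        rw [Real.norm_of_nonneg (by positivity)]
        exact (div_lt_one (by linarith)).2 this) N).2
  have hsm : ∀ m ∈ Icc 1 (N - 1), m ∈ N.smoothNumbers := by
    intro m hm
    rw [mem_Icc] at hm
    rw [Nat.mem_smoothNumbers']
    intro p hp hpm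
    have := Nat.le_of_dvd (by omega) hpm
    omega
  have h2 : ∑ m ∈ (Icc 1 (N - 1)).attach, (1 / ((m : ℕ) : ℝ)) ≤
      ∏ p ∈ N.primesBelow, (1 - recipHom p)⁻¹ := by
    have := sum_le_hasSum ((Icc 1 (N - 1)).attach.image
      (fun m => (⟨m.1, hsm m.1 m.2⟩ : N.smoothNumbers))) (fun m _ => by
        change 0 ≤ 1 / ((m : ℕ) : ℝ); positivity) h1
    rw [sum_image] at this
    · exact this
    · intro a _ b _ hab
      simp only [Subtype.mk.injEq] at hab
      exact Subtype.ext hab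
  rw [sum_attach (Icc 1 (N - 1)) (fun m => 1 / (m : ℝ))] at h2
  have h3 : Real.log N ≤ ∑ m ∈ Icc 1 (N - 1), (1 / (m : ℝ)) := by
    have := log_add_one_le_harmonic (N - 1)
    rw [harmonic_eq_sum_Icc] at this
    push_cast at this
    rw [Nat.cast_sub (by omega)] at this
    simpa using this
  have h4 : ∏ p ∈ N.primesBelow, (1 - recipHom p)⁻¹ =
      (∏ p ∈ (range N).filter Nat.Prime, (1 - 1 / (p : ℝ)))⁻¹ := by
    rw [← prod_inv_distrib]; rfl
  rw [h4] at h2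
  have h5 := h3.trans h2
  have h6 : 0 < ∏ p ∈ (range N).filter Nat.Prime, (1 - 1 / (p : ℝ)) := by
    refine prod_pos fun p hp => ?_
    have h2 : (1 : ℝ) < p := by exact_mod_cast (mem_filter.1 hp).2.one_lt
    have := (div_lt_one (by linarith)).2 h2
    linarith
  rw [le_div_iff₀ hlog, mul_comm]
  calc _ ≤ _ := mul_le_mul_of_nonneg_right h5 h6.le
    _ = 1 := inv_mul_cancel₀ h6.ne'

lemma VV_le (q r : ℕ) (hq : 0 < q) :
    VV q r ≤ (q / (q.totient : ℝ)) / Real.log (zz r) := by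
  have h1 := mertens_prod (zz r) (zz_ge r)
  have h2 : VV q r * ∏ p ∈ (range (zz r)).filter (fun p => p.Prime ∧ p ∣ q), (1 - 1 / (p : ℝ)) =
      ∏ p ∈ (range (zz r)).filter Nat.Prime, (1 - 1 / (p : ℝ)) := by
    unfold VV
    rw [← prod_filter_mul_prod_filter_not ((range (zz r)).filter Nat.Prime) (fun p => ¬ p ∣ q),
      filter_filter, filter_filter]
    simp only [not_not]
  have hφ : (0 : ℝ) < q.totient := by exact_mod_cast Nat.totient_pos.2 hq
  have hq' : (0 : ℝ) < q := by exact_mod_cast hq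
  have h3 : (q.totient : ℝ) / q = ∏ p ∈ q.primeFactors, (1 - 1 / (p : ℝ)) := by
    have := Nat.totient_eq_mul_prod_factors q
    have h4 := congrArg (fun x : ℚ => (x : ℝ)) this
    push_cast at h4
    rw [h4, mul_div_cancel_left₀ _ hq'.ne']
    simp
  have hle : ∀ p : ℕ, p.Prime → 0 ≤ 1 - 1 / (p : ℝ) ∧ 1 - 1 / (p : ℝ) ≤ 1 := by
    intro p hp
    have h2 : (1 : ℝ) ≤ p := by exact_mod_cast hp.one_le
    have := (div_le_one (by linarith)).2 h2
    have h5 : 0 ≤ 1 / (p : ℝ) := by positivity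
    constructor <;> linarith
  have h4 : (q.totient : ℝ) / q ≤ ∏ p ∈ (range (zz r)).filter (fun p => p.Prime ∧ p ∣ q), (1 - 1 / (p : ℝ)) := by
    rw [h3]
    have hsub : (range (zz r)).filter (fun p => p.Prime ∧ p ∣ q) ⊆ q.primeFactors := by
      intro p hp
      rw [mem_filter] at hp
      exact Nat.mem_primeFactors.2 ⟨hp.2.1, hp.2.2, hq.ne'⟩
    rw [← prod_sdiff hsub]
    refine mul_le_of_le_one_left (prod_nonneg fun p hp => (hle p (mem_filter.1 hp).2.1).1) ?_
    refine prod_le_one (fun p hp => ?_) (fun p hp => ?_)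
    · exact (hle p (Nat.prime_of_mem_primeFactors (mem_sdiff.1 hp).1)).1
    · exact (hle p (Nat.prime_of_mem_primeFactors (mem_sdiff.1 hp).1)).2
  have h5 : VV q r * ((q.totient : ℝ) / q) ≤ 1 / Real.log (zz r) := by
    refine le_trans ?_ (h2 ▸ h1)
    exact mul_le_mul_of_nonneg_left h4 (VV_nonneg q r)
  have h6 : VV q r = (VV q r * ((q.totient : ℝ) / q)) * (q / q.totient) := by field_simp
  rw [h6]
  calc _ ≤ 1 / Real.log (zz r) * (q / q.totient) := by gcongr
    _ = _ := by ring

end MajArc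

namespace MajArc

/-- all prime factors are at least `zz r` -/
def Rough (r m : ℕ) : Prop := ∀ p, p.Prime → p ∣ m → zz r ≤ p

lemma Rough.sf {r m : ℕ} (h : Rough r m) (q : ℕ) : Sf q r m := by
  intro p hp hz _ hd
  have := h p hp hd; omega

lemma Rough.coprime {r m q : ℕ} (h : Rough r m) (hq : 0 < q) (hqz : q < zz r) :
    Nat.Coprime m q := by
  rw [Nat.coprime_iff_gcd_eq_one]
  by_contra hne
  obtain ⟨p, hp, hd⟩ := Nat.exists_prime_and_dvd hne
  have h1 := h p hp (hd.trans (Nat.gcd_dvd_left _ _))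
  have h2 := Nat.le_of_dvd hq (hd.trans (Nat.gcd_dvd_right _ _))
  omega

lemma rough_iff_sf {r m q v : ℕ} (hv : Nat.Coprime v q) (hm : m ≡ v [MOD q]) :
    Rough r m ↔ Sf q r m := by
  refine ⟨fun h => h.sf q, fun h p hp hd => ?_⟩
  by_contra hlt
  have hpq : ¬ p ∣ q := by
    intro hpq
    have h1 : p ∣ v := by
      have := hm.of_dvd hpq
      exact (Nat.modEq_zero_iff_dvd).1 (this.symm.trans ((Nat.modEq_zero_iff_dvd).2 hd))
    have h2 := Nat.dvd_gcd h1 hpq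
    rw [hv.gcd_eq_one] at h2
    exact hp.one_lt.ne' (Nat.dvd_one.1 h2)
  exact h p hp (by omega) hpq hd

lemma Sf.mono {q r r' m : ℕ} (h : Sf q r m) (hr : r' ≤ r) : Sf q r' m :=
  fun p hp hz hq => h p hp (lt_of_lt_of_le hz (zz_mono hr)) hq

lemma log_zz (r : ℕ) : Real.log (zz r) = 2 ^ r * Real.log 2 := by
  unfold zz; push_cast; rw [Real.log_pow]; push_cast; ring

lemma log_zz_pos (r : ℕ) : 0 < Real.log (zz r) := by
  rw [log_zz]; have := Real.log_pos (show (1 : ℝ) < 2 by norm_num); positivity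

open Classical in
/-- Brun-Titchmarsh type bound -/
lemma UB : ∃ C : ℝ, 0 < C ∧ ∀ (r q v x y : ℕ), 3 ≤ r → 0 < q → x ≤ y →
    (q : ℝ) * (zz (r - 3) : ℝ) ^ 7 ≤ (y : ℝ) - x →
    ((#{m ∈ Ioc x y | m ≡ v [MOD q] ∧ Rough r m} : ℕ) : ℝ) ≤
      C * ((y : ℝ) - x) / (q.totient * Real.log (zz r)) := by
  obtain ⟨C, hC, h⟩ := FL
  refine ⟨8 * (C + 2), by positivity, ?_⟩
  intro r q v x y hr hq hxy hlen
  set r' := r - 3 with hr'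
  have h1 := (abs_le.1 (h r' 0 q v x y hq hxy)).2
  have h2 := VV_le q r' hq
  have hφ : (0 : ℝ) < q.totient := by exact_mod_cast Nat.totient_pos.2 hq
  have hφq : (q.totient : ℝ) ≤ q := by exact_mod_cast Nat.totient_le q
  have hq' : (0 : ℝ) < q := by exact_mod_cast hq
  have hl := log_zz_pos r'
  have hlog8 : Real.log (zz r) = 8 * Real.log (zz r') := by
    rw [log_zz, log_zz, show r = r' + 3 by omega, pow_add]; ring
  have hcard : ((#{m ∈ Ioc x y | m ≡ v [MOD q] ∧ Rough r m} : ℕ) : ℝ) ≤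
      ((#{m ∈ Ioc x y | m ≡ v [MOD q] ∧ Sf q r' m} : ℕ) : ℝ) := by
    have : #{m ∈ Ioc x y | m ≡ v [MOD q] ∧ Rough r m} ≤ #{m ∈ Ioc x y | m ≡ v [MOD q] ∧ Sf q r' m} := by
      apply card_le_card
      intro m hm
      rw [mem_filter] at hm ⊢
      exact ⟨hm.1, hm.2.1, (hm.2.2.sf q).mono (by omega)⟩
    exact_mod_cast this
  have hy0 : 0 ≤ (y : ℝ) - x := le_trans (by positivity) hlen
  set Hh := (y : ℝ) - x with hHh
  have h3 : Hh / q * VV q r' ≤ Hh / (q.totient * Real.log (zz r')) := by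
    calc _ ≤ Hh / q * ((q / (q.totient : ℝ)) / Real.log (zz r')) := by gcongr
      _ = _ := by field_simp
  have hz : (zz r' : ℝ) ^ (4 * 0 + 6) ≤ Hh / (q.totient * Real.log (zz r')) := by
    rw [le_div_iff₀ (by positivity)]
    have h4 : Real.log (zz r') ≤ zz r' := (Real.log_le_sub_one_of_pos (by
      have := zz_ge r'; positivity)).trans (by linarith)
    calc (zz r' : ℝ) ^ (4 * 0 + 6) * (q.totient * Real.log (zz r'))
        ≤ (zz r' : ℝ) ^ (4 * 0 + 6) * (q * zz r') := by gcongr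
      _ = q * (zz r' : ℝ) ^ 7 := by ring
      _ ≤ Hh := hlen
  have h5 : 8 * (C + 2) * Hh / (q.totient * Real.log (zz r)) =
      (C + 2) * (Hh / (q.totient * Real.log (zz r'))) := by
    rw [hlog8]; field_simp
  rw [h5]
  simp only [pow_zero, mul_one] at h1
  have h6 : 0 ≤ Hh / q * VV q r' := mul_nonneg (div_nonneg hy0 hq'.le) (VV_nonneg _ _)
  nlinarith

/-! exponentials -/

lemma e_add (x y : ℝ) : e (x + y) = e x * e y := by
  unfold e; rw [← Complex.exp_add]; congr 1; push_cast; ring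

lemma e_eq (x : ℝ) : e x = Complex.exp ((2 * Real.pi * x : ℝ) * Complex.I) := by
  unfold e; congr 1; push_cast; ring

@[simp] lemma norm_e (x : ℝ) : ‖e x‖ = 1 := by
  rw [e_eq]; exact Complex.norm_exp_ofReal_mul_I _

lemma e_zero : e 0 = 1 := by simp [e]

lemma e_int (m : ℤ) : e m = 1 := by
  unfold e
  rw [Complex.exp_eq_one_iff]
  exact ⟨m, by push_cast; ring⟩

lemma e_add_int (x : ℝ) (m : ℤ) : e (x + m) = e x := by rw [e_add, e_int, mul_one]

lemma e_congr {x y : ℝ} (m : ℤ) (h : x = y + m) : e x = e y := by rw [h, e_add_int]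

lemma e_neg (x : ℝ) : e (-x) = (starRingEnd ℂ) (e x) := by
  rw [e_eq, e_eq, ← Complex.exp_conj, map_mul, Complex.conj_ofReal, Complex.conj_I]
  congr 1; push_cast; ring

lemma norm_e_sub_le (x y : ℝ) : ‖e x - e y‖ ≤ 2 * Real.pi * |x - y| := by
  have h : e x - e y = e y * (e (x - y) - 1) := by
    rw [mul_sub, ← e_add]; congr 2 <;> ring_nf
  rw [h, norm_mul, norm_e, one_mul, e_eq]
  have := Real.norm_exp_I_mul_ofReal_sub_one_le (x := 2 * Real.pi * (x - y))
  rw [mul_comm Complex.I] at this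
  refine this.trans ?_
  rw [Real.norm_eq_abs, abs_mul, abs_of_pos (by positivity)]

lemma norm_e_sub_one_ge {t : ℝ} (ht : |t| ≤ 1 / 2) : 4 * |t| ≤ ‖e t - 1‖ := by
  rw [e_eq, mul_comm _ Complex.I, Complex.norm_exp_I_mul_ofReal_sub_one]
  rw [norm_mul, Real.norm_eq_abs, Real.norm_eq_abs]
  have h1 : 2 / Real.pi * |2 * Real.pi * t / 2| ≤ |Real.sin (2 * Real.pi * t / 2)| := by
    apply Real.mul_abs_le_abs_sin
    rw [show 2 * Real.pi * t / 2 = Real.pi * t by ring, abs_mul, abs_of_pos Real.pi_pos]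
    have := Real.pi_pos
    nlinarith
  have h2 : 2 / Real.pi * |2 * Real.pi * t / 2| = 2 * |t| := by
    rw [show 2 * Real.pi * t / 2 = Real.pi * t by ring, abs_mul, abs_of_pos Real.pi_pos]
    have := Real.pi_pos
    field_simp
  rw [h2] at h1
  norm_num
  linarith

lemma geom_e (A B : ℕ) {t : ℝ} (ht0 : t ≠ 0) (ht : |t| ≤ 1 / 2) :
    ‖∑ j ∈ Ioc A B, e (j * t)‖ ≤ 1 / (2 * |t|) := by
  have habs : 0 < |t| := abs_pos.2 ht0
  rcases le_total B A with h | h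
  · rw [Ioc_eq_empty_of_le h]; simp
  have htel : (∑ j ∈ Ioc A B, e (j * t)) * (e t - 1) = e ((B + 1 : ℕ) * t) - e ((A + 1 : ℕ) * t) := by
    rw [sum_mul]
    induction B, h using Nat.le_induction with
    | base => simp
    | succ n hn ih =>
      rw [sum_Ioc_succ_top (by omega), ih, mul_sub, ← e_add]
      push_cast
      ring_nf
  have h1 : ‖∑ j ∈ Ioc A B, e (j * t)‖ * ‖e t - 1‖ ≤ 2 := by
    rw [← norm_mul, htel]
    refine (norm_sub_le _ _).trans ?_
    rw [norm_e, norm_e]; norm_num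
  have h2 := norm_e_sub_one_ge ht
  rw [le_div_iff₀ (by positivity)]
  have h3 := mul_le_mul_of_nonneg_left h2 (norm_nonneg (∑ j ∈ Ioc A B, e (j * t)))
  nlinarith

lemma orth (q : ℕ) (hq : 0 < q) (a : ℤ) :
    ∑ w ∈ range q, e ((a : ℝ) * w / q) = if (q : ℤ) ∣ a then (q : ℂ) else 0 := by
  have hq' : (q : ℝ) ≠ 0 := by positivity
  have hpow : ∀ w : ℕ, e ((a : ℝ) * w / q) = (e ((a : ℝ) / q)) ^ w := by
    intro w
    induction w with
    | zero => simp [e_zero]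
    | succ n ih => rw [pow_succ, ← ih, ← e_add]; push_cast; congr 1; ring
  split_ifs with h
  · obtain ⟨c, rfl⟩ := h
    have : ∀ w ∈ range q, e (((q * c : ℤ) : ℝ) * w / q) = 1 := by
      intro w _
      rw [show (((q * c : ℤ) : ℝ) * w / q) = ((c * w : ℤ) : ℝ) by push_cast; field_simp]
      exact e_int _
    rw [sum_congr rfl this]; simp
  · have hne : e ((a : ℝ) / q) ≠ 1 := by
      intro h1
      unfold e at h1
      rw [Complex.exp_eq_one_iff] at h1
      obtain ⟨m, hm⟩ := h1
      apply h
      have hpi : (2 * Real.pi * Complex.I : ℂ) ≠ 0 := by simp [Real.pi_ne_zero]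
      have h2 : (((a : ℝ) / q : ℝ) : ℂ) = m := by
        apply mul_left_cancel₀ hpi; rw [hm]; ring
      have h3 : (a : ℝ) / q = m := by exact_mod_cast h2
      rw [div_eq_iff hq'] at h3
      exact ⟨m, by rw [mul_comm]; exact_mod_cast h3⟩
    rw [sum_congr rfl (fun w _ => hpow w), geom_sum_eq hne, ← hpow]
    rw [show (a : ℝ) * q / q = (a : ℝ) by field_simp, e_int]
    simp

end MajArc

namespace MajArc

/-- number of `k`-th roots of unity modulo `q` -/
noncomputable def rho (k q : ℕ) : ℕ := Nat.card {u : (ZMod q)ˣ // u ^ k = 1}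

lemma rho_mul (k : ℕ) {m n : ℕ} (h : m.Coprime n) : rho k (m * n) = rho k m * rho k n := by
  unfold rho
  rw [← Nat.card_prod]
  apply Nat.card_congr
  let E := (Units.mapEquiv (ZMod.chineseRemainder h).toMulEquiv).trans
    (MulEquiv.prodUnits (M := ZMod m) (N := ZMod n))
  have hE : ∀ u, u ^ k = 1 ↔ (E u).1 ^ k = 1 ∧ (E u).2 ^ k = 1 := by
    intro u
    rw [← Prod.fst_one (M := (ZMod m)ˣ) (N := (ZMod n)ˣ)]
    constructor
    · intro hu
      have h1 : (E u) ^ k = 1 := by rw [← map_pow, hu, map_one]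
      exact ⟨by rw [← Prod.pow_fst, h1], by rw [← Prod.pow_snd, h1]; rfl⟩
    · rintro ⟨h1, h2⟩
      apply E.injective
      rw [map_pow, map_one]
      exact Prod.ext h1 h2
  exact
  { toFun := fun u => (⟨(E u.1).1, ((hE u.1).1 u.2).1⟩, ⟨(E u.1).2, ((hE u.1).1 u.2).2⟩)
    invFun := fun u => ⟨E.symm (u.1.1, u.2.1), by
      rw [hE]; simp [u.1.2, u.2.2]⟩
    left_inv := fun u => by ext; simp
    right_inv := fun u => by ext <;> simp }

lemma card_pow_le_cyclic {G : Type*} [Group G] [Finite G] [IsCyclic G] {k : ℕ} (hk : 0 < k) :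
    Nat.card {u : G // u ^ k = 1} ≤ k := by
  classical
  have := Fintype.ofFinite G
  have := IsCyclic.card_pow_eq_one_le (α := G) hk
  rw [Nat.card_eq_fintype_card, Fintype.card_subtype]
  exact this

lemma card_pow_le_index {G : Type*} [CommGroup G] [Finite G] (H : Subgroup G) [IsCyclic H] {k : ℕ}
    (hk : 0 < k) : Nat.card {u : G // u ^ k = 1} ≤ k * H.index := by
  let K : Subgroup G := (powMonoidHom k : G →* G).ker
  have h1 : Nat.card {u : G // u ^ k = 1} = Nat.card K := by
    apply Nat.card_congr
    exact Equiv.subtypeEquivRight fun u => by simp [K, MonoidHom.mem_ker]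
  have h2 := (H.subgroupOf K).card_mul_index
  rw [h1, ← h2]
  have h3 : (H.subgroupOf K).index ≤ H.index := by
    exact Nat.le_of_dvd (Nat.pos_of_ne_zero Subgroup.FiniteIndex.index_ne_zero)
      (H.relIndex_dvd_index_of_normal K)
  have h4 : Nat.card (H.subgroupOf K) ≤ Nat.card {u : H // u ^ k = 1} := by
    apply Nat.card_le_card_of_injective
      (fun x : H.subgroupOf K => (⟨⟨(x.1 : G), x.2⟩, by
        have := x.1.2
        rw [MonoidHom.mem_ker] at this
        ext; simpa using this⟩ : {u : H // u ^ k = 1}))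
    intro x y hxy
    have h5 := congrArg (fun t => ((t.1 : H) : G)) hxy
    exact Subtype.ext (Subtype.ext h5)
  exact Nat.mul_le_mul (h4.trans (card_pow_le_cyclic hk)) h3

lemma rho_prime_pow (k : ℕ) (hk : 0 < k) (p n : ℕ) (hp : p.Prime) : rho k (p ^ n) ≤ 2 * k := by
  have : NeZero (p ^ n) := ⟨pow_ne_zero _ hp.ne_zero⟩
  by_cases h2 : p = 2
  · subst h2
    by_cases hn : n < 2
    · have h1 : rho k (2 ^ n) ≤ Nat.card (ZMod (2 ^ n))ˣ := Nat.card_le_card_of_injective _ Subtype.val_injective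
      have h3 : Nat.card (ZMod (2 ^ n))ˣ ≤ 2 := by
        rw [Nat.card_eq_fintype_card, ZMod.card_units_eq_totient]
        refine (Nat.totient_le _).trans ?_
        interval_cases n <;> norm_num
      omega
    · obtain ⟨m, rfl⟩ : ∃ m, n = m + 2 := ⟨n - 2, by omega⟩
      have h5 := ZMod.orderOf_five m
      have hu : IsUnit (5 : ZMod (2 ^ (m + 2))) := by
        have : ((5 : ℕ) : ZMod (2 ^ (m + 2))) = 5 := by norm_num
        rw [← this, ZMod.isUnit_iff_coprime]
        exact Nat.Coprime.pow_right _ (by norm_num)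
      obtain ⟨u, hu⟩ := hu
      rw [← hu, orderOf_units] at h5
      have h6 := card_pow_le_index (Subgroup.zpowers u) hk
      have h7 := (Subgroup.zpowers u).card_mul_index
      rw [Nat.card_zpowers, h5, Nat.card_eq_fintype_card, ZMod.card_units_eq_totient,
        Nat.totient_prime_pow Nat.prime_two (by omega)] at h7
      have h8 : (Subgroup.zpowers u).index = 2 := by
        have : 2 ^ m * (Subgroup.zpowers u).index = 2 ^ m * 2 := by
          rw [h7]; simp [pow_succ]
        exact Nat.eq_of_mul_eq_mul_left (by positivity) this
      rw [h8] at h6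
      unfold rho
      omega
  · have := ZMod.isCyclic_units_of_prime_pow p hp h2 n
    have := card_pow_le_cyclic (G := (ZMod (p ^ n))ˣ) hk
    unfold rho
    omega

lemma rho_le (k : ℕ) (hk : 0 < k) (q : ℕ) (hq : 0 < q) : rho k q ≤ (2 * k) ^ (#q.primeFactors) := by
  induction q using Nat.recOnPosPrimePosCoprime with
  | prime_pow p n hp hn =>
    rw [Nat.primeFactors_prime_pow hn.ne' hp]
    simpa using rho_prime_pow k hk p n hp
  | zero => omega
  | one =>
    unfold rho
    have : Subsingleton {u : (ZMod 1)ˣ // u ^ k = 1} := inferInstance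
    rw [Nat.card_eq_fintype_card]
    simpa using Fintype.card_le_one_iff_subsingleton.2 this
  | coprime a b ha hb hab iha ihb =>
    rw [rho_mul k hab, hab.primeFactors_mul, card_union_of_disjoint hab.disjoint_primeFactors, pow_add]
    exact Nat.mul_le_mul (iha (by omega)) (ihb (by omega))

lemma pow_omega_le (K : ℕ) (hK : 1 ≤ K) (ε : ℝ) (hε : 0 < ε) :
    ∃ C : ℝ, 1 ≤ C ∧ ∀ q : ℕ, 0 < q → (K : ℝ) ^ (#q.primeFactors) ≤ C * (q : ℝ) ^ ε := by
  obtain ⟨P0, hP0⟩ := exists_nat_gt ((K : ℝ) ^ (1 / ε))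
  have hK' : (1 : ℝ) ≤ K := by exact_mod_cast hK
  refine ⟨(K : ℝ) ^ P0, one_le_pow₀ hK', ?_⟩
  intro q hq
  have h1 : (K : ℝ) ^ (#q.primeFactors) = ∏ p ∈ q.primeFactors, (K : ℝ) := by rw [prod_const]
  have h2 : ∏ p ∈ q.primeFactors, (K : ℝ) ≤
      ∏ p ∈ q.primeFactors, ((if p < P0 then (K : ℝ) else 1) * (p : ℝ) ^ ε) := by
    refine prod_le_prod (fun _ _ => by positivity) fun p hp => ?_
    have hp1 : (1 : ℝ) ≤ p := by exact_mod_cast (Nat.prime_of_mem_primeFactors hp).one_le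
    split_ifs with h
    · exact le_mul_of_one_le_right (by positivity) (Real.one_le_rpow hp1 hε.le)
    · rw [one_mul]
      have h3 : (K : ℝ) ^ (1 / ε) ≤ p := hP0.le.trans (by exact_mod_cast not_lt.1 h)
      have := Real.rpow_le_rpow (by positivity) h3 hε.le
      rwa [← Real.rpow_mul (by positivity), one_div_mul_cancel hε.ne', Real.rpow_one] at this
  rw [h1]
  refine h2.trans ?_
  rw [prod_mul_distrib]
  have h3 : ∏ p ∈ q.primeFactors, (if p < P0 then (K : ℝ) else 1) ≤ (K : ℝ) ^ P0 := by
    rw [prod_ite, prod_const_one, mul_one, prod_const]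
    apply pow_le_pow_right₀ hK'
    calc _ ≤ #(range P0) := card_le_card (fun p hp => mem_range.2 (mem_filter.1 hp).2)
      _ = P0 := card_range _
  have h4 : ∏ p ∈ q.primeFactors, (p : ℝ) ^ ε ≤ (q : ℝ) ^ ε := by
    rw [Real.finsetProd_rpow _ _ (fun p _ => by positivity)]
    apply Real.rpow_le_rpow (prod_nonneg fun p _ => by positivity) _ hε.le
    have := Nat.le_of_dvd hq (Nat.prod_primeFactors_dvd q)
    rw [← Nat.cast_prod]
    exact Nat.cast_le.2 this
  exact mul_le_mul h3 h4 (prod_nonneg fun p _ => by positivity) (by positivity)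

lemma totient_ge (q : ℕ) (hq : 0 < q) : (q : ℝ) ≤ q.totient * 2 ^ (#q.primeFactors) := by
  have h1 := Nat.totient_eq_mul_prod_factors q
  have h4 := congrArg (fun x : ℚ => (x : ℝ)) h1
  push_cast at h4
  rw [h4]
  have h2 : 1 ≤ (∏ p ∈ q.primeFactors, (1 - (p : ℝ)⁻¹)) * 2 ^ (#q.primeFactors) := by
    rw [← prod_const, ← prod_mul_distrib]
    refine Finset.prod_induction _ (fun x : ℝ => 1 ≤ x) (fun a b ha hb => one_le_mul_of_one_le_of_one_le ha hb)
      le_rfl fun p hp => ?_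
    have h5 : (2 : ℝ) ≤ p := by exact_mod_cast (Nat.prime_of_mem_primeFactors hp).two_le
    have h6 : (p : ℝ)⁻¹ ≤ 2⁻¹ := inv_anti₀ (by norm_num) h5
    linarith
  rw [mul_assoc]
  exact le_mul_of_one_le_right (by positivity) h2

/-- arithmetic bounds with exponent `1/100` -/
lemma arith_bounds (k : ℕ) (hk : 0 < k) : ∃ C : ℝ, 1 ≤ C ∧ ∀ q : ℕ, 0 < q →
    (rho k q : ℝ) ≤ C * (q : ℝ) ^ (1 / 100 : ℝ) ∧
    (q : ℝ) ≤ C * (q : ℝ) ^ (1 / 100 : ℝ) * q.totient := by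
  obtain ⟨C1, h1, h1'⟩ := pow_omega_le (2 * k) (by omega) (1 / 100) (by norm_num)
  obtain ⟨C2, h2, h2'⟩ := pow_omega_le 2 (by omega) (1 / 100) (by norm_num)
  refine ⟨max C1 C2, h1.trans (le_max_left _ _), fun q hq => ⟨?_, ?_⟩⟩
  · have h3 : (rho k q : ℝ) ≤ ((2 * k : ℕ) : ℝ) ^ (#q.primeFactors) := by exact_mod_cast rho_le k hk q hq
    refine h3.trans ((h1' q hq).trans ?_)
    gcongr; exact le_max_left _ _
  · refine (totient_ge q hq).trans ?_
    rw [mul_comm]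
    have := h2' q hq
    push_cast at this
    gcongr
    refine this.trans ?_
    gcongr; exact le_max_right _ _

lemma card_roots_le (k q x0 : ℕ) (hk : 0 < k) (hq : 0 < q) (hx0 : Nat.Coprime x0 q) :
    #{x ∈ range q | x ^ k ≡ x0 ^ k [MOD q]} ≤ rho k q := by
  have : NeZero q := ⟨hq.ne'⟩
  have hcop : ∀ x ∈ (range q).filter (fun x => x ^ k ≡ x0 ^ k [MOD q]), Nat.Coprime x q := by
    intro x hx
    have h1 := (mem_filter.1 hx).2
    have h2 : Nat.Coprime (x ^ k) q := by
      rw [Nat.coprime_iff_gcd_eq_one, h1.gcd_eq]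
      exact (hx0.pow_left k)
    exact (Nat.coprime_pow_left_iff hk x q).1 h2
  classical
  let u0 : (ZMod q)ˣ := ZMod.unitOfCoprime x0 hx0
  have h4 : Nat.card {u : (ZMod q)ˣ // u ^ k = 1} = #{u : (ZMod q)ˣ | u ^ k = 1} := by
    rw [Nat.card_eq_fintype_card, Fintype.card_subtype]
  unfold rho
  rw [h4]
  refine card_le_card_of_surjOn (fun u => ((u * u0 : (ZMod q)ˣ) : ZMod q).val) ?_
  intro x hx
  have hx' : x ∈ (range q).filter (fun x => x ^ k ≡ x0 ^ k [MOD q]) := hx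
  have hc := hcop x hx'
  rw [mem_filter, mem_range] at hx'
  refine ⟨ZMod.unitOfCoprime x hc * u0⁻¹, ?_, ?_⟩
  · simp only [coe_filter, mem_univ, true_and, Set.mem_setOf_eq]
    rw [mul_pow, inv_pow, mul_inv_eq_one]
    ext
    have := (ZMod.natCast_eq_natCast_iff _ _ _).2 hx'.2
    simpa [u0] using this
  · simp [ZMod.val_natCast, Nat.mod_eq_of_lt hx'.1]

end MajArc

namespace MajArc

/-- Cauchy-Schwarz and orthogonality modulo `q`. -/
lemma bilin (q : ℕ) (a : ℤ) (hq : 0 < q) (ha : IsCoprime a (q : ℤ)) {ι κ : Type*} (L : Finset ι)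
    (Pp : Finset κ) (J : Finset ℕ) (jl : ι → ℕ) (hjl : ∀ l ∈ L, jl l ∈ J) (wl : ι → ℕ)
    (x : κ → ℕ) (G : κ → ℕ → ℂ) (vw : ι → ℝ) (hv0 : ∀ l ∈ L, 0 ≤ vw l) (hv1 : ∀ l ∈ L, vw l ≤ 1)
    (M : ℝ) (hM : ∀ j w, (#{l ∈ L | jl l = j ∧ wl l ≡ w [MOD q]} : ℝ) ≤ M) :
    ‖∑ l ∈ L, ∑ p ∈ Pp, (vw l : ℂ) * (e (a * (x p * wl l : ℕ) / q) * G p (jl l))‖ ^ 2 ≤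
      M * #L * (q * ∑ p ∈ Pp, ∑ p' ∈ Pp with x p ≡ x p' [MOD q],
        ‖∑ j ∈ J, G p j * starRingEnd ℂ (G p' j)‖) := by
  classical
  set g : ℕ → ℕ → ℂ := fun j w => ∑ p ∈ Pp, e (a * (x p * w : ℕ) / q) * G p j with hg
  have hq' : (q : ℝ) ≠ 0 := by positivity
  have hgmod : ∀ j w, g j w = g j (w % q) := by
    intro j w
    refine sum_congr rfl fun p _ => ?_
    congr 1
    obtain ⟨d, hd⟩ : ∃ d : ℕ, d = w / q := ⟨_, rfl⟩
    refine e_congr (a * (x p : ℤ) * (d : ℕ)) ?_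
    have h1 : (w : ℝ) = q * (d : ℕ) + (w % q : ℕ) := by
      rw [hd]; exact_mod_cast (Nat.div_add_mod w q).symm
    push_cast
    field_simp
    rw [h1]
    ring
  have hM0 : 0 ≤ M := le_trans (Nat.cast_nonneg _) (hM 0 0)
  have h1 : ‖∑ l ∈ L, ∑ p ∈ Pp, (vw l : ℂ) * (e (a * (x p * wl l : ℕ) / q) * G p (jl l))‖ ≤
      ∑ l ∈ L, ‖g (jl l) (wl l % q)‖ := by
    refine (norm_sum_le _ _).trans (sum_le_sum fun l hl => ?_)
    rw [← mul_sum, norm_mul, ← hgmod]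
    have : ‖(vw l : ℂ)‖ ≤ 1 := by
      rw [Complex.norm_real, Real.norm_eq_abs, abs_of_nonneg (hv0 l hl)]; exact hv1 l hl
    exact mul_le_of_le_one_left (norm_nonneg _) this
  have h2 : (∑ l ∈ L, ‖g (jl l) (wl l % q)‖) ^ 2 ≤ #L * ∑ l ∈ L, ‖g (jl l) (wl l % q)‖ ^ 2 :=
    sq_sum_le_card_mul_sum_sq
  have h3 : ∑ l ∈ L, ‖g (jl l) (wl l % q)‖ ^ 2 ≤ M * ∑ y ∈ J ×ˢ range q, ‖g y.1 y.2‖ ^ 2 := by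
    rw [← sum_fiberwise_of_maps_to (s := L) (t := J ×ˢ range q) (g := fun l => (jl l, wl l % q))
      (fun l hl => mem_product.2 ⟨hjl l hl, mem_range.2 (Nat.mod_lt _ hq)⟩), mul_sum]
    refine sum_le_sum fun y _ => ?_
    have h4 : ∑ l ∈ L with (jl l, wl l % q) = y, ‖g (jl l) (wl l % q)‖ ^ 2 =
        #{l ∈ L | (jl l, wl l % q) = y} * ‖g y.1 y.2‖ ^ 2 := by
      rw [← nsmul_eq_mul, ← sum_const]
      refine sum_congr rfl fun l hl => ?_
      rw [← (mem_filter.1 hl).2]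
    rw [h4]
    refine mul_le_mul_of_nonneg_right ?_ (by positivity)
    refine le_trans ?_ (hM y.1 y.2)
    refine Nat.cast_le.2 (card_le_card fun l hl => ?_)
    rw [mem_filter] at hl ⊢
    refine ⟨hl.1, by rw [← hl.2], ?_⟩
    rw [← hl.2]
    exact (Nat.mod_modEq _ _).symm
  have h5 : ((∑ y ∈ J ×ˢ range q, ‖g y.1 y.2‖ ^ 2 : ℝ) : ℂ) =
      q * ∑ p ∈ Pp, ∑ p' ∈ Pp with x p ≡ x p' [MOD q], ∑ j ∈ J, G p j * starRingEnd ℂ (G p' j) := by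
    have h6 : ∀ y : ℕ × ℕ, ((‖g y.1 y.2‖ ^ 2 : ℝ) : ℂ) = ∑ p ∈ Pp, ∑ p' ∈ Pp,
        (G p y.1 * starRingEnd ℂ (G p' y.1)) * e ((a * ((x p : ℤ) - x p') : ℤ) * y.2 / q) := by
      intro y
      rw [Complex.ofReal_pow, ← Complex.mul_conj', hg]
      simp only [map_sum, map_mul]
      rw [sum_mul_sum]
      refine sum_congr rfl fun p _ => sum_congr rfl fun p' _ => ?_
      rw [← e_neg]
      have : e ((a * ((x p : ℤ) - x p') : ℤ) * y.2 / q) =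
          e (a * (x p * y.2 : ℕ) / q) * e (-(a * (x p' * y.2 : ℕ) / q)) := by
        rw [← e_add]
        congr 1
        push_cast
        ring
      rw [this]; ring
    push_cast
    simp only [← Complex.ofReal_pow]
    rw [sum_congr rfl fun y _ => h6 y, sum_product, mul_sum]
    simp only
    calc ∑ j ∈ J, ∑ w ∈ range q, ∑ p ∈ Pp, ∑ p' ∈ Pp,
        (G p j * starRingEnd ℂ (G p' j)) * e ((a * ((x p : ℤ) - x p') : ℤ) * w / q)
        = ∑ j ∈ J, ∑ p ∈ Pp, ∑ p' ∈ Pp, (G p j * starRingEnd ℂ (G p' j)) *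
          (if x p ≡ x p' [MOD q] then (q : ℂ) else 0) := by
          refine sum_congr rfl fun j _ => ?_
          rw [sum_comm]
          refine sum_congr rfl fun p _ => ?_
          rw [sum_comm]
          refine sum_congr rfl fun p' _ => ?_
          rw [← mul_sum, orth q hq]
          congr 1
          have h7 : ((q : ℤ) ∣ a * ((x p : ℤ) - x p')) ↔ x p ≡ x p' [MOD q] := by
            rw [← Int.natCast_modEq_iff, Int.modEq_comm, Int.modEq_iff_dvd]
            exact ⟨fun h => IsCoprime.dvd_of_dvd_mul_left ha.symm h, fun h => Dvd.dvd.mul_left h _⟩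
          simp only [h7]
      _ = _ := by
          rw [sum_comm]
          refine sum_congr rfl fun p _ => ?_
          rw [sum_comm, mul_sum, sum_filter]
          refine sum_congr rfl fun p' _ => ?_
          split_ifs
          · rw [mul_sum]; exact sum_congr rfl fun j _ => mul_comm _ _
          · simp
  have h8 : ∑ y ∈ J ×ˢ range q, ‖g y.1 y.2‖ ^ 2 ≤ q * ∑ p ∈ Pp, ∑ p' ∈ Pp with x p ≡ x p' [MOD q],
        ‖∑ j ∈ J, G p j * starRingEnd ℂ (G p' j)‖ := by
    have h9 := congrArg norm h5
    rw [Complex.norm_real, Real.norm_eq_abs, abs_of_nonneg (sum_nonneg fun _ _ => by positivity),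
      norm_mul, Complex.norm_natCast] at h9
    rw [h9]
    gcongr
    refine (norm_sum_le _ _).trans (sum_le_sum fun p _ => norm_sum_le _ _)
  calc _ ≤ (∑ l ∈ L, ‖g (jl l) (wl l % q)‖) ^ 2 := by gcongr
    _ ≤ #L * ∑ l ∈ L, ‖g (jl l) (wl l % q)‖ ^ 2 := h2
    _ ≤ #L * (M * (q * ∑ p ∈ Pp, ∑ p' ∈ Pp with x p ≡ x p' [MOD q],
        ‖∑ j ∈ J, G p j * starRingEnd ℂ (G p' j)‖)) :=
        mul_le_mul_of_nonneg_left (h3.trans (mul_le_mul_of_nonneg_left h8 hM0)) (Nat.cast_nonneg _)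
    _ = _ := by ring

/-- complete exponential sum over reduced residues -/
noncomputable def SS (k q : ℕ) (a : ℤ) : ℂ := ∑ v ∈ range q with v.Coprime q, e (a * (v ^ k : ℕ) / q)

lemma card_units (q : ℕ) : #{v ∈ range q | v.Coprime q} = q.totient := by
  rw [Nat.totient_eq_card_coprime]
  congr 1
  exact filter_congr fun v _ => Nat.coprime_comm

lemma SS_le (k q : ℕ) (a : ℤ) (hk : 0 < k) (hq : 0 < q) (ha : IsCoprime a (q : ℤ)) :
    ‖SS k q a‖ ≤ rho k q * Real.sqrt q := by
  classical
  set R := {v ∈ range q | v.Coprime q} with hR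
  have hφ : 0 < q.totient := Nat.totient_pos.2 hq
  have hroots : ∀ w, (#{v ∈ R | v ^ k ≡ w [MOD q]} : ℝ) ≤ rho k q := by
    intro w
    by_cases h : ({v ∈ R | v ^ k ≡ w [MOD q]} : Finset ℕ).Nonempty
    · obtain ⟨v, hv⟩ := h
      rw [mem_filter, hR, mem_filter] at hv
      refine Nat.cast_le.2 (le_trans (card_le_card fun y hy => ?_) (card_roots_le k q v hk hq hv.1.2))
      rw [mem_filter, hR, mem_filter] at hy
      exact mem_filter.2 ⟨hy.1.1, hy.2.trans hv.2.symm⟩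
    · rw [not_nonempty_iff_eq_empty.1 h]; simp
  have h1 := bilin q a hq ha R R {0} (fun _ => 0) (fun _ _ => by simp) (fun l => l ^ k)
    (fun p => p ^ k) (fun _ _ => 1) (fun _ => 1) (fun _ _ => by norm_num) (fun _ _ => le_rfl)
    (rho k q) (by
      intro j w
      refine le_trans (Nat.cast_le.2 (card_le_card fun y hy => ?_)) (hroots w)
      rw [mem_filter] at hy ⊢
      exact ⟨hy.1, hy.2.2⟩)
  have h2 : ∑ l ∈ R, ∑ p ∈ R, ((1 : ℝ) : ℂ) * (e (a * (p ^ k * l ^ k : ℕ) / q) * 1) =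
      q.totient * SS k q a := by
    rw [← card_units q, ← hR, ← nsmul_eq_mul, ← sum_const]
    refine sum_congr rfl fun l hl => ?_
    rw [hR, mem_filter] at hl
    unfold SS
    rw [← hR]
    refine sum_bij (fun p _ => p * l % q) ?_ ?_ ?_ ?_
    · intro p hp
      rw [hR, mem_filter] at hp ⊢
      refine ⟨mem_range.2 (Nat.mod_lt _ hq), ?_⟩
      have := hp.2.mul_left hl.2
      rw [Nat.Coprime, (Nat.mod_modEq (p * l) q).gcd_eq]
      exact this
    · intro p hp p' hp' h
      rw [hR, mem_filter, mem_range] at hp hp'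
      have h3 : p * l ≡ p' * l [MOD q] := h
      have h4 := Nat.ModEq.cancel_right_of_coprime (by rw [Nat.gcd_comm]; exact hl.2) h3
      exact Nat.ModEq.eq_of_lt_of_lt h4 hp.1 hp'.1
    · intro b hb
      rw [hR, mem_filter, mem_range] at hb
      obtain ⟨y, hy⟩ := Nat.exists_mul_mod_eq_of_coprime b hl.2 hq.ne'
      have hyb : l * y ≡ b [MOD q] := hy.2
      refine ⟨y % q, ?_, ?_⟩
      · rw [hR, mem_filter]
        refine ⟨mem_range.2 (Nat.mod_lt _ hq), ?_⟩
        rw [Nat.Coprime, (Nat.mod_modEq y q).gcd_eq]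
        have h5 : Nat.Coprime (l * y) q := by rw [Nat.Coprime, hyb.gcd_eq]; exact hb.2
        exact Nat.Coprime.coprime_mul_left h5
      · rw [Nat.mod_mul_mod, mul_comm]
        have : l * y % q = b % q := hyb
        rw [this, Nat.mod_eq_of_lt hb.1]
    · intro p hp
      simp only [Complex.ofReal_one, one_mul, mul_one]
      have h3 : (p * l % q) ^ k ≡ p ^ k * l ^ k [MOD q] := by
        rw [← mul_pow]; exact (Nat.mod_modEq _ _).pow k
      obtain ⟨d, hd⟩ := (Nat.modEq_iff_dvd.1 h3)
      refine e_congr (a * d) ?_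
      have h4 : ((p ^ k * l ^ k : ℕ) : ℝ) = ((p * l % q) ^ k : ℕ) + q * d := by
        have h5 : ((p ^ k * l ^ k : ℕ) : ℤ) = ((p * l % q) ^ k : ℕ) + q * d := by linarith
        have h6 := congrArg (fun t : ℤ => (t : ℝ)) h5
        push_cast at h6 ⊢
        exact h6
      rw [h4]
      have hq' : (q : ℝ) ≠ 0 := by positivity
      push_cast
      field_simp
  rw [h2] at h1
  have h3 : ∑ p ∈ R, ∑ p' ∈ R with p ^ k ≡ p' ^ k [MOD q],
        ‖∑ j ∈ ({0} : Finset ℕ), (1 : ℂ) * starRingEnd ℂ (1 : ℂ)‖ ≤ q.totient * rho k q := by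
    rw [← card_units q, ← hR, ← nsmul_eq_mul, ← sum_const]
    refine sum_le_sum fun p _ => ?_
    simp only [map_one, mul_one, sum_const, card_singleton, one_smul, norm_one, nsmul_eq_mul]
    refine le_trans (Nat.cast_le.2 (card_le_card fun y hy => ?_)) (hroots (p ^ k))
    rw [mem_filter] at hy ⊢
    exact ⟨hy.1, hy.2.symm⟩
  have h4 : (q.totient * ‖SS k q a‖) ^ 2 ≤ (q.totient * (rho k q * Real.sqrt q)) ^ 2 := by
    rw [norm_mul, Complex.norm_natCast] at h1
    refine h1.trans ?_
    calc _ ≤ (rho k q : ℝ) * #R * (q * (q.totient * rho k q)) := by gcongr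
      _ = _ := by
        rw [hR, card_units, mul_pow, mul_pow (rho k q : ℝ), Real.sq_sqrt (by positivity)]; ring
  have h5 := abs_le_of_sq_le_sq h4 (by positivity)
  have hφ' : (0 : ℝ) < q.totient := by exact_mod_cast hφ
  exact le_of_mul_le_mul_left ((abs_le.1 h5).2) hφ'

open Classical in
/-- rough numbers in short intervals with prescribed `k`-th power residue -/
lemma UBk : ∃ C : ℝ, 0 < C ∧ ∀ (k r q w x y : ℕ), 0 < k → 3 ≤ r → 0 < q → q < zz r → x ≤ y →
    q * (zz (r - 3)) ^ 7 ≤ y - x →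
    (#{m ∈ Ioc x y | m ^ k ≡ w [MOD q] ∧ Rough r m} : ℝ) ≤
      rho k q * (C * ((y - x : ℕ) : ℝ) / (q.totient * Real.log (zz r))) := by
  obtain ⟨C, hC, h⟩ := UB
  refine ⟨C, hC, fun k r q w x y hk hr hq hqz hxy hlen => ?_⟩
  by_cases hne : ({m ∈ Ioc x y | m ^ k ≡ w [MOD q] ∧ Rough r m} : Finset ℕ).Nonempty
  swap
  · rw [not_nonempty_iff_eq_empty.1 hne]
    have := log_zz_pos r
    simp only [card_empty, Nat.cast_zero]
    positivity
  obtain ⟨m0, hm0⟩ := hne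
  rw [mem_filter] at hm0
  have hcop : Nat.Coprime m0 q := Rough.coprime hm0.2.2 hq hqz
  set V := {v ∈ range q | v ^ k ≡ m0 ^ k [MOD q]} with hV
  have h1 : #{m ∈ Ioc x y | m ^ k ≡ w [MOD q] ∧ Rough r m} ≤
      ∑ v ∈ V, #{m ∈ Ioc x y | m ≡ v [MOD q] ∧ Rough r m} := by
    rw [card_eq_sum_card_fiberwise (f := fun m => m % q) (t := V)]
    · refine sum_le_sum fun v _ => card_le_card fun m hm => ?_
      rw [mem_filter, mem_filter] at hm
      refine mem_filter.2 ⟨hm.1.1, ?_, hm.1.2.2⟩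
      rw [← hm.2]; exact (Nat.mod_modEq _ _).symm
    · intro m hm
      have hm' : m ∈ ({m ∈ Ioc x y | m ^ k ≡ w [MOD q] ∧ Rough r m} : Finset ℕ) := hm
      rw [mem_filter] at hm'
      show m % q ∈ V
      refine mem_filter.2 ⟨mem_range.2 (Nat.mod_lt _ hq), ?_⟩
      exact ((Nat.mod_modEq m q).pow k).trans (hm'.2.1.trans hm0.2.1.symm)
  have h2 : (#{m ∈ Ioc x y | m ^ k ≡ w [MOD q] ∧ Rough r m} : ℝ) ≤
      ∑ v ∈ V, (#{m ∈ Ioc x y | m ≡ v [MOD q] ∧ Rough r m} : ℝ) := by exact_mod_cast h1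
  refine h2.trans ?_
  have hyx : ((y - x : ℕ) : ℝ) = y - x := by push_cast [hxy]; ring
  refine (sum_le_sum fun v _ => (h r q v x y hr hq hxy ?_)).trans ?_
  · first | exact hlen | (rw [← hyx]; exact_mod_cast hlen)
  · rw [sum_const, nsmul_eq_mul, ← hyx]
    have := log_zz_pos r
    gcongr
    exact card_roots_le k q m0 hk hq hcop

end MajArc

namespace MajArc

open Classical in
lemma UBs : ∃ C : ℝ, 0 < C ∧ (∀ (k r q w x y : ℕ), 0 < k → 3 ≤ r → 0 < q → q < zz r → x ≤ y →
    q * (zz (r - 3)) ^ 7 ≤ y - x →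
    (#{m ∈ Ioc x y | m ^ k ≡ w [MOD q] ∧ Rough r m} : ℝ) ≤
      rho k q * (C * ((y - x : ℕ) : ℝ) / (q.totient * Real.log (zz r)))) ∧
    (∀ (r x y : ℕ), 3 ≤ r → x ≤ y → (zz (r - 3)) ^ 7 ≤ y - x →
    (#{m ∈ Ioc x y | Rough r m} : ℝ) ≤ C * ((y - x : ℕ) : ℝ) / Real.log (zz r)) := by
  obtain ⟨C1, hC1, h1⟩ := UBk
  obtain ⟨C2, hC2, h2⟩ := UB
  refine ⟨max C1 C2, lt_max_of_lt_left hC1, ?_, ?_⟩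
  · intro k r q w x y hk hr hq hqz hxy hlen
    have := log_zz_pos r
    refine (h1 k r q w x y hk hr hq hqz hxy hlen).trans ?_
    gcongr
    exact le_max_left _ _
  · intro r x y hr hxy hlen
    have := log_zz_pos r
    have hyx : ((y - x : ℕ) : ℝ) = y - x := by push_cast [hxy]; ring
    have h3 := h2 r 1 0 x y hr one_pos hxy (by rw [← hyx, Nat.cast_one, one_mul]; exact_mod_cast hlen)
    rw [hyx]
    have h4 : ({m ∈ Ioc x y | m ≡ 0 [MOD 1] ∧ Rough r m} : Finset ℕ) = {m ∈ Ioc x y | Rough r m} := by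
      refine filter_congr fun m _ => ?_
      simp [Nat.modEq_one]
    rw [h4] at h3
    refine h3.trans ?_
    simp only [Nat.totient_one, Nat.cast_one, one_mul]
    have : (0:ℝ) ≤ y - x := by rw [← hyx]; positivity
    gcongr
    exact le_max_right _ _

/-- elementary: `(y-x) x^(k-1) ≤ y^k - x^k`. -/
lemma pow_sub_ge (k : ℕ) (x y A : ℝ) (hA : 0 ≤ A) (hAx : A ≤ x) (hxy : x ≤ y) :
    (y - x) * A ^ k ≤ y ^ (k + 1) - x ^ (k + 1) := by
  have hx : 0 ≤ x := hA.trans hAx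
  have h1 : A ^ k ≤ x ^ k := pow_le_pow_left₀ hA hAx k
  have h2 : x ^ k ≤ y ^ k := pow_le_pow_left₀ hx hxy k
  have h3 : (y - x) * A ^ k ≤ (y - x) * y ^ k := by
    apply mul_le_mul_of_nonneg_left (h1.trans h2); linarith
  have h4 : (y - x) * A ^ k ≤ (y - x) * x ^ k := by
    apply mul_le_mul_of_nonneg_left h1; linarith
  calc (y - x) * A ^ k ≤ (y - x) * y ^ k := h3
    _ = y ^ (k + 1) - x * y ^ k := by ring
    _ ≤ y ^ (k + 1) - x * x ^ k := by gcongr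
    _ = _ := by ring

/-- the inner sum over `j` -/
lemma inner_le (k J U : ℕ) (hU : 0 < U) (hJ : 0 < J) (X β : ℝ) (hX : 0 < X)
    (hJβ : 2 ^ (k + 2) * (|β| * X ^ (k + 1)) ≤ J) (Y Y' : ℝ) (hY : 0 ≤ Y) (p p' : ℕ)
    (hp : U ≤ p) (hp2 : p < 2 * U) (hp' : U ≤ p') (hp2' : p' < 2 * U) (G : ℕ → ℕ → ℂ)
    (hG : ∀ p j : ℕ, G p j = if Y < (p : ℝ) ^ (k + 1) * (j * ((X / U) ^ (k + 1) / J)) ∧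
      (p : ℝ) ^ (k + 1) * (j * ((X / U) ^ (k + 1) / J)) ≤ Y' then
        e (β * ((p : ℝ) ^ (k + 1) * (j * ((X / U) ^ (k + 1) / J)))) else 0) :
    ‖∑ j ∈ range (J + 1), G p j * starRingEnd ℂ (G p' j)‖ ≤
      4 * J / (((Nat.dist p p' / ⌈(U : ℝ) / (1 + 2 * (|β| * X ^ (k + 1)))⌉₊ : ℕ) : ℝ) + 1) := by
  set H : ℝ := (X / U) ^ (k + 1) / J with hH
  set Δ : ℝ := 2 * (|β| * X ^ (k + 1)) with hΔ
  set W : ℕ := ⌈(U : ℝ) / (1 + Δ)⌉₊ with hW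
  set d := Nat.dist p p' with hd
  have hUr : (0 : ℝ) < U := by exact_mod_cast hU
  have hJr : (0 : ℝ) < J := by exact_mod_cast hJ
  have hHpos : 0 < H := by positivity
  have hΔ0 : 0 ≤ Δ := by positivity
  have hWge : (U : ℝ) / (1 + Δ) ≤ W := Nat.le_ceil _
  have hWpos : 0 < W := Nat.ceil_pos.2 (by positivity)
  have hpp : (0 : ℝ) < p := by exact_mod_cast (lt_of_lt_of_le hU hp)
  have hpp' : (0 : ℝ) < p' := by exact_mod_cast (lt_of_lt_of_le hU hp')
  set t : ℝ := β * ((p : ℝ) ^ (k + 1) - (p' : ℝ) ^ (k + 1)) * H with ht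
  -- the conditions define an interval
  set lo : ℕ → ℕ := fun p => ⌊Y / ((p : ℝ) ^ (k + 1) * H)⌋₊ with hlo
  set hi : ℕ → ℤ := fun p => ⌊Y' / ((p : ℝ) ^ (k + 1) * H)⌋ with hhi
  have hcond : ∀ (p : ℕ), (0 : ℝ) < p → ∀ j : ℕ, (Y < (p : ℝ) ^ (k + 1) * (j * H) ∧
      (p : ℝ) ^ (k + 1) * (j * H) ≤ Y') ↔ (lo p < j ∧ (j : ℤ) ≤ hi p) := by
    intro p hp j
    have h0 : 0 < (p : ℝ) ^ (k + 1) * H := by positivity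
    have h1 : (p : ℝ) ^ (k + 1) * (j * H) = j * ((p : ℝ) ^ (k + 1) * H) := by ring
    rw [h1, hlo, hhi]
    simp only
    rw [Nat.floor_lt (by positivity), div_lt_iff₀ h0, Int.le_floor, le_div_iff₀ h0, Int.cast_natCast]
  set Aa := max (lo p) (lo p')
  set Bb : ℕ := (min (J : ℤ) (min (hi p) (hi p'))).toNat with hBb
  have hprod : ∀ j, G p j * starRingEnd ℂ (G p' j) =
      if (lo p < j ∧ (j : ℤ) ≤ hi p) ∧ (lo p' < j ∧ (j : ℤ) ≤ hi p') then e (j * t) else 0 := by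
    intro j
    rw [hG, hG]
    simp only [hcond p hpp j, hcond p' hpp' j]
    by_cases h1 : (lo p < j ∧ (j : ℤ) ≤ hi p)
    · by_cases h2 : (lo p' < j ∧ (j : ℤ) ≤ hi p')
      · simp only [h1, h2, if_true, and_true]
        rw [← e_neg, ← e_add]
        congr 1
        rw [ht]; ring
      · simp [h1, h2]
    · simp [h1]
  have hsum : ∑ j ∈ range (J + 1), G p j * starRingEnd ℂ (G p' j) = ∑ j ∈ Ioc Aa Bb, e (j * t) := by
    rw [sum_congr rfl fun j _ => hprod j, ← sum_filter]
    congr 1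
    ext j
    simp only [mem_filter, mem_range, mem_Ioc, Aa, hBb]
    omega
  have hcard : ‖∑ j ∈ Ioc Aa Bb, e (j * t)‖ ≤ J := by
    refine (norm_sum_le _ _).trans ?_
    simp only [norm_e, sum_const, Nat.card_Ioc, nsmul_eq_mul, mul_one]
    have : Bb - Aa ≤ J := by omega
    exact_mod_cast this
  rw [hsum]
  rcases Nat.eq_zero_or_pos (d / W) with hs | hs
  · rw [hs]
    refine hcard.trans ?_
    simp only [Nat.cast_zero, zero_add, div_one]
    linarith
  set s := d / W with hsd
  have hs1 : (1 : ℝ) ≤ s := by exact_mod_cast hs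
  have hsW : s * W ≤ d := Nat.div_mul_le_self _ _
  have hdU : d < U := by
    rw [hd, Nat.dist]; omega
  have hgoal : ∀ y : ℝ, y ≤ 2 * J / s → y ≤ 4 * J / (s + 1) := by
    intro y hy
    refine hy.trans ?_
    rw [div_le_div_iff₀ (by positivity) (by positivity)]
    nlinarith
  apply hgoal
  have hdr : (s : ℝ) * (U / (1 + Δ)) ≤ d := by
    calc (s : ℝ) * (U / (1 + Δ)) ≤ s * W := by gcongr
      _ ≤ d := by exact_mod_cast hsW
  rcases lt_or_ge Δ 1 with hΔ1 | hΔ1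
  · refine hcard.trans ?_
    have hdUr : (d : ℝ) < U := by exact_mod_cast hdU
    have h2 : (s : ℝ) * (U / (1 + Δ)) < U := lt_of_le_of_lt hdr hdUr
    have h3 : (s : ℝ) < 1 + Δ := by
      rw [mul_div_assoc', div_lt_iff₀ (by positivity)] at h2
      nlinarith
    rw [le_div_iff₀ (by positivity)]
    nlinarith
  · have hdpos : (0 : ℝ) < d := lt_of_lt_of_le (by positivity) hdr
    -- bounds for t
    have habs : |t| = |β| * |(p : ℝ) ^ (k + 1) - (p' : ℝ) ^ (k + 1)| * H := by
      rw [ht, abs_mul, abs_mul, abs_of_pos hHpos]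
    have hlow : (d : ℝ) * (U : ℝ) ^ k ≤ |(p : ℝ) ^ (k + 1) - (p' : ℝ) ^ (k + 1)| := by
      rcases le_total p p' with h | h
      · have h1 : (d : ℝ) = p' - p := by rw [hd, Nat.dist_eq_sub_of_le h]; push_cast [h]; ring
        rw [h1, abs_sub_comm]
        exact (pow_sub_ge k p p' U hUr.le (by exact_mod_cast hp) (by exact_mod_cast h)).trans (le_abs_self _)
      · have h1 : (d : ℝ) = p - p' := by rw [hd, Nat.dist_eq_sub_of_le_right h]; push_cast [h]; ring
        rw [h1]
        exact (pow_sub_ge k p' p U hUr.le (by exact_mod_cast hp') (by exact_mod_cast h)).trans (le_abs_self _)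
    have hup : |(p : ℝ) ^ (k + 1) - (p' : ℝ) ^ (k + 1)| ≤ (2 * U : ℝ) ^ (k + 1) := by
      have h1 : (p : ℝ) ^ (k + 1) ≤ (2 * U : ℝ) ^ (k + 1) := by
        gcongr; exact_mod_cast hp2.le
      have h2 : (p' : ℝ) ^ (k + 1) ≤ (2 * U : ℝ) ^ (k + 1) := by
        gcongr; exact_mod_cast hp2'.le
      rw [abs_le]; constructor <;> nlinarith [pow_pos hpp (k + 1), pow_pos hpp' (k + 1)]
    have ht_up : |t| ≤ 1 / 2 := by
      rw [habs]
      calc _ ≤ |β| * (2 * U : ℝ) ^ (k + 1) * H := by gcongr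
        _ = (2 ^ (k + 2) * (|β| * X ^ (k + 1)) / J) / 2 := by
          rw [hH, div_pow, mul_pow]; field_simp; ring
        _ ≤ 1 / 2 := by
          gcongr
          rw [div_le_one hJr]; exact hJβ
    have ht_low : Δ * d / (2 * U * J) ≤ |t| := by
      rw [habs]
      calc _ = |β| * ((d : ℝ) * (U : ℝ) ^ k) * H := by
            rw [hH, hΔ, div_pow]; field_simp; ring
        _ ≤ _ := by gcongr
    have ht_pos : 0 < |t| := lt_of_lt_of_le (by positivity) ht_low
    refine (geom_e _ _ (abs_pos.1 ht_pos) ht_up).trans ?_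
    have h5 : (s : ℝ) * U ≤ d * (1 + Δ) := by
      rw [mul_div_assoc', div_le_iff₀ (by positivity)] at hdr; exact hdr
    have h6 : (s : ℝ) * U ≤ d * (2 * Δ) := h5.trans (by gcongr; linarith)
    rw [div_le_div_iff₀ (by positivity) (by positivity), one_mul]
    have h7 : (s : ℝ) ≤ 2 * (2 * J) * (Δ * d / (2 * U * J)) := by
      have : 2 * (2 * J) * (Δ * d / (2 * U * J)) = (d * (2 * Δ)) / U := by field_simp
      rw [this, le_div_iff₀ hUr]; exact h6
    calc (s : ℝ) ≤ 2 * (2 * J) * (Δ * d / (2 * U * J)) := h7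
      _ ≤ 2 * (2 * J) * |t| := by gcongr
      _ = _ := by ring

end MajArc

namespace MajArc

lemma ceil_le_two {x : ℝ} (hx : 1 ≤ x) : (⌈x⌉₊ : ℝ) ≤ 2 * x := by
  have := Nat.ceil_lt_add_one (by linarith : 0 ≤ x)
  linarith

open Classical in
/-- the range of `l` -/
noncomputable def Lset (r X U : ℕ) : Finset ℕ := {l ∈ Ioc (X / (4 * U)) (X / U) | Rough r l}

/-- the cell of `l` -/
noncomputable def jc (k J U X l : ℕ) : ℕ := ⌊(l : ℝ) ^ (k + 1) / (((X : ℝ) / U) ^ (k + 1) / J)⌋₊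

open Classical in
/-- cells of `l` -/
lemma vmax_le (C : ℝ)
    (hUB : ∀ (k r q w x y : ℕ), 0 < k → 3 ≤ r → 0 < q → q < zz r → x ≤ y →
    q * (zz (r - 3)) ^ 7 ≤ y - x →
    (#{m ∈ Ioc x y | m ^ k ≡ w [MOD q] ∧ Rough r m} : ℝ) ≤
      rho k q * (C * ((y - x : ℕ) : ℝ) / (q.totient * Real.log (zz r)))) (hC : 0 < C)
    (k r q J U X : ℕ) (hr : 3 ≤ r) (hq : 0 < q) (hqz : q < zz r) (hJ : 0 < J) (hU : 0 < U)
    (hlen : q * (zz (r - 3)) ^ 7 * (U * J) ≤ X) (j w : ℕ) :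
    ((#{l ∈ Lset r X U | jc k J U X l = j ∧ l ^ (k + 1) ≡ w [MOD q]} : ℕ) : ℝ) ≤
      rho (k + 1) q * (C * (2 * 4 ^ k * (X / (U * J))) / (q.totient * Real.log (zz r))) := by
  set Sx := ({l ∈ Lset r X U | jc k J U X l = j ∧ l ^ (k + 1) ≡ w [MOD q]} : Finset ℕ)
    with hSx
  have hlog := log_zz_pos r
  rcases Sx.eq_empty_or_nonempty with he | hne
  · rw [he]; simp only [card_empty, Nat.cast_zero]; positivity
  set l0 := Sx.min' hne with hl0
  have hl0m : l0 ∈ Sx := Sx.min'_mem hne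
  have hzpos : 0 < zz (r - 3) := lt_of_lt_of_le (by norm_num) (zz_ge _)
  have hUr : (0 : ℝ) < U := by exact_mod_cast hU
  have hJr : (0 : ℝ) < J := by exact_mod_cast hJ
  have hXpos : 0 < X := lt_of_lt_of_le (by positivity) hlen
  have hXr : (0 : ℝ) < X := by exact_mod_cast hXpos
  set H : ℝ := ((X : ℝ) / U) ^ (k + 1) / J with hH
  have hHpos : 0 < H := by positivity
  have hmem : ∀ l ∈ Sx, (X : ℝ) / U / 4 ≤ l ∧ (j : ℝ) * H ≤ (l : ℝ) ^ (k + 1) ∧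
      (l : ℝ) ^ (k + 1) < (j + 1) * H ∧ l ^ (k + 1) ≡ w [MOD q] ∧ Rough r l := by
    intro l hl
    rw [hSx, mem_filter, Lset, mem_filter, mem_Ioc, jc] at hl
    obtain ⟨⟨⟨h1, _⟩, h2⟩, h3, h4⟩ := hl
    have h5 : X < l * (4 * U) := (Nat.div_lt_iff_lt_mul (by positivity)).1 h1
    have h6 : (X : ℝ) < l * (4 * U) := by exact_mod_cast h5
    have h7 : (j : ℝ) ≤ (l : ℝ) ^ (k + 1) / H := by rw [← h3]; exact Nat.floor_le (by positivity)
    have h8 : (l : ℝ) ^ (k + 1) / H < j + 1 := by rw [← h3]; exact Nat.lt_floor_add_one _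
    refine ⟨?_, by rwa [le_div_iff₀ hHpos] at h7, by rwa [div_lt_iff₀ hHpos] at h8, h4, h2⟩
    rw [div_div, div_le_iff₀ (by positivity)]
    linarith
  have hl0' := hmem l0 hl0m
  have hl0pos : 0 < l0 := by
    have : (0 : ℝ) < l0 := lt_of_lt_of_le (by positivity) hl0'.1
    exact_mod_cast this
  set Lr : ℝ := 4 ^ k * (X / (U * J)) with hLr
  have hlen' : (q : ℝ) * (zz (r - 3) : ℝ) ^ 7 ≤ X / (U * J) := by
    rw [le_div_iff₀ (by positivity)]; exact_mod_cast hlen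
  have hLr1 : (q : ℝ) * (zz (r - 3) : ℝ) ^ 7 ≤ Lr := by
    refine hlen'.trans ?_
    rw [hLr]
    exact le_mul_of_one_le_left (by positivity) (one_le_pow₀ (by norm_num))
  have hone : (1 : ℝ) ≤ (q : ℝ) * (zz (r - 3) : ℝ) ^ 7 := by
    have : 1 ≤ q * (zz (r - 3)) ^ 7 := Nat.succ_le_of_lt (by positivity)
    exact_mod_cast this
  have hsub : Sx ⊆ {m ∈ Ioc (l0 - 1) (l0 - 1 + ⌈Lr⌉₊) | m ^ (k + 1) ≡ w [MOD q] ∧ Rough r m} := by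
    intro l hl
    obtain ⟨h1, h2, h3, h4, h5⟩ := hmem l hl
    have hle : l0 ≤ l := Sx.min'_le l hl
    have hler : (l0 : ℝ) ≤ l := by exact_mod_cast hle
    have h6 := pow_sub_ge k l0 l ((X : ℝ) / U / 4) (by positivity) hl0'.1 hler
    have h7 : ((l : ℝ) - l0) * ((X : ℝ) / U / 4) ^ k < H := by
      refine lt_of_le_of_lt h6 ?_
      nlinarith [hl0'.2.1]
    have h8 : (l : ℝ) - l0 < Lr := by
      have h9 : Lr * ((X : ℝ) / U / 4) ^ k = H := by
        rw [hLr, hH, div_pow, div_pow, div_pow]; field_simp; ring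
      rw [← h9] at h7
      exact lt_of_mul_lt_mul_right h7 (by positivity)
    have h10 : ((l - l0 : ℕ) : ℝ) < Lr := by push_cast [hle]; exact h8
    have h11 : l - l0 < ⌈Lr⌉₊ := Nat.lt_ceil.2 h10
    refine mem_filter.2 ⟨mem_Ioc.2 ⟨by omega, by omega⟩, h4, h5⟩
  have h12 := hUB (k + 1) r q w (l0 - 1) (l0 - 1 + ⌈Lr⌉₊) (by omega) hr hq hqz (by omega) (by
    rw [Nat.add_sub_cancel_left]
    have : ((q * zz (r - 3) ^ 7 : ℕ) : ℝ) ≤ ⌈Lr⌉₊ := by push_cast; exact hLr1.trans (Nat.le_ceil _)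
    exact_mod_cast this)
  rw [Nat.add_sub_cancel_left] at h12
  refine le_trans (Nat.cast_le.2 (card_le_card hsub)) (h12.trans ?_)
  have := ceil_le_two (hone.trans hLr1)
  have h13 : 2 * Lr = 2 * 4 ^ k * (X / (U * J)) := by rw [hLr]; ring
  rw [← h13]
  gcongr

open Classical in
/-- shells of `p'` -/
lemma shell_le (C : ℝ)
    (hUB : ∀ (k r q w x y : ℕ), 0 < k → 3 ≤ r → 0 < q → q < zz r → x ≤ y →
    q * (zz (r - 3)) ^ 7 ≤ y - x →
    (#{m ∈ Ioc x y | m ^ k ≡ w [MOD q] ∧ Rough r m} : ℝ) ≤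
      rho k q * (C * ((y - x : ℕ) : ℝ) / (q.totient * Real.log (zz r))))
    (k r q W p s : ℕ) (hk : 0 < k) (hr : 3 ≤ r) (hq : 0 < q) (hqz : q < zz r) (hp : 0 < p)
    (hW : 0 < W) (hlen : q * (zz (r - 3)) ^ 7 ≤ W) (Pp : Finset ℕ) (hPp : ∀ p' ∈ Pp, Rough r p' ∧ 0 < p') :
    (#{p' ∈ Pp | p ^ k ≡ p' ^ k [MOD q] ∧ Nat.dist p p' / W = s} : ℝ) ≤
      2 * (rho k q * (C * W / (q.totient * Real.log (zz r)))) := by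
  have hsub : ({p' ∈ Pp | p ^ k ≡ p' ^ k [MOD q] ∧ Nat.dist p p' / W = s} : Finset ℕ) ⊆
      ({m ∈ Ioc (p + s * W - 1) (p + s * W - 1 + W) | m ^ k ≡ p ^ k [MOD q] ∧ Rough r m} : Finset ℕ) ∪
      ({m ∈ Ioc (p - s * W - W) (p - s * W - W + W) | m ^ k ≡ p ^ k [MOD q] ∧ Rough r m} : Finset ℕ) := by
    intro p' hp'
    rw [mem_filter] at hp'
    obtain ⟨h1, h2, h3⟩ := hp'
    obtain ⟨h4, h5⟩ := hPp p' h1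
    rw [Nat.div_eq_iff hW] at h3
    obtain ⟨h6, h7⟩ := h3
    rw [mem_union, mem_filter, mem_filter, mem_Ioc, mem_Ioc]
    rw [Nat.dist] at h6 h7
    rcases le_total p p' with h | h
    · left
      refine ⟨⟨?_, ?_⟩, h2.symm, h4⟩
      · omega
      · omega
    · right
      refine ⟨⟨?_, ?_⟩, h2.symm, h4⟩
      · omega
      · omega
  have h1 := hUB k r q (p ^ k) (p + s * W - 1) (p + s * W - 1 + W) hk hr hq hqz (by omega) (by omega)
  have h2 := hUB k r q (p ^ k) (p - s * W - W) (p - s * W - W + W) hk hr hq hqz (by omega) (by omega)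
  rw [Nat.add_sub_cancel_left] at h1 h2
  have h3 : (#{p' ∈ Pp | p ^ k ≡ p' ^ k [MOD q] ∧ Nat.dist p p' / W = s} : ℝ) ≤ _ :=
    Nat.cast_le.2 ((card_le_card hsub).trans (card_union_le _ _))
  push_cast at h3
  linarith

end MajArc

namespace MajArc

open Classical in
/-- the range of `p` -/
noncomputable def Pset (r X U : ℕ) : Finset ℕ := {p ∈ Ico U (2 * U) | p.Prime ∧ zz r ≤ p ∧ p * p ≤ X}

open Classical in
/-- the smoothed-out phase -/
noncomputable def Gf (k J U X : ℕ) (β Y Y' : ℝ) (p j : ℕ) : ℂ :=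
  if Y < (p : ℝ) ^ (k + 1) * (j * (((X : ℝ) / U) ^ (k + 1) / J)) ∧
      (p : ℝ) ^ (k + 1) * (j * (((X : ℝ) / U) ^ (k + 1) / J)) ≤ Y' then
        e (β * ((p : ℝ) ^ (k + 1) * (j * (((X : ℝ) / U) ^ (k + 1) / J)))) else 0

lemma prime_rough {r p : ℕ} (hp : p.Prime) (h : zz r ≤ p) : Rough r p := by
  intro p' hp' hd
  rwa [(Nat.prime_dvd_prime_iff_eq hp' hp).1 hd]

lemma jc_le (k J U X l r : ℕ) (hJ : 0 < J) (hU : 0 < U) (hX : 0 < X) (hl : l ∈ Lset r X U) :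
    jc k J U X l ≤ J := by
  classical
  rw [Lset, mem_filter, mem_Ioc] at hl
  have h1 : l * U ≤ X := (Nat.le_div_iff_mul_le hU).1 hl.1.2
  have hUr : (0 : ℝ) < U := by exact_mod_cast hU
  have hJr : (0 : ℝ) < J := by exact_mod_cast hJ
  have hXr : (0 : ℝ) < X := by exact_mod_cast hX
  have h2 : (l : ℝ) ≤ X / U := by rw [le_div_iff₀ hUr]; exact_mod_cast h1
  unfold jc
  apply Nat.floor_le_of_le
  rw [div_le_iff₀ (by positivity)]
  have h3 : (l : ℝ) ^ (k + 1) ≤ ((X : ℝ) / U) ^ (k + 1) := by gcongr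
  calc _ ≤ ((X : ℝ) / U) ^ (k + 1) := h3
    _ = _ := by field_simp

lemma harm_le (x : ℝ) (hx : 1 ≤ x) :
    ∑ s ∈ range (⌊x⌋₊ + 1), 1 / ((s : ℝ) + 1) ≤ 2 + Real.log x := by
  have h1 := harmonic_le_one_add_log (⌊x⌋₊ + 1)
  have h2 : ((harmonic (⌊x⌋₊ + 1) : ℚ) : ℝ) = ∑ s ∈ range (⌊x⌋₊ + 1), 1 / ((s : ℝ) + 1) := by
    rw [harmonic]; push_cast; simp
  rw [← h2]
  refine h1.trans ?_
  have h3 : Real.log ((⌊x⌋₊ + 1 : ℕ) : ℝ) ≤ Real.log (2 * x) := by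
    apply Real.log_le_log (by positivity)
    push_cast
    linarith [Nat.floor_le (by linarith : 0 ≤ x)]
  rw [Real.log_mul (by norm_num) (by linarith)] at h3
  have := Real.log_two_lt_d9
  linarith

/-- the bilinear sum over one dyadic block -/
lemma Tu_sq (k : ℕ) : ∃ C : ℝ, 0 < C ∧ ∀ (r q J X U : ℕ) (a : ℤ) (β Y Y' : ℝ) (vw : ℕ → ℝ), 3 ≤ r → 0 < q →
    q < zz r → IsCoprime a (q : ℤ) → 0 < J → 0 < U → 0 ≤ Y →
    2 ^ (k + 2) * (|β| * (X : ℝ) ^ (k + 1)) ≤ J →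
    q * (zz (r - 3)) ^ 7 * (U * J) ≤ X →
    2 * ((q * (zz (r - 3)) ^ 7 : ℕ) * (1 + 2 * (|β| * (X : ℝ) ^ (k + 1)))) ≤ (zz r : ℝ) →
    (∀ l, 0 ≤ vw l) → (∀ l, vw l ≤ 1) →
    ‖∑ l ∈ Lset r X U, ∑ p ∈ Pset r X U, (vw l : ℂ) *
      (e (a * (p ^ (k + 1) * l ^ (k + 1) : ℕ) / q) * Gf k J U X β Y Y' p (jc k J U X l))‖ ^ 2 ≤
    C * ((rho (k + 1) q : ℝ) ^ 2 * X ^ 2 * q / (q.totient ^ 2 * (1 + 2 * (|β| * (X : ℝ) ^ (k + 1))) *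
      Real.log (zz r) ^ 4) * (2 + Real.log (1 + 2 * (|β| * (X : ℝ) ^ (k + 1))))) := by
  classical
  obtain ⟨C, hC, hUB, hUB1⟩ := UBs
  refine ⟨32 * 4 ^ k * C ^ 4, by positivity, ?_⟩
  intro r q J X U a β Y Y' vw hr hq hqz ha hJ hU hY hJβ hlen1 hlen2 hv0 hv1
  set Δ1 : ℝ := 1 + 2 * (|β| * (X : ℝ) ^ (k + 1)) with hΔ1
  have hΔ1' : 1 ≤ Δ1 := by rw [hΔ1]; linarith [show 0 ≤ 2 * (|β| * (X : ℝ) ^ (k + 1)) by positivity]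
  have hlogΔ : 0 ≤ Real.log Δ1 := Real.log_nonneg hΔ1'
  have hlog := log_zz_pos r
  set Z := Real.log (zz r) with hZ
  have hzpos : 0 < zz (r - 3) := lt_of_lt_of_le (by norm_num) (zz_ge _)
  have hφ : (0 : ℝ) < q.totient := by exact_mod_cast Nat.totient_pos.2 hq
  have hqr : (0 : ℝ) < q := by exact_mod_cast hq
  have hUr : (0 : ℝ) < U := by exact_mod_cast hU
  have hJr : (0 : ℝ) < J := by exact_mod_cast hJ
  have hXpos : 0 < X := lt_of_lt_of_le (by positivity) hlen1
  have hXr : (0 : ℝ) < X := by exact_mod_cast hXpos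
  rcases (Pset r X U).eq_empty_or_nonempty with he | hne
  · rw [he]; simp only [sum_empty, sum_const_zero, norm_zero]
    rw [zero_pow two_ne_zero]
    positivity
  have hzU : zz r ≤ 2 * U := by
    obtain ⟨p, hp⟩ := hne
    rw [Pset, mem_filter, mem_Ico] at hp
    omega
  set s7 : ℕ := q * (zz (r - 3)) ^ 7 with hs7
  have hs7pos : 0 < s7 := by positivity
  have hs7r : (1 : ℝ) ≤ s7 := by exact_mod_cast hs7pos
  have hsU : (s7 : ℝ) * Δ1 ≤ U := by
    have : (zz r : ℝ) ≤ 2 * U := by exact_mod_cast hzU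
    linarith
  set W : ℕ := ⌈(U : ℝ) / Δ1⌉₊ with hW
  have hUΔ : (s7 : ℝ) ≤ U / Δ1 := by rw [le_div_iff₀ (by linarith)]; exact hsU
  have hW1 : s7 ≤ W := by
    have : (s7 : ℝ) ≤ W := hUΔ.trans (Nat.le_ceil _)
    exact_mod_cast this
  have hW2 : (W : ℝ) ≤ 2 * (U / Δ1) := ceil_le_two (hs7r.trans hUΔ)
  have hWpos : 0 < W := lt_of_lt_of_le hs7pos hW1
  have hPm : ∀ p ∈ Pset r X U, Rough r p ∧ 0 < p ∧ U ≤ p ∧ p < 2 * U := by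
    intro p hp
    rw [Pset, mem_filter, mem_Ico] at hp
    exact ⟨prime_rough hp.2.1 hp.2.2.1, hp.2.1.pos, hp.1.1, hp.1.2⟩
  have hs7' : (zz (r - 3)) ^ 7 ≤ s7 := Nat.le_mul_of_pos_left _ hq
  -- cardinalities
  have hNl : (#(Lset r X U) : ℝ) ≤ C * (X / U) / Z := by
    have h1 : Lset r X U ⊆ {m ∈ Ioc 0 (X / U) | Rough r m} := by
      intro l hl
      rw [Lset, mem_filter, mem_Ioc] at hl
      exact mem_filter.2 ⟨mem_Ioc.2 ⟨lt_of_le_of_lt (Nat.zero_le _) hl.1.1, hl.1.2⟩, hl.2⟩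
    have h2 := hUB1 r 0 (X / U) hr (Nat.zero_le _) (by
      rw [Nat.sub_zero]
      refine hs7'.trans ((Nat.le_div_iff_mul_le hU).2 (le_trans ?_ hlen1))
      exact Nat.mul_le_mul_left _ (Nat.le_mul_of_pos_right _ hJ))
    refine le_trans (Nat.cast_le.2 (card_le_card h1)) (h2.trans ?_)
    rw [Nat.sub_zero]
    gcongr
    exact Nat.cast_div_le
  have hNp : (#(Pset r X U) : ℝ) ≤ C * U / Z := by
    have h1 : Pset r X U ⊆ {m ∈ Ioc (U - 1) (U - 1 + U) | Rough r m} := by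
      intro p hp
      obtain ⟨h2, h3, h4, h5⟩ := hPm p hp
      exact mem_filter.2 ⟨mem_Ioc.2 ⟨by omega, by omega⟩, h2⟩
    have hsU' : s7 ≤ U := by
      have : (s7 : ℝ) ≤ U := le_trans (le_mul_of_one_le_right (by positivity) hΔ1') hsU
      exact_mod_cast this
    have h2 := hUB1 r (U - 1) (U - 1 + U) hr (by omega) (by
      rw [Nat.add_sub_cancel_left]; exact hs7'.trans hsU')
    rw [Nat.add_sub_cancel_left] at h2
    exact le_trans (Nat.cast_le.2 (card_le_card h1)) h2
  have hb := bilin q a hq ha (Lset r X U) (Pset r X U) (range (J + 1)) (jc k J U X)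
    (fun l hl => mem_range.2 (Nat.lt_succ_of_le (jc_le k J U X l r hJ hU hXpos hl)))
    (fun l => l ^ (k + 1)) (fun p => p ^ (k + 1)) (Gf k J U X β Y Y') vw (fun l _ => hv0 l)
    (fun l _ => hv1 l) _ (fun j w => vmax_le C hUB hC k r q J U X hr hq hqz hJ hU hlen1 j w)
  refine hb.trans ?_
  have hinner : ∀ p ∈ Pset r X U, ∑ p' ∈ Pset r X U with p ^ (k + 1) ≡ p' ^ (k + 1) [MOD q],
        ‖∑ j ∈ range (J + 1), Gf k J U X β Y Y' p j * starRingEnd ℂ (Gf k J U X β Y Y' p' j)‖ ≤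
        8 * J * (rho (k + 1) q * (C * (2 * (U / Δ1)) / (q.totient * Z))) * (2 + Real.log Δ1) := by
    intro p hp
    obtain ⟨_, hp0, hp1, hp2⟩ := hPm p hp
    calc _ ≤ ∑ p' ∈ Pset r X U with p ^ (k + 1) ≡ p' ^ (k + 1) [MOD q],
          4 * (J : ℝ) / (((Nat.dist p p' / W : ℕ) : ℝ) + 1) := by
          refine sum_le_sum fun p' hp' => ?_
          obtain ⟨_, _, hp1', hp2'⟩ := hPm p' (mem_filter.1 hp').1
          exact inner_le k J U hU hJ X β hXr hJβ Y Y' hY p p' hp1 hp2 hp1' hp2' _ (fun p j => by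
            rw [Gf])
      _ = ∑ s ∈ range (⌊Δ1⌋₊ + 1), ∑ p' ∈ (Pset r X U).filter
            (fun p' => p ^ (k + 1) ≡ p' ^ (k + 1) [MOD q]) with Nat.dist p p' / W = s,
          4 * (J : ℝ) / (((Nat.dist p p' / W : ℕ) : ℝ) + 1) := by
          rw [sum_fiberwise_of_maps_to]
          intro p' hp'
          obtain ⟨_, _, hp1', hp2'⟩ := hPm p' (mem_filter.1 hp').1
          rw [mem_range, Nat.lt_succ_iff]
          apply Nat.le_floor
          refine Nat.cast_div_le.trans ?_
          have hd : Nat.dist p p' ≤ U := by rw [Nat.dist]; omega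
          have hd' : (Nat.dist p p' : ℝ) ≤ U := by exact_mod_cast hd
          have hWr : (0 : ℝ) < W := by exact_mod_cast hWpos
          rw [div_le_iff₀ hWr]
          refine hd'.trans ?_
          have : (U : ℝ) / Δ1 ≤ W := Nat.le_ceil _
          rw [div_le_iff₀ (by linarith)] at this
          linarith
      _ ≤ ∑ s ∈ range (⌊Δ1⌋₊ + 1), 2 * (rho (k + 1) q * (C * W / (q.totient * Z))) *
            (4 * (J : ℝ) / ((s : ℝ) + 1)) := by
          refine sum_le_sum fun s _ => ?_
          have h1 : ∑ p' ∈ (Pset r X U).filter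
            (fun p' => p ^ (k + 1) ≡ p' ^ (k + 1) [MOD q]) with Nat.dist p p' / W = s,
            4 * (J : ℝ) / (((Nat.dist p p' / W : ℕ) : ℝ) + 1) =
            #{p' ∈ Pset r X U | p ^ (k + 1) ≡ p' ^ (k + 1) [MOD q] ∧ Nat.dist p p' / W = s} *
              (4 * (J : ℝ) / ((s : ℝ) + 1)) := by
            rw [← nsmul_eq_mul, ← sum_const, filter_filter]
            refine sum_congr rfl fun p' hp' => ?_
            rw [(mem_filter.1 hp').2.2]
          rw [h1]
          refine mul_le_mul_of_nonneg_right ?_ (by positivity)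
          exact shell_le C hUB (k + 1) r q W p s (by omega) hr hq hqz hp0 hWpos hW1 _
            (fun p' hp' => ⟨(hPm p' hp').1, (hPm p' hp').2.1⟩)
      _ = 8 * J * (rho (k + 1) q * (C * W / (q.totient * Z))) *
            ∑ s ∈ range (⌊Δ1⌋₊ + 1), 1 / ((s : ℝ) + 1) := by
          rw [mul_sum]
          refine sum_congr rfl fun s _ => ?_
          ring
      _ ≤ _ := by
          refine mul_le_mul ?_ (harm_le Δ1 hΔ1') (sum_nonneg fun _ _ => by positivity) (by positivity)
          gcongr
  calc _ ≤ rho (k + 1) q * (C * (2 * 4 ^ k * (X / (U * J))) / (q.totient * Z)) * (C * (X / U) / Z) *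
        (q * ((C * U / Z) * (8 * J * (rho (k + 1) q * (C * (2 * (U / Δ1)) / (q.totient * Z))) *
          (2 + Real.log Δ1)))) := by
        have h1 : ∑ p ∈ Pset r X U, ∑ p' ∈ Pset r X U with p ^ (k + 1) ≡ p' ^ (k + 1) [MOD q],
          ‖∑ j ∈ range (J + 1), Gf k J U X β Y Y' p j * starRingEnd ℂ (Gf k J U X β Y Y' p' j)‖ ≤
          (C * U / Z) * (8 * J * (rho (k + 1) q * (C * (2 * (U / Δ1)) / (q.totient * Z))) *
          (2 + Real.log Δ1)) := by
          refine (sum_le_sum hinner).trans ?_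
          rw [sum_const, nsmul_eq_mul]
          exact mul_le_mul_of_nonneg_right hNp (by positivity)
        refine mul_le_mul (mul_le_mul_of_nonneg_left hNl (by positivity))
          (mul_le_mul_of_nonneg_left h1 hqr.le) ?_ (by positivity)
        exact mul_nonneg hqr.le (sum_nonneg fun _ _ => sum_nonneg fun _ _ => norm_nonneg _)
    _ = _ := by
        have : Δ1 ≠ 0 := by linarith
        field_simp
        ring

end MajArc

namespace MajArc

open Classical in
/-- primes in `[z, √X]` -/
noncomputable def Pall (r X : ℕ) : Finset ℕ := {p ∈ range (X + 1) | p.Prime ∧ zz r ≤ p ∧ p * p ≤ X}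

open Classical in
noncomputable def om (r X l : ℕ) : ℕ := #{p ∈ Pall r X | p ∣ l}

/-- Ramaré weight -/
noncomputable def vw (r X l : ℕ) : ℝ := 1 / (1 + (om r X l : ℝ))

lemma vw_nonneg (r X l : ℕ) : 0 ≤ vw r X l := by unfold vw; positivity

lemma vw_le_one (r X l : ℕ) : vw r X l ≤ 1 := by
  unfold vw
  rw [div_le_one (by positivity)]
  have : (0 : ℝ) ≤ om r X l := by positivity
  linarith

lemma mem_Pall {r X p : ℕ} : p ∈ Pall r X ↔ p.Prime ∧ zz r ≤ p ∧ p * p ≤ X := by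
  classical
  rw [Pall, mem_filter, mem_range]
  constructor
  · exact fun h => h.2
  · exact fun h => ⟨by nlinarith [h.1.pos, h.2.2], h⟩

lemma om_div_ge (r X m p : ℕ) (hp : p ∈ Pall r X) (hpm : p ∣ m) : om r X m ≤ 1 + om r X (m / p) := by
  classical
  unfold om
  have : ({p' ∈ Pall r X | p' ∣ m} : Finset ℕ) ⊆ insert p ({p' ∈ Pall r X | p' ∣ m / p} : Finset ℕ) := by
    intro p' hp'
    rw [mem_filter] at hp'
    rw [mem_insert, mem_filter]
    by_cases h : p' = p
    · left; exact h
    · right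
      refine ⟨hp'.1, ?_⟩
      obtain ⟨t, rfl⟩ := hpm
      rw [Nat.mul_div_cancel_left _ (mem_Pall.1 hp).1.pos]
      have h1 := (mem_Pall.1 hp'.1).1
      rcases (h1.dvd_mul.1 hp'.2) with h2 | h2
      · exact absurd ((Nat.prime_dvd_prime_iff_eq h1 (mem_Pall.1 hp).1).1 h2) h
      · exact h2
  have h2 := (card_le_card this).trans (card_insert_le _ _)
  omega

lemma om_div_eq (r X m p : ℕ) (hp : p ∈ Pall r X) (hpm : p ∣ m) (hpm2 : ¬ p * p ∣ m) :
    om r X m = 1 + om r X (m / p) := by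
  classical
  refine le_antisymm (om_div_ge r X m p hp hpm) ?_
  unfold om
  obtain ⟨t, rfl⟩ := hpm
  have hpp := (mem_Pall.1 hp).1.pos
  rw [Nat.mul_div_cancel_left _ hpp]
  have hpt : ¬ p ∣ t := fun h => hpm2 (Nat.mul_dvd_mul_left p h)
  have : insert p ({p' ∈ Pall r X | p' ∣ t} : Finset ℕ) ⊆ ({p' ∈ Pall r X | p' ∣ p * t} : Finset ℕ) := by
    intro p' hp'
    rw [mem_insert, mem_filter] at hp'
    rw [mem_filter]
    rcases hp' with rfl | h
    · exact ⟨hp, Dvd.intro _ rfl⟩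
    · exact ⟨h.1, Dvd.dvd.mul_left h.2 _⟩
  have h2 := card_le_card this
  rw [card_insert_of_notMem (by rw [mem_filter]; exact fun h => hpt h.2)] at h2
  omega

open Classical in
noncomputable def Rw (r X m : ℕ) : ℝ := ∑ p ∈ Pall r X with p ∣ m, vw r X (m / p)

lemma Rw_le_one (r X m : ℕ) : Rw r X m ≤ 1 := by
  classical
  unfold Rw
  have h1 : ∀ p ∈ (Pall r X).filter (fun p => p ∣ m), vw r X (m / p) ≤ 1 / (om r X m : ℝ) := by
    intro p hp
    rw [mem_filter] at hp
    have h2 := om_div_ge r X m p hp.1 hp.2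
    have h3 : 0 < om r X m := card_pos.2 ⟨p, mem_filter.2 hp⟩
    unfold vw
    apply one_div_le_one_div_of_le
    · exact_mod_cast h3
    · exact_mod_cast h2
  refine (sum_le_sum h1).trans ?_
  rw [sum_const, nsmul_eq_mul]
  show (om r X m : ℝ) * (1 / om r X m) ≤ 1
  rw [mul_one_div]
  exact div_self_le_one _

lemma Rw_nonneg (r X m : ℕ) : 0 ≤ Rw r X m := sum_nonneg fun _ _ => vw_nonneg _ _ _

lemma ramare (r X m : ℕ) (hr : Rough r m) (hX : 4 ≤ X) (hm : X < 2 * m) (hm' : m ≤ X) :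
    |(if m.Prime then (1 : ℝ) else 0) - (1 - Rw r X m)| ≤ #{p ∈ Pall r X | p * p ∣ m} := by
  classical
  have h01 : 0 ≤ Rw r X m := Rw_nonneg _ _ _
  have h02 := Rw_le_one r X m
  by_cases hmp : m.Prime
  · have h1 : Rw r X m = 0 := by
      unfold Rw
      rw [filter_eq_empty_iff.2, sum_empty]
      intro p hp hd
      have h2 := mem_Pall.1 hp
      rw [(Nat.prime_dvd_prime_iff_eq h2.1 hmp).1 hd] at h2
      nlinarith [h2.2.2]
    rw [if_pos hmp, h1]
    simp
  · rw [if_neg hmp]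
    rcases ({p ∈ Pall r X | p * p ∣ m} : Finset ℕ).eq_empty_or_nonempty with he | hne
    · have h1 : Rw r X m = 1 := by
        unfold Rw
        have h3 : ∀ p ∈ (Pall r X).filter (fun p => p ∣ m), vw r X (m / p) = 1 / (om r X m : ℝ) := by
          intro p hp
          rw [mem_filter] at hp
          have h2 := om_div_eq r X m p hp.1 hp.2 (fun h => by
            have : p ∈ ({p ∈ Pall r X | p * p ∣ m} : Finset ℕ) := mem_filter.2 ⟨hp.1, h⟩
            rw [he] at this
            simp at this)
          unfold vw
          rw [h2]
          push_cast; rfl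
        rw [sum_congr rfl h3, sum_const, nsmul_eq_mul]
        show (om r X m : ℝ) * (1 / om r X m) = 1
        have h4 : 0 < om r X m := by
          have hm1 : m ≠ 1 := by omega
          refine card_pos.2 ⟨m.minFac, mem_filter.2 ⟨mem_Pall.2 ⟨Nat.minFac_prime hm1, ?_, ?_⟩, Nat.minFac_dvd m⟩⟩
          · exact hr _ (Nat.minFac_prime hm1) (Nat.minFac_dvd m)
          · have := Nat.minFac_sq_le_self (by omega) hmp
            rw [sq] at this
            omega
        have : (om r X m : ℝ) ≠ 0 := by exact_mod_cast h4.ne'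
        field_simp
      rw [h1]; simp
    · have : 1 ≤ #{p ∈ Pall r X | p * p ∣ m} := card_pos.2 hne
      have h3 : (1 : ℝ) ≤ #{p ∈ Pall r X | p * p ∣ m} := by exact_mod_cast this
      rw [abs_le]; constructor <;> linarith

lemma sq_count (r X Y Y' : ℕ) (hY : Y' ≤ X) :
    ∑ m ∈ Ioc Y Y', (#{p ∈ Pall r X | p * p ∣ m} : ℝ) ≤ 2 * X / zz r := by
  classical
  have hz := zz_ge r
  have h1 : ∑ m ∈ Ioc Y Y', (#{p ∈ Pall r X | p * p ∣ m} : ℝ) =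
      ∑ p ∈ Pall r X, (#{m ∈ Ioc Y Y' | p * p ∣ m} : ℝ) := by
    simp only [card_filter]
    push_cast
    rw [sum_comm]
  rw [h1]
  have h2 : ∀ p ∈ Pall r X, (#{m ∈ Ioc Y Y' | p * p ∣ m} : ℝ) ≤ X * ((p : ℝ) ^ 2)⁻¹ := by
    intro p hp
    have h3 : ({m ∈ Ioc Y Y' | p * p ∣ m} : Finset ℕ) ⊆ {m ∈ Ioc 0 X | p * p ∣ m} := by
      intro m hm
      rw [mem_filter, mem_Ioc] at hm ⊢
      exact ⟨⟨by omega, by omega⟩, hm.2⟩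
    refine le_trans (Nat.cast_le.2 (card_le_card h3)) ?_
    rw [Nat.Ioc_filter_dvd_card_eq_div]
    refine Nat.cast_div_le.trans (le_of_eq ?_)
    push_cast
    rw [sq, div_eq_mul_inv]
  refine (sum_le_sum h2).trans ?_
  rw [← mul_sum]
  have h4 : Pall r X ⊆ Ioc (zz r - 1) (max X (zz r)) := by
    intro p hp
    have h := mem_Pall.1 hp
    have : p ≤ X := by nlinarith [h.1.pos, h.2.2]
    rw [mem_Ioc]
    exact ⟨by omega, le_max_of_le_left this⟩
  have h5 := sum_Ioc_inv_sq_le_sub (α := ℝ) (k := zz r - 1) (n := max X (zz r)) (by omega)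
    (by have := le_max_right X (zz r); omega)
  have h6 : ∑ p ∈ Pall r X, ((p : ℝ) ^ 2)⁻¹ ≤ ((zz r - 1 : ℕ) : ℝ)⁻¹ := by
    refine (sum_le_sum_of_subset_of_nonneg h4 fun _ _ _ => by positivity).trans (h5.trans ?_)
    have : (0 : ℝ) ≤ ((max X (zz r) : ℕ) : ℝ)⁻¹ := by positivity
    linarith
  have h7 : ((zz r - 1 : ℕ) : ℝ)⁻¹ ≤ 2 / zz r := by
    rw [inv_eq_one_div, div_le_div_iff₀]
    · have : zz r ≤ 2 * (zz r - 1) := by omega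
      rw [one_mul]; exact_mod_cast this
    · have : 0 < zz r - 1 := by omega
      exact_mod_cast this
    · have : 0 < zz r := by omega
      exact_mod_cast this
  calc _ ≤ (X : ℝ) * (2 / zz r) := by
        apply mul_le_mul_of_nonneg_left (h6.trans h7); positivity
    _ = _ := by ring

lemma rough_mul {r p l : ℕ} (hp : p.Prime) (hz : zz r ≤ p) : Rough r (p * l) ↔ Rough r l := by
  constructor
  · exact fun h p' hp' hd => h p' hp' (Dvd.dvd.mul_left hd _)
  · intro h p' hp' hd
    rcases hp'.dvd_mul.1 hd with h1 | h1
    · exact prime_rough hp hz p' hp' h1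
    · exact h p' hp' h1

open Classical in
noncomputable def Rw' (r X m : ℕ) : ℝ :=
  ∑ p ∈ Pall r X with p ∣ m ∧ m / p ∈ Lset r X (2 ^ Nat.log 2 p), vw r X (m / p)

lemma Rw'_nonneg (r X m : ℕ) : 0 ≤ Rw' r X m := sum_nonneg fun _ _ => vw_nonneg _ _ _

lemma Rw'_le_one (r X m : ℕ) : Rw' r X m ≤ 1 := by
  classical
  refine le_trans ?_ (Rw_le_one r X m)
  refine sum_le_sum_of_subset_of_nonneg (fun p hp => ?_) fun _ _ _ => vw_nonneg _ _ _
  rw [mem_filter] at hp ⊢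
  exact ⟨hp.1, hp.2.1⟩

lemma Rw'_eq (r X m : ℕ) (hr : Rough r m) (hm : X < 2 * m) (hm' : m ≤ X) : Rw' r X m = Rw r X m := by
  classical
  unfold Rw' Rw
  congr 1
  refine filter_congr fun p hp => ⟨fun h => h.1, fun h => ⟨h, ?_⟩⟩
  have h1 := mem_Pall.1 hp
  have hp1 : 2 ^ Nat.log 2 p ≤ p := Nat.pow_log_le_self 2 h1.1.ne_zero
  have hp2 : p < 2 ^ (Nat.log 2 p + 1) := Nat.lt_pow_succ_log_self (by norm_num) p
  rw [pow_succ] at hp2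
  obtain ⟨t, rfl⟩ := h
  rw [Nat.mul_div_cancel_left _ h1.1.pos, Lset, mem_filter, mem_Ioc]
  refine ⟨⟨(Nat.div_lt_iff_lt_mul (by positivity)).2 ?_, (Nat.le_div_iff_mul_le (by positivity)).2 ?_⟩,
    (rough_mul h1.1 h1.2.1).1 hr⟩
  · have : p * t ≤ (2 ^ Nat.log 2 p * 2) * t := Nat.mul_le_mul_right _ hp2.le
    nlinarith
  · have : 2 ^ Nat.log 2 p * t ≤ p * t := Nat.mul_le_mul_right _ hp1
    nlinarith

open Classical in
/-- rearranging the triple sum -/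
lemma triple_sum (r X : ℕ) (E : ℕ → ℂ) :
    ∑ u ∈ range (Nat.log 2 X + 1), ∑ l ∈ Lset r X (2 ^ u), ∑ p ∈ Pset r X (2 ^ u), (vw r X l : ℂ) * E (p * l) =
      ∑ m ∈ Ioc 0 (2 * X) with Rough r m, (Rw' r X m : ℂ) * E m := by
  have hPset : ∀ u, Pset r X (2 ^ u) = {p ∈ Pall r X | Nat.log 2 p = u} := by
    intro u
    ext p
    rw [Pset, mem_filter, mem_filter, mem_Pall, mem_Ico]
    constructor
    · rintro ⟨⟨h1, h2⟩, h3⟩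
      refine ⟨h3, ?_⟩
      rw [Nat.log_eq_iff (Or.inr ⟨by norm_num, h3.1.ne_zero⟩), pow_succ, mul_comm _ 2]
      exact ⟨h1, h2⟩
    · rintro ⟨h1, h2⟩
      refine ⟨?_, h1⟩
      rw [Nat.log_eq_iff (Or.inr ⟨by norm_num, h1.1.ne_zero⟩), pow_succ, mul_comm _ 2] at h2
      exact h2
  have h1 : ∑ u ∈ range (Nat.log 2 X + 1), ∑ l ∈ Lset r X (2 ^ u), ∑ p ∈ Pset r X (2 ^ u),
      (vw r X l : ℂ) * E (p * l) =
      ∑ p ∈ Pall r X, ∑ l ∈ Lset r X (2 ^ Nat.log 2 p), (vw r X l : ℂ) * E (p * l) := by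
    rw [← sum_fiberwise_of_maps_to (s := Pall r X) (t := range (Nat.log 2 X + 1)) (g := fun p => Nat.log 2 p)]
    · refine sum_congr rfl fun u _ => ?_
      rw [sum_comm, hPset]
      refine sum_congr rfl fun p hp => ?_
      rw [(mem_filter.1 hp).2]
    · intro p hp
      rw [mem_range, Nat.lt_succ_iff]
      have h := mem_Pall.1 hp
      exact Nat.log_mono_right (by nlinarith [h.1.pos, h.2.2])
  rw [h1]
  have h2 : ∀ p ∈ Pall r X, ∑ l ∈ Lset r X (2 ^ Nat.log 2 p), (vw r X l : ℂ) * E (p * l) =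
      ∑ m ∈ ({m ∈ Ioc 0 (2 * X) | Rough r m} : Finset ℕ),
        if p ∣ m ∧ m / p ∈ Lset r X (2 ^ Nat.log 2 p) then (vw r X (m / p) : ℂ) * E m else 0 := by
    intro p hp
    have h := mem_Pall.1 hp
    rw [← sum_filter]
    refine sum_bij (fun l _ => p * l) ?_ ?_ ?_ ?_
    · intro l hl
      rw [mem_filter, mem_filter, Nat.mul_div_cancel_left _ h.1.pos]
      have hl' := hl
      rw [Lset, mem_filter, mem_Ioc] at hl'
      obtain ⟨⟨h3, h4⟩, h5⟩ := hl'
      refine ⟨⟨mem_Ioc.2 ⟨Nat.mul_pos h.1.pos (lt_of_le_of_lt (Nat.zero_le _) h3), ?_⟩,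
        (rough_mul h.1 h.2.1).2 h5⟩, Dvd.intro _ rfl, hl⟩
      have h6 := (Nat.le_div_iff_mul_le (by positivity)).1 h4
      have hp2 : p < 2 ^ (Nat.log 2 p + 1) := Nat.lt_pow_succ_log_self (by norm_num) p
      rw [pow_succ] at hp2
      have : p * l ≤ (2 ^ Nat.log 2 p * 2) * l := Nat.mul_le_mul_right _ hp2.le
      nlinarith
    · intro l _ l' _ hll
      exact Nat.eq_of_mul_eq_mul_left h.1.pos hll
    · intro m hm
      rw [mem_filter] at hm
      exact ⟨m / p, hm.2.2, Nat.mul_div_cancel' hm.2.1⟩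
    · intro l _
      rw [Nat.mul_div_cancel_left _ h.1.pos]
  rw [sum_congr rfl h2, sum_comm]
  refine sum_congr rfl fun m _ => ?_
  unfold Rw'
  rw [← sum_filter]
  push_cast
  rw [sum_mul]

end MajArc

namespace MajArc

lemma e_split (a : ℤ) (q : ℕ) (β : ℝ) (m K : ℕ) :
    e (((a : ℝ) / q + β) * (m : ℝ) ^ K) = e (a * ((m ^ K : ℕ) : ℝ) / q) * e (β * (m : ℝ) ^ K) := by
  rw [← e_add]; congr 1; push_cast; ring

/-- pointwise comparison -/
lemma term_cmp (k r q J X U Y Y' : ℕ) (a : ℤ) (β : ℝ) (hJ : 0 < J) (hU : 0 < U) (hX : 0 < X)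
    (hY : X ≤ 2 * Y) (hYY : Y ≤ Y') (l p : ℕ) (hl : l ∈ Lset r X U) (hp : p ∈ Pset r X U) :
    ‖(if Y < p * l ∧ p * l ≤ Y' then e (((a : ℝ) / q + β) * ((p * l : ℕ) : ℝ) ^ (k + 1)) else 0) -
      e (a * (p ^ (k + 1) * l ^ (k + 1) : ℕ) / q) *
        Gf k J U X β ((Y : ℝ) ^ (k + 1)) ((Y' : ℝ) ^ (k + 1)) p (jc k J U X l)‖ ≤
    (if Y < p * l ∧ p * l ≤ Y' then 2 * Real.pi * (|β| * (2 ^ (k + 1) * (X : ℝ) ^ (k + 1) / J)) else 0) +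
    ((if Y < p * l ∧ p * l ≤ Y + ⌈2 ^ (2 * k + 1) * ((X : ℝ) / J)⌉₊ then 1 else 0) +
    (if Y' < p * l ∧ p * l ≤ Y' + ⌈2 ^ (2 * k + 1) * ((X : ℝ) / J)⌉₊ then 1 else 0)) := by
  classical
  set δ := ⌈2 ^ (2 * k + 1) * ((X : ℝ) / J)⌉₊ with hδ
  set m := p * l with hm
  have hJr : (0 : ℝ) < J := by exact_mod_cast hJ
  have hUr : (0 : ℝ) < U := by exact_mod_cast hU
  have hXr : (0 : ℝ) < X := by exact_mod_cast hX
  set H : ℝ := ((X : ℝ) / U) ^ (k + 1) / J with hH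
  have hHpos : 0 < H := by positivity
  rw [Pset, mem_filter, mem_Ico] at hp
  have hp0 : (0 : ℝ) < p := by exact_mod_cast hp.2.1.pos
  set j := jc k J U X l with hj
  set M : ℝ := (p : ℝ) ^ (k + 1) * (j * H) with hM
  have hj1 : (j : ℝ) * H ≤ (l : ℝ) ^ (k + 1) := by
    have : (j : ℝ) ≤ (l : ℝ) ^ (k + 1) / H := by rw [hj]; exact Nat.floor_le (by positivity)
    rwa [le_div_iff₀ hHpos] at this
  have hj2 : (l : ℝ) ^ (k + 1) < (j + 1) * H := by
    have : (l : ℝ) ^ (k + 1) / H < j + 1 := by rw [hj]; exact Nat.lt_floor_add_one _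
    rwa [div_lt_iff₀ hHpos] at this
  set η : ℝ := 2 ^ (k + 1) * (X : ℝ) ^ (k + 1) / J with hη
  have hpH : (p : ℝ) ^ (k + 1) * H ≤ η := by
    have h1 : (p : ℝ) ^ (k + 1) ≤ (2 * U : ℝ) ^ (k + 1) := by
      gcongr; exact_mod_cast hp.1.2.le
    calc _ ≤ (2 * U : ℝ) ^ (k + 1) * H := by gcongr
      _ = η := by rw [hH, hη, div_pow, mul_pow]; field_simp
  have hmK : ((m : ℕ) : ℝ) ^ (k + 1) = (p : ℝ) ^ (k + 1) * (l : ℝ) ^ (k + 1) := by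
    rw [hm]; push_cast; rw [mul_pow]
  have hM1 : M ≤ (m : ℝ) ^ (k + 1) := by rw [hmK, hM]; gcongr
  have hM2 : (m : ℝ) ^ (k + 1) < M + η := by
    rw [hmK, hM]
    calc (p : ℝ) ^ (k + 1) * (l : ℝ) ^ (k + 1) < (p : ℝ) ^ (k + 1) * ((j + 1) * H) := by gcongr
      _ = (p : ℝ) ^ (k + 1) * (j * H) + (p : ℝ) ^ (k + 1) * H := by ring
      _ ≤ _ := by gcongr
  have hGf : Gf k J U X β ((Y : ℝ) ^ (k + 1)) ((Y' : ℝ) ^ (k + 1)) p j =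
      if (Y : ℝ) ^ (k + 1) < M ∧ M ≤ (Y' : ℝ) ^ (k + 1) then e (β * M) else 0 := by
    rw [Gf]
  have hlt : ∀ y : ℕ, ((y : ℝ) ^ (k + 1) < (m : ℝ) ^ (k + 1)) ↔ y < m := by
    intro y
    rw [pow_lt_pow_iff_left₀ (by positivity) (by positivity) (by omega)]
    exact Nat.cast_lt
  have hnear : ∀ y : ℕ, X ≤ 2 * y → y < m → (m : ℝ) ^ (k + 1) < (y : ℝ) ^ (k + 1) + η → m ≤ y + δ := by
    intro y hy hym h
    have hy2 : (X : ℝ) / 2 ≤ y := by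
      rw [div_le_iff₀ (by norm_num)]
      have : (X : ℝ) ≤ 2 * y := by exact_mod_cast hy
      linarith
    have h1 := pow_sub_ge k y m (X / 2) (by positivity) hy2 (by exact_mod_cast hym.le)
    have h2 : ((m : ℝ) - y) * (X / 2) ^ k < η := by linarith
    have h3 : (2 ^ (2 * k + 1) * ((X : ℝ) / J)) * (X / 2) ^ k = η := by
      rw [hη, div_pow]; field_simp; ring
    rw [← h3] at h2
    have h4 := lt_of_mul_lt_mul_right h2 (by positivity)
    have h5 : (m : ℝ) ≤ y + δ := by
      have := Nat.le_ceil (2 ^ (2 * k + 1) * ((X : ℝ) / J))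
      rw [← hδ] at this
      linarith
    exact_mod_cast h5
  have hpl : (p ^ (k + 1) * l ^ (k + 1) : ℕ) = m ^ (k + 1) := by rw [hm, mul_pow]
  rw [hGf, hpl]
  have hη0 : 0 ≤ η := by positivity
  have hpi := Real.pi_pos
  by_cases hc1 : Y < m ∧ m ≤ Y'
  · by_cases hc2 : (Y : ℝ) ^ (k + 1) < M ∧ M ≤ (Y' : ℝ) ^ (k + 1)
    · rw [if_pos hc1, if_pos hc1, if_pos hc2, e_split, ← mul_sub, norm_mul, norm_e, one_mul]
      refine (norm_e_sub_le _ _).trans ?_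
      have h1 : |β * (m : ℝ) ^ (k + 1) - β * M| ≤ |β| * η := by
        rw [← mul_sub, abs_mul]
        gcongr
        rw [abs_le]; constructor <;> linarith
      have h2 : (0 : ℝ) ≤ ((if Y < m ∧ m ≤ Y + δ then 1 else 0) +
        (if Y' < m ∧ m ≤ Y' + δ then 1 else 0)) := by positivity
      have h3 : 2 * Real.pi * |β * (m : ℝ) ^ (k + 1) - β * M| ≤ 2 * Real.pi * (|β| * η) := by gcongr
      linarith
    · have hMY : M ≤ (Y : ℝ) ^ (k + 1) := by
        by_contra hcon
        apply hc2
        refine ⟨not_le.1 hcon, hM1.trans ?_⟩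
        gcongr
        exact hc1.2
      have h1 := hnear Y hY hc1.1 (by linarith)
      rw [if_pos hc1, if_neg hc2, mul_zero, sub_zero, norm_e, if_pos hc1, if_pos ⟨hc1.1, h1⟩]
      have : (0 : ℝ) ≤ (if Y' < m ∧ m ≤ Y' + δ then 1 else 0) := by positivity
      have : 0 ≤ 2 * Real.pi * (|β| * η) := by positivity
      linarith
  · rw [if_neg hc1, if_neg hc1, zero_sub, norm_neg, norm_mul, norm_e, one_mul]
    by_cases hc2 : (Y : ℝ) ^ (k + 1) < M ∧ M ≤ (Y' : ℝ) ^ (k + 1)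
    · rw [if_pos hc2, norm_e]
      have h1 : Y < m := (hlt Y).1 (lt_of_lt_of_le hc2.1 hM1)
      have h2 : Y' < m := by
        by_contra hcon
        exact hc1 ⟨h1, not_lt.1 hcon⟩
      have h3 := hnear Y' (hY.trans (Nat.mul_le_mul_left 2 hYY)) h2 (by linarith)
      rw [if_pos (⟨h2, h3⟩ : Y' < m ∧ m ≤ Y' + δ)]
      have : (0 : ℝ) ≤ (if Y < m ∧ m ≤ Y + δ then 1 else 0) := by positivity
      linarith
    · rw [if_neg hc2, norm_zero]
      positivity

open Classical in
lemma T2_le (k : ℕ) : ∃ C : ℝ, 0 < C ∧ ∀ (r q J X Y Y' : ℕ) (a : ℤ) (β : ℝ), 3 ≤ r → 0 < q →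
    q < zz r → IsCoprime a (q : ℤ) → 0 < J → X ≤ 2 * Y → Y ≤ Y' → Y' ≤ X →
    2 ^ (k + 2) * (|β| * (X : ℝ) ^ (k + 1)) ≤ J →
    (q * (zz (r - 3)) ^ 7 * J) ^ 2 ≤ X →
    2 * ((q * (zz (r - 3)) ^ 7 : ℕ) * (1 + 2 * (|β| * (X : ℝ) ^ (k + 1)))) ≤ (zz r : ℝ) →
    ‖∑ m ∈ Ioc Y Y' with Rough r m, (Rw r X m : ℂ) * e (((a : ℝ) / q + β) * (m : ℝ) ^ (k + 1))‖ ≤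
    C * (X * (1 + |β| * (X : ℝ) ^ (k + 1)) / (J * Real.log (zz r)) +
      (Nat.log 2 X + 1) * Real.sqrt
      ((rho (k + 1) q : ℝ) ^ 2 * X ^ 2 * q / (q.totient ^ 2 * (1 + 2 * (|β| * (X : ℝ) ^ (k + 1))) *
      Real.log (zz r) ^ 4) * (2 + Real.log (1 + 2 * (|β| * (X : ℝ) ^ (k + 1)))))) := by
  obtain ⟨C1, hC1, hTu⟩ := Tu_sq k
  obtain ⟨C2, hC2, -, hUB1⟩ := UBs
  refine ⟨Real.sqrt C1 + C2 * (8 * 2 ^ (k + 1) + 4 * 2 ^ (2 * k + 1)), by positivity, ?_⟩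
  intro r q J X Y Y' a β hr hq hqz ha hJ hY hYY hYX hJβ hlen1 hlen2
  have hzpos : 0 < zz (r - 3) := lt_of_lt_of_le (by norm_num) (zz_ge _)
  have hXpos : 0 < X := lt_of_lt_of_le (by positivity) hlen1
  have hXr : (0 : ℝ) < X := by exact_mod_cast hXpos
  have hJr : (0 : ℝ) < J := by exact_mod_cast hJ
  have hlog := log_zz_pos r
  set Z := Real.log (zz r) with hZ
  set bb := |β| * (X : ℝ) ^ (k + 1) with hbb
  have hbb0 : 0 ≤ bb := by positivity
  set Q := (rho (k + 1) q : ℝ) ^ 2 * X ^ 2 * q / (q.totient ^ 2 * (1 + 2 * bb) * Z ^ 4) *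
    (2 + Real.log (1 + 2 * bb)) with hQ
  have hQ0 : 0 ≤ Q := by
    have : 0 ≤ Real.log (1 + 2 * bb) := Real.log_nonneg (by linarith)
    positivity
  set E : ℕ → ℂ := fun m => if Y < m ∧ m ≤ Y' then e (((a : ℝ) / q + β) * (m : ℝ) ^ (k + 1)) else 0 with hE
  have hsum1 : ∑ m ∈ Ioc Y Y' with Rough r m, (Rw r X m : ℂ) * e (((a : ℝ) / q + β) * (m : ℝ) ^ (k + 1)) =
      ∑ m ∈ Ioc 0 (2 * X) with Rough r m, (Rw' r X m : ℂ) * E m := by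
    have h1 : ∑ m ∈ Ioc 0 (2 * X) with Rough r m, (Rw' r X m : ℂ) * E m =
      ∑ m ∈ Ioc 0 (2 * X) with Rough r m, if Y < m ∧ m ≤ Y' then
        (Rw' r X m : ℂ) * e (((a : ℝ) / q + β) * (m : ℝ) ^ (k + 1)) else 0 := by
      refine sum_congr rfl fun m _ => ?_
      rw [hE]; simp only [mul_ite, mul_zero]
    rw [h1, ← sum_filter, filter_filter]
    refine sum_congr ?_ ?_
    · ext m
      simp only [mem_filter, mem_Ioc]
      constructor
      · rintro ⟨⟨h2, h3⟩, h4⟩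
        exact ⟨⟨by omega, by omega⟩, h4, h2, h3⟩
      · rintro ⟨_, h4, h2, h3⟩
        exact ⟨⟨h2, h3⟩, h4⟩
    · intro m hm
      simp only [mem_filter, mem_Ioc] at hm
      rw [Rw'_eq r X m hm.2.1 (by omega) (by omega)]
  rw [hsum1, ← triple_sum]
  set δ := ⌈2 ^ (2 * k + 1) * ((X : ℝ) / J)⌉₊ with hδ
  set Er : ℕ → ℝ := fun m =>
    (if Y < m ∧ m ≤ Y' then 2 * Real.pi * (|β| * (2 ^ (k + 1) * (X : ℝ) ^ (k + 1) / J)) else 0) +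
    ((if Y < m ∧ m ≤ Y + δ then 1 else 0) + (if Y' < m ∧ m ≤ Y' + δ then 1 else 0)) with hEr
  set T : ℕ → ℂ := fun u => ∑ l ∈ Lset r X (2 ^ u), ∑ p ∈ Pset r X (2 ^ u), (vw r X l : ℂ) *
      (e (a * (p ^ (k + 1) * l ^ (k + 1) : ℕ) / q) *
        Gf k J (2 ^ u) X β ((Y : ℝ) ^ (k + 1)) ((Y' : ℝ) ^ (k + 1)) p (jc k J (2 ^ u) X l)) with hT
  have hdiff : ‖(∑ u ∈ range (Nat.log 2 X + 1), ∑ l ∈ Lset r X (2 ^ u), ∑ p ∈ Pset r X (2 ^ u),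
      (vw r X l : ℂ) * E (p * l)) - ∑ u ∈ range (Nat.log 2 X + 1), T u‖ ≤
      ∑ m ∈ Ioc 0 (2 * X) with Rough r m, Er m := by
    have h1 : ‖(∑ u ∈ range (Nat.log 2 X + 1), ∑ l ∈ Lset r X (2 ^ u), ∑ p ∈ Pset r X (2 ^ u),
      (vw r X l : ℂ) * E (p * l)) - ∑ u ∈ range (Nat.log 2 X + 1), T u‖ ≤
      ∑ u ∈ range (Nat.log 2 X + 1), ∑ l ∈ Lset r X (2 ^ u), ∑ p ∈ Pset r X (2 ^ u),
        vw r X l * Er (p * l) := by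
      rw [hT]
      simp only [← sum_sub_distrib, ← mul_sub]
      refine (norm_sum_le _ _).trans (sum_le_sum fun u _ => (norm_sum_le _ _).trans
        (sum_le_sum fun l hl => (norm_sum_le _ _).trans (sum_le_sum fun p hp => ?_)))
      rw [norm_mul, Complex.norm_real, Real.norm_eq_abs, abs_of_nonneg (vw_nonneg _ _ _)]
      refine mul_le_mul_of_nonneg_left ?_ (vw_nonneg _ _ _)
      exact term_cmp k r q J X (2 ^ u) Y Y' a β hJ (by positivity) hXpos hY hYY l p hl hp
    refine h1.trans ?_
    have h2 := triple_sum r X (fun m => (Er m : ℂ))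
    have h3 : ∑ u ∈ range (Nat.log 2 X + 1), ∑ l ∈ Lset r X (2 ^ u), ∑ p ∈ Pset r X (2 ^ u),
        vw r X l * Er (p * l) = ∑ m ∈ Ioc 0 (2 * X) with Rough r m, Rw' r X m * Er m := by
      exact_mod_cast h2
    rw [h3]
    refine sum_le_sum fun m _ => mul_le_of_le_one_left ?_ (Rw'_le_one _ _ _)
    have := Real.pi_pos
    rw [hEr]; positivity
  have hs7 : (zz (r - 3)) ^ 7 * J ≤ X := by
    have h1 : (zz (r - 3)) ^ 7 * J ≤ q * (zz (r - 3)) ^ 7 * J := by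
      rw [mul_assoc]; exact Nat.le_mul_of_pos_left _ hq
    exact h1.trans ((Nat.le_self_pow two_ne_zero _).trans hlen1)
  have hs7' : ((zz (r - 3) : ℕ) : ℝ) ^ 7 ≤ X / J := by
    rw [le_div_iff₀ hJr]; exact_mod_cast hs7
  have hs1 : (1 : ℝ) ≤ ((zz (r - 3) : ℕ) : ℝ) ^ 7 := one_le_pow₀ (by exact_mod_cast hzpos)
  have hXJ : (1 : ℝ) ≤ X / J := hs1.trans hs7'
  have h2k : (X : ℝ) / J ≤ 2 ^ (2 * k + 1) * ((X : ℝ) / J) :=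
    le_mul_of_one_le_left (by positivity) (one_le_pow₀ (by norm_num))
  have hcount : ∀ y : ℕ, (∑ m ∈ Ioc 0 (2 * X) with Rough r m,
      if y < m ∧ m ≤ y + δ then (1 : ℝ) else 0) ≤ C2 * (2 * (2 ^ (2 * k + 1) * (X / J))) / Z := by
    intro y
    rw [← sum_filter, sum_const, nsmul_eq_mul, mul_one]
    have h1 := hUB1 r y (y + δ) hr (by omega) (by
      rw [Nat.add_sub_cancel_left]
      have : ((zz (r - 3) ^ 7 : ℕ) : ℝ) ≤ δ := by
        push_cast; exact hs7'.trans (h2k.trans (Nat.le_ceil _))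
      exact_mod_cast this)
    rw [Nat.add_sub_cancel_left] at h1
    refine le_trans (Nat.cast_le.2 (card_le_card fun m hm => ?_)) (h1.trans ?_)
    · rw [mem_filter, mem_filter] at hm
      exact mem_filter.2 ⟨mem_Ioc.2 hm.2, hm.1.2⟩
    · have := ceil_le_two (hXJ.trans h2k)
      rw [← hδ] at this
      gcongr
  have hcount0 : (#{m ∈ Ioc Y Y' | Rough r m} : ℝ) ≤ C2 * X / Z := by
    have h1 := hUB1 r 0 X hr (by omega) (by
      rw [Nat.sub_zero]
      exact le_trans (Nat.le_mul_of_pos_right _ hJ) hs7)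
    rw [Nat.sub_zero] at h1
    refine le_trans (Nat.cast_le.2 (card_le_card fun m hm => ?_)) h1
    rw [mem_filter, mem_Ioc] at hm ⊢
    exact ⟨⟨by omega, by omega⟩, hm.2⟩
  have hErsum : ∑ m ∈ Ioc 0 (2 * X) with Rough r m, Er m ≤
      C2 * (8 * 2 ^ (k + 1) + 4 * 2 ^ (2 * k + 1)) * (X * (1 + bb) / (J * Z)) := by
    rw [hEr]
    simp only [sum_add_distrib]
    have h1 := hcount Y
    have h2 := hcount Y'
    have h3 : (∑ m ∈ Ioc 0 (2 * X) with Rough r m, if Y < m ∧ m ≤ Y' then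
        2 * Real.pi * (|β| * (2 ^ (k + 1) * (X : ℝ) ^ (k + 1) / J)) else 0) ≤
        (C2 * X / Z) * (2 * Real.pi * (|β| * (2 ^ (k + 1) * (X : ℝ) ^ (k + 1) / J))) := by
      rw [← sum_filter, sum_const, nsmul_eq_mul]
      have := Real.pi_pos
      refine mul_le_mul_of_nonneg_right ?_ (by positivity)
      refine le_trans (Nat.cast_le.2 (card_le_card fun m hm => ?_)) hcount0
      rw [mem_filter, mem_filter] at hm
      exact mem_filter.2 ⟨mem_Ioc.2 hm.2, hm.1.2⟩
    have h4 : (C2 * X / Z) * (2 * Real.pi * (|β| * (2 ^ (k + 1) * (X : ℝ) ^ (k + 1) / J))) ≤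
        C2 * (8 * 2 ^ (k + 1)) * (X * bb / (J * Z)) := by
      have hpi := Real.pi_le_four
      calc _ = (2 * Real.pi) * (C2 * 2 ^ (k + 1) * (X * bb / (J * Z))) := by
            rw [hbb]; field_simp
        _ ≤ 8 * (C2 * 2 ^ (k + 1) * (X * bb / (J * Z))) := by gcongr; linarith
        _ = _ := by ring
    have h5 : C2 * (2 * (2 ^ (2 * k + 1) * (X / J))) / Z = C2 * (2 * 2 ^ (2 * k + 1)) * (X / (J * Z)) := by
      field_simp
    rw [h5] at h1 h2
    have h6 : X * (1 + bb) / (J * Z) = X / (J * Z) + X * bb / (J * Z) := by ring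
    rw [h6]
    have h7 : 0 ≤ C2 * (8 * 2 ^ (k + 1)) * (X / (J * Z)) := by positivity
    have h8 : 0 ≤ C2 * (4 * 2 ^ (2 * k + 1)) * (X * bb / (J * Z)) := by positivity
    nlinarith
  have hTle : ∀ u, ‖T u‖ ≤ Real.sqrt C1 * Real.sqrt Q := by
    intro u
    rw [← Real.sqrt_mul hC1.le]
    apply Real.le_sqrt_of_sq_le
    by_cases hu : 2 ^ u * 2 ^ u ≤ X
    · refine hTu r q J X (2 ^ u) a β _ _ (vw r X) hr hq hqz ha hJ (by positivity) (by positivity) hJβ ?_ hlen2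
        (vw_nonneg r X) (vw_le_one r X)
      have h1 : (q * zz (r - 3) ^ 7 * (2 ^ u * J)) ^ 2 ≤ X ^ 2 := by
        calc _ = (q * zz (r - 3) ^ 7 * J) ^ 2 * (2 ^ u * 2 ^ u) := by ring
          _ ≤ X * X := Nat.mul_le_mul hlen1 hu
          _ = _ := by ring
      exact (Nat.pow_le_pow_iff_left two_ne_zero).1 h1
    · have h1 : Pset r X (2 ^ u) = ∅ := by
        rw [Pset, filter_eq_empty_iff]
        intro p hp hp'
        rw [mem_Ico] at hp
        exact hu ((Nat.mul_le_mul hp.1 hp.1).trans hp'.2.2)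
      rw [hT]
      simp only [h1, sum_empty, sum_const_zero, norm_zero]
      rw [zero_pow two_ne_zero]
      positivity
  have hTsum : ‖∑ u ∈ range (Nat.log 2 X + 1), T u‖ ≤ (Nat.log 2 X + 1) * (Real.sqrt C1 * Real.sqrt Q) := by
    refine (norm_sum_le _ _).trans ((sum_le_sum fun u _ => hTle u).trans ?_)
    rw [sum_const, card_range, nsmul_eq_mul]
    push_cast; exact le_rfl
  have htri := norm_le_norm_add_norm_sub' (∑ u ∈ range (Nat.log 2 X + 1), ∑ l ∈ Lset r X (2 ^ u),
    ∑ p ∈ Pset r X (2 ^ u), (vw r X l : ℂ) * E (p * l)) (∑ u ∈ range (Nat.log 2 X + 1), T u)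
  have h1 : 0 ≤ X * (1 + bb) / (J * Z) := by positivity
  have h2 : 0 ≤ ((Nat.log 2 X : ℝ) + 1) * Real.sqrt Q := by positivity
  have h3 : 0 ≤ Real.sqrt C1 * (X * (1 + bb) / (J * Z)) := by positivity
  have h4 : 0 ≤ C2 * (8 * 2 ^ (k + 1) + 4 * 2 ^ (2 * k + 1)) * (((Nat.log 2 X : ℝ) + 1) * Real.sqrt Q) := by
    positivity
  nlinarith

end MajArc


namespace MajArc

lemma abel_id (Y : ℕ) (c g : ℕ → ℂ) (y : ℕ) (hy : Y ≤ y) :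
    ∑ m ∈ Ioc Y y, c m * g m = (∑ m ∈ Ioc Y y, c m) * g y
      - ∑ m ∈ Ico Y y, (∑ j ∈ Ioc Y m, c j) * (g (m + 1) - g m) := by
  induction y, hy using Nat.le_induction with
  | base => simp
  | succ y hy ih =>
    rw [Finset.sum_Ioc_succ_top (by omega), ih, Finset.sum_Ioc_succ_top (by omega),
      Finset.sum_Ico_succ_top (by omega)]
    ring

lemma abel_ineq (Y Y' : ℕ) (hY : Y ≤ Y') (c g : ℕ → ℂ) (E V : ℝ)
    (hc : ∀ y, Y ≤ y → y ≤ Y' → ‖∑ m ∈ Ioc Y y, c m‖ ≤ E)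
    (hV : ‖g Y'‖ + ∑ m ∈ Ico Y Y', ‖g (m + 1) - g m‖ ≤ V) :
    ‖∑ m ∈ Ioc Y Y', c m * g m‖ ≤ E * V := by
  have hE : 0 ≤ E := le_trans (norm_nonneg _) (hc Y le_rfl hY)
  rw [abel_id Y c g Y' hY]
  calc _ ≤ ‖(∑ m ∈ Ioc Y Y', c m) * g Y'‖ + ‖∑ m ∈ Ico Y Y', (∑ j ∈ Ioc Y m, c j) * (g (m + 1) - g m)‖ :=
        norm_sub_le _ _
    _ ≤ E * ‖g Y'‖ + ∑ m ∈ Ico Y Y', E * ‖g (m + 1) - g m‖ := by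
        refine add_le_add ?_ (norm_sum_le_of_le _ fun m hm => ?_)
        · rw [norm_mul]; exact mul_le_mul_of_nonneg_right (hc _ hY le_rfl) (norm_nonneg _)
        · rw [Finset.mem_Ico] at hm
          rw [norm_mul]; exact mul_le_mul_of_nonneg_right (hc _ hm.1 hm.2.le) (norm_nonneg _)
    _ = E * (‖g Y'‖ + ∑ m ∈ Ico Y Y', ‖g (m + 1) - g m‖) := by rw [← mul_sum]; ring
    _ ≤ _ := mul_le_mul_of_nonneg_left hV hE

lemma pow_tele (K Y Y' : ℕ) (hY : Y ≤ Y') :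
    ∑ m ∈ Ico Y Y', (((m + 1 : ℕ) : ℝ) ^ K - (m : ℝ) ^ K) = (Y' : ℝ) ^ K - (Y : ℝ) ^ K := by
  rw [Finset.sum_Ico_eq_sub _ hY, Finset.sum_range_sub (fun m : ℕ => (m : ℝ) ^ K),
    Finset.sum_range_sub (fun m : ℕ => (m : ℝ) ^ K)]
  ring

lemma pow_succ_mono (K m : ℕ) : 0 ≤ ((m + 1 : ℕ) : ℝ) ^ K - (m : ℝ) ^ K := by
  have : (m : ℝ) ^ K ≤ ((m + 1 : ℕ) : ℝ) ^ K := by gcongr; simp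
  linarith

lemma var_e (K Y Y' X : ℕ) (β : ℝ) (hY : Y ≤ Y') (hX : Y' ≤ X) :
    ‖e (β * (Y' : ℝ) ^ K)‖ + ∑ m ∈ Ico Y Y', ‖e (β * ((m + 1 : ℕ) : ℝ) ^ K) - e (β * (m : ℝ) ^ K)‖
      ≤ 7 * (1 + |β| * (X : ℝ) ^ K) := by
  have h1 : ∑ m ∈ Ico Y Y', ‖e (β * ((m + 1 : ℕ) : ℝ) ^ K) - e (β * (m : ℝ) ^ K)‖
      ≤ ∑ m ∈ Ico Y Y', 2 * Real.pi * |β| * (((m + 1 : ℕ) : ℝ) ^ K - (m : ℝ) ^ K) := by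
    refine sum_le_sum fun m _ => (norm_e_sub_le _ _).trans (le_of_eq ?_)
    rw [← mul_sub, abs_mul, abs_of_nonneg (pow_succ_mono K m)]; ring
  rw [← mul_sum, pow_tele K Y Y' hY] at h1
  have h2 : (Y' : ℝ) ^ K ≤ (X : ℝ) ^ K := by gcongr
  have h3 : 0 ≤ (Y : ℝ) ^ K := by positivity
  have h4 : 2 * Real.pi * |β| * ((Y' : ℝ) ^ K - (Y : ℝ) ^ K) ≤ 7 * |β| * (X : ℝ) ^ K := by
    have : 2 * Real.pi ≤ 7 := by linarith [Real.pi_lt_d2]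
    have hb : 0 ≤ |β| := abs_nonneg _
    calc _ ≤ 2 * Real.pi * |β| * (X : ℝ) ^ K := by gcongr; linarith
      _ ≤ _ := by gcongr
  rw [norm_e]; linarith

lemma e_taylor (t : ℝ) : ‖e t - 1 - 2 * Real.pi * Complex.I * t‖ ≤ 3 * (2 * Real.pi * t) ^ 2 := by
  have hz : ‖(2 * Real.pi * Complex.I * t : ℂ)‖ = |2 * Real.pi * t| := by
    rw [abs_mul, abs_mul]; simp
  by_cases h : |2 * Real.pi * t| ≤ 1
  · have := Complex.norm_exp_sub_one_sub_id_le (x := (2 * Real.pi * Complex.I * t : ℂ)) (by rw [hz]; exact h)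
    rw [hz, sq_abs] at this
    unfold e
    nlinarith [sq_nonneg (2 * Real.pi * t)]
  · push Not at h
    have h1 : ‖e t - 1 - 2 * Real.pi * Complex.I * t‖ ≤ 1 + 1 + |2 * Real.pi * t| := by
      refine (norm_sub_le _ _).trans ?_
      rw [hz]
      gcongr
      refine (norm_sub_le _ _).trans ?_
      simp
    rw [← sq_abs]
    nlinarith

/-- smooth exponential sum over an interval -/
lemma smooth_le (k X Y Y' : ℕ) (β : ℝ) (hX : 0 < X) (hXY : X ≤ 2 * Y) (hY : Y ≤ Y') (hY' : Y' ≤ X) :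
    ‖∑ m ∈ Ioc Y Y', e (β * (m : ℝ) ^ (k + 1))‖ ≤
      200 * 2 ^ (2*k) * (X / (1 + |β| * (X : ℝ) ^ (k + 1)) + |β| * (X : ℝ) ^ (k + 1)) := by
  set Δ := |β| * (X : ℝ) ^ (k + 1) with hΔ
  have hXr : (0 : ℝ) < X := by exact_mod_cast hX
  have hΔ0 : 0 ≤ Δ := by positivity
  have h2k : (1 : ℝ) ≤ 2 ^ k := one_le_pow₀ (by norm_num)
  have h22k : (2:ℝ) ^ (2 * k) = 2 ^ k * 2 ^ k := by rw [two_mul, pow_add]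
  have htriv : ‖∑ m ∈ Ioc Y Y', e (β * (m : ℝ) ^ (k + 1))‖ ≤ X := by
    refine (norm_sum_le_of_le _ (fun m _ => (norm_e _).le)).trans ?_
    simp only [sum_const, Nat.card_Ioc, nsmul_eq_mul, mul_one]
    exact_mod_cast (by omega)
  rcases le_or_gt Δ 1 with h1 | h1
  · refine htriv.trans ?_
    have : (X : ℝ) / 2 ≤ X / (1 + Δ) := by gcongr; linarith
    rw [h22k]
    nlinarith [mul_le_mul h2k h2k (by norm_num) (by positivity)]
  have hβ : β ≠ 0 := by rintro rfl; simp [hΔ] at h1; linarith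
  have hβ' : 0 < |β| := abs_pos.mpr hβ
  set d : ℕ → ℝ := fun m => ((m + 1 : ℕ) : ℝ) ^ (k + 1) - (m : ℝ) ^ (k + 1) with hd
  set w : ℕ → ℝ := fun m => 1 / (β * d m) with hw
  set g : ℕ → ℂ := fun m => e (β * (m : ℝ) ^ (k + 1)) with hg
  have hdge : ∀ m, Y ≤ m → ((X : ℝ) / 2) ^ k ≤ d m := by
    intro m hm
    have hXm : (X : ℝ) / 2 ≤ m := by
      have : (X : ℝ) ≤ 2 * m := by exact_mod_cast (by omega)
      linarith
    have := pow_sub_ge k (m : ℝ) ((m + 1 : ℕ) : ℝ) (X / 2) (by positivity) hXm (by push_cast; linarith)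
    push_cast at this ⊢
    simp only [hd]; push_cast
    linarith
  have hdpos : ∀ m, Y ≤ m → 0 < d m := fun m hm => lt_of_lt_of_le (by positivity) (hdge m hm)
  have hdmono : ∀ m, d m ≤ d (m + 1) := by
    intro m
    simp only [hd]
    -- geometric sums
    have key : ∀ x : ℝ, (x + 1) ^ (k + 1) - x ^ (k + 1) = ∑ i ∈ range (k + 1), (x + 1) ^ i * x ^ (k - i) := by
      intro x
      have := Commute.geom_sum₂_mul (Commute.all (x + 1) x) (k + 1)
      rw [← this]; simp
    push_cast
    rw [key, key ((m : ℝ) + 1)]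
    gcongr <;> linarith
  -- main identity
  have hterm : ∀ m, Y ≤ m → ‖g m - (1 / (2 * Real.pi * Complex.I)) * ((g (m + 1) - g m) * (w m : ℂ))‖
      ≤ 20 * (|β| * d m) := by
    intro m hm
    have hdm := hdpos m hm
    have hne : (β * d m) ≠ 0 := mul_ne_zero hβ hdm.ne'
    have hpi : (2 * Real.pi * Complex.I : ℂ) ≠ 0 := by simp [Real.pi_ne_zero]
    have hs : g (m + 1) = g m * e (β * d m) := by
      simp only [hg, hd]; rw [← e_add]; congr 1; ring
    have : g m - (1 / (2 * Real.pi * Complex.I)) * ((g (m + 1) - g m) * (w m : ℂ))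
        = -(g m * (w m : ℂ) / (2 * Real.pi * Complex.I)) * (e (β * d m) - 1 - 2 * Real.pi * Complex.I * (β * d m : ℝ)) := by
      rw [hs]; simp only [hw]; push_cast
      have hβc : (β : ℂ) ≠ 0 := by exact_mod_cast hβ
      have hdc : (d m : ℂ) ≠ 0 := by exact_mod_cast hdm.ne'
      have hpc : (Real.pi : ℂ) ≠ 0 := by exact_mod_cast Real.pi_ne_zero
      field_simp
      ring
    rw [this, norm_mul, norm_neg, norm_div, norm_mul]
    have h1 : ‖g m‖ = 1 := norm_e _
    have h2 : ‖(w m : ℂ)‖ = 1 / (|β| * d m) := by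
      rw [Complex.norm_real, Real.norm_eq_abs]; simp only [hw]
      rw [abs_div, abs_one, abs_mul, abs_of_pos hdm]
    have h3 : ‖(2 * Real.pi * Complex.I : ℂ)‖ = 2 * Real.pi := by
      simp [abs_of_pos Real.pi_pos]
    rw [h1, h2, h3]
    calc _ ≤ 1 * (1 / (|β| * d m)) / (2 * Real.pi) * (3 * (2 * Real.pi * (β * d m)) ^ 2) := by
          gcongr; exact e_taylor _
      _ = 6 * Real.pi * (|β| * d m) := by
          rw [mul_pow, mul_pow β, ← sq_abs β]; field_simp; ring
      _ ≤ 20 * (|β| * d m) := by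
          gcongr; linarith [Real.pi_lt_d2]
  have hwle : ∀ m, Y ≤ m → |w m| ≤ 2 ^ k * X / Δ := by
    intro m hm
    simp only [hw]
    rw [abs_div, abs_one, abs_mul, abs_of_pos (hdpos m hm)]
    have := hdge m hm
    calc 1 / (|β| * d m) ≤ 1 / (|β| * ((X : ℝ) / 2) ^ k) := by gcongr
      _ = 2 ^ k * X / Δ := by rw [hΔ, div_pow, pow_succ]; field_simp
  -- Abel with c m = g(m+1) - g m
  have hA : ‖∑ m ∈ Ioc Y Y', (g (m + 1) - g m) * (w m : ℂ)‖ ≤ 2 * (2 * (2 ^ k * X / Δ)) := by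
    refine abel_ineq Y Y' hY _ _ _ _ ?_ ?_
    · intro y hy _
      have : ∑ m ∈ Ioc Y y, (g (m + 1) - g m) = g (y + 1) - g (Y + 1) := by
        rw [← Finset.Ico_succ_succ_eq_Ioc, Finset.sum_Ico_eq_sub _ (by simpa using hy), Finset.sum_range_sub, Finset.sum_range_sub]
        simp only [Nat.succ_eq_succ, Nat.succ_eq_add_one]; ring
      rw [this]
      refine (norm_sub_le _ _).trans ?_
      simp only [hg, norm_e]; norm_num
    · have h1 : ∑ m ∈ Ico Y Y', ‖(w (m + 1) : ℂ) - (w m : ℂ)‖ = |w Y| - |w Y'| := by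
        have : ∀ m ∈ Ico Y Y', ‖(w (m + 1) : ℂ) - (w m : ℂ)‖ = -(|w (m + 1)| - |w m|) := by
          intro m hm
          rw [Finset.mem_Ico] at hm
          rw [← Complex.ofReal_sub, Complex.norm_real, Real.norm_eq_abs]
          simp only [hw]
          have hp := hdpos m hm.1
          have hp' := hdpos (m + 1) (by omega)
          have hmono := hdmono m
          have e1 : 1 / (β * d (m + 1)) - 1 / (β * d m) = (1 / β) * (1 / d (m + 1) - 1 / d m) := by
            field_simp
          have : 1 / d (m + 1) ≤ 1 / d m := one_div_le_one_div_of_le hp hmono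
          rw [e1, abs_mul, abs_of_nonpos (by linarith : 1 / d (m + 1) - 1 / d m ≤ 0)]
          simp only [abs_div, abs_mul, abs_one, abs_of_pos hp, abs_of_pos hp']
          field_simp
        rw [sum_congr rfl this, sum_neg_distrib, Finset.sum_Ico_eq_sub _ hY,
          Finset.sum_range_sub (fun m => |w m|), Finset.sum_range_sub (fun m => |w m|)]
        ring
      rw [h1, Complex.norm_real, Real.norm_eq_abs]
      have := hwle Y le_rfl
      have : 0 ≤ 2 ^ k * X / Δ := by positivity
      linarith
  have hsum : ‖∑ m ∈ Ioc Y Y', g m‖ ≤ ‖∑ m ∈ Ioc Y Y', (1 / (2 * Real.pi * Complex.I)) * ((g (m + 1) - g m) * (w m : ℂ))‖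
      + ∑ m ∈ Ioc Y Y', 20 * (|β| * d m) := by
    have : ∑ m ∈ Ioc Y Y', g m = ∑ m ∈ Ioc Y Y', (1 / (2 * Real.pi * Complex.I)) * ((g (m + 1) - g m) * (w m : ℂ))
      + ∑ m ∈ Ioc Y Y', (g m - (1 / (2 * Real.pi * Complex.I)) * ((g (m + 1) - g m) * (w m : ℂ))) := by
      rw [← sum_add_distrib]; exact sum_congr rfl fun m _ => by ring
    rw [this]
    refine (norm_add_le _ _).trans (add_le_add le_rfl (norm_sum_le_of_le _ fun m hm => hterm m ?_))
    rw [Finset.mem_Ioc] at hm; omega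
  have hD : ∑ m ∈ Ioc Y Y', 20 * (|β| * d m) ≤ 40 * 2 ^ k * Δ := by
    rw [← mul_sum, ← mul_sum, ← Finset.Ico_succ_succ_eq_Ioc]
    simp only [hd]
    rw [pow_tele (k + 1) _ _ (by simpa using hY)]
    have h0 : (0:ℝ) ≤ ((Order.succ Y : ℕ) : ℝ) ^ (k + 1) := by positivity
    have h1 : ((Order.succ Y' : ℕ) : ℝ) ^ (k + 1) ≤ (2 * X : ℝ) ^ (k + 1) := by
      have : ((Order.succ Y' : ℕ) : ℝ) ≤ 2 * X := by
        simp only [Nat.succ_eq_succ]; exact_mod_cast (by omega : Y' + 1 ≤ 2 * X)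
      gcongr
    rw [mul_pow] at h1
    calc _ ≤ 20 * (|β| * (2 ^ (k + 1) * (X : ℝ) ^ (k + 1))) := by gcongr; linarith
      _ = _ := by rw [hΔ, pow_succ 2]; ring
  rw [← mul_sum, norm_mul] at hsum
  have hpin : ‖(1 / (2 * Real.pi * Complex.I) : ℂ)‖ ≤ 1 := by
    rw [norm_div]; simp only [norm_one, norm_mul, Complex.norm_I, Complex.norm_real, Real.norm_eq_abs, abs_of_pos Real.pi_pos]
    rw [div_le_one (by simp [Real.pi_pos])]
    simp; linarith [Real.pi_gt_three]
  have hXD : (X : ℝ) / Δ ≤ 2 * (X / (1 + Δ)) := by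
    rw [← mul_div_assoc, div_le_div_iff₀ (by linarith) (by linarith)]
    nlinarith
  have hfin : ‖∑ m ∈ Ioc Y Y', g m‖ ≤ 2 * (2 * (2 ^ k * X / Δ)) + 40 * 2 ^ k * Δ := by
    refine hsum.trans (add_le_add ?_ hD)
    calc _ ≤ 1 * (2 * (2 * (2 ^ k * X / Δ))) := by gcongr
      _ = _ := by ring
  refine hfin.trans ?_
  have e1 : 2 ^ k * (X : ℝ) / Δ = 2 ^ k * (X / Δ) := by ring
  rw [e1, h22k]
  have hXD0 : 0 ≤ X / (1 + Δ) := by positivity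
  calc 2 * (2 * (2 ^ k * ((X : ℝ) / Δ))) + 40 * 2 ^ k * Δ ≤ 2 * (2 * (2 ^ k * (2 * (X / (1 + Δ))))) + 40 * 2 ^ k * Δ := by gcongr
    _ ≤ 200 * (2 ^ k * 1) * (X / (1 + Δ) + Δ) := by nlinarith [mul_nonneg (by positivity : (0:ℝ) ≤ 2 ^ k) hXD0, mul_nonneg (by positivity : (0:ℝ) ≤ 2 ^ k) hΔ0]
    _ ≤ _ := by gcongr

open Classical in
lemma T1_le (k : ℕ) : ∃ C : ℝ, 0 < C ∧ ∀ (r b q X Y Y' : ℕ) (a : ℤ) (β : ℝ), 0 < q → q < zz r →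
    IsCoprime a (q : ℤ) → 0 < X → X ≤ 2 * Y → Y ≤ Y' → Y' ≤ X →
    ‖∑ m ∈ Ioc Y Y' with Rough r m, e ((a / q + β) * (m : ℝ) ^ (k + 1))‖ ≤
      C * (rho (k + 1) q * √q / (q.totient * Real.log (zz r)) *
        (X / (1 + |β| * (X : ℝ) ^ (k + 1)) + |β| * (X : ℝ) ^ (k + 1))
       + q.totient * (1 + |β| * (X : ℝ) ^ (k + 1)) *
        ((1 / 4) ^ b * (X / (q.totient * Real.log (zz r))) + (zz r : ℝ) ^ (4 * b + 6))) := by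
  obtain ⟨C0, hC0, hFL⟩ := FL
  refine ⟨200 * 2 ^ (2 * k) + 7 * (C0 + 1), by positivity, ?_⟩
  intro r b q X Y Y' a β hq hqz ha hX hXY hY hY'
  set Δ := |β| * (X : ℝ) ^ (k + 1) with hΔ
  set g : ℕ → ℂ := fun m => e (β * (m : ℝ) ^ (k + 1)) with hg
  have hφ : (0 : ℝ) < q.totient := by exact_mod_cast Nat.totient_pos.mpr hq
  have hqr : (0 : ℝ) < q := by exact_mod_cast hq
  have hlz := log_zz_pos r
  have hV0 := VV_nonneg q r
  have hVq : VV q r / q ≤ 1 / (q.totient * Real.log (zz r)) := by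
    have := VV_le q r hq
    calc VV q r / q ≤ ((q : ℝ) / q.totient / Real.log (zz r)) / q := by gcongr
      _ = _ := by field_simp
  -- split by residues
  have hsplit : ∑ m ∈ Ioc Y Y' with Rough r m, e ((a / q + β) * (m : ℝ) ^ (k + 1))
      = ∑ v ∈ range q with v.Coprime q, e (a * (v ^ (k + 1) : ℕ) / q) *
        ∑ m ∈ Ioc Y Y', (if m ≡ v [MOD q] ∧ Sf q r m then (1 : ℂ) else 0) * g m := by
    have hmaps : ∀ m ∈ (Ioc Y Y').filter (Rough r), m % q ∈ (range q).filter (fun v => v.Coprime q) := by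
      intro m hm
      rw [mem_filter] at hm
      rw [mem_filter, mem_range]
      refine ⟨Nat.mod_lt _ hq, ?_⟩
      have := hm.2.coprime hq hqz
      rw [Nat.Coprime] at this ⊢
      rw [← this, ← Nat.gcd_rec, Nat.gcd_comm]
    rw [← sum_fiberwise_of_maps_to hmaps]
    refine sum_congr rfl fun v hv => ?_
    rw [mem_filter, mem_range] at hv
    rw [mul_sum]
    rw [filter_filter, sum_filter]
    refine sum_congr rfl fun m _ => ?_
    have hiff : (Rough r m ∧ m % q = v) ↔ (m ≡ v [MOD q] ∧ Sf q r m) := by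
      have h1 : m % q = v ↔ m ≡ v [MOD q] := by
        rw [Nat.ModEq, Nat.mod_eq_of_lt hv.1]
      rw [h1, and_comm]
      constructor
      · rintro ⟨h, h'⟩; exact ⟨h, (rough_iff_sf hv.2 h).1 h'⟩
      · rintro ⟨h, h'⟩; exact ⟨h, (rough_iff_sf hv.2 h).2 h'⟩
    simp only [hiff]
    split_ifs with h
    · rw [e_split, one_mul]
      congr 1
      obtain ⟨t, ht⟩ := (Nat.modEq_iff_dvd.mp (h.1.pow (k + 1)).symm)
      refine e_congr (a * t) ?_
      have : ((m ^ (k + 1) : ℕ) : ℝ) = ((v ^ (k + 1) : ℕ) : ℝ) + q * t := by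
        have : ((m ^ (k + 1) : ℕ) : ℤ) = ((v ^ (k + 1) : ℕ) : ℤ) + q * t := by linarith
        exact_mod_cast this
      rw [this]; push_cast; field_simp
    · simp
  set E : ℝ := C0 * (1 / 4) ^ b * ((X : ℝ) / q * VV q r) + (zz r : ℝ) ^ (4 * b + 6) with hE
  have hinner : ∀ v, ‖∑ m ∈ Ioc Y Y', (if m ≡ v [MOD q] ∧ Sf q r m then (1 : ℂ) else 0) * g m
      - (VV q r / q : ℝ) * ∑ m ∈ Ioc Y Y', g m‖ ≤ E * (7 * (1 + Δ)) := by
    intro v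
    rw [mul_sum, ← sum_sub_distrib]
    simp only [← sub_mul]
    refine abel_ineq Y Y' hY _ _ _ _ ?_ (var_e (k + 1) Y Y' X β hY hY')
    intro y hy hy'
    have := hFL r b q v Y y hq hy
    rw [sum_sub_distrib, sum_boole]
    simp only [sum_const, Nat.card_Ioc, nsmul_eq_mul]
    have e1 : (((#{m ∈ Ioc Y y | m ≡ v [MOD q] ∧ Sf q r m} : ℕ) : ℂ) - ((y - Y : ℕ) : ℂ) * ((VV q r / q : ℝ) : ℂ))
        = (((#{m ∈ Ioc Y y | m ≡ v [MOD q] ∧ Sf q r m} : ℕ) : ℝ) - ((y : ℝ) - Y) / q * VV q r : ℝ) := by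
      push_cast [Nat.cast_sub hy]; ring
    rw [e1, Complex.norm_real, Real.norm_eq_abs]
    refine this.trans ?_
    rw [hE]
    have : (y : ℝ) - Y ≤ X := by
      have : (y : ℝ) ≤ X := by exact_mod_cast hy'.trans hY'
      have : (0:ℝ) ≤ Y := by positivity
      linarith
    gcongr
  have hmain : ‖∑ m ∈ Ioc Y Y' with Rough r m, e ((a / q + β) * (m : ℝ) ^ (k + 1))
      - SS (k + 1) q a * ((VV q r / q : ℝ) * ∑ m ∈ Ioc Y Y', g m)‖ ≤ q.totient * (E * (7 * (1 + Δ))) := by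
    rw [hsplit, SS, sum_mul, ← sum_sub_distrib]
    refine (norm_sum_le_of_le (n := fun _ => E * (7 * (1 + Δ))) _ fun v _ => ?_).trans ?_
    · rw [← mul_sub, norm_mul, norm_e, one_mul]; exact hinner v
    · rw [sum_const, card_units, nsmul_eq_mul]
  have hS := SS_le (k + 1) q a (by omega) hq ha
  have hG := smooth_le k X Y Y' β hX hXY hY hY'
  have hmain2 : ‖SS (k + 1) q a * ((VV q r / q : ℝ) * ∑ m ∈ Ioc Y Y', g m)‖ ≤
      rho (k + 1) q * √q * (1 / (q.totient * Real.log (zz r)) * (200 * 2 ^ (2*k) * (X / (1 + Δ) + Δ))) := by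
    rw [norm_mul, norm_mul, Complex.norm_real, Real.norm_eq_abs, abs_of_nonneg (by positivity)]
    gcongr
  have hΔ0 : 0 ≤ Δ := by positivity
  have hEle : E ≤ (C0 + 1) * ((1 / 4) ^ b * (X / (q.totient * Real.log (zz r))) + (zz r : ℝ) ^ (4 * b + 6)) := by
    have h1 : (X : ℝ) / q * VV q r ≤ X / (q.totient * Real.log (zz r)) := by
      calc (X : ℝ) / q * VV q r = X * (VV q r / q) := by ring
        _ ≤ X * (1 / (q.totient * Real.log (zz r))) := by gcongr
        _ = _ := by ring
    have h2 : C0 * (1 / 4) ^ b * ((X : ℝ) / q * VV q r) ≤ C0 * ((1 / 4) ^ b * (X / (q.totient * Real.log (zz r)))) := by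
      rw [mul_assoc]; gcongr
    have h3 : 0 ≤ (1 / 4 : ℝ) ^ b * (X / (q.totient * Real.log (zz r))) := by positivity
    have h4 : 0 ≤ (zz r : ℝ) ^ (4 * b + 6) := by positivity
    rw [hE]; nlinarith
  calc _ ≤ ‖∑ m ∈ Ioc Y Y' with Rough r m, e ((a / q + β) * (m : ℝ) ^ (k + 1))
      - SS (k + 1) q a * ((VV q r / q : ℝ) * ∑ m ∈ Ioc Y Y', g m)‖ + ‖SS (k + 1) q a * ((VV q r / q : ℝ) * ∑ m ∈ Ioc Y Y', g m)‖ := by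
        have := norm_add_le (∑ m ∈ Ioc Y Y' with Rough r m, e ((a / q + β) * (m : ℝ) ^ (k + 1))
      - SS (k + 1) q a * ((VV q r / q : ℝ) * ∑ m ∈ Ioc Y Y', g m)) (SS (k + 1) q a * ((VV q r / q : ℝ) * ∑ m ∈ Ioc Y Y', g m))
        rwa [sub_add_cancel] at this
    _ ≤ q.totient * (E * (7 * (1 + Δ))) + rho (k + 1) q * √q * (1 / (q.totient * Real.log (zz r)) * (200 * 2 ^ (2*k) * (X / (1 + Δ) + Δ))) :=
        add_le_add hmain hmain2
    _ ≤ 7 * (C0 + 1) * (q.totient * (1 + Δ) * ((1 / 4) ^ b * (X / (q.totient * Real.log (zz r))) + (zz r : ℝ) ^ (4 * b + 6)))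
        + 200 * 2 ^ (2*k) * (rho (k + 1) q * √q / (q.totient * Real.log (zz r)) * (X / (1 + Δ) + Δ)) := by
        refine add_le_add ?_ (le_of_eq (by ring))
        calc _ ≤ q.totient * (((C0 + 1) * ((1 / 4) ^ b * (X / (q.totient * Real.log (zz r))) + (zz r : ℝ) ^ (4 * b + 6))) * (7 * (1 + Δ))) := by gcongr
          _ = _ := by ring
    _ ≤ _ := by
        have p1 : 0 ≤ q.totient * (1 + Δ) * ((1 / 4) ^ b * (X / (q.totient * Real.log (zz r))) + (zz r : ℝ) ^ (4 * b + 6)) := by positivity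
        have p2 : 0 ≤ rho (k + 1) q * √q / (q.totient * Real.log (zz r)) * (X / (1 + Δ) + Δ) := by positivity
        have p3 : (0:ℝ) ≤ 200 * 2 ^ (2 * k) := by positivity
        nlinarith [mul_nonneg p3 p1, mul_nonneg hC0.le p2]

end MajArc


namespace MajArc

lemma zz_pow8 (r : ℕ) (hr : 3 ≤ r) : zz (r - 3) ^ 8 = zz r := by
  unfold zz
  rw [← pow_mul]
  congr 1
  obtain ⟨s, rfl⟩ := Nat.exists_eq_add_of_le hr
  simp [pow_add, mul_comm]

set_option maxHeartbeats 1000000 in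
lemma params (k X : ℕ) (D : ℝ) (hX : 2 ≤ X) (hD : 1 ≤ D)
    (hM : (2560000 + 3200 * ((k : ℝ) + 15)) * (1 + Real.log D) ^ 2 ≤ Real.log X) :
    ∃ r b : ℕ, 3 ≤ r ∧ D ^ 2 * (1 / 4) ^ b ≤ 1 ∧ Real.log X ≤ 400 * (1 + Real.log D) * Real.log (zz r) ∧
      2 ^ (k + 5) * D ^ 10 ≤ (zz (r - 3) : ℝ) ∧ 2 * D * Real.log X ≤ (zz r : ℝ) ∧
      (zz r : ℝ) ^ (100 * (b + 1)) ≤ X := by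
  have hXr : (2 : ℝ) ≤ X := by exact_mod_cast hX
  have hX0 : (0 : ℝ) < X := by linarith
  have hlD : 0 ≤ Real.log D := Real.log_nonneg hD
  set lam := 1 + Real.log D with hlam
  have hlam1 : 1 ≤ lam := by linarith
  set ℓ := Real.log X with hℓ
  have hl2 : 0 < Real.log 2 := Real.log_pos (by norm_num)
  have hl2' : Real.log 2 < 1 := by linarith [Real.log_two_lt_d9]
  have hl2'' : 0.69 < Real.log 2 := by linarith [Real.log_two_gt_d9]
  set b := ⌈3 / 2 * Real.log D⌉₊ with hb
  have hb1 : 3 / 2 * Real.log D ≤ b := Nat.le_ceil _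
  have hb2 : (b : ℝ) + 1 ≤ 2 * lam := by
    have := (Nat.ceil_lt_add_one (by positivity : 0 ≤ 3 / 2 * Real.log D)).le
    linarith
  have hlam2 : lam ≤ lam ^ 2 := by nlinarith
  have hk0 : (0:ℝ) ≤ k := by positivity
  have hℓ1 : 2560000 * lam ^ 2 ≤ ℓ := by nlinarith [mul_nonneg hk0 (sq_nonneg lam)]
  set t : ℝ := ℓ / Real.log 2 / (100 * ((b : ℝ) + 1)) with ht
  have hbpos : (0 : ℝ) < (b : ℝ) + 1 := by positivity
  have ht1 : 16 ≤ t := by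
    rw [ht, le_div_iff₀ (by positivity), le_div_iff₀ hl2]
    nlinarith
  set r := Nat.log 2 ⌊t⌋₊ with hr
  have hfl : ⌊t⌋₊ ≠ 0 := by
    have : 1 ≤ ⌊t⌋₊ := Nat.le_floor (by push_cast; linarith)
    omega
  have hr1 : (2 : ℝ) ^ r ≤ t := by
    have : 2 ^ r ≤ ⌊t⌋₊ := Nat.pow_log_le_self 2 hfl
    calc (2 : ℝ) ^ r = ((2 ^ r : ℕ) : ℝ) := by push_cast; rfl
      _ ≤ (⌊t⌋₊ : ℝ) := by exact_mod_cast this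
      _ ≤ t := Nat.floor_le (by linarith)
  have hr2 : t < 2 ^ (r + 1) := by
    have : ⌊t⌋₊ < 2 ^ (r + 1) := Nat.lt_pow_succ_log_self (by norm_num) _
    have h2 : t < ⌊t⌋₊ + 1 := Nat.lt_floor_add_one t
    have h3 : (⌊t⌋₊ : ℝ) + 1 ≤ 2 ^ (r + 1) := by exact_mod_cast this
    linarith
  have hr3 : 3 ≤ r := by
    by_contra hcon
    push Not at hcon
    have : (2 : ℝ) ^ (r + 1) ≤ 2 ^ 4 := pow_le_pow_right₀ (by norm_num) (by omega)
    linarith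
  have hlz := log_zz r
  have hlzp := log_zz_pos r
  have hlogX : ℓ ≤ 400 * lam * Real.log (zz r) := by
    have h1 : ℓ = t * (100 * ((b : ℝ) + 1)) * Real.log 2 := by rw [ht]; field_simp
    rw [h1, hlz]
    calc t * (100 * ((b : ℝ) + 1)) * Real.log 2 ≤ 2 ^ (r + 1) * (100 * (2 * lam)) * Real.log 2 := by gcongr
      _ = _ := by rw [pow_succ]; ring
  have hlz8 : Real.log (zz r) = 8 * Real.log (zz (r - 3)) := by
    rw [← zz_pow8 r hr3]; push_cast; rw [Real.log_pow]; norm_num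
  have hzpos : ∀ u, (0 : ℝ) < zz u := fun u => by
    have := zz_ge u
    exact_mod_cast (by omega)
  refine ⟨r, b, hr3, ?_, hlogX, ?_, ?_, ?_⟩
  · -- D^2 4^{-b} ≤ 1
    have : D ^ 2 ≤ 4 ^ b := by
      rw [← Real.log_le_log_iff (by positivity) (by positivity), Real.log_pow, Real.log_pow,
        show (4 : ℝ) = 2 ^ 2 by norm_num, Real.log_pow]
      push_cast
      nlinarith
    rw [one_div, inv_pow, ← div_eq_mul_inv, div_le_one (by positivity)]
    exact this
  · rw [← Real.log_le_log_iff (by positivity) (hzpos _), Real.log_mul (by positivity) (by positivity), Real.log_pow,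
      Real.log_pow]
    have h1 : ℓ ≤ 3200 * lam * Real.log (zz (r - 3)) := by rw [hlz8] at hlogX; linarith
    have h2 : 3200 * ((k : ℝ) + 15) * lam ^ 2 ≤ 3200 * lam * Real.log (zz (r - 3)) := by nlinarith [sq_nonneg lam]
    have h3 : ((k : ℝ) + 15) * lam ≤ Real.log (zz (r - 3)) := by
      by_contra hcon
      push Not at hcon
      nlinarith
    push_cast
    nlinarith
  · have hℓ0 : 0 < ℓ := by nlinarith
    rw [← Real.log_le_log_iff (by positivity) (hzpos _), Real.log_mul (by positivity) (by positivity),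
      Real.log_mul (by norm_num) (by positivity)]
    set s := √ℓ with hs
    have hs2 : s ^ 2 = ℓ := Real.sq_sqrt hℓ0.le
    have hs0 : 0 < s := Real.sqrt_pos.mpr hℓ0
    have h1 : 1600 * lam ≤ s := by
      apply Real.le_sqrt_of_sq_le; nlinarith
    have h2 : Real.log ℓ ≤ 2 * s := by
      rw [← hs2, Real.log_pow]
      have := Real.log_le_sub_one_of_pos hs0
      push_cast; linarith
    have h3 : 4 * s ≤ Real.log (zz r) := by
      by_contra hcon
      push Not at hcon
      nlinarith
    clear_value s lam ℓ
    have : Real.log D ≤ lam := by rw [hlam]; linarith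
    linarith
  · rw [← Real.log_le_log_iff (by have := hzpos r; positivity) hX0, Real.log_pow, hlz, ← hℓ]
    push_cast
    calc 100 * ((b : ℝ) + 1) * (2 ^ r * Real.log 2) ≤ 100 * ((b : ℝ) + 1) * (t * Real.log 2) := by gcongr
      _ = ℓ := by rw [ht]; field_simp

end MajArc


namespace MajArc

open Classical in
lemma prime_split (k r X Y Y' : ℕ) (α : ℝ) (hX : 4 ≤ X) (hXY : X ≤ 2 * Y) (hY : Y' ≤ X) (hz : zz r ≤ Y) :
    ‖∑ p ∈ Ioc Y Y' with p.Prime, e (α * (p : ℝ) ^ k)‖ ≤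
      ‖∑ m ∈ Ioc Y Y' with Rough r m, e (α * (m : ℝ) ^ k)‖ +
      ‖∑ m ∈ Ioc Y Y' with Rough r m, (Rw r X m : ℂ) * e (α * (m : ℝ) ^ k)‖ + 2 * X / zz r := by
  set g : ℕ → ℂ := fun m => e (α * (m : ℝ) ^ k) with hg
  have h1 : ∑ p ∈ Ioc Y Y' with p.Prime, g p = ∑ m ∈ Ioc Y Y' with Rough r m, (if m.Prime then (1:ℝ) else 0 : ℝ) * g m := by
    rw [sum_filter, sum_filter]
    refine sum_congr rfl fun m hm => ?_
    rw [mem_Ioc] at hm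
    by_cases hp : m.Prime
    · have := prime_rough (r := r) hp (by omega)
      simp [hp, this]
    · simp [hp]
  have h2 : ∑ p ∈ Ioc Y Y' with p.Prime, g p = ∑ m ∈ Ioc Y Y' with Rough r m, g m -
      ∑ m ∈ Ioc Y Y' with Rough r m, (Rw r X m : ℂ) * g m
      + ∑ m ∈ Ioc Y Y' with Rough r m, (((if m.Prime then (1:ℝ) else 0) - (1 - Rw r X m) : ℝ) : ℂ) * g m := by
    rw [h1, ← sum_sub_distrib, ← sum_add_distrib]
    refine sum_congr rfl fun m _ => ?_
    push_cast; ring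
  have h3 : ‖∑ m ∈ Ioc Y Y' with Rough r m, (((if m.Prime then (1:ℝ) else 0) - (1 - Rw r X m) : ℝ) : ℂ) * g m‖
      ≤ 2 * X / zz r := by
    refine le_trans ?_ (sq_count r X Y Y' hY)
    calc _ ≤ ∑ m ∈ Ioc Y Y' with Rough r m, ((#{p ∈ Pall r X | p * p ∣ m} : ℕ) : ℝ) := by
          refine norm_sum_le_of_le _ fun m hm => ?_
          rw [mem_filter, mem_Ioc] at hm
          rw [norm_mul, Complex.norm_real, Real.norm_eq_abs]
          have := ramare r X m hm.2 hX (by omega) (by omega)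
          have h4 : ‖g m‖ = 1 := norm_e _
          rw [h4, mul_one]; exact this
      _ ≤ _ := sum_le_sum_of_subset_of_nonneg (filter_subset _ _) (fun _ _ _ => by positivity)
  rw [h2]
  exact (norm_add_le _ _).trans (add_le_add (norm_sub_le _ _) h3)

lemma lam_le (D : ℝ) (hD : 1 ≤ D) : 1 + Real.log D ≤ 26 * D ^ (1 / 25 : ℝ) := by
  have h1 := Real.log_le_rpow_div (x := D) (by linarith) (ε := 1 / 25) (by norm_num)
  have h2 : 1 ≤ D ^ (1 / 25 : ℝ) := Real.one_le_rpow hD (by norm_num)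
  have : D ^ (1 / 25 : ℝ) / (1 / 25) = 25 * D ^ (1 / 25 : ℝ) := by ring
  linarith

/-- saving from the arithmetic factor -/
lemma arith_D (Ca : ℝ) (k q : ℕ) (Δ : ℝ) (hq : 0 < q) (hΔ : 0 ≤ Δ) (hCa : 1 ≤ Ca)
    (h1 : (rho k q : ℝ) ≤ Ca * (q : ℝ) ^ (1 / 100 : ℝ))
    (h2 : (q : ℝ) ≤ Ca * (q : ℝ) ^ (1 / 100 : ℝ) * q.totient) :
    rho k q * √q / q.totient / √(1 + Δ) ≤ Ca ^ 2 * (q * (1 + Δ)) ^ (-(12 / 25) : ℝ) := by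
  have hqr : (0 : ℝ) < q := by exact_mod_cast hq
  have hq1 : (1 : ℝ) ≤ q := by exact_mod_cast hq
  have hφ : (0 : ℝ) < q.totient := by exact_mod_cast Nat.totient_pos.mpr hq
  have h3 : 1 / (q.totient : ℝ) ≤ Ca * (q : ℝ) ^ (1 / 100 : ℝ) / q := by
    rw [div_le_div_iff₀ hφ hqr]; linarith
  rw [Real.mul_rpow hqr.le (by linarith)]
  have h4 : 1 / √(1 + Δ) ≤ (1 + Δ) ^ (-(12 / 25) : ℝ) := by
    rw [Real.sqrt_eq_rpow, one_div, ← Real.rpow_neg (by linarith)]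
    exact Real.rpow_le_rpow_of_exponent_le (by linarith) (by norm_num)
  have h5 : (q : ℝ) ^ (1 / 100 : ℝ) * √q * ((q : ℝ) ^ (1 / 100 : ℝ) / q) = (q : ℝ) ^ (-(12 / 25) : ℝ) := by
    rw [Real.sqrt_eq_rpow, div_eq_mul_inv _ (q : ℝ), ← Real.rpow_neg_one (q : ℝ), ← Real.rpow_add hqr, ← Real.rpow_add hqr, ← Real.rpow_add hqr]
    norm_num
  calc rho k q * √q / q.totient / √(1 + Δ) = rho k q * √q * (1 / q.totient) * (1 / √(1 + Δ)) := by ring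
    _ ≤ (Ca * (q : ℝ) ^ (1 / 100 : ℝ)) * √q * (Ca * (q : ℝ) ^ (1 / 100 : ℝ) / q) * (1 + Δ) ^ (-(12 / 25) : ℝ) := by
        gcongr
    _ = Ca ^ 2 * ((q : ℝ) ^ (1 / 100 : ℝ) * √q * ((q : ℝ) ^ (1 / 100 : ℝ) / q)) * (1 + Δ) ^ (-(12 / 25) : ℝ) := by ring
    _ = _ := by rw [h5]; ring


lemma hDneg {D : ℝ} (hD1 : 1 ≤ D) (x : ℝ) (hx : x ≤ -(1 / 3)) : D ^ x ≤ D ^ (-(1 / 3) : ℝ) :=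
  Real.rpow_le_rpow_of_exponent_le hD1 hx

lemma num1 (X ℓ lz D Δ Q Ca : ℝ) (hX0 : 0 < X) (hℓ0 : 0 < ℓ) (hzp : 0 < lz) (hD1 : 1 ≤ D) (hΔ0 : 0 ≤ Δ)
    (hilz : 1 / lz ≤ 10400 * D ^ (1 / 25 : ℝ) / ℓ) (hQ0 : 0 ≤ Q) (hΔD : 1 + Δ ≤ D) (hDX : D * D ≤ X)
    (hsav : Q / √(1 + Δ) ≤ Ca ^ 2 * D ^ (-(12 / 25) : ℝ)) :
    Q / lz * (X / (1 + Δ) + Δ) ≤ 2 * Ca ^ 2 * 10400 * (X / ℓ * D ^ (-(1 / 3) : ℝ)) := by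
  have hD0 : 0 < D := by linarith
  have hs1 : √(1 + Δ) ≤ 1 + Δ := by
    rw [Real.sqrt_le_left (by linarith)]; nlinarith
  have hΔX : Δ ≤ X / (1 + Δ) := by
    rw [le_div_iff₀ (by linarith)]
    calc Δ * (1 + Δ) ≤ D * D := by gcongr; linarith
      _ ≤ X := hDX
  have hs0 : 0 < √(1 + Δ) := Real.sqrt_pos.mpr (by linarith)
  calc _ ≤ Q / lz * (X / (1 + Δ) + X / (1 + Δ)) := by gcongr
    _ ≤ Q / lz * (X / √(1 + Δ) + X / √(1 + Δ)) := by gcongr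
    _ = 2 * X * (Q / √(1 + Δ)) * (1 / lz) := by field_simp; ring
    _ ≤ 2 * X * (Ca ^ 2 * D ^ (-(12 / 25) : ℝ)) * (10400 * D ^ (1 / 25 : ℝ) / ℓ) := by gcongr
    _ = 2 * Ca ^ 2 * 10400 * ((X / ℓ) * (D ^ (-(12 / 25) : ℝ) * D ^ (1 / 25 : ℝ))) := by ring
    _ ≤ _ := by
      rw [← Real.rpow_add hD0]
      gcongr
      norm_num

lemma num2 (X ℓ lz D Δ φ c : ℝ) (hX0 : 0 < X) (hℓ0 : 0 < ℓ) (hzp : 0 < lz) (hD1 : 1 ≤ D) (hΔ0 : 0 ≤ Δ)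
    (hilz : 1 / lz ≤ 10400 * D ^ (1 / 25 : ℝ) / ℓ) (hφ : 0 < φ) (hΔD : 1 + Δ ≤ D) (hc0 : 0 ≤ c)
    (hc : D ^ 2 * c ≤ 1) :
    φ * (1 + Δ) * (c * (X / (φ * lz))) ≤ 10400 * (X / ℓ * D ^ (-(1 / 3) : ℝ)) := by
  have hD0 : 0 < D := by linarith
  calc _ = (1 + Δ) * c * X * (1 / lz) := by field_simp
    _ ≤ D * (1 / D ^ 2) * X * (10400 * D ^ (1 / 25 : ℝ) / ℓ) := by
        gcongr
        rw [le_div_iff₀ (by positivity)]; linarith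
    _ = 10400 * ((X / ℓ) * (D ^ (-1 : ℝ) * D ^ (1 / 25 : ℝ))) := by
        rw [Real.rpow_neg_one]; field_simp
    _ ≤ _ := by
      rw [← Real.rpow_add hD0]
      gcongr
      norm_num

lemma num3 (X ℓ lz D Δ J : ℝ) (hX0 : 0 < X) (hℓ0 : 0 < ℓ) (hzp : 0 < lz) (hD1 : 1 ≤ D) (hΔ0 : 0 ≤ Δ)
    (hilz : 1 / lz ≤ 10400 * D ^ (1 / 25 : ℝ) / ℓ) (hΔD : 1 + Δ ≤ D) (hJr : 0 < J) (hJD : D ^ 2 ≤ J) :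
    (X : ℝ) * (1 + Δ) / (J * lz) ≤ 10400 * (X / ℓ * D ^ (-(1 / 3) : ℝ)) := by
  have hD0 : 0 < D := by linarith
  calc _ = X * (1 + Δ) * (1 / J) * (1 / lz) := by field_simp
    _ ≤ X * D * (1 / D ^ 2) * (10400 * D ^ (1 / 25 : ℝ) / ℓ) := by gcongr
    _ = 10400 * ((X / ℓ) * (D ^ (-1 : ℝ) * D ^ (1 / 25 : ℝ))) := by
        rw [Real.rpow_neg_one]; field_simp
    _ ≤ _ := by
      rw [← Real.rpow_add hD0]
      gcongr
      norm_num

lemma num4 (X ℓ lz D Δ ρ q φ Ca NL : ℝ) (hX0 : 0 < X) (hℓ0 : 0 < ℓ) (hzp : 0 < lz) (hD1 : 1 ≤ D) (hΔ0 : 0 ≤ Δ)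
    (hilz : 1 / lz ≤ 10400 * D ^ (1 / 25 : ℝ) / ℓ) (hΔD : 1 + Δ ≤ D) (hρ : 0 ≤ ρ) (hqr : 0 < q) (hφ : 0 < φ)
    (hsav : ρ * √q / φ / √(1 + Δ) ≤ Ca ^ 2 * D ^ (-(12 / 25) : ℝ)) (u1 : NL ≤ 3 * ℓ) :
    NL * √(ρ ^ 2 * X ^ 2 * q / (φ ^ 2 * (1 + 2 * Δ) * lz ^ 4)
      * (2 + Real.log (1 + 2 * Δ))) ≤ 3 * (160000 * 676 * Ca ^ 2 * 9) * (X / ℓ * D ^ (-(1 / 3) : ℝ)) := by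
  have hD0 : 0 < D := by linarith
  have hlamD := lam_le D hD1
  have u2 : 2 + Real.log (1 + 2 * Δ) ≤ 3 * (1 + Real.log D) := by
    have h1 : Real.log (1 + 2 * Δ) ≤ Real.log (2 * D) := Real.log_le_log (by linarith) (by linarith)
    rw [Real.log_mul (by norm_num) hD0.ne'] at h1
    have := Real.log_two_lt_d9
    have := Real.log_nonneg hD1
    linarith
  have hs0 : 0 < √(1 + Δ) := Real.sqrt_pos.mpr (by linarith)
  have hs2 : √(1 + Δ) ^ 2 = 1 + Δ := Real.sq_sqrt (by linarith)
  have hq2 : √(q : ℝ) ^ 2 = q := Real.sq_sqrt hqr.le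
  have hDsq : (D ^ (1 / 50 : ℝ)) ^ 2 = D ^ (1 / 25 : ℝ) := by
    rw [← Real.rpow_natCast, ← Real.rpow_mul hD0.le]; norm_num
  have u3 : √(ρ ^ 2 * X ^ 2 * q / (φ ^ 2 * (1 + 2 * Δ) * lz ^ 4)
    * (2 + Real.log (1 + 2 * Δ))) ≤ X * (ρ * √q / φ / √(1 + Δ)) * (1 / lz) ^ 2 * (9 * D ^ (1 / 50 : ℝ)) := by
    apply Real.sqrt_le_iff.mpr
    refine ⟨by positivity, ?_⟩
    have v1 : 2 + Real.log (1 + 2 * Δ) ≤ 81 * D ^ (1 / 25 : ℝ) := by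
      have : 0 ≤ D ^ (1 / 25 : ℝ) := by positivity
      linarith
    have hlog0 : 0 ≤ 2 + Real.log (1 + 2 * Δ) := by linarith [Real.log_nonneg (by linarith : 1 ≤ 1 + 2 * Δ)]
    calc _ ≤ ρ ^ 2 * X ^ 2 * q / (φ ^ 2 * (1 + Δ) * lz ^ 4)
          * (81 * D ^ (1 / 25 : ℝ)) := by
            gcongr
            linarith
      _ = ρ ^ 2 * X ^ 2 * √q ^ 2 / (φ ^ 2 * √(1 + Δ) ^ 2 * lz ^ 4)
          * (81 * (D ^ (1 / 50 : ℝ)) ^ 2) := by rw [hDsq, hs2, hq2]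
      _ = _ := by
            field_simp
            ring
  calc _ ≤ (3 * ℓ) * (X * (Ca ^ 2 * D ^ (-(12 / 25) : ℝ)) * (10400 * D ^ (1 / 25 : ℝ) / ℓ) ^ 2 * (9 * D ^ (1 / 50 : ℝ))) := by
        refine mul_le_mul u1 (u3.trans ?_) (Real.sqrt_nonneg _) (by positivity)
        gcongr
    _ = 3 * (160000 * 676 * Ca ^ 2 * 9) * ((X / ℓ) * (D ^ (-(12 / 25) : ℝ) * D ^ (1 / 25 : ℝ) * D ^ (1 / 25 : ℝ) * D ^ (1 / 50 : ℝ))) := by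
        field_simp; ring
    _ ≤ _ := by
        rw [← Real.rpow_add hD0, ← Real.rpow_add hD0, ← Real.rpow_add hD0]
        gcongr
        norm_num

set_option maxHeartbeats 1000000 in
lemma A1 (k : ℕ) : ∃ C M : ℝ, 0 < C ∧ 1 ≤ M ∧ ∀ (q X Y Y' : ℕ) (a : ℤ) (β : ℝ), 0 < q →
    IsCoprime a (q : ℤ) → 2 ≤ X → X ≤ 2 * Y → Y ≤ Y' → Y' ≤ X →
    M * (1 + Real.log (q * (1 + |β| * (X : ℝ) ^ (k + 1)))) ^ 2 ≤ Real.log X →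
    ‖∑ p ∈ Ioc Y Y' with p.Prime, e ((a / q + β) * (p : ℝ) ^ (k + 1))‖ ≤
      C * (X / Real.log X) * (q * (1 + |β| * (X : ℝ) ^ (k + 1))) ^ (-(1 / 3) : ℝ) := by
  obtain ⟨Ca, hCa, hab⟩ := arith_bounds (k + 1) (by omega)
  obtain ⟨C1, hC1, hT1⟩ := T1_le k
  obtain ⟨C2, hC2, hT2⟩ := T2_le k
  refine ⟨C1 * (2 * Ca ^ 2 * 10400 + 10400 + 1) + C2 * (10400 + 3 * (160000 * 676 * Ca ^ 2 * 9)) + 1,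
    2560000 + 3200 * ((k : ℝ) + 15), by positivity, by have : (0:ℝ) ≤ k := by positivity
                                                       linarith, ?_⟩
  intro q X Y Y' a β hq ha hX2 hXY hY hY' hM
  classical
  set Δ := |β| * (X : ℝ) ^ (k + 1) with hΔ
  set D := (q : ℝ) * (1 + Δ) with hD
  have hqr : (0 : ℝ) < q := by exact_mod_cast hq
  have hq1 : (1 : ℝ) ≤ q := by exact_mod_cast hq
  have hΔ0 : 0 ≤ Δ := by positivity
  have hD1 : 1 ≤ D := one_le_mul_of_one_le_of_one_le hq1 (by linarith)
  have hD0 : 0 < D := by linarith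
  have hqD : (q : ℝ) ≤ D := le_mul_of_one_le_right hqr.le (by linarith)
  have hΔD : 1 + Δ ≤ D := le_mul_of_one_le_left (by linarith) hq1
  obtain ⟨r, b, hr3, hb, hlog, hzD, hzX, hXz⟩ := params k X D hX2 hD1 hM
  have hXr : (2 : ℝ) ≤ X := by exact_mod_cast hX2
  have hX0 : (0 : ℝ) < X := by linarith
  set lam := 1 + Real.log D with hlam
  have hlam1 : 1 ≤ lam := by linarith [Real.log_nonneg hD1]
  set ℓ := Real.log X with hℓ
  have hℓ0 : 0 < ℓ := Real.log_pos (by linarith)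
  have hzp := log_zz_pos r
  set lz := Real.log (zz r) with hlz
  set z : ℝ := (zz r : ℝ) with hz
  set y : ℝ := (zz (r - 3) : ℝ) with hy
  have hy8 : y ^ 8 = z := by rw [hy, hz, ← zz_pow8 r hr3]; push_cast; rfl
  have h2k : (32 : ℝ) ≤ 2 ^ (k + 5) := by
    rw [pow_add]; have := one_le_pow₀ (n := k) (by norm_num : (1:ℝ) ≤ 2); linarith
  have hDp : D ≤ D ^ 10 := le_self_pow₀ hD1 (by norm_num)
  have hyD : 32 * D ≤ y := by
    refine le_trans ?_ hzD
    exact mul_le_mul h2k hDp hD0.le (by positivity)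
  have hy1 : 32 ≤ y := by linarith
  have hy0 : 0 < y := by linarith
  have hyz : y ≤ z := by rw [← hy8]; exact le_self_pow₀ (by linarith) (by norm_num)
  have hz0 : 0 < z := by linarith
  have hz1 : 1 ≤ z := by linarith
  have hzpow : ∀ j, j ≤ 100 → z ^ j ≤ X := fun j hj =>
    (pow_le_pow_right₀ hz1 (by omega)).trans hXz
  -- natural number versions
  have hzY : zz r ≤ Y := by
    have h1 := hzpow 2 (by norm_num)
    have h2 : (X : ℝ) ≤ 2 * Y := by exact_mod_cast hXY
    have h4 : 2 * z ≤ z ^ 2 := by rw [sq]; gcongr; linarith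
    have h3 : z ≤ (Y : ℝ) := by linarith
    rw [hz] at h3; exact_mod_cast h3
  have hX4 : 4 ≤ X := by
    have h1 := hzpow 2 (by norm_num)
    have h4 : 2 * z ≤ z ^ 2 := by rw [sq]; gcongr; linarith
    have h3 : (4 : ℝ) ≤ X := by linarith
    exact_mod_cast h3
  have hqz : q < zz r := by
    have : (q : ℝ) < z := by linarith
    rw [hz] at this; exact_mod_cast this
  set J := ⌈(2 : ℝ) ^ (k + 2) * D ^ 2⌉₊ with hJ
  have hp2 : (1 : ℝ) ≤ 2 ^ (k + 2) := one_le_pow₀ (by norm_num)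
  have hD2 : 1 ≤ D ^ 2 := one_le_pow₀ hD1
  have hJ1 : (2 : ℝ) ^ (k + 2) * D ^ 2 ≤ J := Nat.le_ceil _
  have hJ2 : (J : ℝ) ≤ 2 * (2 ^ (k + 2) * D ^ 2) := ceil_le_two (one_le_mul_of_one_le_of_one_le hp2 hD2)
  have hJD : D ^ 2 ≤ J := le_trans (le_mul_of_one_le_left (by linarith) hp2) hJ1
  have hJ0 : 0 < J := by
    have : (0 : ℝ) < J := by linarith
    exact_mod_cast this
  have hJr : (0:ℝ) < J := by exact_mod_cast hJ0
  have c1 : (2 : ℝ) ^ (k + 2) * (|β| * (X : ℝ) ^ (k + 1)) ≤ J := by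
    refine le_trans ?_ hJ1
    have : Δ ≤ D ^ 2 := by linarith [le_self_pow₀ hD1 (n := 2) (by norm_num)]
    gcongr
  have c2 : (q * (zz (r - 3)) ^ 7 * J) ^ 2 ≤ X := by
    have h1 : (q : ℝ) * y ^ 7 * J ≤ y ^ 16 := by
      have : (2:ℝ) * (2 ^ (k + 2) * D ^ 2) * D ≤ y := by
        refine le_trans ?_ hzD
        have : D ^ 3 ≤ D ^ 10 := pow_le_pow_right₀ hD1 (by norm_num)
        have e1 : (2:ℝ) ^ (k + 5) = 8 * 2 ^ (k + 2) := by rw [pow_add, pow_add 2 k 2]; ring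
        rw [e1]
        calc 2 * (2 ^ (k + 2) * D ^ 2) * D = 2 * (2 ^ (k + 2) * D ^ 3) := by ring
          _ ≤ 8 * (2 ^ (k + 2) * D ^ 10) := by gcongr; norm_num
          _ = _ := by ring
      calc (q : ℝ) * y ^ 7 * J ≤ D * y ^ 7 * (2 * (2 ^ (k + 2) * D ^ 2)) := by gcongr
        _ = (2 * (2 ^ (k + 2) * D ^ 2) * D) * y ^ 7 := by ring
        _ ≤ y * y ^ 7 := by gcongr
        _ = y ^ 8 := by ring
        _ ≤ y ^ 16 := pow_le_pow_right₀ (by linarith) (by norm_num)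
    have h2 : ((q : ℝ) * y ^ 7 * J) ^ 2 ≤ X := by
      calc _ ≤ (y ^ 16) ^ 2 := by gcongr
        _ = z ^ 4 := by rw [← hy8]; ring
        _ ≤ X := hzpow 4 (by norm_num)
    have h3 : (((q * (zz (r - 3)) ^ 7 * J) ^ 2 : ℕ) : ℝ) ≤ X := by push_cast; exact h2
    exact_mod_cast h3
  have c3 : 2 * (((q * (zz (r - 3)) ^ 7 : ℕ) : ℝ) * (1 + 2 * (|β| * (X : ℝ) ^ (k + 1)))) ≤ (zz r : ℝ) := by
    push_cast
    rw [← hΔ, ← hz, ← hy, ← hy8]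
    have : 2 * (q * (1 + 2 * Δ)) ≤ y := by
      have : q * (1 + 2 * Δ) ≤ 2 * D := by rw [hD]; linarith [mul_nonneg hqr.le hΔ0]
      linarith
    calc 2 * (q * y ^ 7 * (1 + 2 * Δ)) = (2 * (q * (1 + 2 * Δ))) * y ^ 7 := by ring
      _ ≤ y * y ^ 7 := by gcongr
      _ = y ^ 8 := by ring
  have b1 := hT1 r b q X Y Y' a β hq hqz ha (by omega) hXY hY hY'
  have b2 := hT2 r q J X Y Y' a β hr3 hq hqz ha hJ0 hXY hY hY' c1 c2 c3
  have b0 := prime_split (k + 1) r X Y Y' (a / q + β) hX4 hXY hY' hzY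
  rw [← hΔ] at b1 b2
  rw [← hlz, ← hz] at b1
  rw [← hlz] at b2
  rw [← hz] at b0
  refine b0.trans ?_
  -- numerical work
  set T := (X / ℓ) * D ^ (-(1 / 3) : ℝ) with hT
  have hT0 : 0 ≤ T := by positivity
  have hφ : (0 : ℝ) < q.totient := by exact_mod_cast Nat.totient_pos.mpr hq
  have hφq : (q.totient : ℝ) ≤ q := by exact_mod_cast Nat.totient_le q
  have hsav := arith_D Ca (k + 1) q Δ hq hΔ0 hCa (hab q hq).1 (hab q hq).2
  rw [← hD] at hsav
  have hilz : 1 / lz ≤ 400 * lam / ℓ := by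
    rw [div_le_div_iff₀ hzp hℓ0]; linarith
  have hlamD : lam ≤ 26 * D ^ (1 / 25 : ℝ) := lam_le D hD1
  have hilz' : 1 / lz ≤ 10400 * D ^ (1 / 25 : ℝ) / ℓ := by
    refine hilz.trans ?_
    gcongr ?_ / ℓ
    linarith
  -- small term: X / z ≤ T / 2
  have hDinv : 1 / D ≤ D ^ (-(1 / 3) : ℝ) := by
    rw [one_div, ← Real.rpow_neg_one]; exact hDneg hD1 _ (by norm_num)
  have hXz' : X / z ≤ T / 2 := by
    calc (X : ℝ) / z ≤ X / (2 * D * ℓ) := by gcongr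
      _ = (X / ℓ) * (1 / D) / 2 := by field_simp
      _ ≤ _ := by rw [hT]; gcongr
  have hDX : D * D ≤ X := by
    calc D * D ≤ z * z := by gcongr <;> linarith
      _ = z ^ 2 := by ring
      _ ≤ X := hzpow 2 (by norm_num)
  have t1 : rho (k + 1) q * √q / (q.totient * lz) * (X / (1 + Δ) + Δ) ≤ 2 * Ca ^ 2 * 10400 * T := by
    rw [← div_div]
    exact num1 X ℓ lz D Δ _ Ca hX0 hℓ0 hzp hD1 hΔ0 hilz' (by positivity) hΔD hDX hsav
  have t2 : q.totient * (1 + Δ) * ((1 / 4) ^ b * (X / (q.totient * lz)) + z ^ (4 * b + 6)) ≤ (10400 + 1) * T := by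
    have s1 := num2 X ℓ lz D Δ q.totient ((1 / 4) ^ b) hX0 hℓ0 hzp hD1 hΔ0 hilz' hφ hΔD (by positivity) hb
    have s2 : q.totient * (1 + Δ) * z ^ (4 * b + 6) ≤ T := by
      have : z ^ (4 * b + 6) * z ≤ X / z := by
        rw [le_div_iff₀ hz0]
        calc _ = z ^ (4 * b + 8) := by ring
          _ ≤ z ^ (100 * (b + 1)) := pow_le_pow_right₀ hz1 (by omega)
          _ ≤ X := hXz
      calc q.totient * (1 + Δ) * z ^ (4 * b + 6) ≤ D * z ^ (4 * b + 6) := by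
            rw [hD]; gcongr
        _ ≤ z * z ^ (4 * b + 6) := by gcongr; linarith
        _ = z ^ (4 * b + 6) * z := by ring
        _ ≤ T := by linarith
    rw [mul_add]; linarith
  have t3 : (X : ℝ) * (1 + Δ) / (J * lz) ≤ 10400 * T :=
    num3 X ℓ lz D Δ J hX0 hℓ0 hzp hD1 hΔ0 hilz' hΔD hJr hJD
  have u1 : (Nat.log 2 X : ℝ) + 1 ≤ 3 * ℓ := by
    have h1 : ((2 : ℝ) ^ (Nat.log 2 X)) ≤ X := by exact_mod_cast Nat.pow_log_le_self 2 (by omega)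
    have h2 := Real.log_le_log (by positivity) h1
    rw [Real.log_pow] at h2
    have h3 : 1 ≤ ℓ := by
      have : (2560000 : ℝ) * 1 ≤ (2560000 + 3200 * ((k : ℝ) + 15)) * lam ^ 2 := by
        have : (0:ℝ) ≤ k := by positivity
        have : 1 ≤ lam ^ 2 := one_le_pow₀ hlam1
        gcongr; linarith
      linarith
    have h4 := Real.log_two_gt_d9
    have h5 : (0:ℝ) ≤ Nat.log 2 X := by positivity
    have h6 : (Nat.log 2 X : ℝ) * (1 / 2) ≤ Nat.log 2 X * Real.log 2 := by gcongr; linarith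
    linarith
  have t4 := num4 X ℓ lz D Δ (rho (k + 1) q) q q.totient Ca (Nat.log 2 X + 1) hX0 hℓ0 hzp hD1 hΔ0 hilz' hΔD
    (by positivity) hqr hφ hsav u1
  have f1 := b1.trans (mul_le_mul_of_nonneg_left (add_le_add t1 t2) hC1.le)
  have f2 := b2.trans (mul_le_mul_of_nonneg_left (add_le_add t3 t4) hC2.le)
  have f3 : 2 * X / z ≤ T := by rw [mul_div_assoc]; linarith
  rw [mul_assoc, ← hT]
  refine (add_le_add (add_le_add f1 f2) f3).trans (le_of_eq ?_)
  ring

end MajArc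


namespace MajArc

lemma A2 (k : ℕ) : ∃ C M : ℝ, 0 < C ∧ 1 ≤ M ∧ ∀ (q X Y Y' : ℕ) (a : ℤ) (β : ℝ), 0 < q →
    IsCoprime a (q : ℤ) → 2 ≤ X → X ≤ 2 * Y → Y ≤ Y' → Y' ≤ X →
    M * (1 + Real.log (q * (1 + |β| * (X : ℝ) ^ (k + 1)))) ^ 2 ≤ Real.log X →
    ‖∑ p ∈ Ioc Y Y' with p.Prime, e ((a / q + β) * (p : ℝ) ^ (k + 1)) * (Real.log p : ℂ)‖ ≤
      C * X * (q * (1 + |β| * (X : ℝ) ^ (k + 1))) ^ (-(1 / 3) : ℝ) := by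
  obtain ⟨C, M, hC, hM1, h⟩ := A1 k
  refine ⟨2 * C, M, by positivity, hM1, ?_⟩
  intro q X Y Y' a β hq ha hX hXY hY hY' hM
  have hX1 : (1 : ℝ) < X := by exact_mod_cast (by omega : 1 < X)
  have hl : 0 < Real.log X := Real.log_pos hX1
  rw [sum_filter]
  have e1 : ∀ m ∈ Ioc Y Y', (if m.Prime then e ((a / q + β) * (m : ℝ) ^ (k + 1)) * (Real.log m : ℂ) else 0)
      = (if m.Prime then e ((a / q + β) * (m : ℝ) ^ (k + 1)) else 0) * (Real.log m : ℂ) := by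
    intro m _; split_ifs <;> simp
  rw [sum_congr rfl e1]
  have key := abel_ineq Y Y' hY (fun m => if m.Prime then e ((a / q + β) * (m : ℝ) ^ (k + 1)) else 0)
    (fun m => (Real.log m : ℂ)) (C * (X / Real.log X) * (q * (1 + |β| * (X : ℝ) ^ (k + 1))) ^ (-(1 / 3) : ℝ))
    (2 * Real.log X) ?_ ?_
  · refine key.trans (le_of_eq ?_)
    field_simp
  · intro y hy hy'
    rw [← sum_filter]
    exact h q X Y y a β hq ha hX hXY hy (hy'.trans hY') hM
  · have h1 : ∑ m ∈ Ico Y Y', ‖((Real.log (m + 1 : ℕ) : ℝ) : ℂ) - ((Real.log m : ℝ) : ℂ)‖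
        = Real.log Y' - Real.log Y := by
      have : ∀ m ∈ Ico Y Y', ‖((Real.log (m + 1 : ℕ) : ℝ) : ℂ) - ((Real.log m : ℝ) : ℂ)‖
          = Real.log (m + 1 : ℕ) - Real.log m := by
        intro m hm
        rw [mem_Ico] at hm
        rw [← Complex.ofReal_sub, Complex.norm_real, Real.norm_eq_abs, abs_of_nonneg]
        have hm0 : (0 : ℝ) < m := by exact_mod_cast (by omega : 0 < m)
        have := Real.log_le_log hm0 (by push_cast; linarith : (m : ℝ) ≤ ((m + 1 : ℕ) : ℝ))
        linarith
      rw [sum_congr rfl this, Finset.sum_Ico_eq_sub _ hY,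
        Finset.sum_range_sub (fun m : ℕ => Real.log m), Finset.sum_range_sub (fun m : ℕ => Real.log m)]
      ring
    have hY0 : (1 : ℝ) ≤ Y := by exact_mod_cast (by omega : 1 ≤ Y)
    have hYY : (Y : ℝ) ≤ Y' := by exact_mod_cast hY
    have hYX : (Y' : ℝ) ≤ X := by exact_mod_cast hY'
    have h2 := Real.log_nonneg hY0
    have h3 := Real.log_nonneg (hY0.trans hYY)
    have h4 := Real.log_le_log (by linarith) hYX
    rw [h1, Complex.norm_real, Real.norm_eq_abs, abs_of_nonneg h3]
    linarith

lemma evt (M B : ℝ) (hM : 0 < M) (hB : 1 ≤ B) : ∃ N : ℕ, ∀ n : ℕ, N ≤ n → 3 ≤ n ∧ 1 ≤ Real.log n ∧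
    M * (1 + Real.log (Real.log n ^ B * (1 + Real.log n ^ B))) ^ 2 ≤ Real.log n / 12 ∧
    4 * Real.log n ^ (1 + B) ≤ (n : ℝ) ^ (1 / 12 : ℝ) ∧ 2 ≤ (n : ℝ) ^ (1 / 7 - 1 / 12 : ℝ) := by
  have h0 : ∀ᶠ u : ℝ in Filter.atTop, M * (1 + Real.log (u ^ B * (1 + u ^ B))) ^ 2 ≤ u / 12 := by
    have h1 : ∀ᶠ u : ℝ in Filter.atTop, ‖Real.log u ^ 2‖ ≤ (1 / (12 * M * (3 + 2 * B) ^ 2)) * ‖id u‖ :=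
      (Real.isLittleO_pow_log_id_atTop (n := 2)).bound (by positivity)
    filter_upwards [h1, Filter.eventually_ge_atTop (Real.exp 1)] with u hu hu3
    have hu1 : 1 ≤ Real.log u := by
      rw [Real.le_log_iff_exp_le (lt_of_lt_of_le (Real.exp_pos _) hu3)]; exact hu3
    have hu0 : 0 < u := lt_of_lt_of_le (Real.exp_pos _) hu3
    have hu1' : 1 ≤ u := le_trans (by simp) hu3
    simp only [id] at hu
    rw [Real.norm_of_nonneg (by positivity), Real.norm_of_nonneg hu0.le] at hu
    have hB1 : 1 ≤ u ^ B := Real.one_le_rpow hu1' (by linarith)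
    have h2 : Real.log (u ^ B * (1 + u ^ B)) ≤ B * Real.log u + (1 + B * Real.log u) := by
      rw [Real.log_mul (by positivity) (by positivity), Real.log_rpow hu0]
      have : Real.log (1 + u ^ B) ≤ Real.log (2 * u ^ B) := Real.log_le_log (by positivity) (by linarith)
      rw [Real.log_mul (by norm_num) (by positivity), Real.log_rpow hu0] at this
      linarith [Real.log_two_lt_d9]
    have h3 : 0 ≤ Real.log (u ^ B * (1 + u ^ B)) := Real.log_nonneg (one_le_mul_of_one_le_of_one_le hB1 (by linarith))
    have h4 : 1 + Real.log (u ^ B * (1 + u ^ B)) ≤ (3 + 2 * B) * Real.log u := by nlinarith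
    calc _ ≤ M * ((3 + 2 * B) * Real.log u) ^ 2 := by gcongr
      _ = M * (3 + 2 * B) ^ 2 * Real.log u ^ 2 := by ring
      _ ≤ M * (3 + 2 * B) ^ 2 * (1 / (12 * M * (3 + 2 * B) ^ 2) * u) := by gcongr
      _ = u / 12 := by field_simp
  have h1 : ∀ᶠ u : ℝ in Filter.atTop, 4 * u ^ (1 + B) ≤ Real.exp ((1 / 12) * u) := by
    have := (isLittleO_rpow_exp_pos_mul_atTop (1 + B) (by norm_num : (0:ℝ) < 1 / 12)).bound (by norm_num : (0:ℝ) < 1 / 4)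
    filter_upwards [this, Filter.eventually_gt_atTop 0] with u hu hu0
    rw [Real.norm_of_nonneg (by positivity), Real.norm_of_nonneg (by positivity)] at hu
    linarith
  have h2 : ∀ᶠ u : ℝ in Filter.atTop, 2 ≤ Real.exp ((1 / 7 - 1 / 12) * u) := by
    have : Filter.Tendsto (fun u : ℝ => Real.exp ((1 / 7 - 1 / 12) * u)) Filter.atTop Filter.atTop :=
      Real.tendsto_exp_atTop.comp (Filter.tendsto_id.const_mul_atTop (by norm_num))
    exact this.eventually_ge_atTop 2
  have hlim : Filter.Tendsto (fun n : ℕ => Real.log n) Filter.atTop Filter.atTop :=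
    Real.tendsto_log_atTop.comp tendsto_natCast_atTop_atTop
  have hall := (hlim.eventually (h0.and (h1.and (h2.and (Filter.eventually_ge_atTop 1))))).and
    (Filter.eventually_ge_atTop 3)
  obtain ⟨N, hN⟩ := Filter.eventually_atTop.mp hall
  refine ⟨N, fun n hn => ?_⟩
  obtain ⟨⟨a1, a2, a3, a4⟩, a5⟩ := hN n hn
  have hn0 : (0 : ℝ) < n := by exact_mod_cast (by omega : 0 < n)
  refine ⟨a5, a4, a1, ?_, ?_⟩
  · rw [Real.rpow_def_of_pos hn0, mul_comm (Real.log n) (1 / 12)]; exact a2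
  · rw [Real.rpow_def_of_pos hn0, mul_comm (Real.log n)]; exact a3

lemma P_pow (n k : ℕ) (hk : 0 < k) : P n k ^ k = n := by
  unfold P
  rw [← Real.rpow_natCast, ← Real.rpow_mul (by positivity), inv_mul_cancel₀ (by positivity), Real.rpow_one]

lemma P_le (n k : ℕ) (hn : 1 ≤ n) (hk : 0 < k) : P n k ≤ n := by
  unfold P
  have h1 : (1 : ℝ) ≤ n := by exact_mod_cast hn
  have h2 : (1 : ℝ) ≤ k := by exact_mod_cast hk
  calc (n : ℝ) ^ ((k : ℝ))⁻¹ ≤ (n : ℝ) ^ (1 : ℝ) :=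
        Real.rpow_le_rpow_of_exponent_le h1 (inv_le_one_of_one_le₀ h2)
    _ = n := Real.rpow_one _

lemma P_nonneg (n k : ℕ) : 0 ≤ P n k := by unfold P; positivity

lemma P_pos (n k : ℕ) (hn : 1 ≤ n) : 0 < P n k := by
  have h1 : (0 : ℝ) < n := by exact_mod_cast hn
  unfold P; positivity

lemma f_eq (n k : ℕ) (α : ℝ) (hn : 1 ≤ n) (hk : 0 < k) :
    f n k α = ∑ p ∈ Ioc ⌊P n k / 2⌋₊ ⌊P n k⌋₊ with p.Prime, e (α * (p : ℝ) ^ k) * (Real.log p : ℂ) := by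
  unfold f
  congr 1
  ext p
  have hP := P_nonneg n k
  simp only [mem_filter, mem_range, mem_Ioc]
  rw [Nat.floor_lt (by positivity), Nat.le_floor_iff hP]
  constructor
  · rintro ⟨_, h1, h2, h3⟩; exact ⟨⟨h2, h3⟩, h1⟩
  · rintro ⟨⟨h2, h3⟩, h1⟩
    refine ⟨?_, h1, h2, h3⟩
    have : (p : ℝ) ≤ n := h3.trans (P_le n k hn hk)
    have : p ≤ n := by exact_mod_cast this
    omega

/-- Prop A for `f` -/
lemma f_bound (k : ℕ) (hk : 0 < k) (hk7 : k ≤ 7) (B : ℝ) (hB : 1 ≤ B) : ∃ C : ℝ, 0 < C ∧ ∃ N : ℕ, ∀ n : ℕ, N ≤ n →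
    ∀ (q : ℕ) (a : ℤ) (β : ℝ), 0 < q → IsCoprime a (q : ℤ) → (q : ℝ) ≤ Real.log n ^ B → |β| ≤ Real.log n ^ B / n →
    ‖f n k (a / q + β)‖ ≤ C * P n k * (q * (1 + |β| * n)) ^ (-(1 / 3) : ℝ) := by
  obtain ⟨k, rfl⟩ : ∃ j, k = j + 1 := ⟨k - 1, by omega⟩
  obtain ⟨C, M, hC, hM, hA⟩ := A2 k
  obtain ⟨N, hN⟩ := evt M B (by linarith) hB
  refine ⟨C * (2 * (2 ^ (k + 1)) ^ (1 / 3 : ℝ)), by positivity, N, ?_⟩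
  intro n hn q a β hq ha hqL hβ
  obtain ⟨hn3, hL1, hMB, _, h2n⟩ := hN n hn
  have hn0 : (0 : ℝ) < n := by exact_mod_cast (by omega : 0 < n)
  have hn1 : (1 : ℝ) ≤ n := by exact_mod_cast (by omega : 1 ≤ n)
  set L := Real.log n with hL
  have hLB : 1 ≤ L ^ B := Real.one_le_rpow hL1 (by linarith)
  have hq1 : (1 : ℝ) ≤ q := by exact_mod_cast hq
  have hβn : |β| * n ≤ L ^ B := by rwa [le_div_iff₀ hn0] at hβ
  set X := P n (k + 1) with hX
  have hXp : X ^ (k + 1) = n := P_pow n (k + 1) hk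
  have hX0 : 0 < X := P_pos n (k + 1) (by omega)
  -- X ≥ 2 n^{1/12}
  have hXbig : 2 * (n : ℝ) ^ (1 / 12 : ℝ) ≤ X := by
    have : (n : ℝ) ^ (1 / 7 : ℝ) ≤ X := by
      rw [hX]; unfold P
      apply Real.rpow_le_rpow_of_exponent_le hn1
      rw [one_div]
      apply inv_anti₀ (by positivity)
      exact_mod_cast hk7
    calc 2 * (n : ℝ) ^ (1 / 12 : ℝ) ≤ (n : ℝ) ^ (1 / 7 - 1 / 12 : ℝ) * (n : ℝ) ^ (1 / 12 : ℝ) := by gcongr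
      _ = (n : ℝ) ^ (1 / 7 : ℝ) := by rw [← Real.rpow_add hn0]; norm_num
      _ ≤ X := this
  have hn12 : 4 ≤ (n : ℝ) ^ (1 / 12 : ℝ) := by
    obtain ⟨_, _, _, h4, _⟩ := hN n hn
    have : 1 ≤ Real.log n ^ (1 + B) := Real.one_le_rpow hL1 (by linarith)
    linarith
  -- the condition for any natural Z with X/2 ≤ Z ≤ X
  have gen : ∀ Z Y Y' : ℕ, X / 2 ≤ Z → (Z : ℝ) ≤ X → Z ≤ 2 * Y → Y ≤ Y' → Y' ≤ Z →
      ‖∑ p ∈ Ioc Y Y' with p.Prime, e ((a / q + β) * (p : ℝ) ^ (k + 1)) * (Real.log p : ℂ)‖ ≤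
      C * X * ((2 ^ (k + 1)) ^ (1 / 3 : ℝ) * (q * (1 + |β| * n)) ^ (-(1 / 3) : ℝ)) := by
    intro Z Y Y' hZ1 hZ2 hZY hY hY'
    have hZpow : (Z : ℝ) ^ (k + 1) ≤ n := by rw [← hXp]; gcongr
    have hZpow' : (n : ℝ) ≤ 2 ^ (k + 1) * (Z : ℝ) ^ (k + 1) := by
      rw [← hXp, ← mul_pow]; gcongr; linarith
    have hZn : (n : ℝ) ^ (1 / 12 : ℝ) ≤ Z := by linarith
    have hZ2' : 2 ≤ Z := by
      have : (2 : ℝ) ≤ Z := by linarith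
      exact_mod_cast this
    have hD : (q : ℝ) * (1 + |β| * (Z : ℝ) ^ (k + 1)) ≤ L ^ B * (1 + L ^ B) := by
      gcongr
      exact le_trans (by gcongr) hβn
    have hD1 : 1 ≤ (q : ℝ) * (1 + |β| * (Z : ℝ) ^ (k + 1)) :=
      one_le_mul_of_one_le_of_one_le hq1 (by have : 0 ≤ |β| * (Z : ℝ) ^ (k + 1) := by positivity
                                             linarith)
    have hcond : M * (1 + Real.log (q * (1 + |β| * (Z : ℝ) ^ (k + 1)))) ^ 2 ≤ Real.log Z := by
      have h1 : Real.log n / 12 ≤ Real.log Z := by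
        have := Real.log_le_log (by positivity) hZn
        rw [Real.log_rpow hn0] at this
        linarith
      refine le_trans ?_ (hMB.trans h1)
      have h0 := Real.log_nonneg hD1
      have := Real.log_le_log (by linarith) hD
      gcongr
    refine (hA q Z Y Y' a β hq ha hZ2' hZY hY hY' hcond).trans ?_
    have h3 : (q * (1 + |β| * n)) / 2 ^ (k + 1) ≤ q * (1 + |β| * (Z : ℝ) ^ (k + 1)) := by
      rw [div_le_iff₀ (by positivity)]
      have h2k : (1:ℝ) ≤ 2 ^ (k + 1) := one_le_pow₀ (by norm_num)
      calc (q : ℝ) * (1 + |β| * n) ≤ q * (2 ^ (k + 1) + |β| * (2 ^ (k + 1) * (Z : ℝ) ^ (k + 1))) := by gcongr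
        _ = _ := by ring
    have h4 : (q * (1 + |β| * (Z : ℝ) ^ (k + 1))) ^ (-(1 / 3) : ℝ) ≤
        (2 ^ (k + 1)) ^ (1 / 3 : ℝ) * (q * (1 + |β| * n)) ^ (-(1 / 3) : ℝ) := by
      have hpos : 0 < (q * (1 + |β| * n)) / 2 ^ (k + 1) := by positivity
      calc _ ≤ ((q * (1 + |β| * n)) / 2 ^ (k + 1)) ^ (-(1 / 3) : ℝ) :=
            Real.rpow_le_rpow_of_nonpos hpos h3 (by norm_num)
        _ = _ := by
            rw [Real.div_rpow (by positivity) (by positivity), Real.rpow_neg (by positivity : (0:ℝ) ≤ 2 ^ (k + 1))]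
            field_simp
    gcongr
  rw [f_eq n (k + 1) _ (by omega) hk, ← hX]
  set Y := ⌊X / 2⌋₊ with hY
  set Z := ⌊X⌋₊ with hZ
  have hYfl : X / 2 < Y + 1 := Nat.lt_floor_add_one _
  have hYle : (Y : ℝ) ≤ X / 2 := Nat.floor_le (by positivity)
  have hZle : (Z : ℝ) ≤ X := Nat.floor_le (by positivity)
  have hZlt : X < Z + 1 := Nat.lt_floor_add_one _
  have hY1 : 1 ≤ Y := Nat.le_floor (by push_cast; linarith)
  have hYZ : Y + 1 ≤ Z := by
    apply Nat.le_floor; push_cast; linarith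
  have hZY : Z ≤ 2 * (Y + 1) := by
    have : (Z : ℝ) ≤ 2 * (Y + 1) := by linarith
    exact_mod_cast this
  have hsplit : (Ioc Y Z).filter Nat.Prime = (Ioc Y (Y + 1)).filter Nat.Prime ∪ (Ioc (Y + 1) Z).filter Nat.Prime := by
    rw [← filter_union, Ioc_union_Ioc_eq_Ioc (by omega) hYZ]
  have hdisj : Disjoint ((Ioc Y (Y + 1)).filter Nat.Prime) ((Ioc (Y + 1) Z).filter Nat.Prime) := by
    apply disjoint_filter_filter
    rw [Finset.disjoint_left]; intro x; simp only [mem_Ioc]; omega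
  rw [hsplit, sum_union hdisj]
  have g1 := gen (Y + 1) Y (Y + 1) (by push_cast; linarith) (by push_cast; linarith) (by omega) (by omega) le_rfl
  have g2 := gen Z (Y + 1) Z (by linarith) hZle hZY hYZ le_rfl
  refine (norm_add_le _ _).trans ((add_le_add g1 g2).trans (le_of_eq ?_))
  ring

end MajArc

namespace MajArc

lemma X5_lower (n c : ℕ) (hn : 1 ≤ n) : (n : ℝ) ^ (1 / 6 : ℝ) ≤ P n 5 ^ θ c := by
  have h1 : (1 : ℝ) ≤ n := by exact_mod_cast hn
  unfold P
  rw [← Real.rpow_mul (by positivity)]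
  apply Real.rpow_le_rpow_of_exponent_le h1
  unfold θ; split_ifs <;> norm_num

lemma X5_le (n c : ℕ) (hn : 1 ≤ n) : P n 5 ^ θ c ≤ P n 5 := by
  have h1 : (1 : ℝ) ≤ n := by exact_mod_cast hn
  have h2 : 1 ≤ P n 5 := by unfold P; exact Real.one_le_rpow h1 (by positivity)
  calc P n 5 ^ θ c ≤ P n 5 ^ (1 : ℝ) := by
        apply Real.rpow_le_rpow_of_exponent_le h2
        unfold θ; split_ifs <;> norm_num
    _ = _ := Real.rpow_one _

lemma f5_eq (n c : ℕ) (α : ℝ) (hn : 1 ≤ n) :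
    f5 n c α = ∑ p ∈ Ioc 1 ⌊P n 5 ^ θ c⌋₊ with p.Prime, e (α * (p : ℝ) ^ 5) * (Real.log p : ℂ) := by
  unfold f5
  congr 1
  ext p
  have hP : 0 ≤ P n 5 ^ θ c := Real.rpow_nonneg (P_nonneg n 5) _
  simp only [mem_filter, mem_range, mem_Ioc]
  rw [Nat.le_floor_iff hP]
  constructor
  · rintro ⟨_, h1, h2, h3⟩; exact ⟨⟨by exact_mod_cast h2, h3⟩, h1⟩
  · rintro ⟨⟨h2, h3⟩, h1⟩
    refine ⟨?_, h1, by exact_mod_cast h2, h3⟩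
    have : (p : ℝ) ≤ n := h3.trans ((X5_le n c hn).trans (P_le n 5 hn (by norm_num)))
    have : p ≤ n := by exact_mod_cast this
    omega

lemma f5_bound (c : ℕ) (B : ℝ) (hB : 1 ≤ B) : ∃ C : ℝ, 0 < C ∧ ∃ N : ℕ, ∀ n : ℕ, N ≤ n →
    ∀ (q : ℕ) (a : ℤ) (β : ℝ), 0 < q → IsCoprime a (q : ℤ) → (q : ℝ) ≤ Real.log n ^ B → |β| ≤ Real.log n ^ B / n →
    ‖f5 n c (a / q + β)‖ ≤ C * P n 5 ^ θ c * (q : ℝ) ^ (-(1 / 3) : ℝ) := by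
  obtain ⟨C, M, hC, hM, hA⟩ := A2 4
  obtain ⟨N, hN⟩ := evt M B (by linarith) hB
  refine ⟨3 * C + 1, by positivity, N, ?_⟩
  intro n hn q a β hq ha hqL hβ
  obtain ⟨hn3, hL1, hMB, h4n, _⟩ := hN n hn
  have hn0 : (0 : ℝ) < n := by exact_mod_cast (by omega : 0 < n)
  have hn1 : (1 : ℝ) ≤ n := by exact_mod_cast (by omega : 1 ≤ n)
  set L := Real.log n with hL
  have hL0 : 0 < L := by linarith
  have hLB : 1 ≤ L ^ B := Real.one_le_rpow hL1 (by linarith)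
  have hLB1 : 1 ≤ L ^ (1 + B) := Real.one_le_rpow hL1 (by linarith)
  have hq1 : (1 : ℝ) ≤ q := by exact_mod_cast hq
  have hβn : |β| * n ≤ L ^ B := by rwa [le_div_iff₀ hn0] at hβ
  have hXlow := X5_lower n c (by omega)
  have hXle := X5_le n c (by omega)
  have h55 := P_pow n 5 (by norm_num)
  have hX0 : 0 < P n 5 ^ θ c := lt_of_lt_of_le (by positivity) hXlow
  rw [f5_eq n c _ (by omega)]
  set X := P n 5 ^ θ c with hX
  set w12 := (n : ℝ) ^ (1 / 12 : ℝ) with hw12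
  have hw0 : 0 < w12 := by positivity
  have hw4 : 4 ≤ w12 := by linarith
  have hww : w12 * w12 ≤ X := by
    refine le_trans (le_of_eq ?_) hXlow
    rw [hw12, ← Real.rpow_add hn0]; norm_num
  set Z := ⌈w12⌉₊ with hZ
  have hZ1 : w12 ≤ Z := Nat.le_ceil _
  have hZ2 : (Z : ℝ) < w12 + 1 := Nat.ceil_lt_add_one hw0.le
  have hZ4 : 4 ≤ Z := by
    have : (4 : ℝ) ≤ Z := by linarith
    exact_mod_cast this
  set Eq := (q : ℝ) ^ (-(1 / 3) : ℝ) with hEq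
  have hEq0 : 0 < Eq := by positivity
  have hstep : ∀ Y Y' : ℕ, Z < Y' → (Y' : ℝ) ≤ X → Y' ≤ 2 * Y → Y ≤ Y' →
      ‖∑ p ∈ Ioc Y Y' with p.Prime, e ((a / q + β) * (p : ℝ) ^ 5) * (Real.log p : ℂ)‖ ≤ C * Y' * Eq := by
    intro Y Y' h1 h2 h3 h4
    have hY'w : w12 ≤ Y' := hZ1.trans (by exact_mod_cast h1.le)
    have hYp : (Y' : ℝ) ^ (4 + 1) ≤ n := by
      rw [← h55]; gcongr; linarith
    have hD : (q : ℝ) * (1 + |β| * (Y' : ℝ) ^ (4 + 1)) ≤ L ^ B * (1 + L ^ B) := by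
      gcongr
      exact le_trans (by gcongr) hβn
    have hpos : 0 ≤ |β| * (Y' : ℝ) ^ (4 + 1) := by positivity
    have hD1 : 1 ≤ (q : ℝ) * (1 + |β| * (Y' : ℝ) ^ (4 + 1)) :=
      one_le_mul_of_one_le_of_one_le hq1 (by linarith)
    have hcond : M * (1 + Real.log (q * (1 + |β| * (Y' : ℝ) ^ (4 + 1)))) ^ 2 ≤ Real.log Y' := by
      have h1 : Real.log n / 12 ≤ Real.log Y' := by
        have := Real.log_le_log hw0 hY'w
        rw [hw12, Real.log_rpow hn0] at this
        linarith
      refine le_trans ?_ (hMB.trans h1)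
      have h0 := Real.log_nonneg hD1
      have := Real.log_le_log (by linarith) hD
      gcongr
    refine (hA q Y' Y Y' a β hq ha (by omega) h3 h4 le_rfl hcond).trans ?_
    have : (q * (1 + |β| * (Y' : ℝ) ^ (4 + 1))) ^ (-(1 / 3) : ℝ) ≤ Eq := by
      rw [hEq]
      apply Real.rpow_le_rpow_of_nonpos (by positivity) _ (by norm_num)
      exact le_mul_of_one_le_right (by positivity) (by linarith)
    gcongr
  have hsplit : ∀ (U V Y : ℕ), U ≤ V → V ≤ Y →
      ∑ p ∈ Ioc U Y with p.Prime, e ((a / q + β) * (p : ℝ) ^ 5) * (Real.log p : ℂ) =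
      ∑ p ∈ Ioc U V with p.Prime, e ((a / q + β) * (p : ℝ) ^ 5) * (Real.log p : ℂ) +
      ∑ p ∈ Ioc V Y with p.Prime, e ((a / q + β) * (p : ℝ) ^ 5) * (Real.log p : ℂ) := by
    intro U V Y h1 h2
    rw [← Ioc_union_Ioc_eq_Ioc h1 h2, filter_union, sum_union]
    apply disjoint_filter_filter
    rw [Finset.disjoint_left]; intro x; simp only [mem_Ioc]; omega
  have claim : ∀ Y' : ℕ, (Y' : ℝ) ≤ X →
      ‖∑ p ∈ Ioc Z Y' with p.Prime, e ((a / q + β) * (p : ℝ) ^ 5) * (Real.log p : ℂ)‖ ≤ 3 * C * Y' * Eq := by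
    intro Y'
    induction Y' using Nat.strong_induction_on with
    | _ Y' ih =>
      intro hY'X
      by_cases h1 : Z < Y'
      · by_cases h2 : (Y' + 1) / 2 ≤ Z
        · refine (hstep Z Y' h1 hY'X (by omega) h1.le).trans ?_
          gcongr; linarith
        · have hlt : (Y' + 1) / 2 < Y' := by omega
          have hY3 : (((Y' + 1) / 2 : ℕ) : ℝ) ≤ 2 / 3 * Y' := by
            have : 3 * ((Y' + 1) / 2) ≤ 2 * Y' := by omega
            have : (3 : ℝ) * (((Y' + 1) / 2 : ℕ) : ℝ) ≤ 2 * Y' := by exact_mod_cast this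
            linarith
          rw [hsplit Z ((Y' + 1) / 2) Y' (by omega) hlt.le]
          have i1 := ih _ hlt (le_trans (by exact_mod_cast hlt.le) hY'X)
          have i2 := hstep ((Y' + 1) / 2) Y' h1 hY'X (by omega) hlt.le
          refine (norm_add_le _ _).trans ((add_le_add i1 i2).trans ?_)
          calc 3 * C * (((Y' + 1) / 2 : ℕ) : ℝ) * Eq + C * Y' * Eq
              ≤ 3 * C * (2 / 3 * Y') * Eq + C * Y' * Eq := by gcongr
            _ = _ := by ring
      · rw [Ioc_eq_empty (by omega)]
        simp only [filter_empty, sum_empty, norm_zero]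
        positivity
  have hXf : (⌊X⌋₊ : ℝ) ≤ X := Nat.floor_le hX0.le
  have hZX : Z ≤ ⌊X⌋₊ := by
    apply Nat.le_floor
    nlinarith
  rw [hsplit 1 Z ⌊X⌋₊ (by omega) hZX]
  have hsmall : ‖∑ p ∈ Ioc 1 Z with p.Prime, e ((a / q + β) * (p : ℝ) ^ 5) * (Real.log p : ℂ)‖ ≤ X * Eq := by
    have hZn : (Z : ℝ) ≤ n := by
      have h1 : (Z : ℝ) ≤ ⌊X⌋₊ := by exact_mod_cast hZX
      exact h1.trans (hXf.trans (hXle.trans (P_le n 5 (by omega) (by norm_num))))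
    have h1 : ∀ p ∈ (Ioc 1 Z).filter Nat.Prime, ‖e ((a / q + β) * (p : ℝ) ^ 5) * (Real.log p : ℂ)‖ ≤ L := by
      intro p hp
      simp only [mem_filter, mem_Ioc] at hp
      have hp1 : (1 : ℝ) ≤ p := by exact_mod_cast hp.1.1.le
      rw [norm_mul, norm_e, one_mul, Complex.norm_real, Real.norm_of_nonneg (Real.log_nonneg hp1)]
      apply Real.log_le_log (by linarith)
      exact le_trans (by exact_mod_cast hp.1.2) hZn
    refine (norm_sum_le_of_le _ h1).trans ?_
    rw [sum_const, nsmul_eq_mul]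
    have hcard : ((#((Ioc 1 Z).filter Nat.Prime) : ℕ) : ℝ) ≤ Z := by
      have := card_filter_le (Ioc 1 Z) Nat.Prime
      rw [Nat.card_Ioc] at this
      exact_mod_cast (by omega : _ ≤ Z)
    have hE1 : (L ^ B)⁻¹ ≤ Eq := by
      rw [hEq, Real.rpow_neg (by positivity)]
      apply inv_anti₀ (by positivity)
      refine le_trans ?_ hqL
      calc (q : ℝ) ^ (1 / 3 : ℝ) ≤ (q : ℝ) ^ (1 : ℝ) := Real.rpow_le_rpow_of_exponent_le hq1 (by norm_num)
        _ = q := Real.rpow_one _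
    have hLL : L ^ (1 + B) = L * L ^ B := by rw [Real.rpow_add hL0, Real.rpow_one]
    calc _ ≤ (Z : ℝ) * L := by gcongr
      _ ≤ (2 * w12) * L := by gcongr; linarith
      _ = (2 * L ^ (1 + B)) * w12 * (L ^ B)⁻¹ := by rw [hLL]; field_simp
      _ ≤ w12 * w12 * (L ^ B)⁻¹ := by gcongr; linarith
      _ ≤ X * Eq := by gcongr
  refine (norm_add_le _ _).trans ((add_le_add hsmall (claim _ hXf)).trans ?_)
  calc X * Eq + 3 * C * (⌊X⌋₊ : ℝ) * Eq ≤ X * Eq + 3 * C * X * Eq := by gcongr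
    _ = _ := by ring

end MajArc

namespace MajArc

lemma prod_scale (n c : ℕ) (hn : 1 ≤ n) :
    P n 2 ^ 2 * P n 3 ^ 2 * P n 5 ^ θ c * P n 6 * P n c = (n : ℝ) ^ (Θ c + 1) := by
  have hn0 : (0 : ℝ) < n := by exact_mod_cast hn
  unfold P Θ
  rw [← Real.rpow_natCast, ← Real.rpow_natCast, ← Real.rpow_mul hn0.le, ← Real.rpow_mul hn0.le,
    ← Real.rpow_mul hn0.le, ← Real.rpow_add hn0, ← Real.rpow_add hn0, ← Real.rpow_add hn0, ← Real.rpow_add hn0]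
  congr 1
  push_cast
  ring

lemma F_bound (c : ℕ) (hc : c = 6 ∨ c = 7) (B : ℝ) (hB : 1 ≤ B) : ∃ C : ℝ, 0 < C ∧ ∃ N : ℕ, ∀ n : ℕ, N ≤ n →
    ∀ (q : ℕ) (a : ℤ) (β : ℝ), 0 < q → IsCoprime a (q : ℤ) → (q : ℝ) ≤ Real.log n ^ B → |β| ≤ Real.log n ^ B / n →
    ‖F n c (a / q + β)‖ ≤ C * (n : ℝ) ^ (Θ c + 1) * (q : ℝ) ^ (-(7 / 3) : ℝ) * ((1 + |β| * n) ^ 2)⁻¹ := by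
  obtain ⟨C2, h2, N2, H2⟩ := f_bound 2 (by norm_num) (by norm_num) B hB
  obtain ⟨C3, h3, N3, H3⟩ := f_bound 3 (by norm_num) (by norm_num) B hB
  obtain ⟨C6, h6, N6, H6⟩ := f_bound 6 (by norm_num) (by norm_num) B hB
  obtain ⟨Cc, hcc, Nc, Hc⟩ := f_bound c (by omega) (by omega) B hB
  obtain ⟨C5, h5, N5, H5⟩ := f5_bound c B hB
  refine ⟨C2 ^ 2 * C3 ^ 2 * C5 * C6 * Cc, by positivity, N2 + N3 + N5 + N6 + Nc + 1, ?_⟩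
  intro n hn q a β hq ha hqL hβ
  have b2 := H2 n (by omega) q a β hq ha hqL hβ
  have b3 := H3 n (by omega) q a β hq ha hqL hβ
  have b6 := H6 n (by omega) q a β hq ha hqL hβ
  have bc := Hc n (by omega) q a β hq ha hqL hβ
  have b5 := H5 n (by omega) q a β hq ha hqL hβ
  have hq0 : (0 : ℝ) < q := by exact_mod_cast hq
  have hs : (0 : ℝ) < 1 + |β| * n := by positivity
  rw [← prod_scale n c (by omega)]
  have e1 : (q * (1 + |β| * n)) ^ (-(1 / 3) : ℝ) = (q : ℝ) ^ (-(1 / 3) : ℝ) * (1 + |β| * n) ^ (-(1 / 3) : ℝ) :=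
    Real.mul_rpow hq0.le hs.le
  rw [e1] at b2 b3 b6 bc
  set u := (q : ℝ) ^ (-(1 / 3) : ℝ) with hu
  set s := (1 + |β| * n) ^ (-(1 / 3) : ℝ) with hs'
  have eu : (q : ℝ) ^ (-(7 / 3) : ℝ) = u ^ 7 := by
    rw [hu, ← Real.rpow_natCast, ← Real.rpow_mul hq0.le]; norm_num
  have es : ((1 + |β| * n) ^ 2)⁻¹ = s ^ 6 := by
    rw [hs', ← Real.rpow_natCast _ 6, ← Real.rpow_mul hs.le, ← Real.rpow_natCast _ 2, ← Real.rpow_neg hs.le]; norm_num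
  rw [eu, es]
  have hu0 : 0 < u := by positivity
  have hs0 : 0 < s := by positivity
  have p2 := P_nonneg n 2
  have p3 := P_nonneg n 3
  have p6 := P_nonneg n 6
  have pc := P_nonneg n c
  have p5 : 0 ≤ P n 5 ^ θ c := Real.rpow_nonneg (P_nonneg n 5) _
  unfold F
  rw [norm_mul, norm_mul, norm_mul, norm_mul, norm_pow, norm_pow]
  calc _ ≤ (C2 * P n 2 * (u * s)) ^ 2 * (C3 * P n 3 * (u * s)) ^ 2 * (C5 * P n 5 ^ θ c * u) * (C6 * P n 6 * (u * s))
        * (Cc * P n c * (u * s)) := by gcongr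
    _ = _ := by ring

end MajArc

namespace MajArc

noncomputable def II (w : ℝ) : ℂ := ∫ t in (0:ℝ)..1, (Real.sin (Real.pi * t) : ℂ) * Complex.exp (Complex.I * w * t)
noncomputable def JJ (w : ℝ) : ℂ := ∫ t in (0:ℝ)..1, ((Real.pi * Real.cos (Real.pi * t) : ℝ) : ℂ) * Complex.exp (Complex.I * w * t)

lemma II_cont (w : ℝ) : Continuous fun t : ℝ => (Real.sin (Real.pi * t) : ℂ) * Complex.exp (Complex.I * w * t) := by
  fun_prop
lemma JJ_cont (w : ℝ) : Continuous fun t : ℝ => ((Real.pi * Real.cos (Real.pi * t) : ℝ) : ℂ) * Complex.exp (Complex.I * w * t) := by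
  fun_prop

lemma II_ii (z : ℂ) (w : ℝ) : IntervalIntegrable (fun t : ℝ => z * ((Real.sin (Real.pi * t) : ℂ) * Complex.exp (Complex.I * w * t)))
    volume 0 1 := (by fun_prop : Continuous fun t : ℝ => z * ((Real.sin (Real.pi * t) : ℂ) * Complex.exp (Complex.I * w * t))).intervalIntegrable _ _
lemma JJ_ii (z : ℂ) (w : ℝ) : IntervalIntegrable (fun t : ℝ => z * (((Real.pi * Real.cos (Real.pi * t) : ℝ) : ℂ) * Complex.exp (Complex.I * w * t)))
    volume 0 1 := (by fun_prop : Continuous fun t : ℝ => z * (((Real.pi * Real.cos (Real.pi * t) : ℝ) : ℂ) * Complex.exp (Complex.I * w * t))).intervalIntegrable _ _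

lemma hd_exp (w t : ℝ) : HasDerivAt (fun t : ℝ => Complex.exp (Complex.I * w * t)) (Complex.I * w * Complex.exp (Complex.I * w * t)) t := by
  have h := ((hasDerivAt_id (t : ℂ)).const_mul (Complex.I * w)).cexp.comp_ofReal
  simp only [id, mul_one] at h
  exact h.congr_deriv (mul_comm _ _)

lemma hd_sin (t : ℝ) : HasDerivAt (fun t : ℝ => (Real.sin (Real.pi * t) : ℂ)) ((Real.pi * Real.cos (Real.pi * t) : ℝ) : ℂ) t := by
  have h := ((hasDerivAt_id t).const_mul Real.pi).sin.ofReal_comp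
  simp only [id, mul_one] at h
  rw [mul_comm] at h
  exact h

lemma hd_cos (t : ℝ) : HasDerivAt (fun t : ℝ => ((Real.pi * Real.cos (Real.pi * t) : ℝ) : ℂ)) (-(Real.pi : ℂ) ^ 2 * (Real.sin (Real.pi * t) : ℂ)) t := by
  have h := (((hasDerivAt_id t).const_mul Real.pi).cos.const_mul Real.pi).ofReal_comp
  simp only [id, mul_one] at h
  convert h using 1
  push_cast; ring

lemma JJ_eq (w : ℝ) : JJ w = -(Complex.I * w) * II w := by
  have h : ∫ t in (0:ℝ)..1, (((Real.pi * Real.cos (Real.pi * t) : ℝ) : ℂ) * Complex.exp (Complex.I * w * t) +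
      (Complex.I * w) * ((Real.sin (Real.pi * t) : ℂ) * Complex.exp (Complex.I * w * t))) = 0 := by
    rw [intervalIntegral.integral_eq_sub_of_hasDerivAt
      (f := fun t : ℝ => (Real.sin (Real.pi * t) : ℂ) * Complex.exp (Complex.I * w * t))]
    · simp
    · intro t _
      exact ((hd_sin t).mul (hd_exp w t)).congr_deriv (by ring)
    · exact ((JJ_cont w).add (continuous_const.mul (II_cont w))).intervalIntegrable _ _
  rw [intervalIntegral.integral_add ((JJ_cont w).intervalIntegrable _ _)
    (II_ii _ w), intervalIntegral.integral_const_mul] at h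
  unfold JJ II
  linear_combination h

lemma II_eq (w : ℝ) : ((Real.pi : ℂ) ^ 2 - w ^ 2) * II w = Real.pi * (1 + Complex.exp (Complex.I * w)) := by
  have h : ∫ t in (0:ℝ)..1, (-(Real.pi : ℂ) ^ 2 * ((Real.sin (Real.pi * t) : ℂ) * Complex.exp (Complex.I * w * t)) +
      (Complex.I * w) * (((Real.pi * Real.cos (Real.pi * t) : ℝ) : ℂ) * Complex.exp (Complex.I * w * t)))
      = -(Real.pi * (1 + Complex.exp (Complex.I * w))) := by
    rw [intervalIntegral.integral_eq_sub_of_hasDerivAt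
      (f := fun t : ℝ => ((Real.pi * Real.cos (Real.pi * t) : ℝ) : ℂ) * Complex.exp (Complex.I * w * t))]
    · simp; ring
    · intro t _
      exact ((hd_cos t).mul (hd_exp w t)).congr_deriv (by ring)
    · exact ((continuous_const.mul (II_cont w)).add (continuous_const.mul (JJ_cont w))).intervalIntegrable _ _
  rw [intervalIntegral.integral_add (II_ii _ w) (JJ_ii _ w), intervalIntegral.integral_const_mul,
    intervalIntegral.integral_const_mul] at h
  have hJ := JJ_eq w
  unfold JJ II at hJ
  rw [hJ] at h
  unfold II
  have hI := Complex.I_sq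
  linear_combination (-1 : ℂ) * h - (w:ℂ) ^ 2 * (∫ t in (0:ℝ)..1, (Real.sin (Real.pi * t) : ℂ) * Complex.exp (Complex.I * w * t)) * hI

lemma norm_exp_I (w t : ℝ) : ‖Complex.exp (Complex.I * w * t)‖ = 1 := by
  rw [show Complex.I * w * t = ((w * t : ℝ) : ℂ) * Complex.I by push_cast; ring]
  exact Complex.norm_exp_ofReal_mul_I _

lemma II_le (w : ℝ) : ‖II w‖ ≤ 1 := by
  unfold II
  refine (intervalIntegral.norm_integral_le_of_norm_le_const (C := 1) ?_).trans (by simp)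
  intro t _
  rw [norm_mul, norm_exp_I, mul_one, Complex.norm_real, Real.norm_eq_abs]
  exact Real.abs_sin_le_one _

lemma II_tail (w : ℝ) (hw : 100 ≤ |w|) : ‖II w‖ ≤ 7 / w ^ 2 := by
  have h := congrArg norm (II_eq w)
  rw [norm_mul, norm_mul] at h
  have h1 : ‖1 + Complex.exp (Complex.I * w)‖ ≤ 2 := by
    refine (norm_add_le _ _).trans ?_
    have := norm_exp_I w 1
    simp only [Complex.ofReal_one, mul_one] at this
    rw [this]; norm_num
  have h2 : ‖(Real.pi : ℂ) ^ 2 - (w:ℂ) ^ 2‖ = w ^ 2 - Real.pi ^ 2 := by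
    rw [← Complex.ofReal_pow, ← Complex.ofReal_pow, ← Complex.ofReal_sub, Complex.norm_real, Real.norm_eq_abs, abs_sub_comm, abs_of_nonneg]
    have := Real.pi_lt_four
    have := Real.pi_pos
    nlinarith [sq_abs w]
  rw [h2, Complex.norm_real, Real.norm_of_nonneg Real.pi_pos.le] at h
  have hw2 : 10000 ≤ w ^ 2 := by nlinarith [sq_abs w]
  rw [le_div_iff₀ (by linarith)]
  have hp := Real.pi_lt_d2
  have hp0 := Real.pi_pos
  have hI := norm_nonneg (II w)
  have hp2 : Real.pi ^ 2 ≤ 10 := by nlinarith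
  have h3 : (w ^ 2 - Real.pi ^ 2) * ‖II w‖ ≤ 6.3 := by rw [h]; nlinarith
  have h4 : w ^ 2 * (999/1000) ≤ w ^ 2 - Real.pi ^ 2 := by linarith
  nlinarith [mul_le_mul_of_nonneg_right h4 hI]

lemma II_low (w : ℝ) (hw : |w| ≤ 1 / 2) : 1 / 4 ≤ ‖II w‖ := by
  have hint : ∫ t in (0:ℝ)..1, Real.sin (Real.pi * t) = 2 / Real.pi := by
    rw [intervalIntegral.integral_comp_mul_left (fun x => Real.sin x) Real.pi_ne_zero]
    simp; norm_num; ring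
  have h0 : II w = ((2 / Real.pi : ℝ) : ℂ) + ∫ t in (0:ℝ)..1, (Real.sin (Real.pi * t) : ℂ) * (Complex.exp (Complex.I * w * t) - 1) := by
    rw [← hint, ← intervalIntegral.integral_ofReal, ← intervalIntegral.integral_add]
    · unfold II; congr 1; ext t; ring
    · exact (by fun_prop : Continuous fun t : ℝ => (Real.sin (Real.pi * t) : ℂ)).intervalIntegrable _ _
    · exact (by fun_prop : Continuous fun t : ℝ => (Real.sin (Real.pi * t) : ℂ) * (Complex.exp (Complex.I * w * t) - 1)).intervalIntegrable _ _
  have h1 : ‖∫ t in (0:ℝ)..1, (Real.sin (Real.pi * t) : ℂ) * (Complex.exp (Complex.I * w * t) - 1)‖ ≤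
      ∫ t in (0:ℝ)..1, Real.sin (Real.pi * t) * (1 / 2) := by
    apply intervalIntegral.norm_integral_le_of_norm_le (by norm_num)
    · filter_upwards with t ht
      have hs : 0 ≤ Real.sin (Real.pi * t) := Real.sin_nonneg_of_nonneg_of_le_pi
        (mul_nonneg Real.pi_pos.le ht.1.le) (mul_le_of_le_one_right Real.pi_pos.le ht.2)
      rw [norm_mul, Complex.norm_real, Real.norm_of_nonneg hs]
      have h2 : ‖Complex.exp (Complex.I * w * t) - 1‖ ≤ 1 / 2 := by
        rw [show Complex.I * w * t = Complex.I * ((w * t : ℝ) : ℂ) by push_cast; ring]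
        refine (Real.norm_exp_I_mul_ofReal_sub_one_le).trans ?_
        rw [Real.norm_eq_abs, abs_mul, abs_of_pos ht.1]
        calc |w| * t ≤ |w| * 1 := by gcongr; exact ht.2
          _ ≤ 1 / 2 := by linarith
      gcongr
    · exact (by fun_prop : Continuous fun t : ℝ => Real.sin (Real.pi * t) * (1 / 2)).intervalIntegrable _ _
  rw [intervalIntegral.integral_mul_const, hint] at h1
  have hpi : 1 / 4 ≤ 1 / Real.pi := by
    apply one_div_le_one_div_of_le Real.pi_pos Real.pi_lt_four.le
  have h2 : ‖((2 / Real.pi : ℝ) : ℂ)‖ = 2 / Real.pi := by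
    rw [Complex.norm_real, Real.norm_of_nonneg (by positivity)]
  have h3 := norm_sub_le (II w) (∫ t in (0:ℝ)..1, (Real.sin (Real.pi * t) : ℂ) * (Complex.exp (Complex.I * w * t) - 1))
  have h4 : II w - (∫ t in (0:ℝ)..1, (Real.sin (Real.pi * t) : ℂ) * (Complex.exp (Complex.I * w * t) - 1)) = ((2 / Real.pi : ℝ) : ℂ) := by
    rw [h0]; ring
  rw [h4, h2] at h3
  have : 2 / Real.pi = 2 * (1 / Real.pi) := by ring
  linarith

/-- band-limited minorant of the indicator of `[-100,100]` -/
noncomputable def gg (w : ℝ) : ℝ := (1 - w ^ 2 / 10000) * ‖II w‖ ^ 2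

lemma gg_le (w : ℝ) (hw : |w| ≤ 100) : gg w ≤ 1 := by
  unfold gg
  have h1 := II_le w
  have h0 := norm_nonneg (II w)
  have h2 : w ^ 2 ≤ 10000 := by nlinarith [sq_abs w, abs_nonneg w]
  have h3 : ‖II w‖ ^ 2 ≤ 1 := by nlinarith
  have h4 : 0 ≤ ‖II w‖ ^ 2 := by positivity
  nlinarith [sq_nonneg w]

lemma gg_nonpos (w : ℝ) (hw : 100 ≤ |w|) : gg w ≤ 0 := by
  unfold gg
  have h2 : 10000 ≤ w ^ 2 := by nlinarith [sq_abs w, abs_nonneg w]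
  have h4 : 0 ≤ ‖II w‖ ^ 2 := by positivity
  nlinarith

lemma gg_ge (w : ℝ) : -(1 / 200) * (1 + w ^ 2)⁻¹ ≤ gg w := by
  unfold gg
  rcases le_total (|w|) 100 with hw | hw
  · have h2 : w ^ 2 ≤ 10000 := by nlinarith [sq_abs w, abs_nonneg w]
    have h4 : 0 ≤ ‖II w‖ ^ 2 := by positivity
    have h5 : 0 ≤ (1 + w ^ 2)⁻¹ := by positivity
    have h6 : 0 ≤ (1 - w ^ 2 / 10000) * ‖II w‖ ^ 2 := mul_nonneg (by linarith) h4
    linarith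
  · have h1 := II_tail w hw
    have h2 : 10000 ≤ w ^ 2 := by nlinarith [sq_abs w, abs_nonneg w]
    have h3 : ‖II w‖ ^ 2 ≤ (7 / w ^ 2) ^ 2 := by gcongr
    set s := w ^ 2 with hs
    have h4 : 0 ≤ ‖II w‖ ^ 2 := by positivity
    have h5 : (1 - s / 10000) * (7 / s) ^ 2 ≤ (1 - s / 10000) * ‖II w‖ ^ 2 :=
      mul_le_mul_of_nonpos_left h3 (by linarith)
    refine le_trans ?_ h5
    have hs0 : 0 < s := by linarith
    have h6 : -(49 / 10000) * s⁻¹ ≤ (1 - s / 10000) * (7 / s) ^ 2 := by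
      have : (1 - s / 10000) * (7 / s) ^ 2 = -(49 / 10000) * s⁻¹ + 49 / s ^ 2 := by field_simp; ring
      rw [this]
      have : 0 ≤ 49 / s ^ 2 := by positivity
      linarith
    refine le_trans ?_ h6
    have h7 : (49 / 10000) * s⁻¹ ≤ (1 / 200) * (1 + s)⁻¹ := by
      rw [← div_eq_mul_inv, ← div_eq_mul_inv, div_le_div_iff₀ hs0 (by linarith)]
      linarith
    linarith

lemma gg_low (w : ℝ) (hw : |w| ≤ 1 / 2) : 1 / 17 ≤ gg w := by
  unfold gg
  have h1 := II_low w hw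
  have h2 : w ^ 2 ≤ 1 / 4 := by nlinarith [sq_abs w, abs_nonneg w]
  have h3 : 1 / 16 ≤ ‖II w‖ ^ 2 := by nlinarith
  nlinarith

end MajArc

namespace MajArc

noncomputable def mu1 : Measure ℝ := volume.restrict (Set.Ioc 0 1)
instance : IsFiniteMeasure mu1 := by unfold mu1; infer_instance

noncomputable def mu2 : Measure (ℝ × ℝ) := mu1.prod mu1
instance : IsFiniteMeasure mu2 := by unfold mu2; infer_instance

noncomputable def kk (p : ℝ × ℝ) : ℝ :=
  Real.sin (Real.pi * p.1) * Real.sin (Real.pi * p.2) -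
    (Real.pi * Real.cos (Real.pi * p.1)) * (Real.pi * Real.cos (Real.pi * p.2)) / 10000

lemma kk_cont : Continuous kk := by unfold kk; fun_prop

lemma kk_le (p : ℝ × ℝ) : |kk p| ≤ 2 := by
  unfold kk
  have h1 := Real.abs_sin_le_one (Real.pi * p.1)
  have h2 := Real.abs_sin_le_one (Real.pi * p.2)
  have h3 := Real.abs_cos_le_one (Real.pi * p.1)
  have h4 := Real.abs_cos_le_one (Real.pi * p.2)
  have e1 : |Real.sin (Real.pi * p.1) * Real.sin (Real.pi * p.2)| ≤ 1 := by
    rw [abs_mul]; exact mul_le_one₀ h1 (abs_nonneg _) h2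
  have e2 : |Real.cos (Real.pi * p.1) * Real.cos (Real.pi * p.2)| ≤ 1 := by
    rw [abs_mul]; exact mul_le_one₀ h3 (abs_nonneg _) h4
  have e3 : |(Real.pi * Real.cos (Real.pi * p.1)) * (Real.pi * Real.cos (Real.pi * p.2)) / 10000| ≤ 1 := by
    rw [show (Real.pi * Real.cos (Real.pi * p.1)) * (Real.pi * Real.cos (Real.pi * p.2)) / 10000
      = (Real.pi ^ 2 / 10000) * (Real.cos (Real.pi * p.1) * Real.cos (Real.pi * p.2)) by ring, abs_mul,
      abs_of_nonneg (by positivity)]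
    have : Real.pi ^ 2 ≤ 16 := by nlinarith [Real.pi_pos, Real.pi_lt_four]
    exact mul_le_one₀ (by linarith) (abs_nonneg _) e2
  refine (abs_sub _ _).trans ?_
  linarith

lemma II_neg (w : ℝ) : II (-w) = (starRingEnd ℂ) (II w) := by
  unfold II
  rw [intervalIntegral.integral_of_le zero_le_one, intervalIntegral.integral_of_le zero_le_one, ← integral_conj]
  congr 1; ext t
  rw [map_mul, Complex.conj_ofReal, ← Complex.exp_conj]
  congr 2
  simp

lemma JJ_neg (w : ℝ) : JJ (-w) = (starRingEnd ℂ) (JJ w) := by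
  unfold JJ
  rw [intervalIntegral.integral_of_le zero_le_one, intervalIntegral.integral_of_le zero_le_one, ← integral_conj]
  congr 1; ext t
  rw [map_mul, Complex.conj_ofReal, ← Complex.exp_conj]
  congr 2
  simp

lemma gg_eq (w : ℝ) : (gg w : ℂ) = II w * II (-w) - JJ w * JJ (-w) / 10000 := by
  rw [II_neg, JJ_neg, Complex.mul_conj, Complex.mul_conj, JJ_eq, map_mul, Complex.normSq_eq_norm_sq (II w)]
  unfold gg
  have : Complex.normSq (-(Complex.I * (w:ℂ))) = w ^ 2 := by
    rw [Complex.normSq_neg, Complex.normSq_mul, Complex.normSq_I, Complex.normSq_ofReal]; ring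
  rw [this]
  push_cast; ring

lemma int_of_cont (F : ℝ × ℝ → ℂ) (hF : Continuous F) : Integrable F mu2 := by
  unfold mu2 mu1
  rw [Measure.prod_restrict]
  have : IntegrableOn F (Set.Icc 0 1 ×ˢ Set.Icc 0 1) (volume.prod volume) := by
    rw [← Measure.volume_eq_prod]
    exact hF.continuousOn.integrableOn_compact (isCompact_Icc.prod isCompact_Icc)
  exact this.mono_set (Set.prod_mono Set.Ioc_subset_Icc_self Set.Ioc_subset_Icc_self)

lemma gg_rep (w : ℝ) : (gg w : ℂ) = ∫ p, (kk p : ℂ) * Complex.exp (Complex.I * w * (p.1 - p.2 : ℝ)) ∂mu2 := by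
  rw [gg_eq]
  have e1 : ∫ p, ((Real.sin (Real.pi * p.1) : ℂ) * Complex.exp (Complex.I * w * p.1)) *
      ((Real.sin (Real.pi * p.2) : ℂ) * Complex.exp (Complex.I * (-w : ℝ) * p.2)) ∂mu2 = II w * II (-w) := by
    unfold mu2
    rw [integral_prod_mul (fun t : ℝ => (Real.sin (Real.pi * t) : ℂ) * Complex.exp (Complex.I * w * t))
      (fun t : ℝ => (Real.sin (Real.pi * t) : ℂ) * Complex.exp (Complex.I * (-w : ℝ) * t))]
    unfold II mu1
    rw [intervalIntegral.integral_of_le zero_le_one, intervalIntegral.integral_of_le zero_le_one]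
  have e2 : ∫ p, ((((Real.pi * Real.cos (Real.pi * p.1) : ℝ) : ℂ) * Complex.exp (Complex.I * w * p.1)) *
      (((Real.pi * Real.cos (Real.pi * p.2) : ℝ) : ℂ) * Complex.exp (Complex.I * (-w : ℝ) * p.2))) ∂mu2 = JJ w * JJ (-w) := by
    unfold mu2
    rw [integral_prod_mul (fun t : ℝ => ((Real.pi * Real.cos (Real.pi * t) : ℝ) : ℂ) * Complex.exp (Complex.I * w * t))
      (fun t : ℝ => ((Real.pi * Real.cos (Real.pi * t) : ℝ) : ℂ) * Complex.exp (Complex.I * (-w : ℝ) * t))]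
    unfold JJ mu1
    rw [intervalIntegral.integral_of_le zero_le_one, intervalIntegral.integral_of_le zero_le_one]
  rw [← e1, ← e2, ← integral_div, ← integral_sub (int_of_cont _ (by fun_prop)) (int_of_cont _ (by fun_prop))]
  congr 1; ext p
  have : Complex.exp (Complex.I * w * (p.1 - p.2 : ℝ)) = Complex.exp (Complex.I * w * p.1) * Complex.exp (Complex.I * (-w : ℝ) * p.2) := by
    rw [← Complex.exp_add]; congr 1; push_cast; ring
  rw [this]
  unfold kk
  push_cast
  ring

lemma gg_cont : Continuous gg := by
  have : Continuous II := by
    unfold II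
    apply intervalIntegral.continuous_parametric_intervalIntegral_of_continuous'
    fun_prop
  unfold gg
  fun_prop

lemma gg_abs (w : ℝ) : |gg w| ≤ 1 := by
  rcases le_total (|w|) 100 with hw | hw
  · rw [abs_le]
    refine ⟨?_, gg_le w hw⟩
    have h1 := gg_ge w
    have h2 : (1 + w ^ 2)⁻¹ ≤ 1 := inv_le_one_of_one_le₀ (by nlinarith)
    linarith
  · rw [abs_le]
    have h0 := gg_nonpos w hw
    have h1 := gg_ge w
    have h2 : (1 + w ^ 2)⁻¹ ≤ 1 := inv_le_one_of_one_le₀ (by nlinarith)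
    constructor <;> linarith

/-- main term integral -/
noncomputable def EE (l ℓ η : ℝ) : ℝ := ∫ v in Set.Ioi (0:ℝ), Real.exp (-(η * v)) * gg (l * (v - ℓ))

lemma EE_low (l ℓ η : ℝ) (hl : 0 < l) (hη : 0 < η) (h1 : 1 / (2 * l) < ℓ) (h2 : η * (ℓ + 1 / (2 * l)) ≤ Real.log 2) :
    1 / (100 * l) ≤ EE l ℓ η := by
  have hexp : IntegrableOn (fun v : ℝ => Real.exp (-(η * v))) (Set.Ioi 0) := by
    have := exp_neg_integrableOn_Ioi 0 hη
    simpa using this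
  have hi : IntegrableOn (fun v => Real.exp (-(η * v)) * gg (l * (v - ℓ))) (Set.Ioi 0) := by
    apply Integrable.mono' hexp
    · exact (by have := gg_cont; fun_prop : Continuous fun v => Real.exp (-(η * v)) * gg (l * (v - ℓ))).aestronglyMeasurable
    · filter_upwards with v
      rw [norm_mul, Real.norm_of_nonneg (Real.exp_pos _).le]
      exact mul_le_of_le_one_right (Real.exp_pos _).le (gg_abs _)
  have hcau : Integrable (fun v : ℝ => (1 + (l * (v - ℓ)) ^ 2)⁻¹) := by
    have h := (integrable_inv_one_add_sq.comp_mul_left' hl.ne').comp_sub_right ℓ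
    exact h
  have hcauI : ∫ v : ℝ, (1 + (l * (v - ℓ)) ^ 2)⁻¹ = l⁻¹ * Real.pi := by
    rw [integral_sub_right_eq_self (fun v : ℝ => (1 + (l * v) ^ 2)⁻¹) ℓ,
      Measure.integral_comp_mul_left (fun v : ℝ => (1 + v ^ 2)⁻¹) l, integral_univ_inv_one_add_sq, abs_of_pos (by positivity), smul_eq_mul]
  set S : Set ℝ := Set.Icc (ℓ - 1 / (2 * l)) (ℓ + 1 / (2 * l)) with hS
  have hSsub : S ⊆ Set.Ioi 0 := by
    intro v hv; rw [hS, Set.mem_Icc] at hv; rw [Set.mem_Ioi]; linarith [hv.1]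
  have hSI : Integrable (S.indicator fun _ => (1 / 34 : ℝ)) := by
    rw [integrable_indicator_iff measurableSet_Icc]
    exact integrableOn_const (by rw [Real.volume_Icc]; exact ENNReal.ofReal_ne_top)
  have hpw : ∀ v ∈ Set.Ioi (0:ℝ), S.indicator (fun _ => (1 / 34 : ℝ)) v - (1 / 200) * (1 + (l * (v - ℓ)) ^ 2)⁻¹ ≤
      Real.exp (-(η * v)) * gg (l * (v - ℓ)) := by
    intro v hv
    rw [Set.mem_Ioi] at hv
    have hc0 : 0 ≤ (1 + (l * (v - ℓ)) ^ 2)⁻¹ := by positivity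
    by_cases hvS : v ∈ S
    · rw [Set.indicator_of_mem hvS]
      rw [hS, Set.mem_Icc] at hvS
      have hw : |l * (v - ℓ)| ≤ 1 / 2 := by
        rw [abs_mul, abs_of_pos hl]
        have : |v - ℓ| ≤ 1 / (2 * l) := by rw [abs_le]; constructor <;> linarith [hvS.1, hvS.2]
        calc l * |v - ℓ| ≤ l * (1 / (2 * l)) := by gcongr
          _ = 1 / 2 := by field_simp
      have hg := gg_low _ hw
      have he : 1 / 2 ≤ Real.exp (-(η * v)) := by
        have : η * v ≤ Real.log 2 := le_trans (by gcongr; exact hvS.2) h2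
        calc (1:ℝ) / 2 = Real.exp (-Real.log 2) := by rw [Real.exp_neg, Real.exp_log (by norm_num)]; norm_num
          _ ≤ _ := Real.exp_le_exp.mpr (by linarith)
      have : (1:ℝ) / 2 * (1 / 17) ≤ Real.exp (-(η * v)) * gg (l * (v - ℓ)) := by gcongr
      linarith
    · rw [Set.indicator_of_notMem hvS]
      have hg := gg_ge (l * (v - ℓ))
      have he1 : Real.exp (-(η * v)) ≤ 1 := Real.exp_le_one_iff.mpr (by nlinarith)
      have he0 := Real.exp_pos (-(η * v))
      have := mul_le_mul_of_nonneg_left hg he0.le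
      nlinarith
  have hmono : ∫ v in Set.Ioi (0:ℝ), (S.indicator (fun _ => (1 / 34 : ℝ)) v - (1 / 200) * (1 + (l * (v - ℓ)) ^ 2)⁻¹) ≤ EE l ℓ η :=
    setIntegral_mono_on (hSI.sub (hcau.const_mul _)).integrableOn hi measurableSet_Ioi hpw
  refine le_trans ?_ hmono
  rw [integral_sub hSI.integrableOn (hcau.const_mul _).integrableOn]
  have c1 : ∫ v in Set.Ioi (0:ℝ), S.indicator (fun _ => (1 / 34 : ℝ)) v = 1 / 34 * l⁻¹ := by
    rw [setIntegral_indicator measurableSet_Icc, Set.inter_eq_right.mpr hSsub, setIntegral_const, hS, Measure.real, Real.volume_Icc,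
      ENNReal.toReal_ofReal (by have : 0 < 1 / (2 * l) := by positivity
                                linarith), smul_eq_mul]
    field_simp; ring
  have c2 : ∫ v in Set.Ioi (0:ℝ), (1 / 200 : ℝ) * (1 + (l * (v - ℓ)) ^ 2)⁻¹ ≤ 1 / 200 * (l⁻¹ * Real.pi) := by
    rw [← hcauI, ← integral_const_mul]
    exact setIntegral_le_integral (hcau.const_mul _) (by filter_upwards with v; positivity)
  rw [c1]
  have hl0 : 0 < l⁻¹ := by positivity
  have hpi := Real.pi_lt_d2
  have : 1 / (100 * l) = 1 / 100 * l⁻¹ := by field_simp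
  rw [this]
  nlinarith

lemma EE_rep (l ℓ η : ℝ) (hη : 0 < η) :
    (EE l ℓ η : ℂ) = ∫ p, (kk p : ℂ) * Complex.exp (-(Complex.I * l * (p.1 - p.2 : ℝ) * ℓ)) * (1 / ((η : ℂ) - Complex.I * l * (p.1 - p.2 : ℝ))) ∂mu2 := by
  unfold EE
  rw [← integral_complex_ofReal]
  have hexp : IntegrableOn (fun v : ℝ => Real.exp (-(η * v))) (Set.Ioi 0) := by
    have := exp_neg_integrableOn_Ioi 0 hη
    simpa using this
  have h1 : ∀ v : ℝ, (((Real.exp (-(η * v)) * gg (l * (v - ℓ)) : ℝ)) : ℂ) =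
      ∫ p, (Real.exp (-(η * v)) : ℂ) * ((kk p : ℂ) * Complex.exp (Complex.I * (l * (v - ℓ) : ℝ) * (p.1 - p.2 : ℝ))) ∂mu2 := by
    intro v
    rw [integral_const_mul, ← gg_rep]; push_cast; ring
  have h1' : ∫ v in Set.Ioi (0:ℝ), (((Real.exp (-(η * v)) * gg (l * (v - ℓ)) : ℝ)) : ℂ) =
      ∫ v in Set.Ioi (0:ℝ), ∫ p, (Real.exp (-(η * v)) : ℂ) * ((kk p : ℂ) * Complex.exp (Complex.I * (l * (v - ℓ) : ℝ) * (p.1 - p.2 : ℝ))) ∂mu2 := by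
    congr 1; ext v; exact h1 v
  refine Eq.trans h1' ?_
  rw [integral_integral_swap]
  · congr 1; ext p
    have : ∀ v : ℝ, (Real.exp (-(η * v)) : ℂ) * ((kk p : ℂ) * Complex.exp (Complex.I * (l * (v - ℓ) : ℝ) * (p.1 - p.2 : ℝ))) =
        (kk p : ℂ) * Complex.exp (-(Complex.I * l * (p.1 - p.2 : ℝ) * ℓ)) *
          Complex.exp ((-(η : ℂ) + Complex.I * l * (p.1 - p.2 : ℝ)) * v) := by
      intro v
      rw [Complex.ofReal_exp, mul_left_comm, ← Complex.exp_add, mul_assoc (kk p : ℂ), ← Complex.exp_add]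
      congr 2; push_cast; ring
    simp_rw [this]
    rw [integral_const_mul, integral_exp_mul_complex_Ioi (by simp [hη])]
    congr 1
    simp only [Complex.ofReal_zero, mul_zero, Complex.exp_zero]
    rw [neg_div, ← one_div_neg_eq_neg_one_div]
    congr 1; ring
  · have hbd : Integrable (fun z : ℝ × (ℝ × ℝ) => Real.exp (-(η * z.1)) * (2 : ℝ)) ((volume.restrict (Set.Ioi 0)).prod mu2) :=
      Integrable.mul_prod (f := fun v : ℝ => Real.exp (-(η * v))) (g := fun _ : ℝ × ℝ => (2:ℝ)) hexp (integrable_const _)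
    refine hbd.mono' ?_ ?_
    · apply Continuous.aestronglyMeasurable
      have := kk_cont
      unfold Function.uncurry
      fun_prop
    · filter_upwards with z
      simp only [Function.uncurry]
      rw [norm_mul, norm_mul, norm_exp_I, mul_one, Complex.norm_real, Complex.norm_real, Real.norm_of_nonneg (Real.exp_pos _).le, Real.norm_eq_abs]
      gcongr
      exact kk_le _

end MajArc

namespace MajArc

lemma dir_sum (a : ℕ → ℝ) (ha0 : a 0 = 0) (ha : ∀ n, 0 ≤ a n) (σ : ℝ)
    (hs : LSeriesSummable (fun n => (a n : ℂ)) σ) (l ℓ : ℝ) :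
    HasSum (fun n : ℕ => ((a n * (n : ℝ) ^ (-σ) * gg (l * (Real.log n - ℓ)) : ℝ) : ℂ))
      (∫ p, (kk p : ℂ) * Complex.exp (-(Complex.I * l * (p.1 - p.2 : ℝ) * ℓ)) *
        LSeries (fun n => (a n : ℂ)) ((σ : ℂ) - Complex.I * l * (p.1 - p.2 : ℝ)) ∂mu2) := by
  have key : ∀ (n : ℕ) (p : ℝ × ℝ), (kk p : ℂ) * Complex.exp (-(Complex.I * l * (p.1 - p.2 : ℝ) * ℓ)) *
      LSeries.term (fun n => (a n : ℂ)) ((σ : ℂ) - Complex.I * l * (p.1 - p.2 : ℝ)) n =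
      ((a n * (n : ℝ) ^ (-σ) : ℝ) : ℂ) * ((kk p : ℂ) * Complex.exp (Complex.I * (l * (Real.log n - ℓ) : ℝ) * (p.1 - p.2 : ℝ))) := by
    intro n p
    rcases Nat.eq_zero_or_pos n with rfl | hn
    · simp [ha0]
    · have hn0 : (0 : ℝ) < n := by exact_mod_cast hn
      rw [LSeries.term_of_ne_zero hn.ne', div_eq_mul_inv, ← Complex.cpow_neg, Complex.cpow_def_of_ne_zero (by exact_mod_cast hn.ne'),
        Real.rpow_def_of_pos hn0, Complex.natCast_log.symm]
      rw [Complex.ofReal_mul, Complex.ofReal_exp]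
      rw [show (kk p : ℂ) * Complex.exp (-(Complex.I * l * (p.1 - p.2 : ℝ) * ℓ)) *
          ((a n : ℂ) * Complex.exp ((Real.log n : ℂ) * -((σ : ℂ) - Complex.I * l * (p.1 - p.2 : ℝ)))) =
          (a n : ℂ) * (kk p : ℂ) * (Complex.exp (-(Complex.I * l * (p.1 - p.2 : ℝ) * ℓ)) *
          Complex.exp ((Real.log n : ℂ) * -((σ : ℂ) - Complex.I * l * (p.1 - p.2 : ℝ)))) by ring, ← Complex.exp_add]
      rw [show (a n : ℂ) * Complex.exp ((Real.log n * -σ : ℝ) : ℂ) * ((kk p : ℂ) * Complex.exp (Complex.I * (l * (Real.log n - ℓ) : ℝ) * (p.1 - p.2 : ℝ)))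
        = (a n : ℂ) * (kk p : ℂ) * (Complex.exp ((Real.log n * -σ : ℝ) : ℂ) * Complex.exp (Complex.I * (l * (Real.log n - ℓ) : ℝ) * (p.1 - p.2 : ℝ))) by ring,
        ← Complex.exp_add]
      congr 2
      push_cast; ring
  have hkk := kk_cont
  have hint : ∀ n : ℕ, Integrable (fun p => (kk p : ℂ) * Complex.exp (-(Complex.I * l * (p.1 - p.2 : ℝ) * ℓ)) *
      LSeries.term (fun n => (a n : ℂ)) ((σ : ℂ) - Complex.I * l * (p.1 - p.2 : ℝ)) n) mu2 := by
    intro n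
    simp_rw [key n]
    apply int_of_cont
    fun_prop
  have hnorm : ∀ (n : ℕ) (p : ℝ × ℝ), ‖(kk p : ℂ) * Complex.exp (-(Complex.I * l * (p.1 - p.2 : ℝ) * ℓ)) *
      LSeries.term (fun n => (a n : ℂ)) ((σ : ℂ) - Complex.I * l * (p.1 - p.2 : ℝ)) n‖ ≤ a n * (n : ℝ) ^ (-σ) * 2 := by
    intro n p
    have h0 : 0 ≤ a n * (n : ℝ) ^ (-σ) := mul_nonneg (ha n) (by positivity)
    rw [key n p, norm_mul, norm_mul, norm_exp_I, mul_one, Complex.norm_real, Complex.norm_real, Real.norm_of_nonneg h0, Real.norm_eq_abs]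
    gcongr
    exact kk_le p
  have hsumm : Summable fun n : ℕ => a n * (n : ℝ) ^ (-σ) := by
    have h := hs.norm
    refine h.congr ?_
    intro n
    rcases Nat.eq_zero_or_pos n with rfl | hn
    · simp [ha0]
    · rw [LSeries.norm_term_eq, if_neg hn.ne', Complex.norm_real, Real.norm_of_nonneg (ha n), Complex.ofReal_re,
        Real.rpow_neg (by positivity), div_eq_mul_inv]
  have hsum : Summable fun n : ℕ => ∫ p, ‖(kk p : ℂ) * Complex.exp (-(Complex.I * l * (p.1 - p.2 : ℝ) * ℓ)) *
      LSeries.term (fun n => (a n : ℂ)) ((σ : ℂ) - Complex.I * l * (p.1 - p.2 : ℝ)) n‖ ∂mu2 := by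
    refine Summable.of_nonneg_of_le (fun n => integral_nonneg fun p => norm_nonneg _) (fun n => ?_)
      (hsumm.mul_right (2 * mu2.real Set.univ))
    refine (integral_mono (hint n).norm (integrable_const _) (hnorm n)).trans (le_of_eq ?_)
    rw [integral_const, smul_eq_mul]; ring
  have := hasSum_integral_of_summable_integral_norm hint hsum
  have h1 : (fun n : ℕ => ((a n * (n : ℝ) ^ (-σ) * gg (l * (Real.log n - ℓ)) : ℝ) : ℂ)) =
      fun n : ℕ => ∫ p, (kk p : ℂ) * Complex.exp (-(Complex.I * l * (p.1 - p.2 : ℝ) * ℓ)) *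
      LSeries.term (fun n => (a n : ℂ)) ((σ : ℂ) - Complex.I * l * (p.1 - p.2 : ℝ)) n ∂mu2 := by
    funext n
    rw [integral_congr_ae (Filter.Eventually.of_forall (key n)), integral_const_mul, ← gg_rep, ← Complex.ofReal_mul]
  have h2 : (fun p : ℝ × ℝ => (kk p : ℂ) * Complex.exp (-(Complex.I * l * (p.1 - p.2 : ℝ) * ℓ)) *
        LSeries (fun n => (a n : ℂ)) ((σ : ℂ) - Complex.I * l * (p.1 - p.2 : ℝ))) =
      fun p => ∑' n, (kk p : ℂ) * Complex.exp (-(Complex.I * l * (p.1 - p.2 : ℝ) * ℓ)) *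
      LSeries.term (fun n => (a n : ℂ)) ((σ : ℂ) - Complex.I * l * (p.1 - p.2 : ℝ)) n := by
    funext p
    rw [tsum_mul_left]
    rfl
  rw [h1, h2]
  exact this

open ArithmeticFunction.vonMangoldt in
lemma explicit (W : ℕ) [NeZero W] (r : ZMod W) (hr : IsUnit r) (l ℓ η : ℝ) (hη : 0 < η) :
    ∃ T : ℝ, HasSum (fun n : ℕ => residueClass r n * (n : ℝ) ^ (-(1 + η)) * gg (l * (Real.log n - ℓ))) T ∧
      (T : ℂ) - (W.totient : ℂ)⁻¹ * (EE l ℓ η : ℂ) =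
        ∫ p, (kk p : ℂ) * Complex.exp (-(Complex.I * l * (p.1 - p.2 : ℝ) * ℓ)) *
          LFunctionResidueClassAux r (((1 + η : ℝ) : ℂ) - Complex.I * l * (p.1 - p.2 : ℝ)) ∂mu2 := by
  have hs : LSeriesSummable (fun n => (residueClass r n : ℂ)) ((1 + η : ℝ) : ℂ) := by
    apply LSeriesSummable_of_abscissaOfAbsConv_lt_re
    refine lt_of_le_of_lt (abscissaOfAbsConv_residueClass_le_one r) ?_
    rw [Complex.ofReal_re]
    exact_mod_cast (by linarith : (1:ℝ) < 1 + η)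
  have h := dir_sum (residueClass r) (residueClass_apply_zero r) (residueClass_nonneg r) (1 + η) hs l ℓ
  have hre := Complex.hasSum_re h
  have hT := h.tsum_eq
  rw [← Complex.ofReal_tsum] at hT
  refine ⟨_, hre, ?_⟩
  have hT2 : (((∫ p, (kk p : ℂ) * Complex.exp (-(Complex.I * l * (p.1 - p.2 : ℝ) * ℓ)) *
        LSeries (fun n => (residueClass r n : ℂ)) (((1 + η : ℝ) : ℂ) - Complex.I * l * (p.1 - p.2 : ℝ)) ∂mu2).re : ℝ) : ℂ) =
      ∫ p, (kk p : ℂ) * Complex.exp (-(Complex.I * l * (p.1 - p.2 : ℝ) * ℓ)) *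
        LSeries (fun n => (residueClass r n : ℂ)) (((1 + η : ℝ) : ℂ) - Complex.I * l * (p.1 - p.2 : ℝ)) ∂mu2 := by
    rw [← hT, Complex.ofReal_re]
  rw [hT2, EE_rep l ℓ η hη, ← integral_const_mul]
  have heq : ∀ p : ℝ × ℝ, LFunctionResidueClassAux r (((1 + η : ℝ) : ℂ) - Complex.I * l * (p.1 - p.2 : ℝ)) =
      LSeries (fun n => (residueClass r n : ℂ)) (((1 + η : ℝ) : ℂ) - Complex.I * l * (p.1 - p.2 : ℝ)) -
      (W.totient : ℂ)⁻¹ * (1 / ((η : ℂ) - Complex.I * l * (p.1 - p.2 : ℝ))) := by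
    intro p
    have hmem : (((1 + η : ℝ) : ℂ) - Complex.I * l * (p.1 - p.2 : ℝ)) ∈ {s : ℂ | 1 < s.re} := by
      rw [Set.mem_ofPred_eq]
      simp [hη]
    rw [eqOn_LFunctionResidueClassAux hr hmem]
    simp only
    congr 1
    rw [div_eq_mul_one_div]
    rw [show (((1 + η : ℝ) : ℂ) - Complex.I * l * (p.1 - p.2 : ℝ) - 1) = (η : ℂ) - Complex.I * l * (p.1 - p.2 : ℝ) by push_cast; ring]
  have hkk := kk_cont
  have hi2 : Integrable (fun p : ℝ × ℝ => (W.totient : ℂ)⁻¹ * ((kk p : ℂ) * Complex.exp (-(Complex.I * l * (p.1 - p.2 : ℝ) * ℓ)) *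
      (1 / ((η : ℂ) - Complex.I * l * (p.1 - p.2 : ℝ))))) mu2 := by
    apply int_of_cont
    have : ∀ p : ℝ × ℝ, (η : ℂ) - Complex.I * l * (p.1 - p.2 : ℝ) ≠ 0 := by
      intro p h0
      have := congrArg Complex.re h0
      simp at this
      exact hη.ne' this
    have h3 : Continuous fun p : ℝ × ℝ => 1 / ((η : ℂ) - Complex.I * l * (p.1 - p.2 : ℝ)) :=
      Continuous.div (by fun_prop) (by fun_prop) this
    fun_prop
  have hi1 : Integrable (fun p : ℝ × ℝ => (kk p : ℂ) * Complex.exp (-(Complex.I * l * (p.1 - p.2 : ℝ) * ℓ)) *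
      LFunctionResidueClassAux r (((1 + η : ℝ) : ℂ) - Complex.I * l * (p.1 - p.2 : ℝ))) mu2 := by
    apply int_of_cont
    have h3 : Continuous fun p : ℝ × ℝ => LFunctionResidueClassAux r (((1 + η : ℝ) : ℂ) - Complex.I * l * (p.1 - p.2 : ℝ)) := by
      apply (continuousOn_LFunctionResidueClassAux r).comp_continuous (by fun_prop)
      intro p
      rw [Set.mem_ofPred_eq]
      simp [hη.le]
    exact (by fun_prop : Continuous fun p : ℝ × ℝ => (kk p : ℂ) * Complex.exp (-(Complex.I * l * (p.1 - p.2 : ℝ) * ℓ))).mul h3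
  have hi : Integrable (fun p : ℝ × ℝ => (kk p : ℂ) * Complex.exp (-(Complex.I * l * (p.1 - p.2 : ℝ) * ℓ)) *
      LSeries (fun n => (residueClass r n : ℂ)) (((1 + η : ℝ) : ℂ) - Complex.I * l * (p.1 - p.2 : ℝ))) mu2 := by
    refine (hi1.add hi2).congr ?_
    filter_upwards with p
    simp only [Pi.add_apply]
    rw [heq p]; ring
  rw [← integral_sub hi hi2]
  congr 1; ext p
  rw [heq p]; ring

end MajArc

namespace MajArc

lemma RL (g : ℝ × ℝ → ℂ) (l : ℝ) (hl : 0 < l) :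
    Filter.Tendsto (fun ℓ : ℝ => ∫ p, g p * Complex.exp (-(Complex.I * l * (p.1 - p.2 : ℝ) * ℓ)) ∂mu2)
      Filter.atTop (nhds 0) := by
  set D : StrongDual ℝ (ℝ × ℝ) := ContinuousLinearMap.fst ℝ ℝ ℝ - ContinuousLinearMap.snd ℝ ℝ ℝ with hD
  have hD0 : D ≠ 0 := by
    intro h
    have := congrArg (fun T : StrongDual ℝ (ℝ × ℝ) => T (1, 0)) h
    simp [hD] at this
  have ht : Filter.Tendsto (fun ℓ : ℝ => (l * ℓ / (2 * Real.pi)) • D) Filter.atTop (Filter.cocompact (StrongDual ℝ (ℝ × ℝ))) := by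
    rw [← Metric.cobounded_eq_cocompact, ← tendsto_norm_atTop_iff_cobounded]
    simp_rw [norm_smul]
    apply Filter.Tendsto.atTop_mul_const (norm_pos_iff.mpr hD0)
    have h1 : Filter.Tendsto (fun ℓ : ℝ => l * ℓ / (2 * Real.pi)) Filter.atTop Filter.atTop := by
      apply Filter.Tendsto.atTop_div_const (by positivity)
      exact Filter.tendsto_id.const_mul_atTop hl
    exact tendsto_norm_atTop_atTop.comp h1
  have h := (tendsto_integral_exp_smul_cocompact (V := ℝ × ℝ) ((Set.Ioc (0:ℝ) 1 ×ˢ Set.Ioc (0:ℝ) 1).indicator g) volume).comp ht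
  refine h.congr ?_
  intro ℓ
  have hmu : mu2 = (volume : Measure (ℝ × ℝ)).restrict (Set.Ioc (0:ℝ) 1 ×ˢ Set.Ioc (0:ℝ) 1) := by
    unfold mu2 mu1
    rw [Measure.prod_restrict]; rfl
  rw [hmu, ← integral_indicator (measurableSet_Ioc.prod measurableSet_Ioc)]
  simp only [Function.comp]
  congr 1; ext p
  by_cases hp : p ∈ Set.Ioc (0:ℝ) 1 ×ˢ Set.Ioc (0:ℝ) 1
  · rw [Set.indicator_of_mem hp, Set.indicator_of_mem hp, Circle.smul_def, Real.fourierChar_apply, smul_eq_mul, mul_comm]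
    congr 2
    have hpi : (Real.pi : ℂ) ≠ 0 := by exact_mod_cast Real.pi_ne_zero
    simp [hD]
    field_simp
  · rw [Set.indicator_of_notMem hp, Set.indicator_of_notMem hp, smul_zero]

lemma mu2_ae : ∀ᵐ p ∂mu2, |p.1 - p.2| ≤ 1 := by
  have hmu : mu2 = (volume : Measure (ℝ × ℝ)).restrict (Set.Ioc (0:ℝ) 1 ×ˢ Set.Ioc (0:ℝ) 1) := by
    unfold mu2 mu1
    rw [Measure.prod_restrict]; rfl
  rw [hmu]
  filter_upwards [ae_restrict_mem (measurableSet_Ioc.prod measurableSet_Ioc)] with p hp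
  obtain ⟨⟨h1, h2⟩, h3, h4⟩ := hp
  rw [abs_le]; constructor <;> linarith

open ArithmeticFunction.vonMangoldt in
lemma eta_lim (W : ℕ) [NeZero W] (r : ZMod W) (l ℓ : ℝ) :
    Filter.Tendsto (fun η : ℝ => ∫ p, (kk p : ℂ) * Complex.exp (-(Complex.I * l * (p.1 - p.2 : ℝ) * ℓ)) *
          LFunctionResidueClassAux r (((1 + η : ℝ) : ℂ) - Complex.I * l * (p.1 - p.2 : ℝ)) ∂mu2) (nhdsWithin 0 (Set.Ioi 0))
      (nhds (∫ p, (kk p : ℂ) * Complex.exp (-(Complex.I * l * (p.1 - p.2 : ℝ) * ℓ)) *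
          LFunctionResidueClassAux r (((1 + (0:ℝ) : ℝ) : ℂ) - Complex.I * l * (p.1 - p.2 : ℝ)) ∂mu2)) := by
  have hcont := continuousOn_LFunctionResidueClassAux r
  have hkk := kk_cont
  have hK : IsCompact ((fun x : ℝ × ℝ => ((x.1 : ℂ) - Complex.I * l * x.2)) '' (Set.Icc 1 2 ×ˢ Set.Icc (-1) 1)) :=
    (isCompact_Icc.prod isCompact_Icc).image (by fun_prop)
  have hKs : ((fun x : ℝ × ℝ => ((x.1 : ℂ) - Complex.I * l * x.2)) '' (Set.Icc 1 2 ×ˢ Set.Icc (-1) 1)) ⊆ {s : ℂ | 1 ≤ s.re} := by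
    rintro _ ⟨x, ⟨hx1, hx2⟩, rfl⟩
    rw [Set.mem_ofPred_eq]
    simpa using hx1.1
  obtain ⟨M, hM⟩ := hK.exists_bound_of_continuousOn (hcont.mono hKs)
  have hcx : ∀ η : ℝ, 0 ≤ η → Continuous fun p : ℝ × ℝ => LFunctionResidueClassAux r (((1 + η : ℝ) : ℂ) - Complex.I * l * (p.1 - p.2 : ℝ)) := by
    intro η hη
    apply hcont.comp_continuous (by fun_prop)
    intro p
    rw [Set.mem_ofPred_eq]
    simp [hη]
  apply tendsto_integral_filter_of_dominated_convergence (fun _ => 2 * M)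
  · filter_upwards [self_mem_nhdsWithin] with η hη
    have := hcx η (le_of_lt hη)
    exact ((by fun_prop : Continuous fun p : ℝ × ℝ => (kk p : ℂ) * Complex.exp (-(Complex.I * l * (p.1 - p.2 : ℝ) * ℓ))).mul this).aestronglyMeasurable
  · filter_upwards [Ioo_mem_nhdsGT (zero_lt_one)] with η hη
    filter_upwards [mu2_ae] with p hp
    have h1 := hM (((1 + η : ℝ) : ℂ) - Complex.I * l * (p.1 - p.2 : ℝ)) ⟨(1 + η, p.1 - p.2), ⟨⟨by simp only; linarith [hη.1], by simp only; linarith [hη.2]⟩, abs_le.mp hp⟩, rfl⟩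
    rw [norm_mul, norm_mul, Complex.norm_real, Real.norm_eq_abs]
    have h2 : ‖Complex.exp (-(Complex.I * l * (p.1 - p.2 : ℝ) * ℓ))‖ = 1 := by
      have := norm_exp_I (-(l * ℓ)) (p.1 - p.2)
      rw [← this]; congr 2; push_cast; ring
    rw [h2, mul_one]
    exact mul_le_mul (kk_le p) h1 (norm_nonneg _) (by norm_num)
  · exact integrable_const _
  · filter_upwards with p
    apply Filter.Tendsto.const_mul
    have h0 : (((1 + (0:ℝ) : ℝ) : ℂ) - Complex.I * l * (p.1 - p.2 : ℝ)) ∈ {s : ℂ | 1 ≤ s.re} := by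
      rw [Set.mem_ofPred_eq]; simp
    refine (hcont _ h0).tendsto.comp ?_
    apply tendsto_nhdsWithin_of_tendsto_nhds_of_eventually_within
    · have : Continuous fun η : ℝ => (((1 + η : ℝ) : ℂ) - Complex.I * l * (p.1 - p.2 : ℝ)) := by fun_prop
      exact (this.tendsto 0).mono_left nhdsWithin_le_nhds
    · filter_upwards [self_mem_nhdsWithin] with η hη
      simpa using le_of_lt hη

open ArithmeticFunction.vonMangoldt in
lemma PB1 (W : ℕ) [NeZero W] (r : ZMod W) (hr : IsUnit r) (l : ℝ) (hl : 0 < l) :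
    ∃ ℓ0 : ℝ, ∀ ℓ ≥ ℓ0, ∀ s : Finset ℕ, (∀ n : ℕ, 0 < n → |Real.log n - ℓ| < 100 / l → n ∈ s) →
      (W.totient : ℝ)⁻¹ / (200 * l) ≤ ∑ n ∈ s, residueClass r n / n := by
  have hW : 0 < W := Nat.pos_of_ne_zero (NeZero.ne W)
  have hφ : (0:ℝ) < W.totient := by exact_mod_cast Nat.totient_pos.mpr hW
  have hR := RL (fun p => (kk p : ℂ) * LFunctionResidueClassAux r (((1 + (0:ℝ) : ℝ) : ℂ) - Complex.I * l * (p.1 - p.2 : ℝ))) l hl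
  rw [Metric.tendsto_atTop] at hR
  obtain ⟨ℓ1, hℓ1⟩ := hR ((W.totient : ℝ)⁻¹ / (200 * l)) (by positivity)
  refine ⟨max ℓ1 (1 / l), ?_⟩
  intro ℓ hℓ s hs
  have hℓa : ℓ1 ≤ ℓ := (le_max_left _ _).trans hℓ
  have hℓb : 1 / (2 * l) < ℓ := by
    refine lt_of_lt_of_le ?_ ((le_max_right _ _).trans hℓ)
    exact one_div_lt_one_div_of_lt hl (by linarith)
  have hRR := hℓ1 ℓ hℓa
  rw [dist_zero_right] at hRR
  have hRR' : ‖∫ p, (kk p : ℂ) * Complex.exp (-(Complex.I * l * (p.1 - p.2 : ℝ) * ℓ)) *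
          LFunctionResidueClassAux r (((1 + (0:ℝ) : ℝ) : ℂ) - Complex.I * l * (p.1 - p.2 : ℝ)) ∂mu2‖ < (W.totient : ℝ)⁻¹ / (200 * l) := by
    refine lt_of_eq_of_lt ?_ hRR
    congr 2; ext p; ring
  have hlim := (eta_lim W r l ℓ).norm
  -- for all small η
  have hev : ∀ᶠ η in nhdsWithin (0:ℝ) (Set.Ioi 0), (W.totient : ℝ)⁻¹ / (100 * l) - ‖∫ p, (kk p : ℂ) * Complex.exp (-(Complex.I * l * (p.1 - p.2 : ℝ) * ℓ)) *
          LFunctionResidueClassAux r (((1 + η : ℝ) : ℂ) - Complex.I * l * (p.1 - p.2 : ℝ)) ∂mu2‖ ≤ ∑ n ∈ s, residueClass r n / n := by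
    have hpos : 0 < Real.log 2 / (ℓ + 1 / (2 * l)) := by
      apply div_pos (Real.log_pos (by norm_num))
      have : 0 < 1 / (2 * l) := by positivity
      linarith
    filter_upwards [Ioo_mem_nhdsGT hpos] with η hη
    have hη0 : 0 < η := hη.1
    have h2 : η * (ℓ + 1 / (2 * l)) ≤ Real.log 2 := by
      have : 0 < ℓ + 1 / (2 * l) := by
        have : 0 < 1 / (2 * l) := by positivity
        linarith
      rw [← le_div_iff₀ this]; exact hη.2.le
    obtain ⟨T, hT, hTe⟩ := explicit W r hr l ℓ η hη0
    have hE := EE_low l ℓ η hl hη0 hℓb h2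
    have h3 : (W.totient : ℝ)⁻¹ * EE l ℓ η - T ≤ ‖∫ p, (kk p : ℂ) * Complex.exp (-(Complex.I * l * (p.1 - p.2 : ℝ) * ℓ)) *
          LFunctionResidueClassAux r (((1 + η : ℝ) : ℂ) - Complex.I * l * (p.1 - p.2 : ℝ)) ∂mu2‖ := by
      rw [← hTe]
      have : (T : ℂ) - (W.totient : ℂ)⁻¹ * (EE l ℓ η : ℂ) = ((T - (W.totient : ℝ)⁻¹ * EE l ℓ η : ℝ) : ℂ) := by push_cast; ring
      rw [this, Complex.norm_real, Real.norm_eq_abs]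
      have := neg_abs_le (T - (W.totient : ℝ)⁻¹ * EE l ℓ η)
      linarith
    have h4 : T ≤ ∑ n ∈ s, residueClass r n / n := by
      have hs2 : HasSum (fun n : ℕ => if n ∈ s then residueClass r n / n else 0) (∑ n ∈ s, residueClass r n / n) := by
        have := hasSum_sum_of_ne_finset_zero (L := SummationFilter.unconditional ℕ) (f := fun n : ℕ => if n ∈ s then residueClass r n / n else 0) (s := s) (fun n hn => if_neg hn)
        rwa [Finset.sum_congr rfl (fun n hn => if_pos hn)] at this
      refine hasSum_le ?_ hT hs2
      intro n
      have ha := residueClass_nonneg r n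
      rcases Nat.eq_zero_or_pos n with rfl | hn
      · simp only [residueClass_apply_zero]; simp
      have hn1 : (1:ℝ) ≤ n := by exact_mod_cast hn
      have hpw : (0:ℝ) ≤ (n:ℝ) ^ (-(1 + η)) := by positivity
      by_cases hns : n ∈ s
      · rw [if_pos hns]
        have hg : gg (l * (Real.log n - ℓ)) ≤ 1 := (le_abs_self _).trans (gg_abs _)
        have hp2 : (n:ℝ) ^ (-(1 + η)) ≤ (n:ℝ)⁻¹ := by
          rw [← Real.rpow_neg_one]
          exact Real.rpow_le_rpow_of_exponent_le hn1 (by linarith)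
        calc _ ≤ residueClass r n * (n:ℝ) ^ (-(1 + η)) * 1 := mul_le_mul_of_nonneg_left hg (mul_nonneg ha hpw)
          _ = residueClass r n * (n:ℝ) ^ (-(1 + η)) := mul_one _
          _ ≤ residueClass r n * (n:ℝ)⁻¹ := mul_le_mul_of_nonneg_left hp2 ha
          _ = _ := (div_eq_mul_inv _ _).symm
      · rw [if_neg hns]
        apply mul_nonpos_of_nonneg_of_nonpos (mul_nonneg ha hpw)
        apply gg_nonpos
        by_contra hc
        apply hns
        apply hs n hn
        rw [abs_mul, abs_of_pos hl, not_le] at hc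
        rw [lt_div_iff₀ hl, mul_comm]; exact hc
    have h5 : (W.totient : ℝ)⁻¹ / (100 * l) ≤ (W.totient : ℝ)⁻¹ * EE l ℓ η := by
      rw [div_eq_mul_one_div]
      exact mul_le_mul_of_nonneg_left hE (by positivity)
    linarith
  have hfin := le_of_tendsto (Filter.Tendsto.const_sub ((W.totient : ℝ)⁻¹ / (100 * l)) hlim) hev
  have : (W.totient : ℝ)⁻¹ / (100 * l) = 2 * ((W.totient : ℝ)⁻¹ / (200 * l)) := by field_simp; norm_num
  linarith

end MajArc

namespace MajArc

open ArithmeticFunction.vonMangoldt in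
lemma PB2 (W : ℕ) (hW : 0 < W) (ε : ℝ) (h0 : 0 < ε) (h1 : ε ≤ 1 / 2) (r : ℕ) (hr : r.Coprime W) :
    ∃ y0 : ℝ, ∀ y ≥ y0, (1 / 240000) * ε * y / W.totient ≤
      ∑ p ∈ (Ioc ⌊(1 - ε) * y⌋₊ ⌊y⌋₊).filter (fun p => p.Prime ∧ p ≡ r [MOD W]), Real.log p := by
  haveI : NeZero W := ⟨hW.ne'⟩
  have hφ : (0:ℝ) < W.totient := by exact_mod_cast Nat.totient_pos.mpr hW
  have hru : IsUnit (r : ZMod W) := (ZMod.isUnit_iff_coprime r W).mpr hr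
  obtain ⟨ℓ0, hℓ0⟩ := PB1 W (r : ZMod W) hru (300 / ε) (by positivity)
  obtain ⟨C, hC⟩ := Chebyshev.psi_sub_theta_le_mul_sqrt
  set K := (240000 * W.totient * |C|) / ε with hK
  refine ⟨max 1 (max (Real.exp (ℓ0 + ε / 3)) (K ^ 2)), ?_⟩
  intro y hy
  have hy1 : 1 ≤ y := (le_max_left _ _).trans hy
  have hy2 : Real.exp (ℓ0 + ε / 3) ≤ y := (le_max_left _ _).trans ((le_max_right _ _).trans hy)
  have hy3 : K ^ 2 ≤ y := (le_max_right _ _).trans ((le_max_right _ _).trans hy)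
  have hy0 : 0 < y := by linarith
  have hlog : ℓ0 ≤ Real.log y - ε / 3 := by
    have := Real.log_le_log (Real.exp_pos _) hy2
    rw [Real.log_exp] at this; linarith
  have key := hℓ0 _ hlog (Ioc ⌊(1 - ε) * y⌋₊ ⌊y⌋₊) (by
    intro n hn hw
    have hn0 : (0:ℝ) < n := by exact_mod_cast hn
    have e1 : 100 / (300 / ε) = ε / 3 := by field_simp; norm_num
    rw [e1, abs_lt] at hw
    have a1 : Real.log n < Real.log y := by linarith
    have a2 : (n:ℝ) < y := (Real.log_lt_log_iff hn0 hy0).mp a1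
    rw [mem_Ioc]
    refine ⟨?_, Nat.le_floor a2.le⟩
    rw [Nat.floor_lt (by nlinarith)]
    have a3 : Real.log y - 2 * (ε / 3) < Real.log n := by linarith
    have a4 : y * Real.exp (-(2 * (ε / 3))) < n := by
      rw [← Real.exp_log hn0]
      calc y * Real.exp (-(2 * (ε / 3))) = Real.exp (Real.log y - 2 * (ε / 3)) := by
            rw [sub_eq_add_neg, Real.exp_add, Real.exp_log hy0]
        _ < _ := Real.exp_lt_exp.mpr a3
    have a5 := Real.add_one_le_exp (-(2 * (ε / 3)))
    nlinarith)
  set s := Ioc ⌊(1 - ε) * y⌋₊ ⌊y⌋₊ with hs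
  have b1 : ∑ n ∈ s, residueClass (r : ZMod W) n / n ≤ (2 / y) * ∑ n ∈ s, residueClass (r : ZMod W) n := by
    rw [mul_sum]
    apply sum_le_sum
    intro n hn
    rw [hs, mem_Ioc] at hn
    have hn1 : (1 - ε) * y < n := (Nat.floor_lt (by nlinarith)).mp hn.1
    have hn2 : y / 2 ≤ n := by nlinarith
    have hn0 : (0:ℝ) < n := by linarith
    rw [div_eq_mul_inv, mul_comm]
    apply mul_le_mul_of_nonneg_right _ (residueClass_nonneg _ _)
    rw [inv_eq_one_div, div_le_div_iff₀ hn0 hy0]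
    linarith
  have b2 : ∑ n ∈ s, residueClass (r : ZMod W) n ≤
      ∑ p ∈ s.filter (fun p => p.Prime ∧ p ≡ r [MOD W]), Real.log p + (Chebyshev.psi y - Chebyshev.theta y) := by
    rw [Chebyshev.psi_sub_theta_eq_sum_not_prime, ← sum_filter_add_sum_filter_not s (fun p => p.Prime)]
    apply add_le_add
    · rw [← filter_filter, sum_filter (s := s.filter _) (p := fun p => p ≡ r [MOD W])]
      apply sum_le_sum
      intro p hp
      have hpp := (mem_filter.mp hp).2
      unfold residueClass
      by_cases hpr : p ≡ r [MOD W]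
      · rw [if_pos hpr]
        refine (Set.indicator_le_self' (fun _ _ => ArithmeticFunction.vonMangoldt_nonneg) _).trans ?_
        rw [ArithmeticFunction.vonMangoldt_apply_prime hpp]
      · rw [if_neg hpr, Set.indicator_of_notMem]
        intro hmem
        exact hpr ((ZMod.natCast_eq_natCast_iff _ _ _).mp hmem)
    · refine (sum_le_sum fun n _ => residueClass_le _ n).trans ?_
      apply sum_le_sum_of_subset_of_nonneg
      · intro n hn
        rw [mem_filter, hs, mem_Ioc] at hn
        rw [mem_filter, mem_Ioc]
        exact ⟨⟨by omega, hn.1.2⟩, hn.2⟩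
      · intro n _ _
        exact ArithmeticFunction.vonMangoldt_nonneg
  have b3 := hC y
  have b4 : C * √y ≤ (1 / 240000) * ε * y / W.totient := by
    have hsq : √y * √y = y := Real.mul_self_sqrt hy0.le
    have hKs : K ≤ √y := Real.le_sqrt_of_sq_le hy3
    have hs0 : 0 ≤ √y := Real.sqrt_nonneg y
    rw [le_div_iff₀ hφ]
    rw [hK, div_le_iff₀ h0] at hKs
    have hc : C * √y * W.totient ≤ |C| * √y * W.totient := by gcongr; exact le_abs_self C
    nlinarith
  have b5 : (W.totient : ℝ)⁻¹ / (200 * (300 / ε)) = (2 / y) * (2 * ((1 / 240000) * ε * y / W.totient)) := by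
    field_simp; norm_num
  rw [b5] at key
  have b6 := le_of_mul_le_mul_left (key.trans b1) (by positivity)
  linarith

lemma PB (W : ℕ) (hW : 0 < W) (ε : ℝ) (h0 : 0 < ε) (h1 : ε ≤ 1 / 2) :
    ∃ y0 : ℝ, ∀ y ≥ y0, ∀ r : ℕ, r.Coprime W → (1 / 240000) * ε * y / W.totient ≤
      ∑ p ∈ (Ioc ⌊(1 - ε) * y⌋₊ ⌊y⌋₊).filter (fun p => p.Prime ∧ p ≡ r [MOD W]), Real.log p := by
  have h : ∀ r : ℕ, ∃ y0 : ℝ, r.Coprime W → ∀ y ≥ y0, (1 / 240000) * ε * y / W.totient ≤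
      ∑ p ∈ (Ioc ⌊(1 - ε) * y⌋₊ ⌊y⌋₊).filter (fun p => p.Prime ∧ p ≡ r [MOD W]), Real.log p := by
    intro r
    by_cases hr : r.Coprime W
    · obtain ⟨y0, hy⟩ := PB2 W hW ε h0 h1 r hr
      exact ⟨y0, fun _ => hy⟩
    · exact ⟨0, fun h => absurd h hr⟩
  choose Y hY using h
  refine ⟨∑ r ∈ range W, |Y r|, ?_⟩
  intro y hy r hr
  have hmod : (r % W) ≡ r [MOD W] := Nat.mod_modEq r W
  have hr' : (r % W).Coprime W := by
    rw [Nat.Coprime, hmod.gcd_eq]; exact hr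
  have h2 : Y (r % W) ≤ y := by
    refine ((le_abs_self _).trans ?_).trans hy
    exact single_le_sum (f := fun r => |Y r|) (fun i _ => abs_nonneg _) (mem_range.mpr (Nat.mod_lt _ hW))
  have := hY (r % W) hr' y h2
  refine this.trans (le_of_eq ?_)
  congr 1
  apply filter_congr
  intro p _
  constructor
  · rintro ⟨a, b⟩; exact ⟨a, b.trans hmod⟩
  · rintro ⟨a, b⟩; exact ⟨a, b.trans hmod.symm⟩

end MajArc

namespace MajArc

def ex (c : ℕ) : Fin 7 → ℕ := ![2, 2, 3, 3, 5, 6, c]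

noncomputable def MM (c W : ℕ) (n : ℕ) : ℕ :=
  Nat.card {x : Fin 7 → (ZMod W)ˣ // ∑ i, ((x i : ZMod W)) ^ (ex c i) = (n : ZMod W)}

lemma MM_mul (c a b n : ℕ) (h : a.Coprime b) : MM c (a * b) n = MM c a n * MM c b n := by
  unfold MM
  rw [← Nat.card_prod]
  let E : (ZMod (a * b))ˣ ≃* (ZMod a)ˣ × (ZMod b)ˣ :=
    (Units.mapEquiv (ZMod.chineseRemainder h).toMulEquiv).trans MulEquiv.prodUnits
  let E7 : (Fin 7 → (ZMod (a * b))ˣ) ≃ (Fin 7 → (ZMod a)ˣ) × (Fin 7 → (ZMod b)ˣ) :=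
    (Equiv.piCongrRight fun _ => E.toEquiv).trans (Equiv.arrowProdEquivProdArrow _ _ _)
  have h1 : ∀ x i, (((E7 x).1 i : (ZMod a)ˣ) : ZMod a) = (ZMod.chineseRemainder h (x i : ZMod (a * b))).1 := fun x i => rfl
  have h2 : ∀ x i, (((E7 x).2 i : (ZMod b)ˣ) : ZMod b) = (ZMod.chineseRemainder h (x i : ZMod (a * b))).2 := fun x i => rfl
  refine Nat.card_congr ((Equiv.subtypeEquiv E7 ?_).trans (Equiv.subtypeProdEquivProd
    (p := fun x : Fin 7 → (ZMod a)ˣ => ∑ i, ((x i : ZMod a)) ^ (ex c i) = (n : ZMod a))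
    (q := fun x : Fin 7 → (ZMod b)ˣ => ∑ i, ((x i : ZMod b)) ^ (ex c i) = (n : ZMod b))))
  intro x
  rw [← (ZMod.chineseRemainder h).injective.eq_iff, map_sum, map_natCast, Prod.ext_iff]
  simp only [h1, h2, map_pow, Prod.fst_sum, Prod.snd_sum, Prod.pow_fst, Prod.pow_snd, Prod.fst_natCast, Prod.snd_natCast]

lemma ker_card (p v : ℕ) (hp : p.Prime) (hv : 0 < v) :
    Nat.card (ZMod.unitsMap (dvd_pow_self p hv.ne')).ker = p ^ (v - 1) := by
  have : NeZero (p ^ v) := ⟨(pow_pos hp.pos v).ne'⟩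
  have : NeZero p := ⟨hp.pos.ne'⟩
  set π := ZMod.unitsMap (dvd_pow_self p hv.ne') with hπ
  have h1 := Subgroup.card_mul_index π.ker
  rw [Subgroup.index_ker, MonoidHom.range_eq_top.mpr (ZMod.unitsMap_surjective (dvd_pow_self p hv.ne')), Subgroup.card_top,
    Nat.card_eq_fintype_card, Nat.card_eq_fintype_card, Nat.card_eq_fintype_card, ZMod.card_units_eq_totient, ZMod.card_units_eq_totient,
    Nat.totient_prime_pow hp hv, Nat.totient_prime hp] at h1
  rw [Nat.card_eq_fintype_card]
  exact Nat.eq_of_mul_eq_mul_right (Nat.sub_pos_of_lt hp.one_lt) h1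

lemma root_lift (p v k : ℕ) (hp : p.Prime) (hv : 0 < v) (hk : k.Coprime p)
    (t : (ZMod (p ^ v))ˣ) (y : (ZMod p)ˣ) (h : ZMod.unitsMap (dvd_pow_self p hv.ne') t = y ^ k) :
    ∃ x : (ZMod (p ^ v))ˣ, x ^ k = t ∧ ZMod.unitsMap (dvd_pow_self p hv.ne') x = y := by
  have : NeZero (p ^ v) := ⟨(pow_pos hp.pos v).ne'⟩
  have : NeZero p := ⟨hp.pos.ne'⟩
  set π := ZMod.unitsMap (dvd_pow_self p hv.ne') with hπ
  obtain ⟨z, hz⟩ := ZMod.unitsMap_surjective (dvd_pow_self p hv.ne') y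
  have hcard : Nat.card π.ker = p ^ (v - 1) := ker_card p v hp hv
  have hco : (Nat.card π.ker).Coprime k := by
    rw [hcard]; exact (Nat.Coprime.pow_right _ hk).symm
  have hmem : t * (z ^ k)⁻¹ ∈ π.ker := by
    rw [MonoidHom.mem_ker, map_mul, map_inv, map_pow, h, hz, mul_inv_cancel]
  obtain ⟨w, hw⟩ := (powCoprime hco).surjective ⟨_, hmem⟩
  have hw2 : (w : (ZMod (p ^ v))ˣ) ^ k = t * (z ^ k)⁻¹ := by
    have := congrArg Subtype.val hw
    simpa [powCoprime] using this
  refine ⟨w * z, ?_, ?_⟩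
  · rw [mul_pow, hw2]; group
  · rw [map_mul, hz, MonoidHom.mem_ker.mp w.2, one_mul]

lemma MM_lift (c p v n : ℕ) (hp : p.Prime) (hv : 0 < v) (j : Fin 7) (hj : (ex c j).Coprime p) :
    (p ^ (v - 1)) ^ 6 * MM c p n ≤ MM c (p ^ v) n := by
  classical
  have : NeZero (p ^ v) := ⟨(pow_pos hp.pos v).ne'⟩
  have : NeZero p := ⟨hp.pos.ne'⟩
  have hd := dvd_pow_self p hv.ne'
  set π := ZMod.unitsMap hd with hπ
  have hsur : Function.Surjective π := ZMod.unitsMap_surjective hd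
  have hcoe : ∀ u : (ZMod (p ^ v))ˣ, ((π u : (ZMod p)ˣ) : ZMod p) = ZMod.castHom hd (ZMod p) (u : ZMod (p ^ v)) := fun u => rfl
  choose lf hlf using hsur
  have hex : ∀ (s : {x : Fin 7 → (ZMod p)ˣ // ∑ i, ((x i : ZMod p)) ^ (ex c i) = (n : ZMod p)})
      (g : {i : Fin 7 // i ≠ j} → π.ker), ∃ x : (ZMod (p ^ v))ˣ,
      (x : ZMod (p ^ v)) ^ (ex c j) + ∑ i : {i : Fin 7 // i ≠ j}, ((lf (s.1 i) * (g i : (ZMod (p ^ v))ˣ) : (ZMod (p ^ v))ˣ) : ZMod (p ^ v)) ^ (ex c i) = n ∧ π x = s.1 j := by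
    intro s g
    set Tt : ZMod (p ^ v) := n - ∑ i : {i : Fin 7 // i ≠ j}, ((lf (s.1 i) * (g i : (ZMod (p ^ v))ˣ) : (ZMod (p ^ v))ˣ) : ZMod (p ^ v)) ^ (ex c i) with hTt
    have hT : ZMod.castHom hd (ZMod p) Tt = ((s.1 j ^ (ex c j) : (ZMod p)ˣ) : ZMod p) := by
      rw [hTt, map_sub, map_natCast, map_sum, sub_eq_iff_eq_add]
      have : ∀ i : {i : Fin 7 // i ≠ j}, ZMod.castHom hd (ZMod p) (((lf (s.1 i) * (g i : (ZMod (p ^ v))ˣ) : (ZMod (p ^ v))ˣ) : ZMod (p ^ v)) ^ (ex c i)) = (s.1 i : ZMod p) ^ (ex c i) := by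
        intro i
        rw [map_pow, ← hcoe, map_mul, hlf, MonoidHom.mem_ker.mp (g i).2, mul_one]
      rw [Finset.sum_congr rfl (fun i _ => this i), Units.val_pow_eq_pow_val]
      refine s.2.symm.trans ?_
      exact Fintype.sum_eq_add_sum_subtype_ne (fun i => (s.1 i : ZMod p) ^ (ex c i)) j
    have hTu : IsUnit Tt := by
      obtain ⟨m, hm⟩ : ∃ m : ℕ, Tt = (m : ZMod (p ^ v)) := ⟨Tt.val, (ZMod.natCast_zmod_val Tt).symm⟩
      rw [hm, map_natCast] at hT
      have h1 : IsUnit (m : ZMod p) := by rw [hT]; exact Units.isUnit _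
      rw [hm, ZMod.isUnit_iff_coprime]
      exact Nat.Coprime.pow_right _ ((ZMod.isUnit_iff_coprime m p).mp h1)
    obtain ⟨t, ht⟩ := hTu
    have h2 : π t = s.1 j ^ ex c j := by
      apply Units.ext
      rw [hcoe, ht, hT]
    obtain ⟨x, hx1, hx2⟩ := root_lift p v (ex c j) hp hv hj t (s.1 j) h2
    refine ⟨x, ?_, hx2⟩
    rw [← Units.val_pow_eq_pow_val, hx1, ht, hTt, sub_add_cancel]
  choose rt hrt1 hrt2 using hex
  let Φ : ({i : Fin 7 // i ≠ j} → π.ker) × {x : Fin 7 → (ZMod p)ˣ // ∑ i, ((x i : ZMod p)) ^ (ex c i) = (n : ZMod p)} →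
      {x : Fin 7 → (ZMod (p ^ v))ˣ // ∑ i, ((x i : ZMod (p ^ v))) ^ (ex c i) = (n : ZMod (p ^ v))} := fun gs =>
    ⟨fun i => if hi : i = j then rt gs.2 gs.1 else lf (gs.2.1 i) * (gs.1 ⟨i, hi⟩ : (ZMod (p ^ v))ˣ), by
      rw [Fintype.sum_eq_add_sum_subtype_ne _ j]
      refine Eq.trans ?_ (hrt1 gs.2 gs.1)
      simp only
      rw [dif_pos trivial]
      congr 1
      apply Finset.sum_congr rfl
      intro i _
      rw [dif_neg i.2]⟩
  have hΦπ : ∀ gs i, π ((Φ gs).1 i) = gs.2.1 i := by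
    intro gs i
    by_cases hi : i = j
    · subst hi
      simp only [Φ, dif_pos]
      exact hrt2 _ _
    · simp only [Φ, dif_neg hi]
      rw [map_mul, hlf, MonoidHom.mem_ker.mp (gs.1 ⟨i, hi⟩).2, mul_one]
  have hinj : Function.Injective Φ := by
    rintro ⟨g, s⟩ ⟨g', s'⟩ h
    have hs : s = s' := by
      apply Subtype.ext
      funext i
      have h1 := hΦπ (g, s) i
      rw [h, hΦπ] at h1
      exact h1.symm
    subst hs
    refine Prod.ext ?_ rfl
    funext i
    have h1 := congrArg (fun z => z.1 i.1) h
    simp only [Φ, dif_neg i.2] at h1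
    exact Subtype.ext (mul_left_cancel h1)
  have hc := Nat.card_le_card_of_injective Φ hinj
  rw [Nat.card_prod, Nat.card_fun, ker_card p v hp hv] at hc
  unfold MM
  refine le_trans (le_of_eq ?_) hc
  congr 2
  rw [Nat.card_eq_fintype_card, Fintype.card_subtype_compl]
  simp

end MajArc

namespace MajArc

lemma pow_img (p k : ℕ) [Fact p.Prime] (hk : 0 < k) :
    p - 1 ≤ k * ((univ.erase (0 : ZMod p)).image (fun x => x ^ k)).card := by
  have h := Finset.card_le_mul_card_image (s := univ.erase (0 : ZMod p)) (f := fun x => x ^ k) k ?_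
  · rwa [card_erase_of_mem (mem_univ _), card_univ, ZMod.card] at h
  · intro a _
    calc _ ≤ (Polynomial.nthRoots k a).toFinset.card := by
          apply card_le_card
          intro x hx
          rw [Multiset.mem_toFinset, Polynomial.mem_nthRoots hk]
          exact (mem_filter.mp hx).2
      _ ≤ (Polynomial.nthRoots k a).card := Multiset.toFinset_card_le _
      _ ≤ k := Polynomial.card_nthRoots k a

open scoped Pointwise in
lemma sol_big (p : ℕ) [hp : Fact p.Prime] (h11 : 11 ≤ p) (m : ZMod p) :
    ∃ x y z : ZMod p, x ≠ 0 ∧ y ≠ 0 ∧ z ≠ 0 ∧ x ^ 2 + y ^ 2 + z ^ 3 = m := by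
  set A := (univ.erase (0 : ZMod p)).image (fun x => x ^ 2) with hA
  set B := (univ.erase (0 : ZMod p)).image (fun x => x ^ 3) with hB
  have a1 := pow_img p 2 (by norm_num)
  have b1 := pow_img p 3 (by norm_num)
  rw [← hA] at a1
  rw [← hB] at b1
  have nA : A.Nonempty := by rw [← card_pos]; omega
  have nB : B.Nonempty := by rw [← card_pos]; omega
  have c1 := ZMod.cauchy_davenport hp.out nA nA
  have c2 := ZMod.cauchy_davenport hp.out (nA.add nA) nB
  have hfull : (A + A + B).card = p := by
    apply le_antisymm
    · have := card_le_univ (A + A + B)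
      rwa [ZMod.card] at this
    · refine le_trans ?_ c2
      rw [le_min_iff]
      refine ⟨le_rfl, ?_⟩
      rcases min_le_iff.mp c1 with h | h <;> omega
  have hu : A + A + B = univ := by
    rw [← card_eq_iff_eq_univ, hfull, ZMod.card]
  have hm : m ∈ A + A + B := by rw [hu]; exact mem_univ _
  obtain ⟨s, hs, b, hb, rfl⟩ := mem_add.mp hm
  obtain ⟨a, ha, a', ha', rfl⟩ := mem_add.mp hs
  rw [hA] at ha ha'
  rw [hB] at hb
  obtain ⟨x, hx, rfl⟩ := mem_image.mp ha
  obtain ⟨y, hy, rfl⟩ := mem_image.mp ha'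
  obtain ⟨z, hz, rfl⟩ := mem_image.mp hb
  exact ⟨x, y, z, ne_of_mem_erase hx, ne_of_mem_erase hy, ne_of_mem_erase hz, rfl⟩

lemma dec2 : (1 : ZMod 2) ^ 2 + 1 ^ 2 + 1 ^ 3 + 1 ^ 3 + 3 = ((1 : ℕ) : ZMod 2) := by decide

lemma dec3 : ∀ m : ZMod 3, ∃ z w : ZMod 3, z ≠ 0 ∧ w ≠ 0 ∧ 1 ^ 2 + 1 ^ 2 + z ^ 3 + w ^ 3 + 3 = m := by decide

lemma dec5 : ∀ m : ZMod 5, ∃ x y z : ZMod 5, x ≠ 0 ∧ y ≠ 0 ∧ z ≠ 0 ∧ x ^ 2 + y ^ 2 + z ^ 3 = m := by decide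

set_option maxRecDepth 10000 in
lemma dec7 : ∀ m : ZMod 7, ∃ x y z : ZMod 7, x ≠ 0 ∧ y ≠ 0 ∧ z ≠ 0 ∧ x ^ 2 + y ^ 2 + z ^ 3 = m := by decide

lemma MM_pos (c p n : ℕ) (hp : p.Prime) (hn : ¬ 2 ∣ n) : 1 ≤ MM c p n := by
  have : Fact p.Prime := ⟨hp⟩
  suffices h : ∃ x : Fin 7 → ZMod p, (∀ i, x i ≠ 0) ∧ ∑ i, x i ^ (ex c i) = n by
    obtain ⟨x, hx, hs⟩ := h
    unfold MM
    have : Nonempty {x : Fin 7 → (ZMod p)ˣ // ∑ i, ((x i : ZMod p)) ^ (ex c i) = (n : ZMod p)} :=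
      ⟨⟨fun i => Units.mk0 (x i) (hx i), by simpa using hs⟩⟩
    exact Nat.card_pos
  have red : ∀ x y z w : ZMod p, x ≠ 0 → y ≠ 0 → z ≠ 0 → w ≠ 0 → x ^ 2 + y ^ 2 + z ^ 3 + w ^ 3 + 3 = n →
      ∃ x : Fin 7 → ZMod p, (∀ i, x i ≠ 0) ∧ ∑ i, x i ^ (ex c i) = n := by
    intro x y z w hx hy hz hw h
    refine ⟨![x, y, z, w, 1, 1, 1], ?_, ?_⟩
    · intro i; fin_cases i <;> simp [hx, hy, hz, hw]
    · rw [← h]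
      simp [Fin.sum_univ_succ, ex]
      ring
  have red2 : (∀ m : ZMod p, ∃ x y z : ZMod p, x ≠ 0 ∧ y ≠ 0 ∧ z ≠ 0 ∧ x ^ 2 + y ^ 2 + z ^ 3 = m) →
      ∃ x : Fin 7 → ZMod p, (∀ i, x i ≠ 0) ∧ ∑ i, x i ^ (ex c i) = n := by
    intro h
    obtain ⟨x, y, z, hx, hy, hz, hh⟩ := h (n - 4)
    refine red x y z 1 hx hy hz one_ne_zero ?_
    rw [hh]; ring
  by_cases h11 : 11 ≤ p
  · exact red2 (sol_big p h11)
  · have h2 := hp.two_le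
    have : p = 2 ∨ p = 3 ∨ p = 5 ∨ p = 7 := by
      interval_cases p <;> first | omega | (exfalso; revert hp; decide)
    rcases this with rfl | rfl | rfl | rfl
    · apply red 1 1 1 1 one_ne_zero one_ne_zero one_ne_zero one_ne_zero
      have h1 : n % 2 = 1 := by omega
      have : ((n : ℕ) : ZMod 2) = ((1 : ℕ) : ZMod 2) := by
        rw [ZMod.natCast_eq_natCast_iff]; exact h1
      rw [this]; exact dec2
    · obtain ⟨z, w, hz, hw, hh⟩ := dec3 n
      exact red 1 1 z w one_ne_zero one_ne_zero hz hw hh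
    · exact red2 dec5
    · exact red2 dec7

lemma e_sum {ι : Type*} (s : Finset ι) (g : ι → ℝ) : ∏ i ∈ s, e (g i) = e (∑ i ∈ s, g i) := by
  classical
  induction s using Finset.induction_on with
  | empty => simp [e_zero]
  | insert a s ha ih => rw [prod_insert ha, sum_insert ha, ih, e_add]

lemma SS_units (k q : ℕ) [NeZero q] (a : ℤ) :
    SS k q a = ∑ u : (ZMod q)ˣ, e (a * (((u : ZMod q).val ^ k : ℕ) : ℝ) / q) := by
  unfold SS
  symm
  apply Finset.sum_bij (fun (u : (ZMod q)ˣ) _ => (u : ZMod q).val)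
  · intro u _
    rw [mem_filter, mem_range]
    exact ⟨ZMod.val_lt _, ZMod.val_coe_unit_coprime u⟩
  · intro u _ u' _ h
    exact Units.ext (ZMod.val_injective q h)
  · intro v hv
    rw [mem_filter, mem_range] at hv
    refine ⟨ZMod.unitOfCoprime v hv.2, mem_univ _, ?_⟩
    rw [ZMod.coe_unitOfCoprime, ZMod.val_natCast, Nat.mod_eq_of_lt hv.1]
  · intro u _
    rfl

lemma MM_char (c q n : ℕ) (hq : 0 < q) :
    ((q * MM c q n : ℕ) : ℂ) = ∑ b ∈ range q, (∏ i, SS (ex c i) q b) * e (-((b : ℝ) * n / q)) := by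
  classical
  have : NeZero q := ⟨hq.ne'⟩
  have hq0 : (q : ℝ) ≠ 0 := by exact_mod_cast hq.ne'
  have h1 : ∀ b : ℕ, (∏ i, SS (ex c i) q b) * e (-((b : ℝ) * n / q)) =
      ∑ x : Fin 7 → (ZMod q)ˣ, e ((((∑ i, ((x i : ZMod q).val ^ (ex c i) : ℕ) : ℤ) - n : ℤ) : ℝ) * b / q) := by
    intro b
    simp_rw [SS_units]
    rw [Finset.prod_univ_sum, Fintype.piFinset_univ, sum_mul]
    apply sum_congr rfl
    intro x _
    rw [e_sum, ← e_add]
    congr 1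
    push_cast
    rw [← sum_div, ← mul_sum]
    field_simp
    ring
  rw [sum_congr rfl (fun b _ => h1 b), sum_comm]
  rw [sum_congr rfl (fun x _ => orth q hq _)]
  have h2 : MM c q n = (univ.filter fun x : Fin 7 → (ZMod q)ˣ => (q : ℤ) ∣ ((∑ i, ((x i : ZMod q).val ^ (ex c i) : ℕ) : ℤ) - n : ℤ)).card := by
    unfold MM
    rw [Nat.card_eq_fintype_card, Fintype.card_subtype]
    congr 1
    apply filter_congr
    intro x _
    rw [← ZMod.intCast_zmod_eq_zero_iff_dvd]
    push_cast
    simp only [ZMod.natCast_val, ZMod.cast_id', id]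
    rw [sub_eq_zero]
  rw [← sum_filter, sum_const, ← h2, nsmul_eq_mul]
  push_cast; ring

end MajArc

namespace MajArc

lemma ex_pos (c : ℕ) (hc : 0 < c) (i : Fin 7) : 0 < ex c i := by
  fin_cases i <;> simp [ex, hc]

lemma SS_zero (k q : ℕ) : SS k q 0 = (q.totient : ℂ) := by
  unfold SS
  rw [← card_units q]
  simp [e_zero]

lemma num_large (p : ℝ) (hp : 2 ≤ p) (C : ℝ) (hC : 1 ≤ C) :
    p * (C * p ^ (1 / 100 : ℝ) * √p) ^ 7 ≤ 128 * C ^ 7 / p ^ 2 * (p - 1) ^ 7 := by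
  have hp0 : 0 < p := by linarith
  have h1 : (p ^ (1 / 100 : ℝ) * √p) ^ 7 ≤ p ^ 4 := by
    rw [Real.sqrt_eq_rpow, ← Real.rpow_add hp0, ← Real.rpow_natCast, ← Real.rpow_mul hp0.le, ← Real.rpow_natCast]
    apply Real.rpow_le_rpow_of_exponent_le (by linarith)
    norm_num
  have h2 : p ^ 7 ≤ 128 * (p - 1) ^ 7 := by
    calc p ^ 7 ≤ (2 * (p - 1)) ^ 7 := by gcongr; linarith
      _ = _ := by ring
  rw [mul_assoc C, mul_pow, div_mul_eq_mul_div, le_div_iff₀ (by positivity)]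
  calc p * (C ^ 7 * (p ^ (1 / 100 : ℝ) * √p) ^ 7) * p ^ 2 ≤ p * (C ^ 7 * p ^ 4) * p ^ 2 := by gcongr
    _ = C ^ 7 * p ^ 7 := by ring
    _ ≤ C ^ 7 * (128 * (p - 1) ^ 7) := by gcongr
    _ = _ := by ring

lemma MM_large (c : ℕ) (hc : 0 < c) : ∃ K : ℝ, 1 ≤ K ∧ ∀ p n : ℕ, p.Prime →
    (1 - K / (p : ℝ) ^ 2) * ((p : ℝ) - 1) ^ 7 ≤ p * MM c p n := by
  choose C hC1 hC using fun i : Fin 7 => arith_bounds (ex c i) (ex_pos c hc i)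
  set D := ∑ i, C i with hD
  have hDi : ∀ i, C i ≤ D := fun i => single_le_sum (fun j _ => zero_le_one.trans (hC1 j)) (mem_univ i)
  have hD1 : 1 ≤ D := (hC1 0).trans (hDi 0)
  refine ⟨128 * D ^ 7, by nlinarith [one_le_pow₀ hD1 (n := 7)], ?_⟩
  intro p n hp
  have hp2 : (2:ℝ) ≤ p := by exact_mod_cast hp.two_le
  have hch := MM_char c p n hp.pos
  have hr : range p = insert 0 ((range p).erase 0) := (insert_erase (mem_range.mpr hp.pos)).symm
  rw [hr, sum_insert (notMem_erase _ _)] at hch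
  have h0 : (∏ i, SS (ex c i) p ((0:ℕ):ℤ)) * e (-(((0:ℕ) : ℝ) * n / p)) = (((p:ℝ) - 1) ^ 7 : ℝ) := by
    simp only [Nat.cast_zero, SS_zero, zero_mul, zero_div, neg_zero, e_zero, mul_one, prod_const, card_univ, Fintype.card_fin]
    rw [Nat.totient_prime hp, Nat.cast_sub hp.one_le]
    push_cast; ring
  rw [h0] at hch
  have hrest : ‖∑ b ∈ (range p).erase 0, (∏ i, SS (ex c i) p b) * e (-((b : ℝ) * n / p))‖ ≤
      p * (D * (p:ℝ) ^ (1 / 100 : ℝ) * √p) ^ 7 := by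
    have hb : ∀ b ∈ (range p).erase 0, ‖(∏ i, SS (ex c i) p b) * e (-((b : ℝ) * n / p))‖ ≤ (D * (p:ℝ) ^ (1 / 100 : ℝ) * √p) ^ 7 := by
      intro b hb
      rw [mem_erase, mem_range] at hb
      rw [norm_mul, norm_e, mul_one, norm_prod]
      calc _ ≤ ∏ _i : Fin 7, (D * (p:ℝ) ^ (1 / 100 : ℝ) * √p) := by
            apply prod_le_prod (fun _ _ => norm_nonneg _)
            intro i _
            refine (SS_le (ex c i) p b (ex_pos c hc i) hp.pos ?_).trans ?_
            · rw [Nat.isCoprime_iff_coprime]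
              exact (Nat.coprime_of_lt_prime (by omega) hb.2 hp).symm
            · gcongr
              refine ((hC i p hp.pos).1).trans ?_
              gcongr
              exact hDi i
        _ = _ := by simp
    refine (norm_sum_le_of_le _ hb).trans ?_
    rw [sum_const, nsmul_eq_mul]
    gcongr
    refine (card_le_card (erase_subset _ _)).trans ?_
    rw [card_range]
  have hre : ((p:ℝ) - 1) ^ 7 - p * MM c p n ≤ p * (D * (p:ℝ) ^ (1 / 100 : ℝ) * √p) ^ 7 := by
    refine le_trans ?_ hrest
    have : ∑ b ∈ (range p).erase 0, (∏ i, SS (ex c i) p b) * e (-((b : ℝ) * n / p)) = ((p * MM c p n - ((p:ℝ) - 1) ^ 7 : ℝ) : ℂ) := by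
      rw [← sub_eq_iff_eq_add'] at hch
      rw [← hch]; push_cast; ring
    rw [this, Complex.norm_real, Real.norm_eq_abs]
    have := neg_abs_le (p * MM c p n - ((p:ℝ) - 1) ^ 7)
    linarith
  have := num_large p hp2 D hD1
  linarith

noncomputable def gW (c W n : ℕ) : ℝ := MM c W n * W / (W.totient : ℝ) ^ 7

lemma gW_mul (c a b n : ℕ) (h : a.Coprime b) : gW c (a * b) n = gW c a n * gW c b n := by
  unfold gW
  rw [MM_mul c a b n h, Nat.totient_mul h]
  push_cast
  rw [div_mul_div_comm]
  congr 1 <;> ring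

lemma exp_aux (x : ℝ) (h0 : 0 ≤ x) (h1 : x ≤ 1 / 2) : Real.exp (-(2 * x)) ≤ 1 - x := by
  have h2 : 1 + 2 * x ≤ Real.exp (2 * x) := by linarith [Real.add_one_le_exp (2 * x)]
  rw [Real.exp_neg]
  calc (Real.exp (2 * x))⁻¹ ≤ (1 + 2 * x)⁻¹ := inv_anti₀ (by linarith) h2
    _ ≤ 1 - x := by
      rw [inv_le_iff_one_le_mul₀ (by linarith)]
      nlinarith

lemma gW_pp (c : ℕ) (hc : 0 < c) : ∃ K : ℝ, 0 ≤ K ∧ ∀ p v n : ℕ, p.Prime → 0 < v → ¬ 2 ∣ n →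
    Real.exp (-(K / (p : ℝ) ^ 2)) ≤ gW c (p ^ v) n := by
  obtain ⟨K, hK1, hK⟩ := MM_large c hc
  refine ⟨2 * K + (2 * K) ^ 4, by positivity, ?_⟩
  intro p v n hp hv hn
  have hp2 : (2:ℝ) ≤ p := by exact_mod_cast hp.two_le
  have hp0 : (0:ℝ) < p := by linarith
  have hp1 : (0:ℝ) < (p:ℝ) - 1 := by linarith
  have hlift : (((p:ℝ) ^ (v - 1)) ^ 6 * MM c p n) ≤ MM c (p ^ v) n := by
    by_cases h5 : p = 5
    · have := MM_lift c p v n hp hv 2 (by subst h5; simp [ex]; decide)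
      exact_mod_cast this
    · have := MM_lift c p v n hp hv 4 (by
        change Nat.Coprime 5 p
        exact ((Nat.coprime_primes (by norm_num) hp).mpr (Ne.symm h5)))
      exact_mod_cast this
  have hge : p * MM c p n / ((p:ℝ) - 1) ^ 7 ≤ gW c (p ^ v) n := by
    unfold gW
    rw [Nat.totient_prime_pow hp hv]
    push_cast [Nat.cast_sub hp.one_le]
    rw [div_le_div_iff₀ (by positivity) (by positivity)]
    have hv' : (p:ℝ) ^ v = (p:ℝ) ^ (v - 1) * p := by rw [← pow_succ]; congr 1; omega
    rw [hv']
    calc (p:ℝ) * MM c p n * ((p:ℝ) ^ (v - 1) * (p - 1)) ^ 7 =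
        (((p:ℝ) ^ (v - 1)) ^ 6 * MM c p n) * (((p:ℝ) ^ (v - 1) * p) * ((p:ℝ) - 1) ^ 7) := by ring
      _ ≤ MM c (p ^ v) n * (((p:ℝ) ^ (v - 1) * p) * ((p:ℝ) - 1) ^ 7) := by gcongr
      _ = _ := by ring
  refine le_trans ?_ hge
  have hKp : 0 ≤ K / (p:ℝ) ^ 2 := by positivity
  rw [le_div_iff₀ (by positivity)]
  by_cases hs : K / (p:ℝ) ^ 2 ≤ 1 / 2
  · refine le_trans ?_ (hK p n hp)
    gcongr
    refine le_trans ?_ (exp_aux _ hKp hs)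
    apply Real.exp_le_exp.mpr
    have : 0 ≤ (2 * K) ^ 4 / (p:ℝ) ^ 2 := by positivity
    rw [add_div, mul_div_assoc]
    linarith
  · rw [not_le, lt_div_iff₀ (by positivity)] at hs
    have hlt : (p:ℝ) ^ 2 ≤ 2 * K := by linarith
    have hM : (1:ℝ) ≤ MM c p n := by exact_mod_cast MM_pos c p n hp hn
    have h6 : ((p:ℝ) ^ 2) ^ 3 ≤ (2 * K) ^ 3 := by gcongr
    have ht : (p:ℝ) ^ 6 ≤ (2 * K + (2 * K) ^ 4) / (p:ℝ) ^ 2 := by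
      rw [le_div_iff₀ (by positivity)]
      calc (p:ℝ) ^ 6 * p ^ 2 = ((p:ℝ) ^ 2) ^ 4 := by ring
        _ ≤ (2 * K) ^ 4 := by gcongr
        _ ≤ _ := by linarith
    have hexp : Real.exp (-((2 * K + (2 * K) ^ 4) / (p:ℝ) ^ 2)) ≤ ((p:ℝ) ^ 6)⁻¹ := by
      rw [Real.exp_neg]
      apply inv_anti₀ (by positivity)
      linarith [Real.add_one_le_exp ((2 * K + (2 * K) ^ 4) / (p:ℝ) ^ 2)]
    calc _ ≤ ((p:ℝ) ^ 6)⁻¹ * (p:ℝ) ^ 7 := by gcongr; linarith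
      _ = p * 1 := by field_simp
      _ ≤ p * MM c p n := by gcongr

lemma gW_low (c : ℕ) (hc : 0 < c) : ∃ κ : ℝ, 0 < κ ∧ ∀ W n : ℕ, 0 < W → ¬ 2 ∣ n → κ ≤ gW c W n := by
  obtain ⟨K, hK0, hK⟩ := gW_pp c hc
  have hsum : Summable fun n : ℕ => 1 / (n : ℝ) ^ 2 := Real.summable_one_div_nat_pow.mpr (by norm_num)
  refine ⟨Real.exp (-(K * ∑' n : ℕ, 1 / (n : ℝ) ^ 2)), Real.exp_pos _, ?_⟩
  intro W n hW hn
  have h : ∀ W : ℕ, 0 < W → Real.exp (-(K * ∑ p ∈ W.primeFactors, 1 / (p : ℝ) ^ 2)) ≤ gW c W n := by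
    intro W
    induction W using Nat.recOnPosPrimePosCoprime with
    | prime_pow p v hp hv =>
      intro _
      rw [Nat.primeFactors_prime_pow hv.ne' hp, sum_singleton, mul_one_div]
      exact hK p v n hp hv hn
    | zero => intro h; exact absurd h (lt_irrefl 0)
    | one =>
      intro _
      have : MM c 1 n = 1 := by
        unfold MM
        rw [Nat.card_eq_one_iff_unique]
        refine ⟨⟨fun x y => Subtype.ext (Subsingleton.elim _ _)⟩, ⟨⟨fun _ => 1, Subsingleton.elim _ _⟩⟩⟩
      simp [gW, this]
    | coprime a b ha hb hab iha ihb =>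
      intro _
      rw [gW_mul c a b n hab, hab.primeFactors_mul, sum_union hab.disjoint_primeFactors, mul_add, neg_add, Real.exp_add]
      have h1 := iha (by omega)
      exact mul_le_mul h1 (ihb (by omega)) (Real.exp_pos _).le ((Real.exp_pos _).le.trans h1)
  refine le_trans ?_ (h W hW)
  apply Real.exp_le_exp.mpr
  apply neg_le_neg
  gcongr
  exact hsum.sum_le_tsum _ (fun i _ => by positivity)

end MajArc

namespace MajArc

noncomputable def Tset (n k : ℕ) : Finset ℕ := (Finset.range (n + 1)).filter
      (fun p : ℕ => p.Prime ∧ P n k / 2 < (p : ℝ) ∧ (p : ℝ) ≤ P n k)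

noncomputable def T5set (n c : ℕ) : Finset ℕ := (Finset.range (n + 1)).filter
      (fun p : ℕ => p.Prime ∧ 1 < (p : ℝ) ∧ (p : ℝ) ≤ P n 5 ^ _root_.θ c)

def ex6 (c : ℕ) : Fin 6 → ℕ := ![2, 3, 3, 5, 6, c]

noncomputable def TT (n c : ℕ) : Fin 6 → Finset ℕ := ![Tset n 2, Tset n 3, Tset n 3, T5set n c, Tset n 6, Tset n c]

noncomputable def idx (n c : ℕ) : Finset (ℕ × (Fin 6 → ℕ)) := Tset n 2 ×ˢ Fintype.piFinset (TT n c)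

noncomputable def wt (x : ℕ × (Fin 6 → ℕ)) : ℝ := Real.log x.1 * ∏ i, Real.log (x.2 i)

def mm (n c : ℕ) (x : ℕ × (Fin 6 → ℕ)) : ℤ := (x.1 : ℤ) ^ 2 + ∑ i, (x.2 i : ℤ) ^ (ex6 c i) - n

lemma wt_nonneg (x : ℕ × (Fin 6 → ℕ)) : 0 ≤ wt x :=
  mul_nonneg (Real.log_natCast_nonneg _) (prod_nonneg fun _ _ => Real.log_natCast_nonneg _)

noncomputable def Phi (n c : ℕ) (α : ℝ) : ℂ := F n c α * e (-(α * n))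

lemma Phi_exp (n c : ℕ) (α : ℝ) : Phi n c α = ∑ x ∈ idx n c, (wt x : ℂ) * e (α * (mm n c x : ℝ)) := by
  have h1 : F n c α = (∑ p ∈ Tset n 2, e (α * (p : ℝ) ^ 2) * (Real.log p : ℂ)) *
      ∏ i : Fin 6, ∑ p ∈ TT n c i, e (α * (p : ℝ) ^ (ex6 c i)) * (Real.log p : ℂ) := by
    have hf : ∀ k, ∑ p ∈ Tset n k, e (α * (p : ℝ) ^ k) * (Real.log p : ℂ) = f n k α := fun k => rfl
    have hf5 : ∑ p ∈ T5set n c, e (α * (p : ℝ) ^ 5) * (Real.log p : ℂ) = f5 n c α := rfl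
    rw [Fin.prod_univ_six]
    change _ = (∑ p ∈ Tset n 2, e (α * (p : ℝ) ^ 2) * (Real.log p : ℂ)) *
      ((∑ p ∈ Tset n 2, e (α * (p : ℝ) ^ 2) * (Real.log p : ℂ)) * (∑ p ∈ Tset n 3, e (α * (p : ℝ) ^ 3) * (Real.log p : ℂ)) *
      (∑ p ∈ Tset n 3, e (α * (p : ℝ) ^ 3) * (Real.log p : ℂ)) * (∑ p ∈ T5set n c, e (α * (p : ℝ) ^ 5) * (Real.log p : ℂ)) *
      (∑ p ∈ Tset n 6, e (α * (p : ℝ) ^ 6) * (Real.log p : ℂ)) * (∑ p ∈ Tset n c, e (α * (p : ℝ) ^ c) * (Real.log p : ℂ)))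
    rw [hf, hf, hf, hf, hf5]
    unfold F
    ring
  unfold Phi idx
  rw [h1, prod_univ_sum, sum_mul_sum, sum_product, sum_mul]
  apply sum_congr rfl
  intro p _
  rw [sum_mul]
  apply sum_congr rfl
  intro y _
  rw [prod_mul_distrib, e_sum]
  unfold wt mm
  push_cast
  rw [show α * ((p:ℝ) ^ 2 + ∑ i, (y i : ℝ) ^ (ex6 c i) - n) = α * (p:ℝ) ^ 2 + (∑ i, α * (y i : ℝ) ^ (ex6 c i) + -(α * n)) by
    rw [← mul_sum]; ring, e_add, e_add]
  ring

lemma e_cont : Continuous e := by unfold e; fun_prop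

lemma Phi_cont (n c : ℕ) : Continuous (Phi n c) := by
  have h : Phi n c = fun α => ∑ x ∈ idx n c, (wt x : ℂ) * e (α * (mm n c x : ℝ)) := by
    funext α; exact Phi_exp n c α
  rw [h]
  have := e_cont
  fun_prop

lemma Phi_per (n c : ℕ) (α : ℝ) : Phi n c (α + 1) = Phi n c α := by
  rw [Phi_exp, Phi_exp]
  apply sum_congr rfl
  intro x _
  congr 1
  exact e_congr (mm n c x) (by ring)

/-- triangle kernel -/
noncomputable def tri (h β : ℝ) : ℝ := max 0 (1 - |β| / h)

lemma tri_cont (h : ℝ) : Continuous (tri h) := by unfold tri; fun_prop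

lemma re_e (x : ℝ) : (e x).re = Real.cos (2 * Real.pi * x) := by
  rw [e_eq, Complex.exp_ofReal_mul_I_re]

noncomputable def Jm (h : ℝ) (m : ℤ) : ℝ := ∫ β in (-h)..h, tri h β * Real.cos (2 * Real.pi * (β * m))

lemma Jm_eq (h : ℝ) (hh : 0 < h) (m : ℤ) : Jm h m = 2 * ∫ β in (0:ℝ)..h, (1 - β / h) * Real.cos (2 * Real.pi * (β * m)) := by
  have hc : Continuous fun β => tri h β * Real.cos (2 * Real.pi * (β * m)) := by
    have := tri_cont h
    fun_prop
  have h1 : ∫ β in (0:ℝ)..h, tri h β * Real.cos (2 * Real.pi * (β * m)) = ∫ β in (0:ℝ)..h, (1 - β / h) * Real.cos (2 * Real.pi * (β * m)) := by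
    apply intervalIntegral.integral_congr
    intro β hβ
    rw [Set.uIcc_of_le hh.le] at hβ
    simp only
    unfold tri
    rw [abs_of_nonneg hβ.1, max_eq_right]
    rw [sub_nonneg, div_le_one hh]
    exact hβ.2
  have h2 : ∫ β in (-h)..0, tri h β * Real.cos (2 * Real.pi * (β * m)) = ∫ β in (0:ℝ)..h, tri h β * Real.cos (2 * Real.pi * (β * m)) := by
    have := intervalIntegral.integral_comp_neg (a := 0) (b := h) (fun β => tri h β * Real.cos (2 * Real.pi * (β * m)))
    rw [neg_zero] at this
    rw [← this]
    apply intervalIntegral.integral_congr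
    intro β _
    simp only
    unfold tri
    rw [abs_neg, show 2 * Real.pi * (-β * (m:ℝ)) = -(2 * Real.pi * (β * m)) by ring, Real.cos_neg]
  unfold Jm
  rw [← intervalIntegral.integral_add_adjacent_intervals (b := 0) (hc.intervalIntegrable _ _) (hc.intervalIntegrable _ _), h2, h1]
  ring

lemma Jm_nonneg (h : ℝ) (hh : 0 < h) (m : ℤ) : 0 ≤ Jm h m := by
  rw [Jm_eq h hh]
  rcases eq_or_ne m 0 with rfl | hm
  · apply mul_nonneg (by norm_num)
    apply intervalIntegral.integral_nonneg hh.le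
    intro β hβ
    simp only [Int.cast_zero, mul_zero, Real.cos_zero, mul_one]
    rw [sub_nonneg, div_le_one hh]
    exact hβ.2
  · set w := 2 * Real.pi * (m:ℝ) with hw
    have hm' : (m:ℝ) ≠ 0 := by exact_mod_cast hm
    have hw0 : w ≠ 0 := mul_ne_zero (mul_ne_zero two_ne_zero Real.pi_ne_zero) hm'
    have hd : ∀ β ∈ Set.uIcc 0 h, HasDerivAt (fun β => (1 - β / h) * (Real.sin (w * β) / w) - Real.cos (w * β) / (w ^ 2 * h))
        ((1 - β / h) * Real.cos (2 * Real.pi * (β * m))) β := by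
      intro β _
      have e1 : HasDerivAt (fun β : ℝ => w * β) w β := by simpa using (hasDerivAt_id β).const_mul w
      have e2 : HasDerivAt (fun β : ℝ => 1 - β / h) (-(1 / h)) β := by
        simpa using ((hasDerivAt_id β).div_const h).const_sub 1
      refine ((e2.mul (e1.sin.div_const w)).sub (e1.cos.div_const (w ^ 2 * h))).congr_deriv ?_
      rw [show 2 * Real.pi * (β * (m:ℝ)) = w * β by rw [hw]; ring]
      field_simp
      ring
    rw [intervalIntegral.integral_eq_sub_of_hasDerivAt hd ((by fun_prop : Continuous fun β : ℝ => (1 - β / h) * Real.cos (2 * Real.pi * (β * m))).intervalIntegrable _ _)]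
    rw [div_self hh.ne', mul_zero, Real.sin_zero, Real.cos_zero]
    have h1 := Real.cos_le_one (w * h)
    have h2 : Real.cos (w * h) / (w ^ 2 * h) ≤ 1 / (w ^ 2 * h) := by gcongr
    simp only [sub_self, zero_mul, zero_div, mul_zero, sub_zero]
    linarith

lemma Jm_low (h : ℝ) (hh : 0 < h) (m : ℤ) (hm : |(m:ℝ)| * h ≤ 1 / 8) : h / 2 ≤ Jm h m := by
  rw [Jm_eq h hh]
  have h1 : ∫ β in (0:ℝ)..h, (1 - β / h) * (1 / 2) ≤ ∫ β in (0:ℝ)..h, (1 - β / h) * Real.cos (2 * Real.pi * (β * m)) := by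
    apply intervalIntegral.integral_mono_on hh.le
      ((by fun_prop : Continuous fun β : ℝ => (1 - β / h) * (1 / 2)).intervalIntegrable _ _)
      ((by fun_prop : Continuous fun β : ℝ => (1 - β / h) * Real.cos (2 * Real.pi * (β * m))).intervalIntegrable _ _)
    intro β hβ
    have a1 : 0 ≤ 1 - β / h := by
      rw [sub_nonneg, div_le_one hh]; exact hβ.2
    apply mul_le_mul_of_nonneg_left _ a1
    rw [← Real.cos_pi_div_three, ← Real.cos_abs (2 * Real.pi * (β * m))]
    apply Real.cos_le_cos_of_nonneg_of_le_pi (abs_nonneg _) (by linarith [Real.pi_pos])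
    rw [abs_mul, abs_of_nonneg (by positivity : (0:ℝ) ≤ 2 * Real.pi), abs_mul, abs_of_nonneg hβ.1]
    have a2 : β * |(m:ℝ)| ≤ 1 / 8 := by
      refine le_trans ?_ hm
      rw [mul_comm]; gcongr; exact hβ.2
    nlinarith [Real.pi_pos]
  have h2 : ∫ β in (0:ℝ)..h, (1 - β / h) * (1 / 2) = h / 4 := by
    rw [intervalIntegral.integral_mul_const, intervalIntegral.integral_sub (by simp) ((by fun_prop : Continuous fun β : ℝ => β / h).intervalIntegrable _ _),
      intervalIntegral.integral_div, integral_id]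
    simp
    field_simp
    norm_num
  linarith

end MajArc

namespace MajArc

noncomputable def GG (n c W : ℕ) (h : ℝ) : ℂ :=
  ∑ b ∈ Finset.Icc 1 W, ∫ β in (-h)..h, Phi n c ((b:ℝ) / W + β) * (tri h β : ℂ)

noncomputable def JC (h : ℝ) (m : ℤ) : ℂ := ∫ β in (-h)..h, e (β * m) * (tri h β : ℂ)

lemma JC_re (h : ℝ) (m : ℤ) : (JC h m).re = Jm h m := by
  unfold JC Jm
  have hi : IntervalIntegrable (fun β : ℝ => e (β * m) * (tri h β : ℂ)) volume (-h) h := by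
    have := e_cont
    have := tri_cont h
    exact (by fun_prop : Continuous fun β : ℝ => e (β * m) * (tri h β : ℂ)).intervalIntegrable _ _
  have := Complex.reCLM.intervalIntegral_comp_comm hi
  simp only [Complex.reCLM_apply] at this
  rw [← this]
  apply intervalIntegral.integral_congr
  intro β _
  simp only
  rw [Complex.re_mul_ofReal, re_e, mul_comm]

lemma orth_Icc (W : ℕ) (hW : 0 < W) (m : ℤ) : ∑ b ∈ Finset.Icc 1 W, e ((b:ℝ) / W * m) = if (W:ℤ) ∣ m then (W:ℂ) else 0 := by
  rw [← orth W hW m]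
  have h1 : ∑ b ∈ Finset.Icc 1 W, e ((b:ℝ) / W * m) = ∑ b ∈ range W, e (((b + 1 : ℕ):ℝ) / W * m) := by
    rw [← Finset.Ico_add_one_right_eq_Icc, Finset.sum_Ico_eq_sum_range]
    simp [add_comm]
  have h2 := Finset.sum_range_succ' (fun b : ℕ => e ((b:ℝ) / W * m)) W
  have h3 := Finset.sum_range_succ (fun b : ℕ => e ((b:ℝ) / W * m)) W
  have hW' : (W:ℝ) ≠ 0 := by positivity
  have h4 : e ((W:ℝ) / W * m) = e (((0:ℕ):ℝ) / W * m) := e_congr m (by rw [div_self hW']; simp)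
  rw [h1]
  have h5 : ∑ b ∈ range W, e (((b + 1 : ℕ):ℝ) / W * m) = ∑ b ∈ range W, e ((b:ℝ) / W * m) := by
    rw [h2, h4] at h3
    exact add_right_cancel h3
  rw [h5]
  apply sum_congr rfl
  intro b _
  congr 1
  ring

lemma GG_eq (n c W : ℕ) (hW : 0 < W) (h : ℝ) :
    GG n c W h = ∑ x ∈ idx n c, (wt x : ℂ) * (if (W:ℤ) ∣ mm n c x then (W:ℂ) else 0) * JC h (mm n c x) := by
  have h1 : ∀ b : ℕ, ∫ β in (-h)..h, Phi n c ((b:ℝ) / W + β) * (tri h β : ℂ) =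
      ∑ x ∈ idx n c, (wt x : ℂ) * e ((b:ℝ) / W * (mm n c x)) * JC h (mm n c x) := by
    intro b
    have e1 : ∀ β : ℝ, Phi n c ((b:ℝ) / W + β) * (tri h β : ℂ) =
        ∑ x ∈ idx n c, ((wt x : ℂ) * e ((b:ℝ) / W * (mm n c x))) * (e (β * (mm n c x)) * (tri h β : ℂ)) := by
      intro β
      rw [Phi_exp, sum_mul]
      apply sum_congr rfl
      intro x _
      rw [add_mul, e_add]
      ring
    simp only [e1]
    rw [intervalIntegral.integral_finsetSum]
    · apply sum_congr rfl
      intro x _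
      rw [intervalIntegral.integral_const_mul]
      rfl
    · intro x _
      have := e_cont
      have := tri_cont h
      exact (by fun_prop : Continuous fun β : ℝ => (wt x : ℂ) * e ((b:ℝ) / W * (mm n c x)) * (e (β * (mm n c x)) * (tri h β : ℂ))).intervalIntegrable _ _
  unfold GG
  simp only [h1]
  rw [sum_comm]
  apply sum_congr rfl
  intro x _
  rw [← sum_mul, ← mul_sum, orth_Icc W hW]

lemma GG_low (n c W : ℕ) (hW : 0 < W) (h : ℝ) (hh : 0 < h) :
    W * (h / 2) * ∑ x ∈ (idx n c).filter (fun x => (W:ℤ) ∣ mm n c x ∧ |(mm n c x : ℝ)| * h ≤ 1 / 8), wt x ≤ (GG n c W h).re := by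
  classical
  rw [GG_eq n c W hW, Complex.re_sum, sum_filter, mul_sum]
  apply sum_le_sum
  intro x _
  have hj := Jm_nonneg h hh (mm n c x)
  have hw := wt_nonneg x
  by_cases hd : (W:ℤ) ∣ mm n c x
  · have e1 : ((wt x : ℂ) * (if (W:ℤ) ∣ mm n c x then (W:ℂ) else 0) * JC h (mm n c x)).re = wt x * W * Jm h (mm n c x) := by
      rw [if_pos hd, ← JC_re, show (wt x : ℂ) * (W:ℂ) = ((wt x * W : ℝ) : ℂ) by push_cast; rfl, Complex.re_ofReal_mul]
    rw [e1]
    by_cases hm : |(mm n c x : ℝ)| * h ≤ 1 / 8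
    · rw [if_pos ⟨hd, hm⟩]
      have := Jm_low h hh _ hm
      calc W * (h / 2) * wt x = wt x * W * (h / 2) := by ring
        _ ≤ _ := by gcongr
    · rw [if_neg (by tauto)]
      rw [mul_zero]; positivity
  · rw [if_neg (by tauto), if_neg hd]
    simp

end MajArc

namespace MajArc

lemma S_comb (n c W : ℕ) (hW : 0 < W) (h : ℝ) (Win : Fin 6 → Finset ℕ) (wp : (Fin 6 → ℕ) → Finset ℕ)
    (l : Fin 6 → ℝ) (l0 : ℝ) (hl : ∀ i, 0 ≤ l i) (hl0 : 0 ≤ l0)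
    (hmem : ∀ y ∈ Fintype.piFinset Win, ∀ p ∈ wp y, (p, y) ∈ idx n c ∧ |(mm n c (p, y) : ℝ)| * h ≤ 1 / 8)
    (hlow : ∀ i, ∀ r : ℕ, r.Coprime W → l i ≤ ∑ p ∈ (Win i).filter (fun p => p ≡ r [MOD W]), Real.log p)
    (hlow0 : ∀ y ∈ Fintype.piFinset Win, ∀ r : ℕ, r.Coprime W → l0 ≤ ∑ p ∈ (wp y).filter (fun p => p ≡ r [MOD W]), Real.log p) :
    (MM c W n : ℝ) * (l0 * ∏ i, l i) ≤
      ∑ x ∈ (idx n c).filter (fun x => (W:ℤ) ∣ mm n c x ∧ |(mm n c x : ℝ)| * h ≤ 1 / 8), wt x := by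
  classical
  have : NeZero W := ⟨hW.ne'⟩
  have := Fintype.ofFinite {x : Fin 7 → (ZMod W)ˣ // ∑ i, (x i:ZMod W)^(ex c i) = (n:ZMod W)}
  set s := (idx n c).filter (fun x => (W:ℤ) ∣ mm n c x ∧ |(mm n c x : ℝ)| * h ≤ 1 / 8) with hs
  let ρ : ℕ × (Fin 6 → ℕ) → (Fin 7 → ZMod W) := fun x => Fin.cons (x.1 : ZMod W) (fun i => (x.2 i : ZMod W))
  let ι : {x : Fin 7 → (ZMod W)ˣ // ∑ i, (x i:ZMod W)^(ex c i) = (n:ZMod W)} → (Fin 7 → ZMod W) := fun v i => (v.1 i : ZMod W)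
  have hι : Function.Injective ι := by
    intro v w hvw
    apply Subtype.ext
    funext i
    exact Units.ext (congrFun hvw i)
  have h1 : ∑ v ∈ univ.image ι, ∑ x ∈ s with ρ x = v, wt x ≤ ∑ x ∈ s, wt x := by
    apply Finset.sum_fiberwise_le_sum_of_sum_fiber_nonneg
    intro v _
    exact sum_nonneg fun x _ => wt_nonneg x
  refine le_trans ?_ h1
  rw [sum_image (fun a _ b _ hab => hι hab)]
  have h2 : (MM c W n : ℝ) * (l0 * ∏ i, l i) = ∑ v : {x : Fin 7 → (ZMod W)ˣ // ∑ i, (x i:ZMod W)^(ex c i) = (n:ZMod W)}, (l0 * ∏ i, l i) := by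
    rw [sum_const, card_univ, ← Nat.card_eq_fintype_card, nsmul_eq_mul]
    rfl
  rw [h2]
  apply sum_le_sum
  rintro ⟨v, hv⟩ _
  have hcop : ∀ i, ((v i : ZMod W).val).Coprime W := fun i => ZMod.val_coe_unit_coprime (v i)
  let Win' : Fin 6 → Finset ℕ := fun i => (Win i).filter (fun p => p ≡ (v i.succ : ZMod W).val [MOD W])
  let wp' : (Fin 6 → ℕ) → Finset ℕ := fun y => (wp y).filter (fun p => p ≡ (v 0 : ZMod W).val [MOD W])
  have hW'sub : ∀ y ∈ Fintype.piFinset Win', y ∈ Fintype.piFinset Win := by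
    intro y hy
    rw [Fintype.mem_piFinset] at hy ⊢
    intro i
    exact (mem_filter.1 (hy i)).1
  have hmod : ∀ (p : ℕ) (u : ZMod W), p ≡ u.val [MOD W] → (p : ZMod W) = u := by
    intro p u hp
    rw [← ZMod.natCast_eq_natCast_iff] at hp
    rw [hp, ZMod.natCast_zmod_val]
  have hsub : ((Fintype.piFinset Win').sigma wp').image (fun z => (z.2, z.1)) ⊆ s.filter (fun x => ρ x = ι ⟨v, hv⟩) := by
    intro x hx
    rw [mem_image] at hx
    obtain ⟨⟨y, p⟩, hz, rfl⟩ := hx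
    rw [mem_sigma] at hz
    obtain ⟨hy, hp⟩ := hz
    simp only at hy hp
    have hp' := mem_filter.1 hp
    have hm := hmem y (hW'sub y hy) p hp'.1
    have e0 : (p : ZMod W) = v 0 := hmod _ _ hp'.2
    have e1 : ∀ i, (y i : ZMod W) = v i.succ := fun i => hmod _ _ (mem_filter.1 ((Fintype.mem_piFinset.1 hy) i)).2
    simp only [mem_filter]
    refine ⟨mem_filter.2 ⟨hm.1, ?_, hm.2⟩, ?_⟩
    · rw [← ZMod.intCast_zmod_eq_zero_iff_dvd]
      unfold mm
      push_cast
      rw [e0]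
      simp only [e1]
      rw [← hv, Fin.sum_univ_succ]
      exact sub_self _
    · funext i
      refine Fin.cases ?_ (fun j => ?_) i
      · exact e0
      · exact e1 j
  calc l0 * ∏ i, l i ≤ l0 * ∏ i, ∑ p ∈ Win' i, Real.log p := by
        gcongr with i
        · exact fun i _ => hl i
        · exact hlow i _ (hcop _)
    _ = ∑ y ∈ Fintype.piFinset Win', l0 * ∏ i, Real.log (y i) := by
        rw [prod_univ_sum, mul_sum]
    _ ≤ ∑ y ∈ Fintype.piFinset Win', ∑ p ∈ wp' y, wt (p, y) := by
        apply sum_le_sum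
        intro y hy
        unfold wt
        simp only
        rw [← sum_mul]
        exact mul_le_mul_of_nonneg_right (hlow0 y (hW'sub y hy) _ (hcop 0)) (prod_nonneg fun _ _ => Real.log_natCast_nonneg _)
    _ = ∑ x ∈ ((Fintype.piFinset Win').sigma wp').image (fun z => (z.2, z.1)), wt x := by
        rw [sum_image, sum_sigma]
        rintro ⟨y, p⟩ _ ⟨y', p'⟩ _ hh
        simp only [Prod.mk.injEq] at hh
        obtain ⟨rfl, rfl⟩ := hh
        rfl
    _ ≤ _ := sum_le_sum_of_subset_of_nonneg hsub fun x _ _ => wt_nonneg x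

end MajArc

namespace MajArc

noncomputable def win (ε y : ℝ) : Finset ℕ := (Ioc ⌊(1 - ε) * y⌋₊ ⌊y⌋₊).filter (fun p => p.Prime)

lemma mem_win (ε y : ℝ) (hy : 0 ≤ y) (p : ℕ) (hp : p ∈ win ε y) : p.Prime ∧ (1 - ε) * y < p ∧ (p:ℝ) ≤ y := by
  unfold win at hp
  rw [mem_filter, mem_Ioc] at hp
  exact ⟨hp.2, Nat.lt_of_floor_lt hp.1.1, (Nat.le_floor_iff hy).1 hp.1.2⟩

lemma win_low (W : ℕ) (hW : 0 < W) (ε : ℝ) (h0 : 0 < ε) (h1 : ε ≤ 1 / 2) :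
    ∃ y0 : ℝ, ∀ y ≥ y0, ∀ r : ℕ, r.Coprime W → (1 / 240000) * ε * y / W.totient ≤
      ∑ p ∈ (win ε y).filter (fun p => p ≡ r [MOD W]), Real.log p := by
  obtain ⟨y0, h⟩ := PB W hW ε h0 h1
  refine ⟨y0, fun y hy r hr => (h y hy r hr).trans_eq ?_⟩
  unfold win
  rw [filter_filter]

lemma win_T (n k : ℕ) (hn : 1 ≤ n) (hk : 0 < k) (p : ℕ) (hp : p ∈ win (1 / 11) (11 / 20 * P n k)) :
    p ∈ Tset n k ∧ (1 / 2 : ℝ) ^ k * n ≤ (p:ℝ) ^ k ∧ (p:ℝ) ^ k ≤ (11 / 20 : ℝ) ^ k * n := by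
  have hP := P_pos n k hn
  obtain ⟨h1, h2, h3⟩ := mem_win _ _ (by positivity) p hp
  have h4 : P n k / 2 < p := by linarith
  have h5 : (p:ℝ) ≤ P n k := by linarith
  refine ⟨?_, ?_, ?_⟩
  · unfold Tset
    rw [mem_filter, mem_range]
    refine ⟨?_, h1, h4, h5⟩
    have := h5.trans (P_le n k hn hk)
    have : p ≤ n := by exact_mod_cast this
    omega
  · calc (1 / 2 : ℝ) ^ k * n = (P n k / 2) ^ k := by
          rw [← P_pow n k hk]; ring
      _ ≤ _ := by gcongr
  · calc (p:ℝ) ^ k ≤ (11 / 20 * P n k) ^ k := by gcongr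
      _ = _ := by rw [mul_pow, P_pow n k hk]

lemma win_T5 (n c : ℕ) (hn : 1 ≤ n) (hX : (2:ℝ) ≤ (n:ℝ) ^ (1 / 10 : ℝ)) (p : ℕ) (h100 : (100:ℝ) ≤ (n:ℝ) ^ (1 / 10 : ℝ)) (hp : p ∈ win (1 / 2) (P n 5 ^ _root_.θ c)) :
    p ∈ T5set n c ∧ 0 ≤ (p:ℝ) ^ 5 ∧ (p:ℝ) ^ 5 ≤ (1 / 100 : ℝ) * n := by
  have hP := P_pos n 5 hn
  have hn' : (1:ℝ) ≤ n := by exact_mod_cast hn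
  obtain ⟨h1, h2, h3⟩ := mem_win _ _ (by positivity) p hp
  refine ⟨?_, by positivity, ?_⟩
  · unfold T5set
    rw [mem_filter, mem_range]
    refine ⟨?_, h1, by exact_mod_cast h1.one_lt, h3⟩
    have := (h3.trans (X5_le n c hn)).trans (P_le n 5 hn (by norm_num))
    have : p ≤ n := by exact_mod_cast this
    omega
  · calc (p:ℝ) ^ 5 ≤ (P n 5 ^ _root_.θ c) ^ 5 := by gcongr
      _ = (n:ℝ) ^ (_root_.θ c) := by
          rw [← Real.rpow_natCast, ← Real.rpow_mul hP.le, mul_comm, Real.rpow_mul hP.le, Real.rpow_natCast, P_pow n 5 (by norm_num)]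
      _ ≤ (n:ℝ) ^ (9 / 10 : ℝ) := by
          apply Real.rpow_le_rpow_of_exponent_le hn'
          unfold _root_.θ
          split_ifs <;> norm_num
      _ ≤ 1 / 100 * n := by
          have : (n:ℝ) = (n:ℝ) ^ (9 / 10 : ℝ) * (n:ℝ) ^ (1 / 10 : ℝ) := by
            rw [← Real.rpow_add (by positivity)]; norm_num
          have h9 : 0 ≤ (n:ℝ) ^ (9 / 10 : ℝ) := by positivity
          nlinarith

noncomputable def Y6 (n c : ℕ) : Fin 6 → ℝ := ![11 / 20 * P n 2, 11 / 20 * P n 3, 11 / 20 * P n 3, P n 5 ^ _root_.θ c, 11 / 20 * P n 6, 11 / 20 * P n c]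
noncomputable def ε6 : Fin 6 → ℝ := ![1 / 11, 1 / 11, 1 / 11, 1 / 2, 1 / 11, 1 / 11]

lemma win_all (n c : ℕ) (hc : c = 6 ∨ c = 7) (hn : 1 ≤ n) (h100 : (100:ℝ) ≤ (n:ℝ) ^ (1 / 10 : ℝ)) (y : Fin 6 → ℕ)
    (hy : y ∈ Fintype.piFinset (fun i => win (ε6 i) (Y6 n c i))) :
    y ∈ Fintype.piFinset (TT n c) ∧ (1 / 2 : ℝ) * n ≤ ∑ i, (y i : ℝ) ^ (ex6 c i) ∧ ∑ i, (y i : ℝ) ^ (ex6 c i) ≤ (71 / 100 : ℝ) * n := by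
  rw [Fintype.mem_piFinset] at hy
  have b0 := win_T n 2 hn (by norm_num) (y 0) (hy 0)
  have b1 := win_T n 3 hn (by norm_num) (y 1) (hy 1)
  have b2 := win_T n 3 hn (by norm_num) (y 2) (hy 2)
  have b3 := win_T5 n c hn (by linarith) (y 3) h100 (hy 3)
  have b4 := win_T n 6 hn (by norm_num) (y 4) (hy 4)
  have b5 := win_T n c hn (by omega) (y 5) (hy 5)
  have hn0 : (0:ℝ) ≤ n := by positivity
  refine ⟨?_, ?_⟩
  · rw [Fintype.mem_piFinset]
    intro i
    fin_cases i
    · exact b0.1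
    · exact b1.1
    · exact b2.1
    · exact b3.1
    · exact b4.1
    · exact b5.1
  · rw [Fin.sum_univ_six]
    change (1 / 2 : ℝ) * n ≤ (y 0:ℝ) ^ 2 + (y 1:ℝ) ^ 3 + (y 2:ℝ) ^ 3 + (y 3:ℝ) ^ 5 + (y 4:ℝ) ^ 6 + (y 5:ℝ) ^ c ∧
      (y 0:ℝ) ^ 2 + (y 1:ℝ) ^ 3 + (y 2:ℝ) ^ 3 + (y 3:ℝ) ^ 5 + (y 4:ℝ) ^ 6 + (y 5:ℝ) ^ c ≤ 71 / 100 * n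
    have b5' : (y 5:ℝ) ^ c ≤ (11 / 20 : ℝ) ^ 6 * n := by
      refine b5.2.2.trans ?_
      gcongr ?_ * _
      apply pow_le_pow_of_le_one (by norm_num) (by norm_num)
      omega
    have b5'' : (0:ℝ) ≤ (y 5:ℝ) ^ c := by positivity
    have b4'' : (0:ℝ) ≤ (y 4:ℝ) ^ 6 := by positivity
    obtain ⟨-, b01, b02⟩ := b0
    obtain ⟨-, b11, b12⟩ := b1
    obtain ⟨-, b21, b22⟩ := b2
    obtain ⟨-, b31, b32⟩ := b3
    obtain ⟨-, -, b42⟩ := b4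
    norm_num at b01 b02 b11 b12 b21 b22 b32 b42 b5'
    constructor <;> linarith

lemma sq_num (ε s P2 n p Y T : ℝ) (hT : 1 ≤ T) (hε : ε = 1 / (16 * T)) (hn : 0 < n) (hP : 0 < P2) (hPn : P2 ^ 2 = n) (hs0 : 0 ≤ s) (hs : s ^ 2 = Y)
    (h1 : 29 / 100 * n ≤ Y) (h2 : Y ≤ n / 2) (hp1 : (1 - ε) * s < p) (hp2 : p ≤ s) :
    P2 / 2 < p ∧ p ≤ P2 ∧ |p ^ 2 - Y| * (T / n) ≤ 1 / 8 := by
  have hε1 : ε ≤ 1 / 16 := by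
    rw [hε]; apply one_div_le_one_div_of_le (by norm_num); linarith
  have hε0 : 0 < ε := by rw [hε]; positivity
  have hεT : ε * T = 1 / 16 := by rw [hε]; field_simp
  have a1 : P2 * (8 / 15) ≤ s := by
    refine (pow_le_pow_iff_left₀ (by positivity) hs0 two_ne_zero).1 ?_
    rw [mul_pow, hPn, hs]; linarith
  have a2 : (15 / 16) * s ≤ (1 - ε) * s := by gcongr; linarith
  have a3 : s ≤ P2 := by
    refine (pow_le_pow_iff_left₀ (by positivity) hP.le two_ne_zero).1 ?_
    rw [hPn, hs]; linarith
  have a4 : 0 ≤ (1 - ε) * s := mul_nonneg (by linarith) hs0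
  refine ⟨by linarith, by linarith, ?_⟩
  have a5 : p ^ 2 ≤ Y := by rw [← hs]; exact pow_le_pow_left₀ (by linarith) hp2 2
  have a6 : ((1 - ε) * s) ^ 2 ≤ p ^ 2 := pow_le_pow_left₀ a4 hp1.le 2
  rw [mul_pow, hs] at a6
  have hY : 0 ≤ Y := by linarith
  have a7 : Y - p ^ 2 ≤ 2 * ε * Y := by nlinarith [mul_nonneg (sq_nonneg ε) hY]
  rw [abs_of_nonpos (by linarith)]
  calc -(p ^ 2 - Y) * (T / n) ≤ (2 * ε * n) * (T / n) := by
        apply mul_le_mul_of_nonneg_right _ (by positivity)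
        have : 2 * ε * Y ≤ 2 * ε * n := by gcongr; linarith
        linarith
    _ = 2 * (ε * T) := by field_simp
    _ = _ := by rw [hεT]; norm_num

end MajArc

namespace MajArc

lemma ev_large (M s : ℝ) (hs : 0 < s) : ∃ N : ℕ, ∀ n : ℕ, N ≤ n → M ≤ (n:ℝ) ^ s := by
  have h := (tendsto_rpow_atTop hs).comp (tendsto_natCast_atTop_atTop (R := ℝ))
  exact Filter.eventually_atTop.1 (h.eventually_ge_atTop M)

lemma P_ge (n k : ℕ) (hn : 1 ≤ n) (hk : 0 < k) (hk7 : k ≤ 7) : (n:ℝ) ^ (1 / 7 : ℝ) ≤ P n k := by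
  unfold P
  apply Real.rpow_le_rpow_of_exponent_le (by exact_mod_cast hn)
  rw [← one_div]
  apply one_div_le_one_div_of_le (by exact_mod_cast hk)
  exact_mod_cast hk7

lemma S_low (c : ℕ) (hc : c = 6 ∨ c = 7) (W : ℕ) (hW : 0 < W) (T : ℝ) (hT : 1 ≤ T) : ∃ N : ℕ, ∀ n : ℕ, N ≤ n →
    (1 / 240000 : ℝ) ^ 7 / (20 ^ 5 * 64) * (MM c W n : ℝ) / (W.totient : ℝ) ^ 7 * (n:ℝ) ^ (Θ c + 1) / T ≤
      ∑ x ∈ (idx n c).filter (fun x => (W:ℤ) ∣ mm n c x ∧ |(mm n c x : ℝ)| * (T / n) ≤ 1 / 8), wt x := by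
  have hε0 : 0 < 1 / (16 * T) := by positivity
  have hε1 : 1 / (16 * T) ≤ 1 / 2 := by
    apply one_div_le_one_div_of_le (by norm_num); linarith
  obtain ⟨ya, ha⟩ := win_low W hW (1 / 11) (by norm_num) (by norm_num)
  obtain ⟨yb, hb⟩ := win_low W hW (1 / 2) (by norm_num) (by norm_num)
  obtain ⟨yc, hcc⟩ := win_low W hW (1 / (16 * T)) hε0 hε1
  obtain ⟨N1, hN1⟩ := ev_large (2 * (|ya| + |yb| + |yc|)) (1 / 7) (by norm_num)
  obtain ⟨N2, hN2⟩ := ev_large 100 (1 / 10) (by norm_num)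
  refine ⟨N1 + N2 + 1, fun n hn => ?_⟩
  have hn1 : 1 ≤ n := by omega
  have hnr : (1:ℝ) ≤ n := by exact_mod_cast hn1
  have hM := hN1 n (by omega)
  have h100 := hN2 n (by omega)
  have hya := le_abs_self ya
  have hyb := le_abs_self yb
  have hyc := le_abs_self yc
  have hya' := abs_nonneg ya
  have hyb' := abs_nonneg yb
  have hyc' := abs_nonneg yc
  have hφ : (0:ℝ) < W.totient := by exact_mod_cast Nat.totient_pos.2 hW
  have hP : ∀ k, 0 < k → k ≤ 7 → 2 * (|ya| + |yb| + |yc|) ≤ P n k := fun k h0 h7 => hM.trans (P_ge n k hn1 h0 h7)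
  have hP' : ∀ k, 0 < k → k ≤ 7 → ya ≤ 11 / 20 * P n k := fun k h0 h7 => by
    have := hP k h0 h7; linarith
  have hX : yb ≤ P n 5 ^ _root_.θ c := by
    have h1 := X5_lower n c hn1
    have h2 : (n:ℝ) ^ (1 / 7 : ℝ) ≤ (n:ℝ) ^ (1 / 6 : ℝ) := Real.rpow_le_rpow_of_exponent_le hnr (by norm_num)
    linarith
  have hP2 := P_pos n 2 hn1
  have hP3 := P_pos n 3 hn1
  have hP5 := P_pos n 5 hn1
  have hP6 := P_pos n 6 hn1
  have hPc := P_pos n c hn1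
  have hPs := P_pow n 2 (by norm_num)
  let sq : (Fin 6 → ℕ) → ℝ := fun y => Real.sqrt ((n:ℝ) - ∑ i, (y i : ℝ) ^ (ex6 c i))
  have key := S_comb n c W hW (T / n) (fun i => win (ε6 i) (Y6 n c i)) (fun y => win (1 / (16 * T)) (sq y))
    (fun i => (1 / 240000) * ε6 i * Y6 n c i / W.totient) ((1 / 240000) * (1 / (16 * T)) * (P n 2 / 2) / W.totient)
    ?_ (by positivity) ?_ ?_ ?_
  · refine le_of_eq_of_le ?_ key
    rw [Fin.prod_univ_six]
    change _ = (MM c W n : ℝ) * ((1 / 240000) * (1 / (16 * T)) * (P n 2 / 2) / W.totient *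
      ((1 / 240000) * (1 / 11) * (11 / 20 * P n 2) / W.totient * ((1 / 240000) * (1 / 11) * (11 / 20 * P n 3) / W.totient) *
      ((1 / 240000) * (1 / 11) * (11 / 20 * P n 3) / W.totient) * ((1 / 240000) * (1 / 2) * (P n 5 ^ _root_.θ c) / W.totient) *
      ((1 / 240000) * (1 / 11) * (11 / 20 * P n 6) / W.totient) * ((1 / 240000) * (1 / 11) * (11 / 20 * P n c) / W.totient)))
    rw [← prod_scale n c hn1]
    field_simp
    norm_num
    ring
  · intro i
    fin_cases i <;> simp [ε6, Y6] <;> positivity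
  · intro y hy p hp
    obtain ⟨h1, h2, h3⟩ := win_all n c hc hn1 h100 y hy
    obtain ⟨q1, q2, q3⟩ := mem_win _ _ (Real.sqrt_nonneg _) p hp
    have hY : 0 ≤ (n:ℝ) - ∑ i, (y i : ℝ) ^ (ex6 c i) := by linarith
    obtain ⟨r1, r2, r3⟩ := sq_num (1 / (16 * T)) (sq y) (P n 2) n p ((n:ℝ) - ∑ i, (y i : ℝ) ^ (ex6 c i)) T hT rfl (by linarith) hP2 hPs
      (Real.sqrt_nonneg _) (Real.sq_sqrt hY) (by linarith) (by linarith) q2 q3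
    refine ⟨?_, ?_⟩
    · unfold idx
      rw [mem_product]
      refine ⟨?_, h1⟩
      unfold Tset
      rw [mem_filter, mem_range]
      refine ⟨?_, q1, r1, r2⟩
      have := r2.trans (P_le n 2 hn1 (by norm_num))
      have : p ≤ n := by exact_mod_cast this
      omega
    · convert r3 using 3
      unfold mm
      push_cast
      ring
  · intro i r hr
    fin_cases i
    · exact ha _ (hP' 2 (by norm_num) (by norm_num)) r hr
    · exact ha _ (hP' 3 (by norm_num) (by norm_num)) r hr
    · exact ha _ (hP' 3 (by norm_num) (by norm_num)) r hr
    · exact hb _ hX r hr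
    · exact ha _ (hP' 6 (by norm_num) (by norm_num)) r hr
    · exact ha _ (hP' c (by omega) (by omega)) r hr
  · intro y hy r hr
    obtain ⟨h1, h2, h3⟩ := win_all n c hc hn1 h100 y hy
    have hY : 0 ≤ (n:ℝ) - ∑ i, (y i : ℝ) ^ (ex6 c i) := by linarith
    have hs : P n 2 / 2 ≤ sq y := by
      apply Real.le_sqrt_of_sq_le
      rw [div_pow, hPs]; linarith
    have h4 : yc ≤ sq y := by
      have := hP 2 (by norm_num) (by norm_num)
      linarith
    refine le_trans ?_ (hcc _ h4 r hr)
    gcongr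

lemma GG_main (c : ℕ) (hc : c = 6 ∨ c = 7) : ∃ κ : ℝ, 0 < κ ∧ ∀ (W : ℕ) (_ : 0 < W) (T : ℝ) (_ : 1 ≤ T), ∃ N : ℕ, ∀ n : ℕ, N ≤ n → ¬ 2 ∣ n →
    κ * (n:ℝ) ^ (Θ c) ≤ (GG n c W (T / n)).re := by
  obtain ⟨κ, hκ, H⟩ := gW_low c (by omega)
  refine ⟨(1 / 240000 : ℝ) ^ 7 / (20 ^ 5 * 64) / 2 * κ, by positivity, fun W hW T hT => ?_⟩
  obtain ⟨N, hN⟩ := S_low c hc W hW T hT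
  refine ⟨N + 1, fun n hn h2 => ?_⟩
  have hn0 : (0:ℝ) < n := by exact_mod_cast (by omega : 0 < n)
  have hT0 : 0 < T := by linarith
  have hφ : (0:ℝ) < W.totient := by exact_mod_cast Nat.totient_pos.2 hW
  have h1 := hN n (by omega)
  have h3 := H W n hW h2
  refine le_trans ?_ (GG_low n c W hW (T / n) (by positivity))
  calc (1 / 240000 : ℝ) ^ 7 / (20 ^ 5 * 64) / 2 * κ * (n:ℝ) ^ (Θ c) ≤ (1 / 240000 : ℝ) ^ 7 / (20 ^ 5 * 64) / 2 * gW c W n * (n:ℝ) ^ (Θ c) := by gcongr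
    _ = W * (T / n / 2) * ((1 / 240000 : ℝ) ^ 7 / (20 ^ 5 * 64) * (MM c W n : ℝ) / (W.totient : ℝ) ^ 7 * (n:ℝ) ^ (Θ c + 1) / T) := by
        rw [Real.rpow_add hn0, Real.rpow_one]
        unfold gW
        field_simp
    _ ≤ _ := by gcongr

end MajArc

namespace MajArc

def DD (N : ℕ) : Finset ((_ : ℕ) × ℕ) := (Finset.Icc 1 N).sigma (fun q => (Finset.Icc 1 q).filter (fun a => Nat.gcd a q = 1))

lemma mem_DD (N q a : ℕ) : (⟨q, a⟩ : (_ : ℕ) × ℕ) ∈ DD N ↔ (1 ≤ q ∧ q ≤ N) ∧ (1 ≤ a ∧ a ≤ q) ∧ Nat.gcd a q = 1 := by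
  unfold DD
  rw [mem_sigma, mem_filter, mem_Icc, mem_Icc]

/-- reduced fractions are determined by their values -/
lemma frac_uniq (q q' : ℕ) (a a' : ℤ) (hq : 0 < q) (hq' : 0 < q') (h : IsCoprime a (q:ℤ)) (h' : IsCoprime a' (q':ℤ))
    (he : a * q' = a' * q) : q = q' ∧ a = a' := by
  have h1 : (q:ℤ) ∣ q' := by
    apply h.symm.dvd_of_dvd_mul_left
    rw [he]; exact dvd_mul_left _ _
  have h2 : (q':ℤ) ∣ q := by
    apply h'.symm.dvd_of_dvd_mul_left
    rw [← he]; exact dvd_mul_left _ _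
  have h3 : q = q' := Nat.dvd_antisymm (Int.natCast_dvd_natCast.1 h1) (Int.natCast_dvd_natCast.1 h2)
  subst h3
  refine ⟨rfl, ?_⟩
  have : (q:ℤ) ≠ 0 := by exact_mod_cast hq.ne'
  exact mul_right_cancel₀ this he

lemma sum_frac (W N : ℕ) (hW : 0 < W) (hN : W ≤ N) (g : ℝ → ℂ) :
    ∑ b ∈ Finset.Icc 1 W, g ((b:ℝ) / W) = ∑ x ∈ (DD N).filter (fun x => x.1 ∣ W), g ((x.2:ℝ) / x.1) := by
  symm
  apply sum_nbij (fun x => x.2 * (W / x.1))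
  · rintro ⟨q, a⟩ hx
    rw [mem_filter, mem_DD] at hx
    obtain ⟨⟨⟨h1, h2⟩, ⟨h3, h4⟩, h5⟩, h6⟩ := hx
    simp only at h6
    obtain ⟨d, rfl⟩ := h6
    have hd : 0 < d := Nat.pos_of_mul_pos_left hW
    simp only
    rw [Nat.mul_div_cancel_left _ (by omega), mem_Icc]
    exact ⟨Nat.mul_pos h3 hd, Nat.mul_le_mul_right _ h4⟩
  · rintro ⟨q, a⟩ hx ⟨q', a'⟩ hx' he
    rw [mem_coe, mem_filter, mem_DD] at hx hx'
    obtain ⟨⟨⟨h1, h2⟩, ⟨h3, h4⟩, h5⟩, h6⟩ := hx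
    obtain ⟨⟨⟨h1', h2'⟩, ⟨h3', h4'⟩, h5'⟩, h6'⟩ := hx'
    simp only at h6 h6' he
    have e1 : a * q' = a' * q := by
      have w1 : W / q * q = W := Nat.div_mul_cancel h6
      have w2 : W / q' * q' = W := Nat.div_mul_cancel h6'
      apply Nat.eq_of_mul_eq_mul_right hW
      calc a * q' * W = (a * (W / q)) * q * q' := by rw [show a * (W / q) * q * q' = a * q' * (W / q * q) by ring, w1]
        _ = (a' * (W / q')) * q * q' := by rw [he]
        _ = a' * q * (W / q' * q') := by ring
        _ = _ := by rw [w2]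
    have := frac_uniq q q' a a' h1 h1' (Nat.isCoprime_iff_coprime.2 h5) (Nat.isCoprime_iff_coprime.2 h5') (by exact_mod_cast e1)
    obtain ⟨rfl, h7⟩ := this
    have : a = a' := by exact_mod_cast h7
    subst this
    rfl
  · intro b hb
    rw [mem_coe, mem_Icc] at hb
    rw [Set.mem_image]
    have hg : 0 < Nat.gcd b W := Nat.gcd_pos_of_pos_right _ hW
    obtain ⟨g', a, q, hg', hcop, hb', hW'⟩ := Nat.exists_coprime' hg
    have hq0 : 0 < q := by
      rcases Nat.eq_zero_or_pos q with h | h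
      · subst h; omega
      · exact h
    have ha0 : 0 < a := by
      rcases Nat.eq_zero_or_pos a with h | h
      · subst h; omega
      · exact h
    have haq : a ≤ q := by
      apply Nat.le_of_mul_le_mul_right _ hg'
      rw [← hb', ← hW']; exact hb.2
    have hqW : q ∣ W := ⟨g', hW'⟩
    refine ⟨⟨q, a⟩, ?_, ?_⟩
    · rw [mem_coe, mem_filter, mem_DD]
      exact ⟨⟨⟨hq0, (Nat.le_of_dvd hW hqW).trans hN⟩, ⟨ha0, haq⟩, hcop⟩, hqW⟩
    · simp only
      rw [hb', hW', Nat.mul_div_cancel_left _ hq0]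
  · rintro ⟨q, a⟩ hx
    rw [mem_filter, mem_DD] at hx
    obtain ⟨⟨⟨h1, h2⟩, ⟨h3, h4⟩, h5⟩, h6⟩ := hx
    simp only at h6
    obtain ⟨d, rfl⟩ := h6
    have hd : 0 < d := Nat.pos_of_mul_pos_left hW
    simp only
    rw [Nat.mul_div_cancel_left _ (by omega)]
    congr 1
    have : (q:ℝ) ≠ 0 := by positivity
    have : (d:ℝ) ≠ 0 := by positivity
    push_cast
    field_simp

/-- arcs around the fraction `a/q`, with the two half arcs at `0` and `1` glued -/
def KK (δ : ℝ) (x : (_ : ℕ) × ℕ) : Set ℝ :=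
  if x.1 = 1 then Set.Icc 0 δ ∪ Set.Icc (1 - δ) 1 else Set.Icc ((x.2:ℝ) / x.1 - δ) ((x.2:ℝ) / x.1 + δ)

lemma KK_near (δ : ℝ) (N q a : ℕ) (hx : (⟨q, a⟩ : (_ : ℕ) × ℕ) ∈ DD N) (α : ℝ) (h : α ∈ KK δ ⟨q, a⟩) :
    ∃ t : ℤ, |α - ((a + t * q : ℤ) : ℝ) / q| ≤ δ := by
  rw [mem_DD] at hx
  unfold KK at h
  simp only at h
  split_ifs at h with h1
  · subst h1
    have ha : a = 1 := by omega
    subst ha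
    rcases h with h | h
    · exact ⟨-1, by simp only [abs_le]; push_cast; constructor <;> linarith [h.1, h.2]⟩
    · refine ⟨0, ?_⟩
      rw [abs_le]; push_cast; constructor <;> linarith [h.1, h.2]
  · refine ⟨0, ?_⟩
    rw [abs_le]; push_cast; rw [zero_mul, add_zero]; constructor <;> linarith [h.1, h.2]

lemma KK_disj (δ : ℝ) (N : ℕ) (hδ : 2 * δ * N ^ 2 < 1) (x y : (_ : ℕ) × ℕ) (hx : x ∈ DD N) (hy : y ∈ DD N) (hxy : x ≠ y) :
    Disjoint (KK δ x) (KK δ y) := by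
  obtain ⟨q, a⟩ := x
  obtain ⟨q', a'⟩ := y
  rw [Set.disjoint_left]
  intro α h1 h2
  apply hxy
  obtain ⟨t, ht⟩ := KK_near δ N q a hx α h1
  obtain ⟨t', ht'⟩ := KK_near δ N q' a' hy α h2
  rw [mem_DD] at hx hy
  obtain ⟨⟨hq1, hqN⟩, ⟨ha1, haq⟩, hc⟩ := hx
  obtain ⟨⟨hq1', hqN'⟩, ⟨ha1', haq'⟩, hc'⟩ := hy
  have hδ0 : 0 ≤ δ := (abs_nonneg _).trans ht
  have c1 : IsCoprime ((a:ℤ) + t * q) (q:ℤ) := (Nat.isCoprime_iff_coprime.2 hc).add_mul_right_left t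
  have c2 : IsCoprime ((a':ℤ) + t' * q') (q':ℤ) := (Nat.isCoprime_iff_coprime.2 hc').add_mul_right_left t'
  set A : ℤ := a + t * q with hA
  set A' : ℤ := a' + t' * q' with hA'
  have hq0 : (0:ℝ) < q := by exact_mod_cast hq1
  have hq0' : (0:ℝ) < q' := by exact_mod_cast hq1'
  have hqr : (q:ℝ) ≤ N := by exact_mod_cast hqN
  have hqr' : (q':ℝ) ≤ N := by exact_mod_cast hqN'
  have h3 : |(A:ℝ) / q - A' / q'| ≤ 2 * δ := by
    rw [abs_le] at ht ht' ⊢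
    constructor <;> linarith [ht.1, ht.2, ht'.1, ht'.2]
  have h4 : |((A * q' - A' * q : ℤ) : ℝ)| < 1 := by
    have : ((A * q' - A' * q : ℤ) : ℝ) = ((A:ℝ) / q - A' / q') * (q * q') := by
      push_cast; field_simp
    rw [this, abs_mul, abs_of_pos (mul_pos hq0 hq0')]
    calc |(A:ℝ) / q - A' / q'| * (q * q') ≤ 2 * δ * (N * N) := by gcongr
      _ = 2 * δ * N ^ 2 := by ring
      _ < 1 := hδ
  have h5 : A * q' = A' * q := by
    have : |A * q' - A' * q| < 1 := by exact_mod_cast h4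
    have := Int.abs_lt_one_iff.1 this
    linarith
  obtain ⟨rfl, h6⟩ := frac_uniq q q' A A' hq1 hq1' c1 c2 h5
  have h7 : a = a' := by
    have e1 : (a:ℤ) - a' = (t' - t) * q := by rw [hA, hA'] at h6; linarith
    have e2 : |(a:ℤ) - a'| < q := by rw [abs_lt]; omega
    have e3 := Int.eq_zero_of_abs_lt_dvd ⟨t' - t, by rw [e1]; ring⟩ e2
    omega
  subst h7
  rfl

lemma KK_meas (δ : ℝ) (x : (_ : ℕ) × ℕ) : MeasurableSet (KK δ x) := by
  unfold KK
  split_ifs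
  · exact measurableSet_Icc.union measurableSet_Icc
  · exact measurableSet_Icc

lemma KK_int (n c : ℕ) (δ : ℝ) (x : (_ : ℕ) × ℕ) : IntegrableOn (Phi n c) (KK δ x) := by
  unfold KK
  split_ifs
  · exact ((Phi_cont n c).continuousOn.integrableOn_Icc).union ((Phi_cont n c).continuousOn.integrableOn_Icc)
  · exact (Phi_cont n c).continuousOn.integrableOn_Icc

lemma Icc_ii (g : ℝ → ℂ) (a b : ℝ) (h : a ≤ b) : ∫ α in Set.Icc a b, g α = ∫ α in a..b, g α := by
  rw [intervalIntegral.integral_of_le h, integral_Icc_eq_integral_Ioc]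

lemma KK_integral (n c N : ℕ) (δ : ℝ) (hδ0 : 0 < δ) (hδ : δ < 1 / 2) (x : (_ : ℕ) × ℕ) (hx : x ∈ DD N) :
    ∫ α in KK δ x, Phi n c α = ∫ β in (-δ)..δ, Phi n c ((x.2:ℝ) / x.1 + β) := by
  obtain ⟨q, a⟩ := x
  rw [mem_DD] at hx
  unfold KK
  simp only
  have hI : ∀ s t, IntervalIntegrable (Phi n c) volume s t := fun s t => (Phi_cont n c).intervalIntegrable s t
  rw [intervalIntegral.integral_comp_add_left (fun α => Phi n c α)]
  split_ifs with h1
  · subst h1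
    have ha : a = 1 := by omega
    subst ha
    rw [setIntegral_union _ measurableSet_Icc (Phi_cont n c).continuousOn.integrableOn_Icc (Phi_cont n c).continuousOn.integrableOn_Icc,
      Icc_ii _ _ _ hδ0.le, Icc_ii _ _ _ (by linarith)]
    · have e1 : ∫ α in (0:ℝ)..δ, Phi n c α = ∫ α in (1:ℝ)..(1 + δ), Phi n c α := by
        have h2 := intervalIntegral.integral_comp_add_right (a := 0) (b := δ) (fun α => Phi n c α) 1
        rw [zero_add, add_comm δ 1] at h2
        rw [← h2]
        exact intervalIntegral.integral_congr fun α _ => (Phi_per n c α).symm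
      rw [e1, add_comm, intervalIntegral.integral_add_adjacent_intervals (hI _ _) (hI _ _)]
      norm_num
      rw [← sub_eq_add_neg]
    · rw [Set.disjoint_left]
      intro α h2 h3
      linarith [h2.2, h3.1]
  · rw [Icc_ii _ _ _ (by linarith), ← sub_eq_add_neg]

lemma Maj_eq (n : ℕ) (B : ℝ) (hL : 0 ≤ Real.log n ^ B) (hδ : 2 * (Real.log n ^ B / n) * (⌊Real.log n ^ B⌋₊ : ℝ) ^ 2 < 1)
    (h1 : 1 ≤ ⌊Real.log n ^ B⌋₊) :
    Maj n B = ⋃ x ∈ DD ⌊Real.log n ^ B⌋₊, KK (Real.log n ^ B / n) x := by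
  set Λ := Real.log n ^ B with hΛ
  set N := ⌊Λ⌋₊ with hN
  set δ := Λ / n with hδd
  have hδ0 : 0 ≤ δ := by positivity
  have hNr : (1:ℝ) ≤ N := by exact_mod_cast h1
  have hδ1 : δ ≤ 1 / 2 := by nlinarith
  ext α
  unfold Maj
  rw [Set.mem_iUnion₂]
  constructor
  · rintro ⟨⟨hα0, hα1⟩, a, q, haq, hq, hqL, hg, hα⟩
    have hqN : q ≤ N := Nat.le_floor hqL
    rw [abs_le] at hα
    rcases eq_or_ne q 1 with rfl | hq1
    · refine ⟨⟨1, 1⟩, (mem_DD _ _ _).2 (by simp [h1]), ?_⟩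
      unfold KK
      simp only [if_true]
      have : a = 0 ∨ a = 1 := by omega
      rcases this with rfl | rfl
      · left
        simp at hα
        exact ⟨hα0, hα.2⟩
      · right
        simp at hα
        exact ⟨by linarith [hα.1], hα1⟩
    · have ha : 1 ≤ a := by
        rcases Nat.eq_zero_or_pos a with rfl | h
        · simp at hg; omega
        · exact h
      refine ⟨⟨q, a⟩, (mem_DD _ _ _).2 ⟨⟨hq, hqN⟩, ⟨ha, haq⟩, hg⟩, ?_⟩
      unfold KK
      rw [if_neg hq1]
      exact ⟨by linarith [hα.1], by linarith [hα.2]⟩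
  · rintro ⟨⟨q, a⟩, hx, hα⟩
    rw [mem_DD] at hx
    obtain ⟨⟨hq1, hqN⟩, ⟨ha1, haq⟩, hc⟩ := hx
    have hqL : (q:ℝ) ≤ Λ := (Nat.le_floor_iff hL).1 hqN
    unfold KK at hα
    simp only at hα
    split_ifs at hα with h2
    · subst h2
      rcases hα with h | h
      · refine ⟨⟨h.1, by linarith [h.2]⟩, 0, 1, by norm_num, le_refl _, hqL, by norm_num, ?_⟩
        rw [abs_le]; push_cast; constructor <;> linarith [h.1, h.2]
      · refine ⟨⟨by linarith [h.1], h.2⟩, 1, 1, by norm_num, le_refl _, hqL, by norm_num, ?_⟩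
        rw [abs_le]; push_cast; constructor <;> linarith [h.1, h.2]
    · have hq0 : (0:ℝ) < q := by exact_mod_cast hq1
      have hqr : (q:ℝ) ≤ N := by exact_mod_cast hqN
      have hlt : a < q := by
        rcases haq.lt_or_eq with h | rfl
        · exact h
        · simp at hc; exact absurd hc h2
      have hδq : δ * q ≤ 1 := by nlinarith
      have hδq' : δ ≤ 1 / q := by rw [le_div_iff₀ hq0]; exact hδq
      have e1 : (1:ℝ) / q ≤ a / q := by gcongr; exact_mod_cast ha1
      have e2 : (a:ℝ) / q ≤ 1 - 1 / q := by
        rw [le_sub_iff_add_le, ← add_div, div_le_one hq0]; exact_mod_cast hlt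
      refine ⟨⟨by linarith [hα.1], by linarith [hα.2]⟩, a, q, haq, hq1, hqL, hc, ?_⟩
      rw [abs_le]; constructor <;> linarith [hα.1, hα.2]

end MajArc

namespace MajArc

lemma int_bound (n δ : ℝ) (hn : 0 < n) (hδ : 0 < δ) : ∫ β in (-δ)..δ, (1 + |β| * n) ^ (-(3 / 2) : ℝ) ≤ 4 / n := by
  have hc : Continuous fun β : ℝ => (1 + |β| * n) ^ (-(3 / 2) : ℝ) := by
    apply Continuous.rpow_const (by fun_prop)
    intro β; left; positivity
  have h0 : ∫ β in (0:ℝ)..δ, (1 + |β| * n) ^ (-(3 / 2) : ℝ) ≤ 2 / n := by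
    have hd : ∀ β ∈ Set.uIcc 0 δ, HasDerivAt (fun β : ℝ => -(2 / n) * (1 + β * n) ^ (-(1 / 2) : ℝ)) ((1 + |β| * n) ^ (-(3 / 2) : ℝ)) β := by
      intro β hβ
      rw [Set.uIcc_of_le hδ.le] at hβ
      have hb := hβ.1
      have e1 : HasDerivAt (fun β : ℝ => 1 + β * n) n β := by
        simpa using ((hasDerivAt_id β).mul_const n).const_add 1
      have hp : 0 < 1 + β * n := by positivity
      refine ((e1.rpow_const (p := -(1 / 2)) (Or.inl hp.ne')).const_mul (-(2 / n))).congr_deriv ?_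
      rw [abs_of_nonneg hβ.1, show (-(1 / 2) - 1 : ℝ) = -(3 / 2) by norm_num]
      field_simp
    rw [intervalIntegral.integral_eq_sub_of_hasDerivAt hd (hc.intervalIntegrable _ _)]
    have : 0 ≤ 2 / n * (1 + δ * n) ^ (-(1 / 2) : ℝ) := by positivity
    simp only [zero_mul, add_zero, Real.one_rpow]
    linarith
  have h2 : ∫ β in (-δ)..0, (1 + |β| * n) ^ (-(3 / 2) : ℝ) = ∫ β in (0:ℝ)..δ, (1 + |β| * n) ^ (-(3 / 2) : ℝ) := by
    have := intervalIntegral.integral_comp_neg (a := 0) (b := δ) (fun β : ℝ => (1 + |β| * n) ^ (-(3 / 2) : ℝ))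
    rw [neg_zero] at this
    rw [← this]
    simp only [abs_neg]
  rw [← intervalIntegral.integral_add_adjacent_intervals (b := 0) (hc.intervalIntegrable _ _) (hc.intervalIntegrable _ _), h2]
  have : 4 / n = 2 / n + 2 / n := by ring
  linarith

lemma Maj_int (n c : ℕ) (B : ℝ) (hn : 0 < n) (hL : 1 ≤ Real.log n ^ B) (hδ : 2 * (Real.log n ^ B / n) * (⌊Real.log n ^ B⌋₊ : ℝ) ^ 2 < 1) :
    ∫ α in Maj n B, Phi n c α = ∑ x ∈ DD ⌊Real.log n ^ B⌋₊, ∫ β in (-(Real.log n ^ B / n))..(Real.log n ^ B / n), Phi n c ((x.2:ℝ) / x.1 + β) := by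
  have h1 : 1 ≤ ⌊Real.log n ^ B⌋₊ := Nat.le_floor (by simpa using hL)
  have hn' : (0:ℝ) < n := by exact_mod_cast hn
  have hd0 : 0 < Real.log n ^ B / n := by positivity
  have hNr : (1:ℝ) ≤ ⌊Real.log n ^ B⌋₊ := by exact_mod_cast h1
  have hd1 : Real.log n ^ B / n < 1 / 2 := by
    have : (1:ℝ) ≤ (⌊Real.log n ^ B⌋₊ : ℝ) ^ 2 := one_le_pow₀ hNr
    nlinarith
  rw [Maj_eq n B (by linarith) hδ h1, integral_biUnion_finset]
  · exact sum_congr rfl fun x hx => KK_integral n c _ _ hd0 hd1 x hx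
  · exact fun x _ => KK_meas _ x
  · exact fun x hx y hy hxy => KK_disj _ _ hδ x y hx hy hxy
  · exact fun x _ => KK_int n c _ x

lemma tri_zero (h β : ℝ) (hh : 0 < h) (hb : h ≤ |β|) : tri h β = 0 := by
  unfold tri
  rw [max_eq_left]
  rw [sub_nonpos, one_le_div hh]
  exact hb

lemma tri_ext (g : ℝ → ℂ) (hg : Continuous g) (h δ : ℝ) (hh : 0 < h) (hδ : h ≤ δ) :
    ∫ β in (-h)..h, g β * (tri h β : ℂ) = ∫ β in (-δ)..δ, g β * (tri h β : ℂ) := by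
  have hc : Continuous fun β => g β * (tri h β : ℂ) := by
    have := tri_cont h
    fun_prop
  have hi : ∀ s t, IntervalIntegrable (fun β => g β * (tri h β : ℂ)) volume s t := fun s t => hc.intervalIntegrable s t
  rw [← intervalIntegral.integral_add_adjacent_intervals (hi (-δ) (-h)) (hi (-h) δ),
    ← intervalIntegral.integral_add_adjacent_intervals (hi (-h) h) (hi h δ)]
  have e1 : ∫ β in (-δ)..(-h), g β * (tri h β : ℂ) = 0 := by
    rw [← intervalIntegral.integral_zero (a := -δ) (b := -h) (μ := volume)]
    apply intervalIntegral.integral_congr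
    intro β hβ
    rw [Set.uIcc_of_le (by linarith)] at hβ
    simp only
    rw [tri_zero h β hh (by linarith [neg_le_abs β, hβ.2])]
    simp
  have e2 : ∫ β in h..δ, g β * (tri h β : ℂ) = 0 := by
    rw [← intervalIntegral.integral_zero (a := h) (b := δ) (μ := volume)]
    apply intervalIntegral.integral_congr
    intro β hβ
    rw [Set.uIcc_of_le (by linarith)] at hβ
    simp only
    rw [tri_zero h β hh (by linarith [le_abs_self β, hβ.1])]
    simp
  rw [e1, e2, zero_add, add_zero]

noncomputable def ind (W q : ℕ) (h β : ℝ) : ℝ := if q ∣ W then tri h β else 0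

lemma ind_cont (W q : ℕ) (h : ℝ) : Continuous (ind W q h) := by
  unfold ind
  split_ifs
  · exact tri_cont h
  · exact continuous_const

lemma GG_split (n c W N : ℕ) (hW : 0 < W) (hN : W ≤ N) (h δ : ℝ) (hh : 0 < h) (hδ : h ≤ δ) :
    GG n c W h = ∑ x ∈ DD N, ∫ β in (-δ)..δ, Phi n c ((x.2:ℝ) / x.1 + β) * (ind W x.1 h β : ℂ) := by
  unfold GG
  rw [sum_frac W N hW hN (fun u => ∫ β in (-h)..h, Phi n c (u + β) * (tri h β : ℂ)), sum_filter]
  apply sum_congr rfl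
  intro x _
  unfold ind
  split_ifs with h1
  · have := Phi_cont n c
    exact tri_ext (fun β => Phi n c ((x.2:ℝ) / x.1 + β)) (by fun_prop) h δ hh hδ
  · simp

lemma one_sub_tri (T n β : ℝ) (hT : 0 < T) (hn : 0 < n) : |1 - tri (T / n) β| ≤ Real.sqrt (|β| * n) / Real.sqrt T := by
  rw [← Real.sqrt_div (by positivity)]
  have e : |β| / (T / n) = |β| * n / T := by field_simp
  unfold tri
  rw [e]
  set u := |β| * n / T with hu
  have hu0 : 0 ≤ u := by positivity
  have h0 := Real.sqrt_nonneg u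
  have h1 := Real.sq_sqrt hu0
  rcases le_total u 1 with h | h
  · rw [max_eq_right (by linarith), abs_of_nonneg (by linarith)]
    have : Real.sqrt u ≤ 1 := Real.sqrt_le_one.2 h
    nlinarith
  · rw [max_eq_left (by linarith), sub_zero, abs_one]
    exact Real.one_le_sqrt.2 h

noncomputable def wq (W q : ℕ) (T : ℝ) : ℝ := if q ∣ W then (Real.sqrt T)⁻¹ else 1

lemma wq_bound (W q : ℕ) (T n β : ℝ) (hT : 0 < T) (hn : 0 < n) :
    ((1 + |β| * n) ^ 2)⁻¹ * |1 - ind W q (T / n) β| ≤ wq W q T * (1 + |β| * n) ^ (-(3 / 2) : ℝ) := by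
  set u := 1 + |β| * n with hu
  have hu1 : 1 ≤ u := by have : 0 ≤ |β| * n := by positivity
                         linarith
  have hu0 : 0 < u := by linarith
  have e1 : (u ^ 2)⁻¹ = u ^ (-2 : ℝ) := by
    rw [Real.rpow_neg hu0.le]; norm_num
  rw [e1]
  unfold wq ind
  split_ifs with h
  · calc u ^ (-2 : ℝ) * |1 - tri (T / n) β| ≤ u ^ (-2 : ℝ) * (u ^ (1 / 2 : ℝ) / Real.sqrt T) := by
          gcongr
          refine (one_sub_tri T n β hT hn).trans ?_
          rw [← Real.sqrt_eq_rpow]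
          gcongr
          linarith
      _ = (Real.sqrt T)⁻¹ * (u ^ (-2 : ℝ) * u ^ (1 / 2 : ℝ)) := by ring
      _ = _ := by rw [← Real.rpow_add hu0]; norm_num
  · rw [sub_zero, abs_one, mul_one, one_mul]
    exact Real.rpow_le_rpow_of_exponent_le hu1 (by norm_num)

lemma wq_nonneg (W q : ℕ) (T : ℝ) : 0 ≤ wq W q T := by
  unfold wq; split_ifs <;> positivity

/-- comparison of the smoothed and the sharp major arc integrals -/
lemma diff_bound (c : ℕ) (n W N : ℕ) (δ T K : ℝ) (hW : 0 < W) (hN : W ≤ N) (hn : 0 < n) (hT : 0 < T) (hδ : T / n ≤ δ) (hK : 0 ≤ K)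
    (hF : ∀ (q : ℕ) (a : ℤ) (β : ℝ), 0 < q → IsCoprime a (q : ℤ) → q ≤ N → |β| ≤ δ →
      ‖F n c (a / q + β)‖ ≤ K * (q : ℝ) ^ (-(7 / 3) : ℝ) * ((1 + |β| * n) ^ 2)⁻¹) :
    ‖∑ x ∈ DD N, (∫ β in (-δ)..δ, Phi n c ((x.2:ℝ) / x.1 + β)) - GG n c W (T / n)‖ ≤
      4 * K / n * ∑ q ∈ Finset.Icc 1 N, wq W q T * (q:ℝ) ^ (-(4 / 3) : ℝ) := by
  have hn' : (0:ℝ) < n := by exact_mod_cast hn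
  have hh : 0 < T / n := by positivity
  have hδ0 : 0 < δ := by linarith
  rw [GG_split n c W N hW hN (T / n) δ hh hδ, ← sum_sub_distrib]
  have hterm : ∀ x ∈ DD N, ‖(∫ β in (-δ)..δ, Phi n c ((x.2:ℝ) / x.1 + β)) -
      ∫ β in (-δ)..δ, Phi n c ((x.2:ℝ) / x.1 + β) * (ind W x.1 (T / n) β : ℂ)‖ ≤
      4 * K / n * (wq W x.1 T * (x.1 : ℝ) ^ (-(7 / 3) : ℝ)) := by
    rintro ⟨q, a⟩ hx
    rw [mem_DD] at hx
    obtain ⟨⟨hq1, hqN⟩, ⟨ha1, haq⟩, hcop⟩ := hx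
    simp only
    have hPc := Phi_cont n c
    have hic := ind_cont W q (T / n)
    have hw := wq_nonneg W q T
    rw [← intervalIntegral.integral_sub
      ((by fun_prop : Continuous fun β : ℝ => Phi n c ((a:ℝ) / q + β)).intervalIntegrable _ _)
      ((by fun_prop : Continuous fun β : ℝ => Phi n c ((a:ℝ) / q + β) * (ind W q (T / n) β : ℂ)).intervalIntegrable _ _)]
    have hc : Continuous fun β : ℝ => K * (q : ℝ) ^ (-(7 / 3) : ℝ) * wq W q T * (1 + |β| * n) ^ (-(3 / 2) : ℝ) := by
      apply Continuous.mul continuous_const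
      apply Continuous.rpow_const (by fun_prop)
      intro β; left; positivity
    calc _ ≤ ∫ β in (-δ)..δ, K * (q : ℝ) ^ (-(7 / 3) : ℝ) * wq W q T * (1 + |β| * n) ^ (-(3 / 2) : ℝ) := by
          apply intervalIntegral.norm_integral_le_of_norm_le (by linarith) _ (hc.intervalIntegrable _ _)
          apply Filter.Eventually.of_forall
          intro β hβ
          have hβ' : |β| ≤ δ := by rw [abs_le]; exact ⟨hβ.1.le, hβ.2⟩
          have e1 : Phi n c ((a:ℝ) / q + β) - Phi n c ((a:ℝ) / q + β) * (ind W q (T / n) β : ℂ) =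
              Phi n c ((a:ℝ) / q + β) * ((1 - ind W q (T / n) β : ℝ) : ℂ) := by push_cast; ring
          have e2 : ‖Phi n c ((a:ℝ) / q + β)‖ = ‖F n c ((a:ℝ) / q + β)‖ := by
            unfold Phi; rw [norm_mul, norm_e, mul_one]
          have e3 := hF q a β hq1 (Nat.isCoprime_iff_coprime.2 hcop) hqN hβ'
          push_cast at e3
          rw [e1, norm_mul, e2, Complex.norm_real, Real.norm_eq_abs]
          calc _ ≤ K * (q : ℝ) ^ (-(7 / 3) : ℝ) * ((1 + |β| * n) ^ 2)⁻¹ * |1 - ind W q (T / n) β| := by gcongr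
            _ = K * (q : ℝ) ^ (-(7 / 3) : ℝ) * (((1 + |β| * n) ^ 2)⁻¹ * |1 - ind W q (T / n) β|) := by ring
            _ ≤ K * (q : ℝ) ^ (-(7 / 3) : ℝ) * (wq W q T * (1 + |β| * n) ^ (-(3 / 2) : ℝ)) := by
                exact mul_le_mul_of_nonneg_left (wq_bound W q T n β hT hn') (by positivity)
            _ = _ := by ring
      _ = K * (q : ℝ) ^ (-(7 / 3) : ℝ) * wq W q T * ∫ β in (-δ)..δ, (1 + |β| * n) ^ (-(3 / 2) : ℝ) := by
          rw [intervalIntegral.integral_const_mul]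
      _ ≤ K * (q : ℝ) ^ (-(7 / 3) : ℝ) * wq W q T * (4 / n) := by
          gcongr
          exact int_bound n δ hn' hδ0
      _ = _ := by ring
  refine (norm_sum_le_of_le _ hterm).trans ?_
  rw [← mul_sum]
  apply mul_le_mul_of_nonneg_left _ (by positivity)
  unfold DD
  rw [sum_sigma]
  apply sum_le_sum
  intro q hq
  simp only
  rw [sum_const, nsmul_eq_mul]
  have hq0 : (0:ℝ) < q := by exact_mod_cast (mem_Icc.1 hq).1
  have hw := wq_nonneg W q T
  have hcard : (((Finset.Icc 1 q).filter (fun a => Nat.gcd a q = 1)).card : ℝ) ≤ q := by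
    have := card_filter_le (Finset.Icc 1 q) (fun a => Nat.gcd a q = 1)
    rw [Nat.card_Icc, Nat.add_sub_cancel] at this
    exact_mod_cast this
  calc _ ≤ (q:ℝ) * (wq W q T * (q : ℝ) ^ (-(7 / 3) : ℝ)) := by gcongr
    _ = wq W q T * ((q:ℝ) ^ (1:ℝ) * (q : ℝ) ^ (-(7 / 3) : ℝ)) := by rw [Real.rpow_one]; ring
    _ = _ := by rw [← Real.rpow_add hq0]; norm_num

end MajArc

namespace MajArc

lemma summ43 : Summable fun q : ℕ => (q:ℝ) ^ (-(4 / 3) : ℝ) := by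
  rw [Real.summable_nat_rpow]; norm_num

lemma wq_sum (N Q0 : ℕ) (T ε Z : ℝ) (hZ : ∑' q : ℕ, (q:ℝ) ^ (-(4 / 3) : ℝ) ≤ Z)
    (htail : ∀ t : Finset ℕ, Disjoint t (range (Q0 + 1)) → ∑ q ∈ t, (q:ℝ) ^ (-(4 / 3) : ℝ) ≤ ε) :
    ∑ q ∈ Finset.Icc 1 N, wq (Q0.factorial) q T * (q:ℝ) ^ (-(4 / 3) : ℝ) ≤ (Real.sqrt T)⁻¹ * Z + ε := by
  classical
  rw [← sum_filter_add_sum_filter_not (Finset.Icc 1 N) (fun q => q ∣ Q0.factorial)]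
  apply add_le_add
  · calc _ = ∑ q ∈ (Finset.Icc 1 N).filter (fun q => q ∣ Q0.factorial), (Real.sqrt T)⁻¹ * (q:ℝ) ^ (-(4 / 3) : ℝ) := by
          apply sum_congr rfl
          intro q hq
          unfold wq
          rw [if_pos (mem_filter.1 hq).2]
      _ = (Real.sqrt T)⁻¹ * ∑ q ∈ (Finset.Icc 1 N).filter (fun q => q ∣ Q0.factorial), (q:ℝ) ^ (-(4 / 3) : ℝ) := by rw [mul_sum]
      _ ≤ _ := by
          gcongr
          exact (summ43.sum_le_tsum _ fun q _ => by positivity).trans hZ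
  · calc _ = ∑ q ∈ (Finset.Icc 1 N).filter (fun q => ¬ q ∣ Q0.factorial), (q:ℝ) ^ (-(4 / 3) : ℝ) := by
          apply sum_congr rfl
          intro q hq
          unfold wq
          rw [if_neg (mem_filter.1 hq).2, one_mul]
      _ ≤ ε := by
          apply htail
          rw [Finset.disjoint_left]
          intro q hq hq'
          rw [mem_filter, mem_Icc] at hq
          rw [mem_range] at hq'
          exact hq.2 (Nat.dvd_factorial (by omega) (by omega))

lemma tail43 (ε : ℝ) (hε : 0 < ε) : ∃ Q0 : ℕ, ∀ t : Finset ℕ, Disjoint t (range (Q0 + 1)) → ∑ q ∈ t, (q:ℝ) ^ (-(4 / 3) : ℝ) ≤ ε := by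
  obtain ⟨s, hs⟩ := summable_iff_vanishing_norm.1 summ43 ε hε
  obtain ⟨Q0, hQ⟩ := s.exists_nat_subset_range
  refine ⟨Q0, fun t ht => ?_⟩
  have := hs t (ht.mono_right (hQ.trans (range_mono (by omega))))
  exact (le_abs_self _).trans this.le

lemma ev_log (M B : ℝ) (hB : 1 ≤ B) : ∃ N : ℕ, ∀ n : ℕ, N ≤ n → M ≤ Real.log n ^ B := by
  have h := ((tendsto_rpow_atTop (by linarith : 0 < B)).comp Real.tendsto_log_atTop).comp (tendsto_natCast_atTop_atTop (R := ℝ))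
  exact Filter.eventually_atTop.1 (h.eventually_ge_atTop M)

lemma ev_small (B : ℝ) : ∃ N : ℕ, ∀ n : ℕ, N ≤ n → 0 < n → 1 ≤ Real.log n ^ B →
    2 * (Real.log n ^ B / n) * (⌊Real.log n ^ B⌋₊ : ℝ) ^ 2 < 1 := by
  have h := (isLittleO_log_rpow_rpow_atTop (B * 3) (zero_lt_one)).comp_tendsto (tendsto_natCast_atTop_atTop (R := ℝ))
  have h1 := h.def (show (0:ℝ) < 1 / 4 by norm_num)
  obtain ⟨N, hN⟩ := Filter.eventually_atTop.1 h1
  refine ⟨N, fun n hn hn0 hL => ?_⟩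
  have h2 := hN n hn
  have hn' : (0:ℝ) < n := by exact_mod_cast hn0
  have hl : 0 ≤ Real.log n := Real.log_natCast_nonneg _
  simp only [Function.comp_apply, Real.rpow_one, Real.norm_eq_abs] at h2
  rw [abs_of_nonneg (by positivity), abs_of_pos hn', Real.rpow_mul hl] at h2
  have e3 : (Real.log n ^ B) ^ (3:ℝ) = (Real.log n ^ B) ^ 3 := by norm_cast
  rw [e3] at h2
  set Λ := Real.log n ^ B
  have hf : (⌊Λ⌋₊ : ℝ) ≤ Λ := Nat.floor_le (by linarith)
  calc 2 * (Λ / n) * (⌊Λ⌋₊ : ℝ) ^ 2 ≤ 2 * (Λ / n) * Λ ^ 2 := by gcongr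
    _ = 2 * Λ ^ 3 / n := by ring
    _ < 1 := by rw [div_lt_one hn']; linarith

lemma main (c : ℕ) (hc : c = 6 ∨ c = 7) (B : ℝ) (hB : 1 ≤ B) : ∃ κ : ℝ, 0 < κ ∧ ∃ N : ℕ, ∀ n : ℕ, N ≤ n → ¬ 2 ∣ n →
    κ * (n:ℝ) ^ (Θ c) ≤ (∫ α in Maj n B, Phi n c α).re := by
  obtain ⟨κ, hκ, HG⟩ := GG_main c hc
  obtain ⟨C, hC, N1, HF⟩ := F_bound c hc B hB
  set Z := ∑' q : ℕ, (q:ℝ) ^ (-(4 / 3) : ℝ) with hZ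
  have hZ0 : 0 ≤ Z := tsum_nonneg fun q => by positivity
  set ε := κ / (16 * C) with hε
  have hε0 : 0 < ε := by positivity
  obtain ⟨Q0, hQ0⟩ := tail43 ε hε0
  set T : ℝ := (1 + Z / ε) ^ 2 with hT
  have hT1 : 1 ≤ T := one_le_pow₀ (by have : 0 ≤ Z / ε := by positivity
                                      linarith)
  have hTZ : (Real.sqrt T)⁻¹ * Z ≤ ε := by
    rw [hT, Real.sqrt_sq (by positivity), inv_mul_le_iff₀ (by positivity)]
    have : (1 + Z / ε) * ε = ε + Z := by field_simp
    linarith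
  have hW := Nat.factorial_pos Q0
  obtain ⟨N2, HG2⟩ := HG _ hW T hT1
  obtain ⟨N3, h3⟩ := ev_log (Q0.factorial + T) B hB
  obtain ⟨N4, h4⟩ := ev_small B
  refine ⟨κ / 2, by positivity, N1 + N2 + N3 + N4 + 1, fun n hn hodd => ?_⟩
  have hn0 : 0 < n := by omega
  have hn' : (0:ℝ) < n := by exact_mod_cast hn0
  have hΛ := h3 n (by omega)
  have hWr : (0:ℝ) < Q0.factorial := by exact_mod_cast hW
  have hΛ1 : 1 ≤ Real.log n ^ B := by linarith
  have hδ := h4 n (by omega) hn0 hΛ1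
  have g1 := HG2 n (by omega) hodd
  have hd := diff_bound c n Q0.factorial ⌊Real.log n ^ B⌋₊ (Real.log n ^ B / n) T (C * (n:ℝ) ^ (Θ c + 1)) hW
    (Nat.le_floor (by linarith)) hn0 (by linarith) (by gcongr; linarith) (by positivity)
    (fun q a β hq hcop hqN hβ => HF n (by omega) q a β hq hcop ((Nat.le_floor_iff (by linarith)).1 hqN) hβ)
  rw [← Maj_int n c B hn0 hΛ1 hδ] at hd
  have hs := wq_sum ⌊Real.log n ^ B⌋₊ Q0 T ε Z le_rfl hQ0
  have hfin : ‖(∫ α in Maj n B, Phi n c α) - GG n c Q0.factorial (T / n)‖ ≤ κ / 2 * (n:ℝ) ^ (Θ c) := by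
    refine hd.trans ?_
    calc _ ≤ 4 * (C * (n:ℝ) ^ (Θ c + 1)) / n * (ε + ε) := by
          gcongr
          linarith
      _ = _ := by
          rw [Real.rpow_add hn', Real.rpow_one, hε]
          field_simp
          norm_num
  have hre := (Complex.abs_re_le_norm _).trans hfin
  rw [Complex.sub_re, abs_le] at hre
  linarith [hre.1]

end MajArc

/-- The major arcs contribution: `∫_𝔐 F_c(α) e(-αn) dα ≫ n^{Θ_c}` for large odd `n`;
in particular its real part is `≥ κ n^{Θ_c}`. -/
theorem major_arcs_lower_bound (c : ℕ) (hc : c = 6 ∨ c = 7) (B : ℝ) (hB : 1 ≤ B) :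
    ∃ κ : ℝ, 0 < κ ∧ ∃ N : ℕ, ∀ n : ℕ, N ≤ n → ¬ 2 ∣ n →
      κ * (n : ℝ) ^ Θ c ≤ (∫ α in Maj n B, F n c α * e (-(α * n))).re := by
  exact MajArc.main c hc B hB
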